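/- Let u be a second Neumann eigenfunction of a triangle T. If v and v' are two distinct vertices of T, then u(v) and u(v') cannot both equal zero. -/

import Mathlib

open Set

noncomputable section

abbrev E2 : Type := EuclideanSpace ℝ (Fin 2)

/-- The closed triangle: convex hull of the three vertices. -/
def Tri (v₁ v₂ v₃ : E2) : Set E2 := convexHull ℝ {v₁, v₂, v₃}

/-- The vertex set of the triangle. -/
def Vtx (v₁ v₂ v₃ : E2) : Set E2 := {v₁, v₂, v₃}

/-- The triangle minus its vertices. -/
def TriDom (v₁ v₂ v₃ : E2) : Set E2 := Tri v₁ v₂ v₃ \ Vtx v₁ v₂ v₃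

/-- Second (mixed) directional derivative of `u` at `p`: first in direction `v`, then `w`. -/
def mixedDeriv (u : E2 → ℝ) (p v w : E2) : ℝ :=
  fderiv ℝ (fun y => fderiv ℝ u y v) p w

/-- The (geometers') Laplacian `−(∂ₓ² + ∂_y²) u` at `p`. -/
def negLap (u : E2 → ℝ) (p : E2) : ℝ :=
  -(mixedDeriv u p (EuclideanSpace.single 0 1) (EuclideanSpace.single 0 1)
    + mixedDeriv u p (EuclideanSpace.single 1 1) (EuclideanSpace.single 1 1))

/-- `u` satisfies Neumann conditions along the segment `[a,b]`: at every non-endpoint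
point of the segment, the derivative of `u` (within `S`) annihilates every vector
orthogonal to the direction of the side; equivalently the normal derivative vanishes. -/
def NeumannOn (S : Set E2) (a b : E2) (u : E2 → ℝ) : Prop :=
  ∀ p ∈ segment ℝ a b, p ≠ a → p ≠ b →
    ∀ w : E2, @inner ℝ _ _ w (b - a) = 0 → fderivWithin ℝ u S p w = 0

/-- `u` is a Neumann eigenfunction of the triangle with vertices `v₁ v₂ v₃`,
with eigenvalue `μ > 0`. -/
structure IsNeumannEigenfun (v₁ v₂ v₃ : E2) (μ : ℝ) (u : E2 → ℝ) : Prop where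
  pos : 0 < μ
  nonconst : ¬ ∃ c : ℝ, ∀ z ∈ Tri v₁ v₂ v₃, u z = c
  cont : ContinuousOn u (Tri v₁ v₂ v₃)
  smooth : ContDiffOn ℝ (⊤ : ℕ∞) u (TriDom v₁ v₂ v₃)
  eqn : ∀ p ∈ interior (Tri v₁ v₂ v₃), negLap u p = μ * u p
  neumann₁₂ : NeumannOn (TriDom v₁ v₂ v₃) v₁ v₂ u
  neumann₂₃ : NeumannOn (TriDom v₁ v₂ v₃) v₂ v₃ u
  neumann₃₁ : NeumannOn (TriDom v₁ v₂ v₃) v₃ v₁ u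

/-- `u` is a second Neumann eigenfunction: a Neumann eigenfunction whose eigenvalue is
the least `μ > 0` admitting a Neumann eigenfunction. -/
def IsSecondNeumannEigenfun (v₁ v₂ v₃ : E2) (u : E2 → ℝ) : Prop :=
  ∃ μ : ℝ, IsNeumannEigenfun v₁ v₂ v₃ μ u ∧
    ∀ (μ' : ℝ) (u' : E2 → ℝ), IsNeumannEigenfun v₁ v₂ v₃ μ' u' → μ ≤ μ'

/-- `p` is a critical point of `u`: a non-vertex point of the triangle at which the
derivative (within the triangle minus vertices) vanishes. -/
def IsCritPt (v₁ v₂ v₃ : E2) (u : E2 → ℝ) (p : E2) : Prop :=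
  p ∈ TriDom v₁ v₂ v₃ ∧ fderivWithin ℝ u (TriDom v₁ v₂ v₃) p = 0

/-- `(a, b)` is (an ordering of) a side of the triangle `v₁ v₂ v₃`. -/
def IsSide (v₁ v₂ v₃ a b : E2) : Prop :=
  (a = v₁ ∧ b = v₂) ∨ (a = v₂ ∧ b = v₃) ∨ (a = v₃ ∧ b = v₁)

/-- Reflection of `z` across the line through `a` and `b`. -/
def lineReflect (a b z : E2) : E2 :=
  (2 : ℝ) • (a + ((@inner ℝ _ _ (z - a) (b - a)) / (@inner ℝ _ _ (b - a) (b - a))) • (b - a)) - z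

/-- Determinant of the Hessian of `w` at `p` (in the standard coordinates). -/
def hessDet (w : E2 → ℝ) (p : E2) : ℝ :=
  mixedDeriv w p (EuclideanSpace.single 0 1) (EuclideanSpace.single 0 1) *
      mixedDeriv w p (EuclideanSpace.single 1 1) (EuclideanSpace.single 1 1) -
    mixedDeriv w p (EuclideanSpace.single 0 1) (EuclideanSpace.single 1 1) *
      mixedDeriv w p (EuclideanSpace.single 1 1) (EuclideanSpace.single 0 1)

/-- The Hessian at `p` of the extension of `u` by reflection across the side `[a,b]`
satisfies the predicate `P`: there is a smooth local extension `w` of `u` near `p`,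
invariant under the reflection across the line through `a, b`, with `P (hessDet w p)`. -/
def ReflHessAt (v₁ v₂ v₃ a b : E2) (u : E2 → ℝ) (p : E2) (P : ℝ → Prop) : Prop :=
  ∃ (U : Set E2) (w : E2 → ℝ), IsOpen U ∧ p ∈ U ∧ ContDiffOn ℝ (⊤ : ℕ∞) w U ∧
    (∀ z ∈ U ∩ Tri v₁ v₂ v₃, w z = u z) ∧
    (∀ z ∈ U, lineReflect a b z ∈ U → w (lineReflect a b z) = w z) ∧
    P (hessDet w p)

/-- `p` is an isolated local extremum of `u` on the triangle: the connected component
of the level set `{z ∈ T : u z = u p}` containing `p` is `{p}`. -/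
def IsIsolatedExtremum (v₁ v₂ v₃ : E2) (u : E2 → ℝ) (p : E2) : Prop :=
  connectedComponentIn {z ∈ Tri v₁ v₂ v₃ | u z = u p} p = {p}

namespace NZ

open MeasureTheory Filter Topology

/-- linear functional with coefficients `a`, `b`. -/
def lin (a b : ℝ) : ℝ × ℝ →L[ℝ] ℝ :=
  a • ContinuousLinearMap.fst ℝ ℝ ℝ + b • ContinuousLinearMap.snd ℝ ℝ ℝ

@[simp] lemma lin_apply (a b : ℝ) (v : ℝ × ℝ) : lin a b v = a * v.1 + b * v.2 := by
  simp [lin]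

lemma eq_lin (l : ℝ × ℝ →L[ℝ] ℝ) : l = lin (l (1, 0)) (l (0, 1)) := by
  ext <;> simp

/-- partial derivatives within a set -/
def dX (S : Set (ℝ × ℝ)) (f : ℝ × ℝ → ℝ) (p : ℝ × ℝ) : ℝ := fderivWithin ℝ f S p (1, 0)
def dY (S : Set (ℝ × ℝ)) (f : ℝ × ℝ → ℝ) (p : ℝ × ℝ) : ℝ := fderivWithin ℝ f S p (0, 1)

/-- smoothness within a set -/
abbrev Sm (S : Set (ℝ × ℝ)) (f : ℝ × ℝ → ℝ) : Prop := ContDiffOn ℝ (⊤ : ℕ∞) f S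

structure Good (S : Set (ℝ × ℝ)) : Prop where
  ud : UniqueDiffOn ℝ S
  cl : S ⊆ closure (interior S)

variable {S : Set (ℝ × ℝ)} {f g : ℝ × ℝ → ℝ} {p : ℝ × ℝ}

lemma Sm.dX (hS : Good S) (hf : Sm S f) : Sm S (dX S f) := by
  have := hf.fderivWithin hS.ud (m := (⊤ : ℕ∞)) (by simp)
  exact this.clm_apply contDiffOn_const

lemma Sm.dY (hS : Good S) (hf : Sm S f) : Sm S (dY S f) := by
  have := hf.fderivWithin hS.ud (m := (⊤ : ℕ∞)) (by simp)
  exact this.clm_apply contDiffOn_const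

lemma Sm.diff (hf : Sm S f) (hp : p ∈ S) : DifferentiableWithinAt ℝ f S p :=
  (hf.differentiableOn (by simp)) p hp

lemma Sm.has (hf : Sm S f) (hp : p ∈ S) :
    HasFDerivWithinAt f (lin (NZ.dX S f p) (NZ.dY S f p)) S p := by
  have h := (hf.diff hp).hasFDerivWithinAt
  rwa [eq_lin (fderivWithin ℝ f S p)] at h

lemma Sm.hasAt (hf : Sm S f) (hp : p ∈ interior S) :
    HasFDerivAt f (lin (NZ.dX S f p) (NZ.dY S f p)) p :=
  (hf.has (interior_subset hp)).hasFDerivAt (mem_interior_iff_mem_nhds.mp hp)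

lemma dX_of_has {a b : ℝ} (hS : Good S) (hp : p ∈ S)
    (h : HasFDerivWithinAt f (lin a b) S p) : dX S f p = a := by
  simp [dX, h.fderivWithin (hS.ud p hp)]

lemma dY_of_has {a b : ℝ} (hS : Good S) (hp : p ∈ S)
    (h : HasFDerivWithinAt f (lin a b) S p) : dY S f p = b := by
  simp [dY, h.fderivWithin (hS.ud p hp)]

lemma lin_ext {l : ℝ × ℝ →L[ℝ] ℝ} {a b : ℝ} (h1 : l (1, 0) = a) (h2 : l (0, 1) = b) :
    l = lin a b := by
  rw [eq_lin l, h1, h2]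

lemma has_mul (hf : Sm S f) (hg : Sm S g) (hp : p ∈ S) :
    HasFDerivWithinAt (fun q => f q * g q)
      (lin (dX S f p * g p + f p * dX S g p) (dY S f p * g p + f p * dY S g p)) S p := by
  refine ((hf.has hp).mul (hg.has hp)).congr_fderiv ?_
  apply lin_ext <;> simp <;> ring

lemma dX_mul (hS : Good S) (hf : Sm S f) (hg : Sm S g) (hp : p ∈ S) :
    dX S (fun q => f q * g q) p = dX S f p * g p + f p * dX S g p :=
  dX_of_has hS hp (has_mul hf hg hp)

lemma dY_mul (hS : Good S) (hf : Sm S f) (hg : Sm S g) (hp : p ∈ S) :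
    dY S (fun q => f q * g q) p = dY S f p * g p + f p * dY S g p :=
  dY_of_has hS hp (has_mul hf hg hp)

lemma has_add (hf : Sm S f) (hg : Sm S g) (hp : p ∈ S) :
    HasFDerivWithinAt (fun q => f q + g q)
      (lin (dX S f p + dX S g p) (dY S f p + dY S g p)) S p := by
  refine ((hf.has hp).add (hg.has hp)).congr_fderiv ?_
  apply lin_ext <;> simp

lemma dX_add (hS : Good S) (hf : Sm S f) (hg : Sm S g) (hp : p ∈ S) :
    dX S (fun q => f q + g q) p = dX S f p + dX S g p :=
  dX_of_has hS hp (has_add hf hg hp)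

lemma dY_add (hS : Good S) (hf : Sm S f) (hg : Sm S g) (hp : p ∈ S) :
    dY S (fun q => f q + g q) p = dY S f p + dY S g p :=
  dY_of_has hS hp (has_add hf hg hp)

lemma has_sub (hf : Sm S f) (hg : Sm S g) (hp : p ∈ S) :
    HasFDerivWithinAt (fun q => f q - g q)
      (lin (dX S f p - dX S g p) (dY S f p - dY S g p)) S p := by
  refine ((hf.has hp).sub (hg.has hp)).congr_fderiv ?_
  apply lin_ext <;> simp

lemma dX_sub (hS : Good S) (hf : Sm S f) (hg : Sm S g) (hp : p ∈ S) :
    dX S (fun q => f q - g q) p = dX S f p - dX S g p :=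
  dX_of_has hS hp (has_sub hf hg hp)

lemma dY_sub (hS : Good S) (hf : Sm S f) (hg : Sm S g) (hp : p ∈ S) :
    dY S (fun q => f q - g q) p = dY S f p - dY S g p :=
  dY_of_has hS hp (has_sub hf hg hp)

lemma dX_const_mul (hS : Good S) (c : ℝ) (hf : Sm S f) (hp : p ∈ S) :
    dX S (fun q => c * f q) p = c * dX S f p := by
  refine dX_of_has hS hp (b := c * dY S f p) (((hf.has hp).const_mul c).congr_fderiv ?_)
  apply lin_ext <;> simp

lemma dY_const_mul (hS : Good S) (c : ℝ) (hf : Sm S f) (hp : p ∈ S) :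
    dY S (fun q => c * f q) p = c * dY S f p := by
  refine dY_of_has hS hp (a := c * dX S f p) (((hf.has hp).const_mul c).congr_fderiv ?_)
  apply lin_ext <;> simp

lemma dX_congr (h : EqOn f g S) (hp : p ∈ S) : dX S f p = dX S g p := by
  simp only [dX, fderivWithin_congr h (h hp)]

lemma dY_congr (h : EqOn f g S) (hp : p ∈ S) : dY S f p = dY S g p := by
  simp only [dY, fderivWithin_congr h (h hp)]

lemma dX_dY_comm (hS : Good S) (hf : Sm S f) (hp : p ∈ S) :
    dX S (dY S f) p = dY S (dX S f) p := by
  have hsym : IsSymmSndFDerivWithinAt ℝ f S p :=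
    (hf p hp).isSymmSndFDerivWithinAt (by simpa using (WithTop.coe_le_coe.mpr (le_top : (2 : ℕ∞) ≤ ⊤) : ((2 : ℕ∞) : WithTop ℕ∞) ≤ _)) hS.ud (hS.cl hp) hp
  have hd : DifferentiableWithinAt ℝ (fderivWithin ℝ f S) S p :=
    ((hf.fderivWithin hS.ud (m := (⊤ : ℕ∞)) (by simp)).differentiableOn (by simp)) p hp
  have key : ∀ v w : ℝ × ℝ, fderivWithin ℝ (fun q => fderivWithin ℝ f S q v) S p w
      = fderivWithin ℝ (fderivWithin ℝ f S) S p w v := by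
    intro v w
    have h1 := (hd.hasFDerivWithinAt.clm_apply (hasFDerivWithinAt_const v p S))
    rw [h1.fderivWithin (hS.ud p hp)]
    simp
  have e1 : dX S (dY S f) p = fderivWithin ℝ (fderivWithin ℝ f S) S p (1, 0) (0, 1) :=
    key (0, 1) (1, 0)
  have e2 : dY S (dX S f) p = fderivWithin ℝ (fderivWithin ℝ f S) S p (0, 1) (1, 0) :=
    key (1, 0) (0, 1)
  rw [e1, e2]
  exact hsym (1, 0) (0, 1)

lemma Sm.cont (hf : Sm S f) : ContinuousOn f S := hf.continuousOn

end NZ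

namespace NZ

open MeasureTheory Filter Topology

/-- half strip -/
def KS (s0 β : ℝ) : Set (ℝ × ℝ) := Iio s0 ×ˢ Icc 0 β

/-- a convex set with nonempty interior is good -/
lemma good_of_convex {S : Set (ℝ × ℝ)} (h : Convex ℝ S) (hn : (interior S).Nonempty) : Good S where
  ud := uniqueDiffOn_convex h hn
  cl := by
    rw [h.closure_interior_eq_closure_of_nonempty_interior hn]
    exact subset_closure

lemma interior_KS (s0 β : ℝ) : interior (KS s0 β) = Iio s0 ×ˢ Ioo 0 β := by
  simp [KS, interior_prod_eq]

lemma good_KS {s0 β : ℝ} (hβ : 0 < β) : Good (KS s0 β) := by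
  refine good_of_convex ((convex_Iio s0).prod (convex_Icc 0 β)) ?_
  rw [interior_KS]
  exact ⟨(s0 - 1, β / 2), by simp, by constructor <;> simp <;> linarith⟩

/-- integral over a vertical slice -/
def av (β : ℝ) (f : ℝ × ℝ → ℝ) (s : ℝ) : ℝ := ∫ θ in (0 : ℝ)..β, f (s, θ)

variable {s0 β s μ : ℝ} {f g : ℝ × ℝ → ℝ}

lemma slice_contOn (hf : ContinuousOn f (KS s0 β)) (hs : s < s0) :
    ContinuousOn (fun θ => f (s, θ)) (Icc 0 β) :=
  hf.comp (by fun_prop) (fun θ hθ => ⟨hs, hθ⟩)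

lemma slice_int (hβ : 0 < β) (hf : ContinuousOn f (KS s0 β)) (hs : s < s0) :
    IntervalIntegrable (fun θ => f (s, θ)) volume 0 β := by
  apply ContinuousOn.intervalIntegrable
  rw [uIcc_of_le hβ.le]
  exact slice_contOn hf hs

lemma av_add (hβ : 0 < β) (hf : ContinuousOn f (KS s0 β)) (hg : ContinuousOn g (KS s0 β))
    (hs : s < s0) : av β (fun q => f q + g q) s = av β f s + av β g s :=
  intervalIntegral.integral_add (slice_int hβ hf hs) (slice_int hβ hg hs)

lemma av_sub (hβ : 0 < β) (hf : ContinuousOn f (KS s0 β)) (hg : ContinuousOn g (KS s0 β))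
    (hs : s < s0) : av β (fun q => f q - g q) s = av β f s - av β g s :=
  intervalIntegral.integral_sub (slice_int hβ hf hs) (slice_int hβ hg hs)

lemma av_const_mul (c : ℝ) : av β (fun q => c * f q) s = c * av β f s :=
  intervalIntegral.integral_const_mul _ _

lemma av_mono (hβ : 0 < β) (hf : ContinuousOn f (KS s0 β)) (hg : ContinuousOn g (KS s0 β))
    (hs : s < s0) (h : ∀ θ ∈ Icc 0 β, f (s, θ) ≤ g (s, θ)) : av β f s ≤ av β g s :=
  intervalIntegral.integral_mono_on hβ.le (slice_int hβ hf hs) (slice_int hβ hg hs) h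

lemma av_nonneg (hβ : 0 < β) (h : ∀ θ ∈ Icc 0 β, 0 ≤ f (s, θ)) : 0 ≤ av β f s :=
  intervalIntegral.integral_nonneg hβ.le h

lemma av_congr (hβ : 0 < β) (h : ∀ θ ∈ Icc 0 β, f (s, θ) = g (s, θ)) : av β f s = av β g s := by
  apply intervalIntegral.integral_congr
  rw [uIcc_of_le hβ.le]
  exact h

lemma slice_hasX (hf : Sm (KS s0 β) f) (hs : s < s0) {θ : ℝ} (hθ : θ ∈ Icc 0 β) :
    HasDerivAt (fun t => f (t, θ)) (dX (KS s0 β) f (s, θ)) s := by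
  have h := hf.has (p := (s, θ)) ⟨hs, hθ⟩
  have h2 : HasDerivWithinAt (fun t : ℝ => (t, θ)) ((1 : ℝ), (0 : ℝ)) (Iio s0) s :=
    (hasDerivWithinAt_id s _).prodMk (hasDerivWithinAt_const s _ θ)
  have h3 := h.comp_hasDerivWithinAt s h2
    (show MapsTo (fun t : ℝ => (t, θ)) (Iio s0) (KS s0 β) from fun t ht => ⟨ht, hθ⟩)
  have h4 := h3.hasDerivAt (Iio_mem_nhds hs)
  simpa [Function.comp_def] using h4

lemma slice_hasY (hf : Sm (KS s0 β) f) (hs : s < s0) {θ : ℝ} (hθ : θ ∈ Icc 0 β) :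
    HasDerivWithinAt (fun t => f (s, t)) (dY (KS s0 β) f (s, θ)) (Icc 0 β) θ := by
  have h := hf.has (p := (s, θ)) ⟨hs, hθ⟩
  have h2 : HasDerivWithinAt (fun t : ℝ => (s, t)) ((0 : ℝ), (1 : ℝ)) (Icc 0 β) θ :=
    (hasDerivWithinAt_const θ _ s).prodMk (hasDerivWithinAt_id θ _)
  have h3 := h.comp_hasDerivWithinAt θ h2
    (show MapsTo (fun t : ℝ => (s, t)) (Icc 0 β) (KS s0 β) from fun t ht => ⟨hs, ht⟩)
  simpa [Function.comp_def] using h3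

lemma av_dY (hβ : 0 < β) (hf : Sm (KS s0 β) f) (hs : s < s0) :
    av β (dY (KS s0 β) f) s = f (s, β) - f (s, 0) := by
  have hc := (hf.dY (good_KS hβ)).cont
  refine intervalIntegral.integral_eq_sub_of_hasDerivAt_of_le hβ.le (slice_contOn hf.cont hs)
    (fun θ hθ => ?_) (slice_int hβ hc hs)
  exact (slice_hasY hf hs (Ioo_subset_Icc_self hθ)).hasDerivAt (Icc_mem_nhds hθ.1 hθ.2)

lemma av_hasDerivAt (hβ : 0 < β) (hf : Sm (KS s0 β) f) (hs : s < s0) :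
    HasDerivAt (av β f) (av β (dX (KS s0 β) f) s) s := by
  have hc := (hf.dX (good_KS hβ)).cont
  obtain ⟨s1, hs1, hs1'⟩ := exists_between hs
  have hK : IsCompact (Icc (s - 1) s1 ×ˢ Icc 0 β) := isCompact_Icc.prod isCompact_Icc
  have hsub : Icc (s - 1) s1 ×ˢ Icc 0 β ⊆ KS s0 β :=
    fun q hq => ⟨lt_of_le_of_lt hq.1.2 hs1', hq.2⟩
  obtain ⟨C, hC⟩ := hK.exists_bound_of_continuousOn (hc.mono hsub)
  have hnhds : Icc (s - 1) s1 ∈ 𝓝 s := Icc_mem_nhds (by linarith) hs1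
  refine (intervalIntegral.hasDerivAt_integral_of_dominated_loc_of_deriv_le (μ := volume)
    (F := fun t θ => f (t, θ)) (F' := fun t θ => dX (KS s0 β) f (t, θ)) (bound := fun _ => C)
    hnhds ?_ (slice_int hβ hf.cont hs) ?_ ?_ (by simp) ?_).2
  · filter_upwards [Iio_mem_nhds hs] with t ht
    exact (slice_int hβ hf.cont ht).aestronglyMeasurable_restrict_uIoc
  · exact (slice_int hβ hc hs).aestronglyMeasurable_restrict_uIoc
  · refine Eventually.of_forall (fun θ hθ t ht => hC (t, θ) ⟨ht, ?_⟩)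
    rw [uIoc_of_le hβ.le] at hθ
    exact Ioc_subset_Icc_self hθ
  · refine Eventually.of_forall (fun θ hθ t ht => ?_)
    rw [uIoc_of_le hβ.le] at hθ
    exact slice_hasX hf (lt_of_le_of_lt ht.2 hs1') (Ioc_subset_Icc_self hθ)

lemma av_cont (hβ : 0 < β) (hf : Sm (KS s0 β) f) : ContinuousOn (av β f) (Iio s0) :=
  fun _ hs => (av_hasDerivAt hβ hf hs).continuousAt.continuousWithinAt

end NZ

namespace NZ

open MeasureTheory Filter Topology

/-! ### one-variable lemmas -/

lemma small_of_integrable {p : ℝ → ℝ} {s1 : ℝ} (hp : IntegrableOn p (Iic s1))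
    {ε s : ℝ} (hε : 0 < ε) : ∃ t ≤ s, p t < ε := by
  by_contra! hcon
  have h1 : IntegrableOn p (Iic (min s s1)) := hp.mono_set (Iic_subset_Iic.mpr (min_le_right _ _))
  have h2 : IntegrableOn (fun _ : ℝ => ε) (Iic (min s s1)) := by
    refine Integrable.mono' h1 aestronglyMeasurable_const ?_
    refine (ae_restrict_mem measurableSet_Iic).mono (fun t ht => ?_)
    rw [Real.norm_of_nonneg hε.le]
    exact hcon t (le_trans ht (min_le_left _ _))
  rw [integrableOn_const_iff (by simp)] at h2
  simp at h2
  exact hε.ne' h2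

lemma integrableOn_of_deriv {E G g' : ℝ → ℝ} {s1 B : ℝ} (hE : ContinuousOn E (Iic s1))
    (hE0 : ∀ s ≤ s1, 0 ≤ E s) (hG : ∀ s ≤ s1, HasDerivAt G (g' s) s) (hle : ∀ s ≤ s1, E s ≤ g' s)
    (hB : ∀ s, ∃ t ≤ s, -G t ≤ B) : IntegrableOn E (Iic s1) := by
  choose ξ h1 h2 using hB
  have key : ∀ t ≤ s1, IntegrableOn E (Icc t s1) := fun t _ =>
    (hE.mono Icc_subset_Iic_self).integrableOn_Icc
  refine integrableOn_Iic_of_intervalIntegral_norm_bounded (l := atTop) (I := G s1 + B) s1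
    (a := fun n : ℕ => ξ (s1 - n)) (fun n => ?_) ?_ (Eventually.of_forall fun n => ?_)
  · have : ξ (s1 - n) ≤ s1 := (h1 _).trans (by simp)
    exact (key _ this).mono_set Ioc_subset_Icc_self
  · refine tendsto_atBot_mono (fun n => h1 (s1 - n)) ?_
    exact tendsto_atBot_add_const_left _ s1 (tendsto_neg_atTop_atBot.comp tendsto_natCast_atTop_atTop)
  · have hx : ξ (s1 - n) ≤ s1 := (h1 _).trans (by simp)
    have e1 : (∫ x in ξ (s1 - n)..s1, ‖E x‖) = ∫ x in ξ (s1 - n)..s1, E x := by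
      apply intervalIntegral.integral_congr
      intro x hx'
      rw [uIcc_of_le hx] at hx'
      exact Real.norm_of_nonneg (hE0 x hx'.2)
    rw [e1]
    have := intervalIntegral.integral_le_sub_of_hasDeriv_right_of_le (g := G) (g' := g') (φ := E) hx
      (fun x hx' => (hG x hx'.2).continuousAt.continuousWithinAt)
      (fun x hx' => (hG x hx'.2.le).hasDerivWithinAt) (key _ hx) (fun x hx' => hle x hx'.2.le)
    linarith [h2 (s1 - n)]

lemma mono_of_deriv {z z' : ℝ → ℝ} {s1 : ℝ} (hz : ∀ s ≤ s1, HasDerivAt z (z' s) s)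
    (h0 : ∀ s ≤ s1, 0 ≤ z' s) : MonotoneOn z (Iic s1) := by
  refine monotoneOn_of_deriv_nonneg (convex_Iic s1)
    (fun x hx => (hz x hx).continuousAt.continuousWithinAt) ?_ ?_
  · intro x hx
    rw [interior_Iic] at hx
    exact (hz x (le_of_lt hx)).differentiableAt.differentiableWithinAt
  · intro x hx
    rw [interior_Iic] at hx
    rw [(hz x (le_of_lt hx)).deriv]
    exact h0 x (le_of_lt hx)

lemma hasDerivAt_exp_mul (c s : ℝ) :
    HasDerivAt (fun t => Real.exp (c * t)) (c * Real.exp (c * s)) s := by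
  have := ((hasDerivAt_id s).const_mul c).exp
  simpa [mul_comm] using this

/-- R1 -/
lemma stripA {m n E : ℝ → ℝ} {s1 M μ : ℝ} (hμ : 0 ≤ μ)
    (hm : ∀ s ≤ s1, HasDerivAt m (2 * n s) s)
    (hn : ∀ s ≤ s1, HasDerivAt n (E s - μ * Real.exp (2 * s) * m s) s)
    (hE : ContinuousOn E (Iic s1)) (hE0 : ∀ s ≤ s1, 0 ≤ E s)
    (hm0 : ∀ s ≤ s1, 0 ≤ m s) (hM : ∀ s ≤ s1, m s ≤ M) : IntegrableOn E (Iic s1) := by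
  have hM0 : 0 ≤ M := (hm0 s1 le_rfl).trans (hM s1 le_rfl)
  refine integrableOn_of_deriv (G := fun s => n s + μ * M / 2 * Real.exp (2 * s))
    (B := M) hE hE0
    (fun s hs => (hn s hs).add ((hasDerivAt_exp_mul 2 s).const_mul (μ * M / 2))) ?_ ?_
  · intro s hs
    have h1 : 0 ≤ μ * Real.exp (2 * s) * (M - m s) :=
      mul_nonneg (by positivity) (by linarith [hM s hs])
    nlinarith
  · intro s
    set b := min s s1 with hb
    have hbs : b ≤ s1 := min_le_right _ _
    obtain ⟨c, hc, hc'⟩ := exists_hasDerivAt_eq_slope m (fun s => 2 * n s) (a := b - 1) (b := b)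
      (by linarith) (fun x hx => (hm x (hx.2.trans hbs)).continuousAt.continuousWithinAt)
      (fun x hx => hm x (hx.2.le.trans hbs))
    refine ⟨c, hc.2.le.trans (min_le_left _ _), ?_⟩
    have h1 := hM (b - 1) (by linarith)
    have h2 := hm0 b hbs
    have h3 : 0 ≤ μ * M / 2 * Real.exp (2 * c) := by positivity
    rw [eq_div_iff (by linarith)] at hc'
    linarith

lemma exists_exp_small (μ ε s1 : ℝ) (hε : 0 < ε) :
    ∃ s2 ≤ s1, ∀ s ≤ s2, μ * Real.exp (2 * s) ≤ ε := by
  have h : Tendsto (fun s : ℝ => μ * Real.exp (2 * s)) atBot (𝓝 (μ * 0)) :=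
    (Real.tendsto_exp_atBot.comp (tendsto_id.const_mul_atBot (by norm_num : (0 : ℝ) < 2))).const_mul μ
  rw [mul_zero] at h
  have h2 := (h.eventually (gt_mem_nhds hε))
  obtain ⟨a, ha⟩ := eventually_atBot.mp h2
  exact ⟨min a s1, min_le_right _ _, fun s hs => (ha s (hs.trans (min_le_left _ _))).le⟩

/-- R2 -/
lemma stripB {p q a b : ℝ → ℝ} {s1 μ k k1 : ℝ} (hμ : 0 ≤ μ) (hk : 1 < k) (hkk : k < k1)
    (hp : ∀ s ≤ s1, HasDerivAt p (2 * q s) s)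
    (hq : ∀ s ≤ s1, HasDerivAt q (a s + b s - μ * Real.exp (2 * s) * p s) s)
    (hac : ContinuousOn a (Iic s1)) (hbc : ContinuousOn b (Iic s1))
    (ha : ∀ s ≤ s1, 0 ≤ a s) (hb : ∀ s ≤ s1, k1 ^ 2 * p s ≤ b s)
    (hsq : ∀ s ≤ s1, 0 ≤ a s - 2 * k * q s + k ^ 2 * p s)
    (hp0 : ∀ s ≤ s1, 0 ≤ p s) (hpi : IntegrableOn p (Iic s1)) :
    ∃ s2 ≤ s1, ∃ C, (∀ s ≤ s2, p s ≤ C * Real.exp (2 * k * s)) ∧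
      IntegrableOn (fun s => Real.exp (-2 * s) * p s) (Iic s2) ∧
      IntegrableOn (fun s => Real.exp (-2 * s) * (a s + b s)) (Iic s2) := by
  obtain ⟨s2, h21, hs2⟩ := exists_exp_small μ (k1 ^ 2 - k ^ 2) s1 (by nlinarith)
  have hle : ∀ {s}, s ≤ s2 → s ≤ s1 := fun h => h.trans h21
  have hq' : ∀ s ≤ s2, a s + k ^ 2 * p s ≤ a s + b s - μ * Real.exp (2 * s) * p s := by
    intro s hs
    have := mul_le_mul_of_nonneg_right (hs2 s hs) (hp0 s (hle hs))
    linarith [hb s (hle hs)]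
  have hqmono : MonotoneOn q (Iic s2) := mono_of_deriv (fun s hs => hq s (hle hs)) (fun s hs => by
    have h1 := ha s (hle hs)
    have h2 := hp0 s (hle hs)
    have := hq' s hs
    have : 0 ≤ k ^ 2 * p s := by positivity
    linarith)
  have hq0 : ∀ s ≤ s2, 0 ≤ q s := by
    intro s hs
    by_contra! hneg
    obtain ⟨t, ht, hpt⟩ := small_of_integrable hpi (ε := -2 * q s) (s := s - 1) (by linarith)
    have hts : t < s := by linarith
    obtain ⟨c, hc, hc'⟩ := exists_hasDerivAt_eq_slope p (fun s => 2 * q s) hts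
      (fun x hx => (hp x (hle (hx.2.trans hs))).continuousAt.continuousWithinAt)
      (fun x hx => hp x (hle (hx.2.le.trans hs)))
    have h1 : q c ≤ q s := hqmono (hc.2.le.trans hs) hs hc.2.le
    rw [eq_div_iff (by linarith)] at hc'
    have h2 := hp0 s (hle hs)
    nlinarith
  have hz : MonotoneOn (fun s => q s - k * p s) (Iic s2) := mono_of_deriv
    (fun s hs => (hq s (hle hs)).sub ((hp s (hle hs)).const_mul k)) (fun s hs => by
      linarith [hq' s hs, hsq s (hle hs)])
  have hk0 : 0 < k := by linarith
  have hz0 : ∀ s ≤ s2, k * p s ≤ q s := by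
    intro s hs
    by_contra! hneg
    obtain ⟨t, ht, hpt⟩ := small_of_integrable hpi (ε := (k * p s - q s) / k) (s := s)
      (div_pos (by linarith) hk0)
    have h1 := hz (ht.trans hs) hs ht
    rw [lt_div_iff₀ hk0] at hpt
    simp only at h1
    linarith [hq0 t (ht.trans hs)]
  have hpe : MonotoneOn (fun s => Real.exp (-(2 * k) * s) * p s) (Iic s2) := mono_of_deriv
    (fun s hs => (hasDerivAt_exp_mul (-(2 * k)) s).mul (hp s (hle hs))) (fun s hs => by
      have := mul_nonneg (Real.exp_pos (-(2 * k) * s)).le (sub_nonneg.mpr (hz0 s hs))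
      linarith)
  set C := Real.exp (-(2 * k) * s2) * p s2 with hC
  have hC0 : 0 ≤ C := mul_nonneg (Real.exp_pos _).le (hp0 s2 h21)
  have hpC : ∀ s ≤ s2, p s ≤ C * Real.exp (2 * k * s) := by
    intro s hs
    have h1 : Real.exp (-(2 * k) * s) * p s ≤ C := hpe hs (le_refl s2) hs
    have h2 := mul_le_mul_of_nonneg_right h1 (Real.exp_pos (2 * k * s)).le
    have h3 : Real.exp (-(2 * k) * s) * p s * Real.exp (2 * k * s) = p s := by
      rw [mul_right_comm, ← Real.exp_add]
      simp
    linarith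
  have hpcont : ContinuousOn p (Iic s1) := fun s hs => (hp s hs).continuousAt.continuousWithinAt
  have hexpc : ContinuousOn (fun s : ℝ => Real.exp (-2 * s)) (Iic s2) := by fun_prop
  have hpC2 : ∀ s ≤ s2, Real.exp (-2 * s) * p s ≤ C * Real.exp ((2 * k - 2) * s) := by
    intro s hs
    have := mul_le_mul_of_nonneg_left (hpC s hs) (Real.exp_pos (-2 * s)).le
    refine this.trans (le_of_eq ?_)
    rw [mul_left_comm, ← Real.exp_add]
    ring_nf
  have hk2 : 0 < 2 * k - 2 := by linarith
  refine ⟨s2, h21, C, hpC, ?_, ?_⟩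
  · refine integrableOn_of_deriv (G := fun s => C / (2 * k - 2) * Real.exp ((2 * k - 2) * s)) (B := 0)
      (hexpc.mul (hpcont.mono (Iic_subset_Iic.mpr h21)))
      (fun s hs => mul_nonneg (Real.exp_pos _).le (hp0 s (hle hs)))
      (fun s hs => (hasDerivAt_exp_mul (2 * k - 2) s).const_mul _) ?_ ?_
    · intro s hs
      refine (hpC2 s hs).trans (le_of_eq ?_)
      rw [← mul_assoc, div_mul_cancel₀ _ hk2.ne']
    · intro s
      exact ⟨s, le_rfl, by simp only [neg_nonpos]; positivity⟩
  · set D := C * (μ * Real.exp (2 * s2) + 2) with hD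
    have hD0 : 0 ≤ D := by positivity
    refine integrableOn_of_deriv (G := fun s => Real.exp (-2 * s) * (q s + p s) +
      D / (2 * k - 2) * Real.exp ((2 * k - 2) * s)) (B := 0)
      (hexpc.mul ((hac.add hbc).mono (Iic_subset_Iic.mpr h21))) (fun s hs => ?_)
      (fun s hs => (((hasDerivAt_exp_mul (-2) s).mul ((hq s (hle hs)).add (hp s (hle hs)))).add
        ((hasDerivAt_exp_mul (2 * k - 2) s).const_mul _))) ?_ ?_
    · have h1 := ha s (hle hs)
      have h2 := hb s (hle hs)
      have h3 := hp0 s (hle hs)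
      have : 0 ≤ b s := le_trans (by positivity) h2
      positivity
    · intro s hs
      have e1 : D / (2 * k - 2) * ((2 * k - 2) * Real.exp ((2 * k - 2) * s)) =
        D * Real.exp ((2 * k - 2) * s) := by
        rw [← mul_assoc, div_mul_cancel₀ _ hk2.ne']
      rw [e1]
      have h1 := hpC2 s hs
      have h2 : Real.exp (2 * s) ≤ Real.exp (2 * s2) := Real.exp_le_exp.mpr (by linarith)
      have h3 : 0 ≤ Real.exp (-2 * s) * p s := mul_nonneg (Real.exp_pos _).le (hp0 s (hle hs))
      have h4 : (μ * Real.exp (2 * s) + 2) * (Real.exp (-2 * s) * p s) ≤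
          (μ * Real.exp (2 * s2) + 2) * (C * Real.exp ((2 * k - 2) * s)) := by
        apply mul_le_mul _ h1 h3 (by positivity)
        have := mul_le_mul_of_nonneg_left h2 hμ
        linarith
      rw [hD]
      simp only [Pi.add_apply]
      nlinarith
    · intro s
      refine ⟨min s s2, min_le_left _ _, ?_⟩
      have h1 := hq0 (min s s2) (min_le_right _ _)
      have h2 := hp0 (min s s2) (hle (min_le_right _ _))
      simp only [neg_nonpos]
      positivity

/-- R3 -/
lemma stripC {y n E : ℝ → ℝ} {s1 μ D : ℝ} (hμ : 0 ≤ μ)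
    (hy : ∀ s ≤ s1, HasDerivAt y (n s) s)
    (hn : ∀ s ≤ s1, HasDerivAt n (-μ * Real.exp (2 * s) * y s) s)
    (hE : IntegrableOn E (Iic s1)) (hD : 0 < D) (hnE : ∀ s ≤ s1, n s ^ 2 ≤ D * E s) :
    ∃ s2 ≤ s1, ∃ C, 0 ≤ C ∧ (∀ s ≤ s2, |n s| ≤ C * Real.exp (1.4 * s)) ∧
      (∀ s ≤ s2, ∀ t ≤ s, |y s - y t| ≤ C * Real.exp (1.4 * s)) := by
  obtain ⟨s2, h21, hs2⟩ := exists_exp_small μ 0.2 s1 (by norm_num)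
  have hle : ∀ {s}, s ≤ s2 → s ≤ s1 := fun h => h.trans h21
  have hY : MonotoneOn (fun s => Real.exp (1.2 * s) * (y s * y s + n s * n s)) (Iic s2) :=
    mono_of_deriv (fun s hs => (hasDerivAt_exp_mul 1.2 s).mul
      (((hy s (hle hs)).mul (hy s (hle hs))).add ((hn s (hle hs)).mul (hn s (hle hs)))))
      (fun s hs => by
        have h1 := hs2 s hs
        have h2 : 0 ≤ μ * Real.exp (2 * s) := by positivity
        set e := μ * Real.exp (2 * s)
        have h3 : 0 ≤ 1.2 * (y s * y s + n s * n s) + 2 * (y s * n s) - 2 * e * (y s * n s) := by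
          nlinarith [mul_nonneg h2 (sq_nonneg (y s - n s)), mul_nonneg h2 (sq_nonneg (y s + n s)), sq_nonneg (y s + n s), sq_nonneg (y s - n s),
            mul_nonneg (sub_nonneg.mpr h1) (sq_nonneg (y s - n s)), mul_nonneg (sub_nonneg.mpr h1) (sq_nonneg (y s + n s))]
        have h4 := mul_nonneg (Real.exp_pos (1.2 * s)).le h3
        refine h4.trans (le_of_eq ?_)
        simp only [e]
        ring)
  set C0 := Real.exp (1.2 * s2) * (y s2 * y s2 + n s2 * n s2) with hC0
  have hC00 : 0 ≤ C0 := mul_nonneg (Real.exp_pos _).le (by nlinarith)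
  have hyC : ∀ s ≤ s2, |y s| ≤ Real.sqrt C0 * Real.exp (-0.6 * s) := by
    intro s hs
    have h1 : Real.exp (1.2 * s) * (y s * y s + n s * n s) ≤ C0 := hY hs (le_refl s2) hs
    apply abs_le_of_sq_le_sq _ (by positivity)
    rw [mul_pow, Real.sq_sqrt hC00, ← Real.exp_nat_mul]
    have h3 : Real.exp (1.2 * s) * Real.exp (((2 : ℕ) : ℝ) * (-0.6 * s)) = 1 := by
      rw [← Real.exp_add]; norm_num; ring
    have h2 := mul_le_mul_of_nonneg_right h1 (Real.exp_pos (((2 : ℕ) : ℝ) * (-0.6 * s))).le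
    have h5 : Real.exp (1.2 * s) * (y s * y s + n s * n s) * Real.exp (((2 : ℕ) : ℝ) * (-0.6 * s))
      = y s * y s + n s * n s := by
      rw [mul_right_comm, h3, one_mul]
    nlinarith [mul_self_nonneg (n s)]
  set C1 := μ * Real.sqrt C0 with hC1
  have hC10 : 0 ≤ C1 := by positivity
  have hnd : ∀ s ≤ s2, |(-μ * Real.exp (2 * s) * y s)| ≤ C1 * Real.exp (1.4 * s) := by
    intro s hs
    rw [abs_mul, neg_mul, abs_neg, abs_of_nonneg (by positivity : 0 ≤ μ * Real.exp (2 * s))]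
    have h1 := mul_le_mul_of_nonneg_left (hyC s hs) (by positivity : 0 ≤ μ * Real.exp (2 * s))
    refine h1.trans (le_of_eq ?_)
    have : Real.exp (1.4 * s) = Real.exp (2 * s) * Real.exp (-0.6 * s) := by
      rw [← Real.exp_add]; ring_nf
    rw [this, hC1]; ring
  have diffbound : ∀ (A : ℝ) (w w' : ℝ → ℝ), (∀ s ≤ s2, HasDerivAt w (w' s) s) →
      (∀ s ≤ s2, |w' s| ≤ A * Real.exp (1.4 * s)) → ∀ s ≤ s2, ∀ t ≤ s,
      |w s - w t| ≤ A / 1.4 * Real.exp (1.4 * s) - A / 1.4 * Real.exp (1.4 * t) := by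
    intro A w w' hw hw' s hs t ht
    have m1 : MonotoneOn (fun s => A / 1.4 * Real.exp (1.4 * s) - w s) (Iic s2) := mono_of_deriv
      (fun s hs => ((hasDerivAt_exp_mul 1.4 s).const_mul _).sub (hw s hs)) (fun s hs => by
        have := (abs_le.mp (hw' s hs)).2
        have e : A / 1.4 * (1.4 * Real.exp (1.4 * s)) = A * Real.exp (1.4 * s) := by ring
        linarith)
    have m2 : MonotoneOn (fun s => A / 1.4 * Real.exp (1.4 * s) + w s) (Iic s2) := mono_of_deriv
      (fun s hs => ((hasDerivAt_exp_mul 1.4 s).const_mul _).add (hw s hs)) (fun s hs => by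
        have := (abs_le.mp (hw' s hs)).1
        have e : A / 1.4 * (1.4 * Real.exp (1.4 * s)) = A * Real.exp (1.4 * s) := by ring
        linarith)
    have a1 := m1 (ht.trans hs) hs ht
    have a2 := m2 (ht.trans hs) hs ht
    simp only at a1 a2
    rw [abs_le]
    constructor <;> linarith
  have hnC : ∀ s ≤ s2, |n s| ≤ C1 / 1.4 * Real.exp (1.4 * s) := by
    intro s hs
    refine le_of_forall_pos_le_add (fun ε hε => ?_)
    obtain ⟨t, ht, hEt⟩ := small_of_integrable hE (ε := ε ^ 2 / D) (s := s) (by positivity)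
    have h1 := diffbound C1 n _ (fun s hs => hn s (hle hs)) hnd s hs t ht
    have h2 : |n t| ≤ ε := by
      apply abs_le_of_sq_le_sq _ hε.le
      rw [lt_div_iff₀ hD] at hEt
      linarith [hnE t (hle (ht.trans hs))]
    have h3 : 0 ≤ C1 / 1.4 * Real.exp (1.4 * t) := by positivity
    have h4 : |n s| ≤ |n s - n t| + |n t| := by
      have := abs_add_le (n s - n t) (n t); simpa using this
    linarith
  set C2 := C1 / 1.4 with hC2
  have hC20 : 0 ≤ C2 := by positivity
  refine ⟨s2, h21, C2, hC20, hnC, ?_⟩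
  intro s hs t ht
  have h1 := diffbound C2 y n (fun s hs => hy s (hle hs)) hnC s hs t ht
  have h3 : 0 ≤ C2 / 1.4 * Real.exp (1.4 * t) := by positivity
  have h4 : C2 / 1.4 * Real.exp (1.4 * s) ≤ C2 * Real.exp (1.4 * s) := by
    apply mul_le_mul_of_nonneg_right _ (Real.exp_pos _).le
    rw [div_le_iff₀ (by norm_num)]
    linarith
  linarith

end NZ

namespace NZ

open MeasureTheory Filter Topology

variable {s0 β s μ : ℝ} {f g : ℝ × ℝ → ℝ}

/-- the equation on the strip -/
def StripEq (s0 β μ : ℝ) (f : ℝ × ℝ → ℝ) : Prop :=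
  ∀ q ∈ KS s0 β, dX (KS s0 β) (dX (KS s0 β) f) q + dY (KS s0 β) (dY (KS s0 β) f) q
    = -μ * Real.exp (2 * q.1) * f q

lemma sm_mul {S : Set (ℝ × ℝ)} {f g : ℝ × ℝ → ℝ} (hf : Sm S f) (hg : Sm S g) :
    Sm S (fun q => f q * g q) := ContDiffOn.mul hf hg

lemma sm_expfst (S : Set (ℝ × ℝ)) (c : ℝ) : Sm S (fun q => Real.exp (c * q.1)) := by
  apply ContDiff.contDiffOn
  fun_prop

/-- integration by parts in `θ` -/
lemma av_ibp (hβ : 0 < β) (hf : Sm (KS s0 β) f) (hg : Sm (KS s0 β) g) (hs : s < s0)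
    (h0 : f (s, 0) * g (s, 0) = 0) (h1 : f (s, β) * g (s, β) = 0) :
    av β (fun q => f q * dY (KS s0 β) g q) s = - av β (fun q => dY (KS s0 β) f q * g q) s := by
  have hG := good_KS (s0 := s0) hβ
  have h := av_dY hβ (sm_mul hf hg) hs
  rw [av_congr (g := fun q => dY (KS s0 β) f q * g q + f q * dY (KS s0 β) g q) hβ
    (fun θ hθ => dY_mul hG hf hg ⟨hs, hθ⟩), av_add hβ (sm_mul (hf.dY hG) hg).cont
    (sm_mul hf (hg.dY hG)).cont hs, h0, h1] at h
  linarith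

/-- energy identity -/
lemma energy (hβ : 0 < β) (hf : Sm (KS s0 β) f) (heq : StripEq s0 β μ f) (hs : s < s0)
    (h0 : f (s, 0) * dY (KS s0 β) f (s, 0) = 0) (h1 : f (s, β) * dY (KS s0 β) f (s, β) = 0) :
    HasDerivAt (av β (fun q => f q * f q)) (2 * av β (fun q => f q * dX (KS s0 β) f q) s) s ∧
    HasDerivAt (av β (fun q => f q * dX (KS s0 β) f q))
      (av β (fun q => dX (KS s0 β) f q * dX (KS s0 β) f q) s
        + av β (fun q => dY (KS s0 β) f q * dY (KS s0 β) f q) s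
        - μ * Real.exp (2 * s) * av β (fun q => f q * f q) s) s := by
  have hG := good_KS (s0 := s0) hβ
  have hX := hf.dX hG
  have hY := hf.dY hG
  constructor
  · have h := av_hasDerivAt hβ (sm_mul hf hf) hs
    convert h using 1
    rw [← av_const_mul]
    apply av_congr hβ
    intro θ hθ
    rw [dX_mul hG hf hf (p := (s, θ)) ⟨hs, hθ⟩]
    ring
  · have h := av_hasDerivAt hβ (sm_mul hf hX) hs
    convert h using 1
    have hibp := av_ibp hβ hf hY hs h0 h1
    have e : av β (dX (KS s0 β) fun q => f q * dX (KS s0 β) f q) s =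
        av β (fun q => (dX (KS s0 β) f q * dX (KS s0 β) f q
          - f q * dY (KS s0 β) (dY (KS s0 β) f) q)
          - μ * Real.exp (2 * s) * (f q * f q)) s := by
      apply av_congr hβ
      intro θ hθ
      rw [dX_mul hG hf hX (p := (s, θ)) ⟨hs, hθ⟩]
      have := heq (s, θ) ⟨hs, hθ⟩
      simp only at this
      linear_combination f (s, θ) * this
    rw [e, av_sub (f := fun q => dX (KS s0 β) f q * dX (KS s0 β) f q
          - f q * dY (KS s0 β) (dY (KS s0 β) f) q)
      (g := fun q => μ * Real.exp (2 * s) * (f q * f q)) hβ (ContinuousOn.sub (sm_mul hX hX).cont (sm_mul hf (hY.dY hG)).cont)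
      (continuousOn_const.mul (sm_mul hf hf).cont) hs, av_sub hβ (sm_mul hX hX).cont
      (sm_mul hf (hY.dY hG)).cont hs, hibp, av_const_mul]
    ring

lemma stripEq_dY (hβ : 0 < β) (hf : Sm (KS s0 β) f) (heq : StripEq s0 β μ f) :
    StripEq s0 β μ (dY (KS s0 β) f) := by
  have hG := good_KS (s0 := s0) hβ
  intro q hq
  have hX := hf.dX hG
  have hY := hf.dY hG
  set K := KS s0 β
  have e1 : dX K (dX K (dY K f)) q = dY K (dX K (dX K f)) q := by
    rw [dX_congr (g := dY K (dX K f)) (fun p hp => dX_dY_comm hG hf hp) hq,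
      dX_dY_comm hG hX hq]
  have e2 : dY K (fun q => dX K (dX K f) q + dY K (dY K f) q) q =
      dY K (fun q => (-μ) * (Real.exp (2 * q.1) * f q)) q :=
    dY_congr (fun p hp => by rw [heq p hp]; ring) hq
  have hexp := sm_expfst K 2
  rw [dY_add hG (hX.dX hG) (hY.dY hG) hq, dY_const_mul hG _ (sm_mul hexp hf) hq,
    dY_mul hG hexp hf hq] at e2
  have e3 : dY K (fun q => Real.exp (2 * q.1)) q = 0 := by
    have h : HasFDerivWithinAt (fun q : ℝ × ℝ => Real.exp (2 * q.1))
        (lin (2 * Real.exp (2 * q.1)) 0) K q := by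
      have h1 : HasFDerivAt (fun q : ℝ × ℝ => Real.exp (2 * q.1)) _ q :=
        ((hasFDerivAt_fst (𝕜 := ℝ) (p := q)).const_mul (2 : ℝ)).exp
      refine h1.hasFDerivWithinAt.congr_fderiv ?_
      apply lin_ext <;> simp
      ring
    exact dY_of_has hG hq h
  rw [e1, e2, e3]
  ring

/-- Wirtinger inequality with Dirichlet conditions -/
lemma wirtinger (hβ : 0 < β) (hf : Sm (KS s0 β) f) (hs : s < s0) {k : ℝ} (hk : 0 < k)
    (hkβ : k * β < Real.pi) (h0 : f (s, 0) = 0) (h1 : f (s, β) = 0) :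
    k ^ 2 * av β (fun q => f q * f q) s ≤ av β (fun q => dY (KS s0 β) f q * dY (KS s0 β) f q) s := by
  have hG := good_KS (s0 := s0) hβ
  have hY := hf.dY hG
  set K := KS s0 β
  have hcos : ∀ θ ∈ Icc 0 β, Real.cos (k * (θ - β / 2)) ≠ 0 := by
    intro θ hθ
    apply (Real.cos_pos_of_mem_Ioo _).ne'
    constructor <;> nlinarith [hθ.1, hθ.2]
  set c : ℝ → ℝ := fun θ => k * Real.tan (k * (θ - β / 2)) with hc
  have hcd : ∀ θ ∈ Icc 0 β, HasDerivAt c (k ^ 2 + c θ ^ 2) θ := by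
    intro θ hθ
    have h := (((Real.hasDerivAt_tan (hcos θ hθ)).comp θ
      (((hasDerivAt_id θ).sub_const (β / 2)).const_mul k)).const_mul k)
    refine h.congr_deriv ?_
    simp only [hc]
    have h2 := Real.tan_sq_div_one_add_tan_sq (hcos θ hθ)
    rw [one_div, ← Real.inv_one_add_tan_sq (hcos θ hθ)]
    simp
    ring
  have hcc : ContinuousOn c (Icc 0 β) := fun θ hθ => (hcd θ hθ).continuousAt.continuousWithinAt
  have hFc := slice_contOn hf.cont hs
  have hYc := slice_contOn hY.cont hs
  have hu : uIcc 0 β = Icc 0 β := uIcc_of_le hβ.le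
  have hintg : ∀ {w : ℝ → ℝ}, ContinuousOn w (Icc 0 β) → IntervalIntegrable w volume 0 β := by
    intro w hw
    apply ContinuousOn.intervalIntegrable
    rwa [hu]
  have key : ∫ θ in (0 : ℝ)..β, ((k ^ 2 + c θ ^ 2) * (f (s, θ) * f (s, θ))
      + c θ * (2 * (f (s, θ) * dY K f (s, θ)))) = c β * (f (s, β) * f (s, β)) - c 0 * (f (s, 0) * f (s, 0)) := by
    refine intervalIntegral.integral_eq_sub_of_hasDerivAt_of_le (f := fun θ => c θ * (f (s, θ) * f (s, θ))) hβ.le (hcc.mul (hFc.mul hFc))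
      (fun θ hθ => ?_) ?_
    · have hθ' := Ioo_subset_Icc_self hθ
      have hd := (slice_hasY hf hs hθ').hasDerivAt (Icc_mem_nhds hθ.1 hθ.2)
      refine ((hcd θ hθ').mul (hd.mul hd)).congr_deriv ?_
      simp only [Pi.mul_apply]
      ring
    · exact hintg (((continuousOn_const.add (hcc.pow 2)).mul (hFc.mul hFc)).add
        (hcc.mul (continuousOn_const.mul (hFc.mul hYc))))
  have key2 : 0 ≤ ∫ θ in (0 : ℝ)..β, (dY K f (s, θ) + c θ * f (s, θ)) ^ 2 :=
    intervalIntegral.integral_nonneg hβ.le (fun θ _ => sq_nonneg _)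
  have e : ∫ θ in (0 : ℝ)..β, (dY K f (s, θ) + c θ * f (s, θ)) ^ 2 =
      (∫ θ in (0 : ℝ)..β, dY K f (s, θ) * dY K f (s, θ)) + ((∫ θ in (0 : ℝ)..β, ((k ^ 2 + c θ ^ 2) * (f (s, θ) * f (s, θ))
      + c θ * (2 * (f (s, θ) * dY K f (s, θ))))) - ∫ θ in (0 : ℝ)..β, k ^ 2 * (f (s, θ) * f (s, θ))) := by
    rw [← intervalIntegral.integral_sub, ← intervalIntegral.integral_add]
    · congr 1
      ext θ
      ring
    · exact hintg (hYc.mul hYc)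
    · exact hintg ((((continuousOn_const.add (hcc.pow 2)).mul (hFc.mul hFc)).add
        (hcc.mul (continuousOn_const.mul (hFc.mul hYc)))).sub (continuousOn_const.mul (hFc.mul hFc)))
    · exact hintg (((continuousOn_const.add (hcc.pow 2)).mul (hFc.mul hFc)).add
        (hcc.mul (continuousOn_const.mul (hFc.mul hYc))))
    · exact hintg (continuousOn_const.mul (hFc.mul hFc))
  rw [e, key, h0, h1, intervalIntegral.integral_const_mul] at key2
  simp only [av]
  linarith

/-- Cauchy-Schwarz against constants -/
lemma av_sq_le (hβ : 0 < β) (hf : ContinuousOn f (KS s0 β)) (hs : s < s0) :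
    av β f s ^ 2 ≤ β * av β (fun q => f q * f q) s := by
  set A := av β f s
  have h : 0 ≤ av β (fun q => (f q - A / β) * (f q - A / β)) s :=
    av_nonneg hβ (fun θ _ => mul_self_nonneg _)
  have e : av β (fun q => (f q - A / β) * (f q - A / β)) s =
      av β (fun q => f q * f q + ((-2 * (A / β)) * f q + (A / β) ^ 2)) s := by
    congr 1; ext q; ring
  rw [e, av_add (f := fun q => f q * f q) (g := fun q => -2 * (A / β) * f q + (A / β) ^ 2) hβ
    (hf.mul hf) ((continuousOn_const.mul hf).add continuousOn_const) hs,
    av_add (f := fun q => -2 * (A / β) * f q) (g := fun _ => (A / β) ^ 2) hβ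
    (continuousOn_const.mul hf) continuousOn_const hs, av_const_mul] at h
  have e2 : av β (fun _ => (A / β) ^ 2) s = β * (A / β) ^ 2 := by
    simp [av]
  rw [e2] at h
  have e3 : β * (A / β) ^ 2 = A * (A / β) := by field_simp
  rw [e3] at h
  have e4 : A ^ 2 = β * (A * (A / β)) := by field_simp
  have : 0 ≤ β * (av β (fun q => f q * f q) s - A * (A / β)) := mul_nonneg hβ.le (by
    change 0 ≤ _ + (-2 * (A / β) * A + A * (A / β)) at h
    linarith)
  linarith

/-- oscillation on a slice -/
lemma osc (hβ : 0 < β) (hf : Sm (KS s0 β) f) (hs : s < s0) {θ : ℝ} (hθ : θ ∈ Icc 0 β) :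
    (f (s, θ) - av β f s / β) ^ 2 ≤ β * av β (fun q => dY (KS s0 β) f q * dY (KS s0 β) f q) s := by
  have hG := good_KS (s0 := s0) hβ
  have hY := hf.dY hG
  set K := KS s0 β
  set N := av β (fun q => |dY K f q|) s with hN
  have hYc := slice_contOn hY.cont hs
  have hN0 : 0 ≤ N := av_nonneg hβ (fun θ _ => abs_nonneg _)
  have hN2 : N ^ 2 ≤ β * av β (fun q => dY K f q * dY K f q) s := by
    have := av_sq_le hβ (hY.cont.abs) hs
    simpa using this
  have hd : ∀ φ ∈ Icc 0 β, |f (s, θ) - f (s, φ)| ≤ N := by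
    have aux : ∀ a ∈ Icc 0 β, ∀ b ∈ Icc 0 β, a ≤ b → |f (s, b) - f (s, a)| ≤ N := by
      intro a ha b hb hab
      have hsub : Icc a b ⊆ Icc 0 β := Icc_subset_Icc ha.1 hb.2
      have e : ∫ t in a..b, dY K f (s, t) = f (s, b) - f (s, a) := by
        refine intervalIntegral.integral_eq_sub_of_hasDerivAt_of_le hab
          ((slice_contOn hf.cont hs).mono hsub) (fun t ht => ?_) ?_
        · exact (slice_hasY hf hs (hsub (Ioo_subset_Icc_self ht))).hasDerivAt
            (Icc_mem_nhds (ha.1.trans_lt ht.1) (ht.2.trans_le hb.2))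
        · apply ContinuousOn.intervalIntegrable
          rw [uIcc_of_le hab]
          exact hYc.mono hsub
      rw [← e]
      refine (intervalIntegral.abs_integral_le_integral_abs hab).trans ?_
      refine intervalIntegral.integral_mono_interval ha.1 hab hb.2 ?_ ?_
      · exact Eventually.of_forall (fun _ => abs_nonneg _)
      · exact slice_int hβ hY.cont.abs hs
    intro φ hφ
    rcases le_total θ φ with h | h
    · rw [abs_sub_comm]; exact aux θ hθ φ hφ h
    · exact aux φ hφ θ hθ h
  have h3 : |f (s, θ) - av β f s / β| ≤ N := by
    have e : β * (f (s, θ) - av β f s / β) = ∫ φ in (0 : ℝ)..β, (f (s, θ) - f (s, φ)) := by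
      rw [intervalIntegral.integral_sub (by simp) (slice_int hβ hf.cont hs)]
      simp only [av, intervalIntegral.integral_const, sub_zero, smul_eq_mul]
      field_simp
    have h := intervalIntegral.norm_integral_le_of_norm_le_const (a := 0) (b := β) (C := N)
      (f := fun φ => f (s, θ) - f (s, φ)) (fun φ hφ => by
        rw [uIoc_of_le hβ.le] at hφ
        exact hd φ (Ioc_subset_Icc_self hφ))
    rw [← e, Real.norm_eq_abs, abs_mul, sub_zero, abs_of_pos hβ, mul_comm] at h
    exact le_of_mul_le_mul_right h hβ
  calc (f (s, θ) - av β f s / β) ^ 2 = |f (s, θ) - av β f s / β| ^ 2 := (sq_abs _).symm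
    _ ≤ N ^ 2 := by gcongr
    _ ≤ _ := hN2

end NZ

namespace NZ

open MeasureTheory Filter Topology

variable {s0 β s μ : ℝ} {f g : ℝ × ℝ → ℝ}

structure StripSol (s0 β μ : ℝ) (f : ℝ × ℝ → ℝ) : Prop where
  hβ : 0 < β
  hπ : β < Real.pi
  hμ : 0 ≤ μ
  sm : Sm (KS s0 β) f
  eq : StripEq s0 β μ f
  n0 : ∀ s < s0, dY (KS s0 β) f (s, 0) = 0
  n1 : ∀ s < s0, dY (KS s0 β) f (s, β) = 0

/-- energy density on a strip -/
def en (s0 β : ℝ) (f : ℝ × ℝ → ℝ) (q : ℝ × ℝ) : ℝ :=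
  dX (KS s0 β) f q * dX (KS s0 β) f q + dY (KS s0 β) f q * dY (KS s0 β) f q

lemma en_sm (hβ : 0 < β) (hf : Sm (KS s0 β) f) : Sm (KS s0 β) (en s0 β f) := by
  have hG := good_KS (s0 := s0) hβ
  exact ContDiffOn.add (sm_mul (hf.dX hG) (hf.dX hG)) (sm_mul (hf.dY hG) (hf.dY hG))

lemma av_en (hβ : 0 < β) (hf : Sm (KS s0 β) f) (hs : s < s0) : av β (en s0 β f) s =
    av β (fun q => dX (KS s0 β) f q * dX (KS s0 β) f q) s
    + av β (fun q => dY (KS s0 β) f q * dY (KS s0 β) f q) s := by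
  have hG := good_KS (s0 := s0) hβ
  exact av_add hβ (sm_mul (hf.dX hG) (hf.dX hG)).cont (sm_mul (hf.dY hG) (hf.dY hG)).cont hs

lemma av_sq_nonneg (hβ : 0 < β) (g : ℝ × ℝ → ℝ) (s : ℝ) : 0 ≤ av β (fun q => g q * g q) s :=
  av_nonneg hβ (fun _ _ => mul_self_nonneg _)

lemma StripSol.en_integrable (h : StripSol s0 β μ f) {M : ℝ} (hM : ∀ q ∈ KS s0 β, |f q| ≤ M)
    {s1 : ℝ} (hs1 : s1 < s0) : IntegrableOn (av β (en s0 β f)) (Iic s1) := by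
  have hlt : ∀ {s}, s ≤ s1 → s < s0 := fun h => lt_of_le_of_lt h hs1
  have hE : ∀ s ≤ s1, _ := fun s hs => energy h.hβ h.sm h.eq (hlt hs) (by rw [h.n0 s (hlt hs), mul_zero])
    (by rw [h.n1 s (hlt hs), mul_zero])
  refine stripA (M := β * M ^ 2) h.hμ (fun s hs => (hE s hs).1) (fun s hs => ?_)
    ((av_cont h.hβ (en_sm h.hβ h.sm)).mono (fun s hs => hlt hs)) (fun s hs => ?_)
    (fun s hs => av_sq_nonneg h.hβ _ _) (fun s hs => ?_)
  · rw [av_en h.hβ h.sm (hlt hs)]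
    exact (hE s hs).2
  · rw [av_en h.hβ h.sm (hlt hs)]
    exact add_nonneg (av_sq_nonneg h.hβ _ _) (av_sq_nonneg h.hβ _ _)
  · have := av_mono (g := fun _ => M ^ 2) h.hβ (sm_mul h.sm h.sm).cont continuousOn_const (hlt hs)
      (fun θ hθ => by
        have := hM (s, θ) ⟨hlt hs, hθ⟩
        rw [← sq]
        exact sq_le_sq' (abs_le.mp this).1 (abs_le.mp this).2)
    simpa [av] using this

lemma StripSol.main (h : StripSol s0 β μ f) {s1 : ℝ} (hs1 : s1 < s0)
    (hE : IntegrableOn (av β (en s0 β f)) (Iic s1)) :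
    ∃ s2 ≤ s1, ∃ C k, 1 < k ∧ 0 ≤ C ∧
      (∀ s ≤ s2, av β (fun q => dY (KS s0 β) f q * dY (KS s0 β) f q) s ≤ C * Real.exp (2 * k * s)) ∧
      IntegrableOn (fun s => Real.exp (-2 * s) *
        av β (fun q => dY (KS s0 β) f q * dY (KS s0 β) f q) s) (Iic s2) ∧
      IntegrableOn (fun s => Real.exp (-2 * s) * av β (en s0 β (dY (KS s0 β) f)) s) (Iic s2) ∧
      (∀ s ≤ s2, |av β (dX (KS s0 β) f) s| ≤ C * Real.exp (1.4 * s)) ∧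
      (∀ s ≤ s2, ∀ t ≤ s, |av β f s - av β f t| ≤ C * Real.exp (1.4 * s)) := by
  have hβ := h.hβ
  have hG := good_KS (s0 := s0) hβ
  have hX := h.sm.dX hG
  have hY := h.sm.dY hG
  have hlt : ∀ {s}, s ≤ s1 → s < s0 := fun h => lt_of_le_of_lt h hs1
  set K := KS s0 β
  have hk : 1 < Real.pi / β := by rw [lt_div_iff₀ hβ]; linarith [h.hπ]
  obtain ⟨k1, hk1, hk1'⟩ := exists_between hk
  obtain ⟨k, hk0, hkk⟩ := exists_between hk1
  have hEn : ∀ s ≤ s1, _ := fun s hs => energy hβ hY (stripEq_dY hβ h.sm h.eq) (hlt hs)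
    (by rw [h.n0 s (hlt hs), zero_mul]) (by rw [h.n1 s (hlt hs), zero_mul])
  have hintg : ∀ {w : ℝ × ℝ → ℝ}, Sm K w → ContinuousOn (av β w) (Iic s1) :=
    fun hw => (av_cont hβ hw).mono (fun s hs => hlt hs)
  have hpi : IntegrableOn (av β (fun q => dY K f q * dY K f q)) (Iic s1) := by
    refine Integrable.mono' hE ((hintg (sm_mul hY hY)).aestronglyMeasurable measurableSet_Iic) ?_
    refine (ae_restrict_mem measurableSet_Iic).mono (fun s hs => ?_)
    rw [Real.norm_of_nonneg (av_sq_nonneg hβ _ _), av_en hβ h.sm (hlt hs)]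
    linarith [av_sq_nonneg hβ (dX K f) s]
  obtain ⟨s2, h21, C, hC, hi1, hi2⟩ := stripB (k := k) (k1 := k1) h.hμ hk0 hkk
    (fun s hs => (hEn s hs).1) (fun s hs => (hEn s hs).2)
    (hintg (sm_mul (hY.dX hG) (hY.dX hG))) (hintg (sm_mul (hY.dY hG) (hY.dY hG)))
    (fun s hs => av_sq_nonneg hβ _ _)
    (fun s hs => wirtinger hβ hY (hlt hs) (by linarith) (by rwa [lt_div_iff₀ hβ] at hk1')
      (h.n0 s (hlt hs)) (h.n1 s (hlt hs)))
    (fun s hs => by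
      have h1 : 0 ≤ av β (fun q => (dX K (dY K f) q - k * dY K f q) *
        (dX K (dY K f) q - k * dY K f q)) s := av_sq_nonneg hβ _ _
      have e : (fun q => (dX K (dY K f) q - k * dY K f q) * (dX K (dY K f) q - k * dY K f q)) =
        fun q => (dX K (dY K f) q * dX K (dY K f) q) +
          (((-2 * k) * (dY K f q * dX K (dY K f) q)) +
          ((k ^ 2) * (dY K f q * dY K f q))) := by
        ext q; ring
      have hc1 := (sm_mul (hY.dX hG) (hY.dX hG)).cont
      have hc2 : ContinuousOn (fun q => (-2 * k) * (dY K f q * dX K (dY K f) q)) K :=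
        continuousOn_const.mul (sm_mul hY (hY.dX hG)).cont
      have hc3 : ContinuousOn (fun q => (k ^ 2) * (dY K f q * dY K f q)) K :=
        continuousOn_const.mul (sm_mul hY hY).cont
      have hc23 : ContinuousOn (fun q => (-2 * k) * (dY K f q * dX K (dY K f) q) +
        (k ^ 2) * (dY K f q * dY K f q)) K := hc2.add hc3
      rw [e, av_add hβ hc1 hc23 (hlt hs), av_add hβ hc2 hc3 (hlt hs), av_const_mul,
        av_const_mul] at h1
      linarith)
    (fun s hs => av_sq_nonneg hβ _ _) hpi
  obtain ⟨s3, h31, C', hC'0, hC', hC''⟩ := stripC (y := av β f) (n := av β (dX K f)) (D := β) h.hμ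
    (fun s hs => av_hasDerivAt hβ h.sm (hlt hs))
    (fun s hs => by
      have h1 := av_hasDerivAt hβ hX (hlt hs)
      convert h1 using 1
      have e : av β (dX K (dX K f)) s = av β (fun q => (-μ * Real.exp (2 * s)) * f q - dY K (dY K f) q) s :=
        av_congr hβ (fun θ hθ => by
          have := h.eq (s, θ) ⟨hlt hs, hθ⟩
          simp only at this
          linarith)
      have hc2 : ContinuousOn (fun q => (-μ * Real.exp (2 * s)) * f q) K :=
        continuousOn_const.mul h.sm.cont
      rw [e, av_sub hβ hc2 (hY.dY hG).cont (hlt hs), av_const_mul, av_dY hβ hY (hlt hs),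
        h.n0 s (hlt hs), h.n1 s (hlt hs)]
      ring)
    hE hβ (fun s hs => by
      refine (av_sq_le hβ hX.cont (hlt hs)).trans ?_
      rw [av_en hβ h.sm (hlt hs)]
      exact mul_le_mul_of_nonneg_left (by linarith [av_sq_nonneg hβ (dY K f) s]) hβ.le)
  have hs2 : Iic (min s2 s3) ⊆ Iic s2 := Iic_subset_Iic.mpr (min_le_left _ _)
  refine ⟨min s2 s3, (min_le_left _ _).trans h21, max C C', k, hk0, le_max_of_le_right hC'0, ?_,
    hi1.mono_set hs2, ?_, ?_, ?_⟩
  · intro s hs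
    refine (hC s (hs2 hs)).trans ?_
    gcongr
    exact le_max_left _ _
  · refine (integrableOn_congr_fun (fun s hs => ?_) measurableSet_Iic).mpr (hi2.mono_set hs2)
    rw [av_en hβ hY (hlt ((hs2 hs).trans h21))]
  · intro s hs
    refine (hC' s (hs.trans (min_le_right _ _))).trans ?_
    gcongr
    exact le_max_right _ _
  · intro s hs t ht
    refine (hC'' s (hs.trans (min_le_right _ _)) t ht).trans ?_
    gcongr
    exact le_max_right _ _

/-- uniform convergence at the vertex -/
lemma StripSol.tendsto (h : StripSol s0 β μ f) {s1 : ℝ} (hs1 : s1 < s0)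
    (hE : IntegrableOn (av β (en s0 β f)) (Iic s1)) :
    ∃ c, ∀ ε > 0, ∃ s2 < s0, ∀ s < s2, ∀ θ ∈ Icc 0 β, |f (s, θ) - c| < ε := by
  obtain ⟨s2, h21, C, k, hk, hC0, hp, -, -, -, hy⟩ := h.main hs1 hE
  have hβ := h.hβ
  have hlt : ∀ {s}, s ≤ s2 → s < s0 := fun h => lt_of_le_of_lt (h.trans h21) hs1
  have hb : Tendsto (fun s : ℝ => C * Real.exp (1.4 * s)) atBot (𝓝 0) := by
    have := (Real.tendsto_exp_atBot.comp
      (tendsto_id.const_mul_atBot (by norm_num : (0 : ℝ) < 1.4))).const_mul C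
    simpa using this
  have hb2 : Tendsto (fun s : ℝ => β * (C * Real.exp (2 * k * s))) atBot (𝓝 0) := by
    have := ((Real.tendsto_exp_atBot.comp
      (tendsto_id.const_mul_atBot (by linarith : (0 : ℝ) < 2 * k))).const_mul C).const_mul β
    simpa using this
  have hseq : Tendsto (fun n : ℕ => s2 - (n : ℝ)) atTop atBot :=
    tendsto_atBot_add_const_left _ s2 (tendsto_neg_atTop_atBot.comp tendsto_natCast_atTop_atTop)
  have hcs : CauchySeq (fun n : ℕ => av β f (s2 - n)) := by
    refine cauchySeq_of_le_tendsto_0 (fun n : ℕ => 2 * (C * Real.exp (1.4 * (s2 - n)))) ?_ ?_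
    · intro n m N hn hm
      have h1 := hy (s2 - N) (by simp) (s2 - n) (by gcongr)
      have h2 := hy (s2 - N) (by simp) (s2 - m) (by gcongr)
      rw [Real.dist_eq]
      rw [abs_le] at *
      constructor <;> linarith
    · have := (hb.comp hseq).const_mul 2
      simpa using this
  obtain ⟨y, hyl⟩ := cauchySeq_tendsto_of_complete hcs
  have hyb : ∀ s ≤ s2, |av β f s - y| ≤ C * Real.exp (1.4 * s) := by
    intro s hs
    have h1 : Tendsto (fun n : ℕ => |av β f s - av β f (s2 - n)|) atTop (𝓝 |av β f s - y|) :=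
      (tendsto_const_nhds.sub hyl).abs
    refine le_of_tendsto h1 ?_
    filter_upwards [hseq.eventually (eventually_le_atBot s)] with n hn
    exact hy s hs _ hn
  refine ⟨y / β, fun ε hε => ?_⟩
  have e1 := hb.eventually (gt_mem_nhds (show 0 < β * (ε / 2) by positivity))
  have e2 := hb2.eventually (gt_mem_nhds (show 0 < (ε / 2) ^ 2 by positivity))
  obtain ⟨a, ha⟩ := eventually_atBot.mp (e1.and e2)
  refine ⟨min a s2, lt_of_le_of_lt (min_le_right _ _) (hlt le_rfl), fun s hs θ hθ => ?_⟩
  have hsa := ha s (hs.le.trans (min_le_left _ _))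
  have hs2 : s ≤ s2 := hs.le.trans (min_le_right _ _)
  have h1 := osc hβ h.sm (hlt hs2) hθ
  have h2 : |f (s, θ) - av β f s / β| < ε / 2 := by
    apply abs_lt_of_sq_lt_sq _ (by positivity)
    refine h1.trans_lt (lt_of_le_of_lt ?_ hsa.2)
    exact mul_le_mul_of_nonneg_left (hp s hs2) hβ.le
  have h3 : |av β f s / β - y / β| < ε / 2 := by
    rw [← sub_div, abs_div, abs_of_pos hβ, div_lt_iff₀ hβ]
    linarith [hyb s hs2, hsa.1]
  have h4 := abs_add_le (f (s, θ) - av β f s / β) (av β f s / β - y / β)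
  have h5 : f (s, θ) - av β f s / β + (av β f s / β - y / β) = f (s, θ) - y / β := by ring
  rw [h5] at h4
  linarith

lemma integrableOn_strip_of_av (hβ : 0 < β) {F : ℝ × ℝ → ℝ} (hF : ContinuousOn F (KS s0 β))
    (hF0 : ∀ q ∈ KS s0 β, 0 ≤ F q) {s2 : ℝ} (hs2 : s2 < s0) (hi : IntegrableOn (av β F) (Iic s2)) :
    IntegrableOn F (Iic s2 ×ˢ Ioc 0 β) := by
  have hsub : Iic s2 ×ˢ Ioc 0 β ⊆ KS s0 β :=
    fun q hq => ⟨lt_of_le_of_lt hq.1 hs2, Ioc_subset_Icc_self hq.2⟩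
  have hm : AEStronglyMeasurable F (volume.restrict (Iic s2 ×ˢ Ioc 0 β)) :=
    (hF.mono hsub).aestronglyMeasurable (measurableSet_Iic.prod measurableSet_Ioc)
  rw [IntegrableOn, Measure.volume_eq_prod, ← Measure.prod_restrict] at *
  rw [integrable_prod_iff hm]
  constructor
  · refine (ae_restrict_mem measurableSet_Iic).mono (fun s hs => ?_)
    have := slice_int hβ hF (lt_of_le_of_lt hs hs2)
    rwa [intervalIntegrable_iff_integrableOn_Ioc_of_le hβ.le] at this
  · refine hi.congr ?_
    refine (ae_restrict_mem measurableSet_Iic).mono (fun s hs => ?_)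
    simp only [av]
    rw [intervalIntegral.integral_of_le hβ.le]
    refine setIntegral_congr_fun measurableSet_Ioc (fun θ hθ => ?_)
    exact (Real.norm_of_nonneg (hF0 (s, θ) (hsub ⟨hs, hθ⟩))).symm

lemma av_integrable_of_strip (hβ : 0 < β) {F : ℝ × ℝ → ℝ} {s2 : ℝ}
    (hi : IntegrableOn F (Iic s2 ×ˢ Ioc 0 β)) : IntegrableOn (av β F) (Iic s2) := by
  rw [IntegrableOn, Measure.volume_eq_prod, ← Measure.prod_restrict] at hi
  refine hi.integral_prod_left.congr ?_
  refine Eventually.of_forall (fun s => ?_)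
  simp only [av]
  rw [intervalIntegral.integral_of_le hβ.le]

/-- density with all derivatives up to order two -/
def en2 (s0 β : ℝ) (f : ℝ × ℝ → ℝ) (q : ℝ × ℝ) : ℝ :=
  en s0 β f q + (en s0 β (dX (KS s0 β) f) q + en s0 β (dY (KS s0 β) f) q)

lemma StripSol.en2_integrable (h : StripSol s0 β μ f) {M : ℝ} (hM : ∀ q ∈ KS s0 β, |f q| ≤ M) :
    ∃ s2 < s0, IntegrableOn (fun q : ℝ × ℝ => Real.exp (-2 * q.1) * en2 s0 β f q)
      (Iic s2 ×ˢ Ioc 0 β) := by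
  have hβ := h.hβ
  have hG := good_KS (s0 := s0) hβ
  have hX := h.sm.dX hG
  have hY := h.sm.dY hG
  have hs1 : s0 - 1 < s0 := by linarith
  obtain ⟨s2, h21, C, k, hk, hC0, -, hi1, hi2, hn, -⟩ := h.main hs1 (h.en_integrable hM hs1)
  set K := KS s0 β
  have hlt : ∀ {s}, s ≤ s2 → s < s0 := fun h => lt_of_le_of_lt (h.trans h21) hs1
  refine ⟨s2, hlt le_rfl, ?_⟩
  have hsm2 : Sm K (en2 s0 β f) :=
    ContDiffOn.add (en_sm hβ h.sm) (ContDiffOn.add (en_sm hβ hX) (en_sm hβ hY))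
  have hsmE : Sm K (fun q => Real.exp (-2 * q.1) * en2 s0 β f q) := sm_mul (sm_expfst K (-2)) hsm2
  have en0 : ∀ g q, 0 ≤ en s0 β g q := fun g q => add_nonneg (mul_self_nonneg _) (mul_self_nonneg _)
  refine integrableOn_strip_of_av hβ hsmE.cont (fun q _ => mul_nonneg (Real.exp_pos _).le
    (add_nonneg (en0 _ _) (add_nonneg (en0 _ _) (en0 _ _)))) (hlt le_rfl) ?_
  have hdom : IntegrableOn (fun s => (2 * C ^ 2 / β) * Real.exp (0.8 * s) +
      (2 * μ ^ 2 * (β * M ^ 2)) * Real.exp (2 * s) +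
      (Real.exp (-2 * s) * av β (fun q => dY K f q * dY K f q) s +
      (2 * β ^ 2 + 4) * (Real.exp (-2 * s) * av β (en s0 β (dY K f)) s))) (Iic s2) :=
    (((integrableOn_exp_mul_Iic (by norm_num) _).const_mul _).add
      ((integrableOn_exp_mul_Iic (by norm_num) _).const_mul _)).add (hi1.add (hi2.const_mul _))
  refine Integrable.mono' hdom (((av_cont hβ hsmE).mono
    (fun s hs => hlt hs)).aestronglyMeasurable measurableSet_Iic) ?_
  refine (ae_restrict_mem measurableSet_Iic).mono (fun s hs => ?_)
  have hs0 : s < s0 := hlt hs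
  rw [Real.norm_of_nonneg (av_nonneg hβ (fun θ _ => mul_nonneg (Real.exp_pos _).le
    (add_nonneg (en0 _ _) (add_nonneg (en0 _ _) (en0 _ _)))))]
  have e1 : av β (fun q => Real.exp (-2 * q.1) * en2 s0 β f q) s
      = Real.exp (-2 * s) * av β (en2 s0 β f) s := by
    rw [← av_const_mul]; rfl
  have e2 : av β (en2 s0 β f) s = av β (en s0 β f) s + (av β (en s0 β (dX K f)) s +
      av β (en s0 β (dY K f)) s) := by
    have := av_add (f := en s0 β f) (g := fun q => en s0 β (dX K f) q + en s0 β (dY K f) q) hβ (en_sm hβ h.sm).cont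
      (ContDiffOn.add (en_sm hβ hX) (en_sm hβ hY)).continuousOn hs0
    rw [av_add hβ (en_sm hβ hX).cont (en_sm hβ hY).cont hs0] at this
    exact this
  rw [e1, e2, av_en hβ h.sm hs0, av_en hβ hX hs0, av_en hβ hY hs0]
  set p := av β (fun q => dY K f q * dY K f q) s
  set a := av β (fun q => dX K (dY K f) q * dX K (dY K f) q) s with ha_def
  set b := av β (fun q => dY K (dY K f) q * dY K (dY K f) q) s
  have hb0 : 0 ≤ b := av_sq_nonneg hβ _ _
  have ha0 : 0 ≤ a := av_sq_nonneg hβ _ _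
  have hcomm : av β (fun q => dY K (dX K f) q * dY K (dX K f) q) s = a :=
    av_congr hβ (fun θ hθ => by rw [dX_dY_comm hG h.sm (p := (s, θ)) ⟨hs0, hθ⟩])
  rw [hcomm]
  set n := av β (dX K f) s
  have hfs : av β (fun q => dX K f q * dX K f q) s ≤ 2 * n ^ 2 / β + 2 * β ^ 2 * a := by
    have := av_mono (f := fun q => dX K f q * dX K f q)
      (g := fun _ => 2 * (n / β) ^ 2 + 2 * (β * a)) hβ (sm_mul hX hX).cont continuousOn_const hs0
      (fun θ hθ => by
        have h1 := osc hβ hX hs0 hθ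
        rw [hcomm] at h1
        change (dX K f (s, θ) - n / β) ^ 2 ≤ _ at h1
        nlinarith [sq_nonneg (dX K f (s, θ) - 2 * (n / β))])
    refine this.trans (le_of_eq ?_)
    simp only [av, intervalIntegral.integral_const, smul_eq_mul, sub_zero]
    field_simp
  have hfss : av β (fun q => dX K (dX K f) q * dX K (dX K f) q) s ≤
      2 * b + 2 * μ ^ 2 * (β * M ^ 2) * Real.exp (2 * s) ^ 2 := by
    have hc2 : ContinuousOn (fun q => 2 * (dY K (dY K f) q * dY K (dY K f) q)) K :=
        continuousOn_const.mul (sm_mul (hY.dY hG) (hY.dY hG)).cont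
    have := av_mono (f := fun q => dX K (dX K f) q * dX K (dX K f) q)
      (g := fun q => 2 * (dY K (dY K f) q * dY K (dY K f) q) + 2 * μ ^ 2 * M ^ 2 * Real.exp (2 * s) ^ 2) hβ
      (sm_mul (hX.dX hG) (hX.dX hG)).cont (hc2.add continuousOn_const) hs0
      (fun θ hθ => by
        have h1 := h.eq (s, θ) ⟨hs0, hθ⟩
        have h2 := hM (s, θ) ⟨hs0, hθ⟩
        have h3 : f (s, θ) ^ 2 ≤ M ^ 2 := sq_le_sq' (abs_le.mp h2).1 (abs_le.mp h2).2
        simp only at h1 ⊢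
        have h4 : dX K (dX K f) (s, θ) = -μ * Real.exp (2 * s) * f (s, θ) - dY K (dY K f) (s, θ) := by
          linarith
        rw [h4]
        have h5 := mul_le_mul_of_nonneg_left h3 (by positivity : 0 ≤ 2 * (μ * Real.exp (2 * s)) ^ 2)
        nlinarith [sq_nonneg (μ * Real.exp (2 * s) * f (s, θ) - dY K (dY K f) (s, θ))])
    rw [av_add hβ hc2 continuousOn_const hs0, av_const_mul] at this
    refine this.trans (le_of_eq ?_)
    simp only [av, intervalIntegral.integral_const, smul_eq_mul, sub_zero, b]
    ring
  have hexp : 0 < Real.exp (-2 * s) := Real.exp_pos _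
  have hn2 : Real.exp (-2 * s) * (2 * n ^ 2 / β) ≤ 2 * C ^ 2 / β * Real.exp (0.8 * s) := by
    have h1 := hn s hs
    have h2 : n ^ 2 ≤ (C * Real.exp (1.4 * s)) ^ 2 := sq_le_sq' (abs_le.mp h1).1 (abs_le.mp h1).2
    have h3 : Real.exp (0.8 * s) = Real.exp (-2 * s) * Real.exp (1.4 * s) ^ 2 := by
      rw [← Real.exp_nat_mul, ← Real.exp_add]; congr 1; push_cast; ring
    rw [h3]
    have h4 := mul_le_mul_of_nonneg_left h2 (by positivity : 0 ≤ 2 / β * Real.exp (-2 * s))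
    refine le_trans (le_of_eq ?_) (h4.trans (le_of_eq ?_)) <;> ring
  have h3 : Real.exp (2 * s) = Real.exp (-2 * s) * Real.exp (2 * s) ^ 2 := by
      rw [← Real.exp_nat_mul, ← Real.exp_add]; congr 1; push_cast; ring
  have t1 := mul_le_mul_of_nonneg_left hfs hexp.le
  have t2 := mul_le_mul_of_nonneg_left hfss hexp.le
  have t3 : 2 * μ ^ 2 * (β * M ^ 2) * Real.exp (2 * s) =
    Real.exp (-2 * s) * (2 * μ ^ 2 * (β * M ^ 2) * Real.exp (2 * s) ^ 2) := by
    conv_lhs => rw [h3]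
    ring
  rw [t3]
  have t4 : 0 ≤ Real.exp (-2 * s) * a := by positivity
  have t5 : 0 ≤ Real.exp (-2 * s) * b := by positivity
  have t6 : 0 ≤ 2 * β ^ 2 * (Real.exp (-2 * s) * b) := by positivity
  nlinarith

end NZ

namespace NZ

open MeasureTheory Filter Topology

/-- parameters of a normalised triangle with vertices `(0,0)`, `(L,0)`, `(a,h)`. -/
structure TriP where
  L : ℝ
  h : ℝ
  a : ℝ
  hL : 0 < L
  hh : 0 < h

namespace TriP
variable (τ : TriP)

def l2 (p : ℝ × ℝ) : ℝ := τ.h * p.1 - τ.a * p.2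
def l3 (p : ℝ × ℝ) : ℝ := τ.h * τ.L - τ.h * p.1 - (τ.L - τ.a) * p.2
def Om : Set (ℝ × ℝ) := {p | 0 < p.2 ∧ 0 < τ.l2 p ∧ 0 < τ.l3 p}
def T : Set (ℝ × ℝ) := {p | 0 ≤ p.2 ∧ 0 ≤ τ.l2 p ∧ 0 ≤ τ.l3 p}
def V : Set (ℝ × ℝ) := {(0, 0), (τ.L, 0), (τ.a, τ.h)}
def S : Set (ℝ × ℝ) := τ.T \ τ.V

@[fun_prop] lemma cont_l2 : Continuous τ.l2 := by unfold l2; fun_prop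
@[fun_prop] lemma cont_l3 : Continuous τ.l3 := by unfold l3; fun_prop

lemma isOpen_Om : IsOpen τ.Om :=
  (isOpen_lt continuous_const continuous_snd).inter
    ((isOpen_lt continuous_const τ.cont_l2).inter (isOpen_lt continuous_const τ.cont_l3))

lemma isClosed_T : IsClosed τ.T :=
  (isClosed_le continuous_const continuous_snd).inter
    ((isClosed_le continuous_const τ.cont_l2).inter (isClosed_le continuous_const τ.cont_l3))

lemma convex_T : Convex ℝ τ.T := by
  intro p hp q hq s t hs ht hst
  obtain ⟨h1, h2, h3⟩ := hp
  obtain ⟨k1, k2, k3⟩ := hq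
  simp only [l2, l3] at *
  refine ⟨?_, ?_, ?_⟩
  · simp; positivity
  · simp only [l2, Prod.fst_add, Prod.smul_fst, Prod.snd_add, Prod.smul_snd, smul_eq_mul]
    nlinarith [mul_nonneg hs h2, mul_nonneg ht k2]
  · simp only [l3, Prod.fst_add, Prod.smul_fst, Prod.snd_add, Prod.smul_snd, smul_eq_mul]
    have e : τ.h * τ.L = (s + t) * (τ.h * τ.L) := by rw [hst, one_mul]
    rw [e]
    nlinarith [mul_nonneg hs h3, mul_nonneg ht k3]

lemma convex_Om : Convex ℝ τ.Om := by
  intro p hp q hq s t hs ht hst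
  obtain ⟨h1, h2, h3⟩ := hp
  obtain ⟨k1, k2, k3⟩ := hq
  have key : ∀ {x y : ℝ}, 0 < x → 0 < y → 0 < s * x + t * y := by
    intro x y hx hy
    rcases hs.eq_or_lt with rfl | h
    · have : t = 1 := by linarith
      subst this; simpa
    · have := mul_pos h hx; have := mul_nonneg ht hy.le; linarith
  refine ⟨?_, ?_, ?_⟩
  · simpa using key h1 k1
  · have := key h2 k2
    simp only [l2, Prod.fst_add, Prod.smul_fst, Prod.snd_add, Prod.smul_snd, smul_eq_mul] at *
    linarith
  · have := key h3 k3
    simp only [l3, Prod.fst_add, Prod.smul_fst, Prod.snd_add, Prod.smul_snd, smul_eq_mul] at *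
    have e : τ.h * τ.L = (s + t) * (τ.h * τ.L) := by rw [hst, one_mul]
    rw [e]
    linarith

lemma V_not_Om {p : ℝ × ℝ} (hp : p ∈ τ.V) : p ∉ τ.Om := by
  rintro ⟨h1, h2, h3⟩
  simp only [l2, l3] at *
  rcases hp with rfl | rfl | rfl
  · simp at h1
  · simp at h1
  · simp at h2; linarith [mul_comm τ.a τ.h]

lemma Om_sub_S : τ.Om ⊆ τ.S := fun p hp =>
  ⟨⟨hp.1.le, hp.2.1.le, hp.2.2.le⟩, fun hV => τ.V_not_Om hV hp⟩

lemma S_sub_T : τ.S ⊆ τ.T := Set.sdiff_subset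

lemma Om_nonempty : ((τ.L + τ.a) / 3, τ.h / 3) ∈ τ.Om := by
  have := τ.hL
  have := τ.hh
  have := mul_pos τ.hL τ.hh
  refine ⟨by simp; linarith, ?_, ?_⟩ <;> simp only [l2, l3] <;> nlinarith

lemma interior_T : interior τ.T = τ.Om := by
  apply Subset.antisymm
  · intro p hp
    have hT := interior_subset hp
    -- move towards the outside
    have key : ∀ w : ℝ × ℝ, ∃ ε > (0 : ℝ), p + ε • w ∈ τ.T := by
      intro w
      have hc : Tendsto (fun ε : ℝ => p + ε • w) (𝓝[>] 0) (𝓝 p) := by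
        have : Tendsto (fun ε : ℝ => p + ε • w) (𝓝 0) (𝓝 (p + (0 : ℝ) • w)) :=
          Continuous.tendsto (by fun_prop) 0
        simp only [zero_smul, add_zero] at this
        exact this.mono_left nhdsWithin_le_nhds
      have h1 := hc.eventually (mem_interior_iff_mem_nhds.mp hp)
      obtain ⟨ε, h2, h3⟩ := (h1.and self_mem_nhdsWithin).exists
      exact ⟨ε, h3, h2⟩
    refine ⟨?_, ?_, ?_⟩
    · obtain ⟨ε, hε, h1, -, -⟩ := key (0, -1)
      simp at h1; linarith
    · obtain ⟨ε, hε, -, h1, -⟩ := key (-1, 0)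
      have := mul_pos hε τ.hh
      simp [l2] at h1 ⊢; nlinarith
    · obtain ⟨ε, hε, -, -, h1⟩ := key (1, 0)
      have := mul_pos hε τ.hh
      simp [l3] at h1 ⊢; nlinarith
  · exact interior_maximal (τ.Om_sub_S.trans τ.S_sub_T) τ.isOpen_Om

lemma finite_V : τ.V.Finite := by unfold V; simp

lemma interior_S : interior τ.S = τ.Om := by
  apply Subset.antisymm
  · rw [← τ.interior_T]; exact interior_mono τ.S_sub_T
  · exact interior_maximal τ.Om_sub_S τ.isOpen_Om

lemma good_T : Good τ.T :=
  good_of_convex τ.convex_T (by rw [τ.interior_T]; exact ⟨_, τ.Om_nonempty⟩)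

lemma good_S : Good τ.S where
  ud := by
    have : τ.S = τ.T ∩ τ.Vᶜ := Set.sdiff_eq _ _
    rw [this]
    exact τ.good_T.ud.inter τ.finite_V.isClosed.isOpen_compl
  cl := by
    rw [τ.interior_S, ← τ.interior_T]
    exact τ.S_sub_T.trans τ.good_T.cl

lemma T_sub_closure : τ.T ⊆ closure τ.Om := by
  rw [← τ.interior_T]; exact τ.good_T.cl

lemma isCompact_T : IsCompact τ.T := by
  apply Metric.isCompact_of_isClosed_isBounded τ.isClosed_T
  have hsub : τ.T ⊆ Icc (-|τ.a| - τ.L) (|τ.a| + τ.L) ×ˢ Icc 0 τ.h := by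
    rintro ⟨x, y⟩ ⟨h1, h2, h3⟩
    simp only [l2, l3] at *
    have hL := τ.hL
    have hh := τ.hh
    have hy : y ≤ τ.h := by
      by_contra! hc
      nlinarith
    have e1 := neg_abs_le τ.a
    have e2 := le_abs_self τ.a
    refine ⟨⟨?_, ?_⟩, h1, hy⟩
    · by_contra! hc
      have : τ.a * y ≥ -|τ.a| * τ.h := by nlinarith [abs_nonneg τ.a]
      nlinarith
    · by_contra! hc
      have : τ.a * y ≤ |τ.a| * τ.h := by nlinarith [abs_nonneg τ.a]
      nlinarith [mul_nonneg hL.le h1]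
  exact (isCompact_Icc.prod isCompact_Icc).isBounded.subset hsub

/-- Neumann conditions on the three sides -/
def Neu (U : ℝ × ℝ → ℝ) : Prop :=
  (∀ p ∈ τ.S, p.2 = 0 → dY τ.S U p = 0) ∧
  (∀ p ∈ τ.S, τ.l2 p = 0 → τ.h * dX τ.S U p - τ.a * dY τ.S U p = 0) ∧
  (∀ p ∈ τ.S, τ.l3 p = 0 → τ.h * dX τ.S U p + (τ.L - τ.a) * dY τ.S U p = 0)

/-- the core eigenfunction predicate -/
structure Eig (μ : ℝ) (U : ℝ × ℝ → ℝ) : Prop where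
  pos : 0 < μ
  nonconst : ¬ ∃ c : ℝ, ∀ p ∈ τ.T, U p = c
  cont : ContinuousOn U τ.T
  sm : Sm τ.S U
  eqn : ∀ p ∈ τ.Om, dX τ.S (dX τ.S U) p + dY τ.S (dY τ.S U) p = -μ * U p
  neu : τ.Neu U

end TriP

/-- polar components -/
def cx (d1 d2 : ℝ) (q : ℝ × ℝ) : ℝ := Real.exp q.1 * (Real.cos q.2 * d1 - Real.sin q.2 * d2)
def cy (d1 d2 : ℝ) (q : ℝ × ℝ) : ℝ := Real.exp q.1 * (Real.cos q.2 * d2 + Real.sin q.2 * d1)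
/-- log-polar map -/
def Ph (P : ℝ × ℝ) (d1 d2 : ℝ) (q : ℝ × ℝ) : ℝ × ℝ := (P.1 + cx d1 d2 q, P.2 + cy d1 d2 q)

/-- squared distance -/
def rsq (P q : ℝ × ℝ) : ℝ := (q.1 - P.1) ^ 2 + (q.2 - P.2) ^ 2

lemma cxy_sq {d1 d2 : ℝ} (hd : d1 ^ 2 + d2 ^ 2 = 1) (q : ℝ × ℝ) :
    cx d1 d2 q ^ 2 + cy d1 d2 q ^ 2 = Real.exp (2 * q.1) := by
  have e : Real.exp (2 * q.1) = Real.exp q.1 ^ 2 := by rw [← Real.exp_nat_mul]; norm_num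
  have := Real.sin_sq_add_cos_sq q.2
  rw [e]
  simp only [cx, cy]
  calc _ = Real.exp q.1 ^ 2 * ((d1 ^ 2 + d2 ^ 2) * (Real.sin q.2 ^ 2 + Real.cos q.2 ^ 2)) := by ring
    _ = _ := by rw [hd, this]; ring

lemma rsq_Ph {d1 d2 : ℝ} (hd : d1 ^ 2 + d2 ^ 2 = 1) (P q : ℝ × ℝ) :
    rsq P (Ph P d1 d2 q) = Real.exp (2 * q.1) := by
  rw [← cxy_sq hd q]; simp [rsq, Ph]

structure Sector (τ : TriP) (P : ℝ × ℝ) (d1 d2 β s0 : ℝ) : Prop where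
  hd : d1 ^ 2 + d2 ^ 2 = 1
  hβ : 0 < β
  hπ : β < Real.pi
  mapsS : ∀ s < s0, ∀ θ ∈ Icc 0 β, Ph P d1 d2 (s, θ) ∈ τ.S
  mapsO : ∀ s < s0, ∀ θ ∈ Ioo 0 β, Ph P d1 d2 (s, θ) ∈ τ.Om
  coverS : ∀ q ∈ τ.S, rsq P q < Real.exp (2 * s0) → ∃ s < s0, ∃ θ ∈ Icc 0 β, Ph P d1 d2 (s, θ) = q
  coverO : ∀ q ∈ τ.Om, rsq P q < Real.exp (2 * s0) →
    ∃ s < s0, ∃ θ ∈ Ioo 0 β, Ph P d1 d2 (s, θ) = q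
  neu0 : ∀ U, τ.Neu U → ∀ s < s0, -cy d1 d2 (s, 0) * dX τ.S U (Ph P d1 d2 (s, 0))
    + cx d1 d2 (s, 0) * dY τ.S U (Ph P d1 d2 (s, 0)) = 0
  neu1 : ∀ U, τ.Neu U → ∀ s < s0, -cy d1 d2 (s, β) * dX τ.S U (Ph P d1 d2 (s, β))
    + cx d1 d2 (s, β) * dY τ.S U (Ph P d1 d2 (s, β)) = 0

set_option maxHeartbeats 1000000 in
lemma sector_mk (τ : TriP) (P : ℝ × ℝ) (d1 d2 e1 e2 s0 : ℝ) (hd : d1 ^ 2 + d2 ^ 2 = 1)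
    (he : e1 ^ 2 + e2 ^ 2 = 1) (hcr : 0 < d1 * e2 - d2 * e1)
    (hS : ∀ q, rsq P q < Real.exp (2 * s0) → 0 < rsq P q → (q ∈ τ.S ↔
      0 ≤ d1 * (q.2 - P.2) - d2 * (q.1 - P.1) ∧ 0 ≤ (q.1 - P.1) * e2 - (q.2 - P.2) * e1))
    (hO : ∀ q, rsq P q < Real.exp (2 * s0) → 0 < rsq P q → (q ∈ τ.Om ↔
      0 < d1 * (q.2 - P.2) - d2 * (q.1 - P.1) ∧ 0 < (q.1 - P.1) * e2 - (q.2 - P.2) * e1))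
    (hP : P ∉ τ.S)
    (hN0 : ∀ U, τ.Neu U → ∀ q ∈ τ.S, d1 * (q.2 - P.2) - d2 * (q.1 - P.1) = 0 →
      -d2 * dX τ.S U q + d1 * dY τ.S U q = 0)
    (hN1 : ∀ U, τ.Neu U → ∀ q ∈ τ.S, (q.1 - P.1) * e2 - (q.2 - P.2) * e1 = 0 →
      -e2 * dX τ.S U q + e1 * dY τ.S U q = 0) :
    ∃ β, Sector τ P d1 d2 β s0 := by
  set c := d1 * e1 + d2 * e2 with hc
  set σ := d1 * e2 - d2 * e1 with hσ
  have hcs : c ^ 2 + σ ^ 2 = 1 := by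
    have : c ^ 2 + σ ^ 2 = (d1 ^ 2 + d2 ^ 2) * (e1 ^ 2 + e2 ^ 2) := by rw [hc, hσ]; ring
    rw [this, hd, he]; norm_num
  have hc1 : -1 < c ∧ c < 1 := by constructor <;> nlinarith
  set β := Real.arccos c with hβ
  have hcosβ : Real.cos β = c := Real.cos_arccos hc1.1.le hc1.2.le
  have hβ0 : 0 < β := Real.arccos_pos.mpr hc1.2
  have hβπ : β < Real.pi := by
    refine lt_of_le_of_ne (Real.arccos_le_pi c) (fun h => ?_)
    have := hcosβ
    rw [h, Real.cos_pi] at this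
    linarith [hc1.1]
  have hsinβ : Real.sin β = σ := by
    rw [hβ, Real.sin_arccos]
    rw [show 1 - c ^ 2 = σ ^ 2 by linarith, Real.sqrt_sq hcr.le]
  have he1 : e1 = Real.cos β * d1 - Real.sin β * d2 := by
    rw [hcosβ, hsinβ, hc, hσ]
    linear_combination (-e1) * hd
  have he2 : e2 = Real.cos β * d2 + Real.sin β * d1 := by
    rw [hcosβ, hsinβ, hc, hσ]
    linear_combination (-e2) * hd
  have fr : ∀ s θ, d1 * ((Ph P d1 d2 (s, θ)).2 - P.2) - d2 * ((Ph P d1 d2 (s, θ)).1 - P.1)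
      = Real.exp s * Real.sin θ := by
    intro s θ
    simp only [Ph, cx, cy]
    linear_combination (Real.exp s * Real.sin θ) * hd
  have fr2 : ∀ s θ, ((Ph P d1 d2 (s, θ)).1 - P.1) * e2 - ((Ph P d1 d2 (s, θ)).2 - P.2) * e1
      = Real.exp s * Real.sin (β - θ) := by
    intro s θ
    rw [Real.sin_sub, he1, he2]
    simp only [Ph, cx, cy]
    linear_combination (Real.exp s * (Real.sin β * Real.cos θ - Real.cos β * Real.sin θ)) * hd
  have hrs : ∀ {s}, s < s0 → ∀ θ, rsq P (Ph P d1 d2 (s, θ)) < Real.exp (2 * s0) := by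
    intro s hs θ
    rw [rsq_Ph hd]; exact Real.exp_lt_exp.mpr (by simpa using hs)
  have hrs0 : ∀ s θ, 0 < rsq P (Ph P d1 d2 (s, θ)) := by
    intro s θ
    rw [rsq_Ph hd]; exact Real.exp_pos _
  have cover : ∀ q, 0 < rsq P q → rsq P q < Real.exp (2 * s0) →
      0 ≤ d1 * (q.2 - P.2) - d2 * (q.1 - P.1) → ∃ s < s0, ∃ θ ∈ Icc 0 Real.pi,
        Ph P d1 d2 (s, θ) = q := by
    intro q h0 h1 h2
    set x := d1 * (q.1 - P.1) + d2 * (q.2 - P.2) with hx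
    set y := d1 * (q.2 - P.2) - d2 * (q.1 - P.1) with hy
    set r := Real.sqrt (rsq P q) with hr
    have hr0 : 0 < r := Real.sqrt_pos.mpr h0
    have hr2 : r ^ 2 = rsq P q := Real.sq_sqrt h0.le
    have hxy : x ^ 2 + y ^ 2 = r ^ 2 := by
      rw [hr2, rsq, hx, hy]
      linear_combination ((q.1 - P.1) ^ 2 + (q.2 - P.2) ^ 2) * hd
    have hxr : -1 ≤ x / r ∧ x / r ≤ 1 := by
      rw [le_div_iff₀ hr0, div_le_iff₀ hr0]
      constructor <;> nlinarith
    have hcos : r * Real.cos (Real.arccos (x / r)) = x := by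
      rw [Real.cos_arccos hxr.1 hxr.2]; field_simp
    have hsin : r * Real.sin (Real.arccos (x / r)) = y := by
      rw [Real.sin_arccos]
      have : 1 - (x / r) ^ 2 = (y / r) ^ 2 := by field_simp; linarith
      rw [this, Real.sqrt_sq (by positivity)]; field_simp
    have hexp : Real.exp (Real.log r) = r := Real.exp_log hr0
    refine ⟨Real.log r, ?_, Real.arccos (x / r), ⟨Real.arccos_nonneg _, Real.arccos_le_pi _⟩, ?_⟩
    · rw [← Real.exp_lt_exp, hexp]
      have : r ^ 2 < (Real.exp s0) ^ 2 := by
        rw [hr2, ← Real.exp_nat_mul]; exact_mod_cast h1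
      exact lt_of_pow_lt_pow_left₀ 2 (Real.exp_pos _).le this
    · ext
      · simp only [Ph, cx, hexp]
        have : r * (Real.cos (Real.arccos (x / r)) * d1 - Real.sin (Real.arccos (x / r)) * d2)
          = x * d1 - y * d2 := by linear_combination d1 * hcos - d2 * hsin
        rw [this, hx, hy]
        linear_combination (q.1 - P.1) * hd
      · simp only [Ph, cy, hexp]
        have : r * (Real.cos (Real.arccos (x / r)) * d2 + Real.sin (Real.arccos (x / r)) * d1)
          = x * d2 + y * d1 := by linear_combination d2 * hcos + d1 * hsin
        rw [this, hx, hy]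
        linear_combination (q.2 - P.2) * hd
  have r0 : ∀ q, q ≠ P → 0 < rsq P q := by
    intro q hq
    by_contra! hcon
    apply hq
    simp only [rsq] at hcon
    ext <;> nlinarith [sq_nonneg (q.1 - P.1), sq_nonneg (q.2 - P.2)]
  have mS : ∀ s < s0, ∀ θ ∈ Icc 0 β, Ph P d1 d2 (s, θ) ∈ τ.S := by
    intro s hs θ hθ
    rw [hS _ (hrs hs θ) (hrs0 s θ), fr, fr2]
    constructor
    · exact mul_nonneg (Real.exp_pos _).le (Real.sin_nonneg_of_nonneg_of_le_pi hθ.1 (by linarith [hθ.2]))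
    · exact mul_nonneg (Real.exp_pos _).le (Real.sin_nonneg_of_nonneg_of_le_pi (by linarith [hθ.2]) (by linarith [hθ.1]))
  refine ⟨β, hd, hβ0, hβπ, mS, ?_, ?_, ?_, ?_, ?_⟩
  · intro s hs θ hθ
    rw [hO _ (hrs hs θ) (hrs0 s θ), fr, fr2]
    constructor
    · exact mul_pos (Real.exp_pos _) (Real.sin_pos_of_pos_of_lt_pi hθ.1 (by linarith [hθ.2]))
    · exact mul_pos (Real.exp_pos _) (Real.sin_pos_of_pos_of_lt_pi (by linarith [hθ.2]) (by linarith [hθ.1]))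
  · intro q hq hr
    have hq0 : 0 < rsq P q := r0 q (fun h => by rw [h] at hq; exact hP hq)
    have hq' := (hS q hr hq0).mp hq
    obtain ⟨s, hs, θ, hθ, rfl⟩ := cover q hq0 hr hq'.1
    refine ⟨s, hs, θ, ⟨hθ.1, ?_⟩, rfl⟩
    by_contra! hcon
    have := hq'.2
    rw [fr2] at this
    have h2 : Real.sin (β - θ) < 0 :=
      Real.sin_neg_of_neg_of_neg_pi_lt (by linarith) (by linarith [hθ.2])
    nlinarith [Real.exp_pos s]
  · intro q hq hr
    have hq0 : 0 < rsq P q := r0 q (fun h => by rw [h] at hq; exact hP (τ.Om_sub_S hq))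
    have hq' := (hO q hr hq0).mp hq
    obtain ⟨s, hs, θ, hθ, rfl⟩ := cover q hq0 hr hq'.1.le
    refine ⟨s, hs, θ, ⟨?_, ?_⟩, rfl⟩
    · rcases hθ.1.eq_or_lt with h | h
      · have := hq'.1
        rw [fr, ← h] at this
        simp at this
      · exact h
    · by_contra! hcon
      have := hq'.2
      rw [fr2] at this
      have h2 : Real.sin (β - θ) ≤ 0 :=
        Real.sin_nonpos_of_nonpos_of_neg_pi_le (by linarith) (by linarith [hθ.2])
      nlinarith [Real.exp_pos s]
  · intro U hU s hs
    have := hN0 U hU _ (mS s hs 0 ⟨le_rfl, hβ0.le⟩) (by rw [fr]; simp)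
    simp only [cx, cy, Real.cos_zero, Real.sin_zero]
    linear_combination (Real.exp s) * this
  · intro U hU s hs
    have := hN1 U hU _ (mS s hs β ⟨hβ0.le, le_rfl⟩) (by rw [fr2]; simp)
    have h1 : cx d1 d2 (s, β) = Real.exp s * e1 := by simp only [cx]; rw [he1]
    have h2 : cy d1 d2 (s, β) = Real.exp s * e2 := by simp only [cy]; rw [he2]
    rw [h1, h2]
    linear_combination (Real.exp s) * this

end NZ

namespace NZ

open MeasureTheory Filter Topology

lemma rsq_near {P : ℝ × ℝ} {W : Set (ℝ × ℝ)} (hW : W ∈ 𝓝 P) :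
    ∃ s0 : ℝ, ∀ q, rsq P q < Real.exp (2 * s0) → q ∈ W := by
  obtain ⟨ε, hε, hb⟩ := Metric.mem_nhds_iff.mp hW
  refine ⟨Real.log ε, fun q hq => hb ?_⟩
  have e : Real.exp (2 * Real.log ε) = ε ^ 2 := by
    rw [two_mul, Real.exp_add, Real.exp_log hε]; ring
  rw [e, rsq] at hq
  rw [Metric.mem_ball, Prod.dist_eq, max_lt_iff, Real.dist_eq, Real.dist_eq]
  constructor
  · exact abs_lt_of_sq_lt_sq (by nlinarith [sq_nonneg (q.2 - P.2)]) hε.le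
  · exact abs_lt_of_sq_lt_sq (by nlinarith [sq_nonneg (q.1 - P.1)]) hε.le

lemma rsq_self (P : ℝ × ℝ) : rsq P P = 0 := by simp [rsq]

/-- generic: near a vertex `P` with opposite linear function `k`, membership is given by two
inequalities -/
lemma sector_gen (τ : TriP) (P : ℝ × ℝ) (d1 d2 e1 e2 c1 c2 : ℝ) (f g k : ℝ × ℝ → ℝ)
    (hk : Continuous k) (hkP : 0 < k P) (hPV : P ∈ τ.V)
    (hT : ∀ q, q ∈ τ.T ↔ 0 ≤ f q ∧ 0 ≤ g q ∧ 0 ≤ k q)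
    (hOm : ∀ q, q ∈ τ.Om ↔ 0 < f q ∧ 0 < g q ∧ 0 < k q)
    (hV : ∀ q ∈ τ.V, q ≠ P → k q = 0)
    (hd : d1 ^ 2 + d2 ^ 2 = 1)
    (he : e1 ^ 2 + e2 ^ 2 = 1) (hcr : 0 < d1 * e2 - d2 * e1)
    (hc1 : 0 < c1) (hc2 : 0 < c2)
    (hf : ∀ q, d1 * (q.2 - P.2) - d2 * (q.1 - P.1) = c1 * f q)
    (hg : ∀ q, (q.1 - P.1) * e2 - (q.2 - P.2) * e1 = c2 * g q)
    (hN0 : ∀ U, τ.Neu U → ∀ q ∈ τ.S, f q = 0 →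
      -d2 * dX τ.S U q + d1 * dY τ.S U q = 0)
    (hN1 : ∀ U, τ.Neu U → ∀ q ∈ τ.S, g q = 0 →
      -e2 * dX τ.S U q + e1 * dY τ.S U q = 0) :
    ∃ β s0, Sector τ P d1 d2 β s0 := by
  obtain ⟨s0, hs0⟩ := rsq_near ((isOpen_lt continuous_const hk).mem_nhds hkP)
  have hs0' : ∀ q, rsq P q < Real.exp (2 * s0) → 0 < k q := hs0
  suffices h : ∃ β, Sector τ P d1 d2 β s0 by
    obtain ⟨β, hβ⟩ := h
    exact ⟨β, s0, hβ⟩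
  refine sector_mk τ P d1 d2 e1 e2 s0 hd he hcr ?_ ?_ (fun h => h.2 hPV) ?_ ?_
  · intro q h1 h2
    rw [hf, hg]
    have hkq := hs0' q h1
    constructor
    · intro hq
      have := (hT q).mp hq.1
      exact ⟨mul_nonneg hc1.le this.1, mul_nonneg hc2.le this.2.1⟩
    · rintro ⟨h3, h4⟩
      refine ⟨(hT q).mpr ⟨nonneg_of_mul_nonneg_right h3 hc1, nonneg_of_mul_nonneg_right h4 hc2,
        hkq.le⟩, fun hqV => ?_⟩
      have : q ≠ P := by rintro rfl; rw [rsq_self] at h2; exact lt_irrefl _ h2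
      exact hkq.ne' (hV q hqV this)
  · intro q h1 h2
    rw [hf, hg]
    have hkq := hs0' q h1
    constructor
    · intro hq
      have := (hOm q).mp hq
      exact ⟨mul_pos hc1 this.1, mul_pos hc2 this.2.1⟩
    · rintro ⟨h3, h4⟩
      exact (hOm q).mpr ⟨(mul_pos_iff_of_pos_left hc1).mp h3, (mul_pos_iff_of_pos_left hc2).mp h4,
        hkq⟩
  · intro U hU q hq h0
    rw [hf] at h0
    exact hN0 U hU q hq ((mul_eq_zero.mp h0).resolve_left hc1.ne')
  · intro U hU q hq h0
    rw [hg] at h0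
    exact hN1 U hU q hq ((mul_eq_zero.mp h0).resolve_left hc2.ne')

lemma unit_sq {x y r : ℝ} (hr : 0 < r) (h : r ^ 2 = x ^ 2 + y ^ 2) :
    (x / r) ^ 2 + (y / r) ^ 2 = 1 := by
  field_simp; linarith

lemma exists_len (x : ℝ) {y : ℝ} (hy : 0 < y) : ∃ r : ℝ, 0 < r ∧ r ^ 2 = x ^ 2 + y ^ 2 :=
  ⟨Real.sqrt (x ^ 2 + y ^ 2), Real.sqrt_pos.mpr (by positivity), Real.sq_sqrt (by positivity)⟩

lemma sector_exists (τ : TriP) : ∀ P ∈ τ.V, ∃ d1 d2 β s0, Sector τ P d1 d2 β s0 := by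
  have hL := τ.hL
  have hh := τ.hh
  have hhL := mul_pos hh hL
  obtain ⟨r, hr, hr2⟩ := exists_len τ.a hh
  obtain ⟨t, ht, ht2⟩ := exists_len (τ.L - τ.a) hh
  intro P hP
  rcases hP with rfl | rfl | rfl
  · refine ⟨1, 0, ?_⟩
    refine sector_gen τ (0, 0) 1 0 (τ.a / r) (τ.h / r) 1 (1 / r) (fun q => q.2) τ.l2 τ.l3
      τ.cont_l3 ?_ ?_ ?_ ?_ ?_ ?_ ?_ ?_ ?_ ?_ ?_ ?_ ?_ ?_
    · simpa [TriP.l3] using hhL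
    · simp [TriP.V]
    · intro q; rfl
    · intro q; rfl
    · intro q hq hne
      rcases hq with rfl | rfl | rfl
      · exact absurd rfl hne
      · simp [TriP.l3]
      · simp [TriP.l3]; ring
    · norm_num
    · exact unit_sq hr hr2
    · have := div_pos hh hr; linarith
    · norm_num
    · positivity
    · intro q; simp
    · intro q; simp only [TriP.l2]; field_simp; ring
    · intro U hU q hq h0
      have := hU.1 q hq h0
      linarith
    · intro U hU q hq h0
      have := hU.2.1 q hq h0
      field_simp; linarith
  · refine ⟨(τ.a - τ.L) / t, τ.h / t, ?_⟩
    refine sector_gen τ (τ.L, 0) _ _ (-1) 0 (1 / t) 1 τ.l3 (fun q => q.2) τ.l2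
      τ.cont_l2 ?_ ?_ ?_ ?_ ?_ ?_ ?_ ?_ ?_ ?_ ?_ ?_ ?_ ?_
    · simpa [TriP.l2] using hhL
    · simp [TriP.V]
    · intro q; simp only [TriP.T, mem_ofPred_eq]; tauto
    · intro q; simp only [TriP.Om, mem_ofPred_eq]; tauto
    · intro q hq hne
      rcases hq with rfl | rfl | rfl
      · simp [TriP.l2]
      · exact absurd rfl hne
      · simp [TriP.l2]; ring
    · exact unit_sq ht (by rw [ht2]; ring)
    · norm_num
    · have := div_pos hh ht; linarith
    · positivity
    · norm_num
    · intro q; simp only [TriP.l3]; field_simp; ring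
    · intro q; simp
    · intro U hU q hq h0
      have := hU.2.2 q hq h0
      field_simp; linarith
    · intro U hU q hq h0
      have := hU.1 q hq h0
      linarith
  · refine ⟨-τ.a / r, -τ.h / r, ?_⟩
    refine sector_gen τ (τ.a, τ.h) _ _ ((τ.L - τ.a) / t) (-τ.h / t) (1 / r) (1 / t) τ.l2 τ.l3
      (fun q => q.2) continuous_snd ?_ ?_ ?_ ?_ ?_ ?_ ?_ ?_ ?_ ?_ ?_ ?_ ?_ ?_
    · simpa using hh
    · simp [TriP.V]
    · intro q; simp only [TriP.T, mem_ofPred_eq]; tauto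
    · intro q; simp only [TriP.Om, mem_ofPred_eq]; tauto
    · intro q hq hne
      rcases hq with rfl | rfl | rfl
      · rfl
      · rfl
      · exact absurd rfl hne
    · exact unit_sq hr (by rw [hr2]; ring)
    · exact unit_sq ht (by rw [ht2]; ring)
    · have : -τ.a / r * (-τ.h / t) - -τ.h / r * ((τ.L - τ.a) / t) = τ.h * τ.L / (r * t) := by
        field_simp; ring
      rw [this]; positivity
    · positivity
    · positivity
    · intro q; simp only [TriP.l2]; field_simp; ring
    · intro q; simp only [TriP.l3]; field_simp; ring
    · intro U hU q hq h0
      have := hU.2.1 q hq h0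
      field_simp; linarith
    · intro U hU q hq h0
      have := hU.2.2 q hq h0
      field_simp; linarith

end NZ

namespace NZ

open MeasureTheory Filter Topology

variable {S K : Set (ℝ × ℝ)} {V : ℝ × ℝ → ℝ} {P : ℝ × ℝ} {d1 d2 : ℝ}

lemma hasStrictFDerivAt_cx (q : ℝ × ℝ) : HasFDerivAt (cx d1 d2) (lin (cx d1 d2 q) (-cy d1 d2 q)) q := by
  have h1 : HasFDerivAt (fun q : ℝ × ℝ => q.1) (ContinuousLinearMap.fst ℝ ℝ ℝ) q := hasFDerivAt_fst
  have h2 : HasFDerivAt (fun q : ℝ × ℝ => q.2) (ContinuousLinearMap.snd ℝ ℝ ℝ) q := hasFDerivAt_snd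
  refine (h1.exp.mul ((h2.cos.mul_const d1).sub (h2.sin.mul_const d2))).congr_fderiv ?_
  apply lin_ext <;> simp [cx, cy] <;> ring

lemma hasStrictFDerivAt_cy (q : ℝ × ℝ) : HasFDerivAt (cy d1 d2) (lin (cy d1 d2 q) (cx d1 d2 q)) q := by
  have h1 : HasFDerivAt (fun q : ℝ × ℝ => q.1) (ContinuousLinearMap.fst ℝ ℝ ℝ) q := hasFDerivAt_fst
  have h2 : HasFDerivAt (fun q : ℝ × ℝ => q.2) (ContinuousLinearMap.snd ℝ ℝ ℝ) q := hasFDerivAt_snd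
  refine (h1.exp.mul ((h2.cos.mul_const d2).add (h2.sin.mul_const d1))).congr_fderiv ?_
  apply lin_ext <;> simp [cx, cy] <;> ring

lemma hasFDerivAt_Ph (q : ℝ × ℝ) : HasFDerivAt (Ph P d1 d2)
    ((lin (cx d1 d2 q) (-cy d1 d2 q)).prod (lin (cy d1 d2 q) (cx d1 d2 q))) q :=
  ((hasStrictFDerivAt_cx q).const_add P.1).prodMk ((hasStrictFDerivAt_cy q).const_add P.2)

lemma contDiff_cx : ContDiff ℝ (⊤ : ℕ∞) (cx d1 d2) := by unfold cx; fun_prop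
lemma contDiff_cy : ContDiff ℝ (⊤ : ℕ∞) (cy d1 d2) := by unfold cy; fun_prop
lemma contDiff_Ph : ContDiff ℝ (⊤ : ℕ∞) (Ph P d1 d2) :=
  (contDiff_const.add contDiff_cx).prodMk (contDiff_const.add contDiff_cy)

lemma polar_has (hmap : ∀ q ∈ K, Ph P d1 d2 q ∈ S) (hV : Sm S V) {q : ℝ × ℝ} (hq : q ∈ K) :
    HasFDerivWithinAt (fun q => V (Ph P d1 d2 q))
      (lin (cx d1 d2 q * dX S V (Ph P d1 d2 q) + cy d1 d2 q * dY S V (Ph P d1 d2 q))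
        (-cy d1 d2 q * dX S V (Ph P d1 d2 q) + cx d1 d2 q * dY S V (Ph P d1 d2 q))) K q := by
  have h := (hV.has (hmap q hq)).comp q (hasFDerivAt_Ph (P := P) (d1 := d1) (d2 := d2) q).hasFDerivWithinAt
    (fun x hx => hmap x hx)
  refine h.congr_fderiv ?_
  apply lin_ext <;> simp <;> ring

lemma polar_sm (hmap : ∀ q ∈ K, Ph P d1 d2 q ∈ S) (hV : Sm S V) :
    Sm K (fun q => V (Ph P d1 d2 q)) :=
  ContDiffOn.comp hV contDiff_Ph.contDiffOn hmap

lemma polar_dX (hK : Good K) (hmap : ∀ q ∈ K, Ph P d1 d2 q ∈ S) (hV : Sm S V) {q : ℝ × ℝ}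
    (hq : q ∈ K) : dX K (fun q => V (Ph P d1 d2 q)) q =
      cx d1 d2 q * dX S V (Ph P d1 d2 q) + cy d1 d2 q * dY S V (Ph P d1 d2 q) :=
  dX_of_has hK hq (polar_has hmap hV hq)

lemma polar_dY (hK : Good K) (hmap : ∀ q ∈ K, Ph P d1 d2 q ∈ S) (hV : Sm S V) {q : ℝ × ℝ}
    (hq : q ∈ K) : dY K (fun q => V (Ph P d1 d2 q)) q =
      -cy d1 d2 q * dX S V (Ph P d1 d2 q) + cx d1 d2 q * dY S V (Ph P d1 d2 q) :=
  dY_of_has hK hq (polar_has hmap hV hq)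

lemma polar_two (hS : Good S) (hK : Good K) (hmap : ∀ q ∈ K, Ph P d1 d2 q ∈ S) (hV : Sm S V)
    {q : ℝ × ℝ} (hq : q ∈ K) :
    let W := fun q => V (Ph P d1 d2 q)
    let x := cx d1 d2 q
    let y := cy d1 d2 q
    let p := Ph P d1 d2 q
    let Vx := dX S V p
    let Vy := dY S V p
    let Vxx := dX S (dX S V) p
    let Vxy := dY S (dX S V) p
    let Vyy := dY S (dY S V) p
    dX K (dX K W) q = x * Vx + x * (x * Vxx + y * Vxy) + y * Vy + y * (x * Vxy + y * Vyy) ∧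
    dY K (dX K W) q = -y * Vx + x * (-y * Vxx + x * Vxy) + x * Vy + y * (-y * Vxy + x * Vyy) ∧
    dY K (dY K W) q = -x * Vx - y * (-y * Vxx + x * Vxy) - y * Vy + x * (-y * Vxy + x * Vyy) := by
  intro W x y p Vx Vy Vxx Vxy Vyy
  have hVx := hV.dX hS
  have hVy := hV.dY hS
  have hcx : HasFDerivWithinAt (cx d1 d2) (lin x (-y)) K q := (hasStrictFDerivAt_cx q).hasFDerivWithinAt
  have hcy : HasFDerivWithinAt (cy d1 d2) (lin y x) K q := (hasStrictFDerivAt_cy q).hasFDerivWithinAt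
  have hA := polar_has hmap hVx hq
  have hB := polar_has hmap hVy hq
  have hcomm : dX S (dY S V) p = Vxy := dX_dY_comm hS hV (hmap q hq)
  have e1 : EqOn (dX K W) (fun q => cx d1 d2 q * dX S V (Ph P d1 d2 q)
    + cy d1 d2 q * dY S V (Ph P d1 d2 q)) K := fun q hq => polar_dX hK hmap hV hq
  have e2 : EqOn (dY K W) (fun q => -cy d1 d2 q * dX S V (Ph P d1 d2 q)
    + cx d1 d2 q * dY S V (Ph P d1 d2 q)) K := fun q hq => polar_dY hK hmap hV hq
  have k1 := ((hcx.mul hA).add (hcy.mul hB)).congr e1 (e1 hq)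
  have k2 := ((hcy.neg.mul hA).add (hcx.mul hB)).congr e2 (e2 hq)
  change HasFDerivWithinAt (dX K W) (x • lin (x * Vxx + y * Vxy) (-y * Vxx + x * Vxy) + Vx • lin x (-y)
    + (y • lin (x * dX S (dY S V) p + y * Vyy) (-y * dX S (dY S V) p + x * Vyy) + Vy • lin y x)) K q at k1
  change HasFDerivWithinAt (dY K W) (-y • lin (x * Vxx + y * Vxy) (-y * Vxx + x * Vxy) + Vx • -lin y x
    + (x • lin (x * dX S (dY S V) p + y * Vyy) (-y * dX S (dY S V) p + x * Vyy) + Vy • lin x (-y))) K q at k2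
  rw [hcomm] at k1 k2
  refine ⟨?_, ?_, ?_⟩
  · simp only [dX, k1.fderivWithin (hK.ud q hq)]
    simp; ring
  · simp only [dY, k1.fderivWithin (hK.ud q hq)]
    simp; ring
  · simp only [dY, k2.fderivWithin (hK.ud q hq)]
    simp; ring

/-- pull-back of an eigenfunction is a strip solution -/
lemma strip_of_pde {τ : TriP} {β s0 μ : ℝ} (hs : Sector τ P d1 d2 β s0) {U : ℝ × ℝ → ℝ}
    (hμ : 0 ≤ μ) (hU : Sm τ.S U)
    (hpde : ∀ p ∈ τ.S, dX τ.S (dX τ.S U) p + dY τ.S (dY τ.S U) p = -μ * U p) (hN : τ.Neu U) :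
    StripSol s0 β μ (fun q => U (Ph P d1 d2 q)) := by
  have hG := good_KS (s0 := s0) hs.hβ
  have hmap : ∀ q ∈ KS s0 β, Ph P d1 d2 q ∈ τ.S := fun q hq => hs.mapsS q.1 hq.1 q.2 hq.2
  refine ⟨hs.hβ, hs.hπ, hμ, polar_sm hmap hU, ?_, ?_, ?_⟩
  · intro q hq
    obtain ⟨h1, -, h3⟩ := polar_two τ.good_S hG hmap hU hq
    rw [h1, h3]
    have := hpde _ (hmap q hq)
    have e := cxy_sq hs.hd q
    rw [← e]
    linear_combination (cx d1 d2 q ^ 2 + cy d1 d2 q ^ 2) * this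
  · intro s hs'
    rw [polar_dY hG hmap hU (q := (s, 0)) ⟨hs', le_rfl, hs.hβ.le⟩]
    exact hs.neu0 U hN s hs'
  · intro s hs'
    rw [polar_dY hG hmap hU (q := (s, β)) ⟨hs', hs.hβ.le, le_rfl⟩]
    exact hs.neu1 U hN s hs'

lemma pde_S {τ : TriP} {μ : ℝ} {U : ℝ × ℝ → ℝ} (hU : Sm τ.S U)
    (h : ∀ p ∈ τ.Om, dX τ.S (dX τ.S U) p + dY τ.S (dY τ.S U) p = -μ * U p) :
    ∀ p ∈ τ.S, dX τ.S (dX τ.S U) p + dY τ.S (dY τ.S U) p = -μ * U p := by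
  have hG := τ.good_S
  have hxx := ((hU.dX hG).dX hG).cont
  have hyy := ((hU.dY hG).dY hG).cont
  have e : EqOn (fun p => dX τ.S (dX τ.S U) p + dY τ.S (dY τ.S U) p) (fun p => -μ * U p) τ.S :=
    Set.EqOn.of_subset_closure (s := τ.Om) h (hxx.add hyy) (continuousOn_const.mul hU.cont)
      τ.Om_sub_S (τ.S_sub_T.trans τ.T_sub_closure)
  exact e

lemma TriP.Eig.pde {τ : TriP} {μ : ℝ} {U : ℝ × ℝ → ℝ} (h : τ.Eig μ U) :
    ∀ p ∈ τ.S, dX τ.S (dX τ.S U) p + dY τ.S (dY τ.S U) p = -μ * U p := pde_S h.sm h.eqn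

lemma Ph_det (q : ℝ × ℝ) (hd : d1 ^ 2 + d2 ^ 2 = 1) :
    |((lin (cx d1 d2 q) (-cy d1 d2 q)).prod (lin (cy d1 d2 q) (cx d1 d2 q))).det|
      = Real.exp (2 * q.1) := by
  have : ((lin (cx d1 d2 q) (-cy d1 d2 q)).prod (lin (cy d1 d2 q) (cx d1 d2 q))).det
      = cx d1 d2 q ^ 2 + cy d1 d2 q ^ 2 := by
    rw [ContinuousLinearMap.det, ← LinearMap.det_toMatrix (Module.Basis.finTwoProd ℝ), Matrix.det_fin_two]
    simp [LinearMap.toMatrix_apply]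
    ring
  rw [this, cxy_sq hd, abs_of_pos (Real.exp_pos _)]

lemma Ph_injOn (hd : d1 ^ 2 + d2 ^ 2 = 1) {A : Set (ℝ × ℝ)} (hA : ∀ q ∈ A, q.2 ∈ Icc 0 Real.pi) :
    InjOn (Ph P d1 d2) A := by
  intro q hq q' hq' he
  have h1 : Real.exp (2 * q.1) = Real.exp (2 * q'.1) := by
    rw [← rsq_Ph hd P q, ← rsq_Ph hd P q', he]
  have h1' : q.1 = q'.1 := by have := Real.exp_injective h1; linarith
  have hx : cx d1 d2 q = cx d1 d2 q' := by simpa [Ph] using congrArg Prod.fst he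
  have hy : cy d1 d2 q = cy d1 d2 q' := by simpa [Ph] using congrArg Prod.snd he
  simp only [cx, cy, h1'] at hx hy
  have hp := Real.exp_pos q'.1
  have hx' := mul_left_cancel₀ hp.ne' hx
  have hy' := mul_left_cancel₀ hp.ne' hy
  have hc : Real.cos q.2 = Real.cos q'.2 := by
    linear_combination d1 * hx' + d2 * hy' - (Real.cos q.2 - Real.cos q'.2) * hd
  exact Prod.ext h1' (Real.injOn_cos (hA q hq) (hA q' hq') hc)

/-- change of variables near a vertex -/
lemma polar_integrable (hd : d1 ^ 2 + d2 ^ 2 = 1) {A : Set (ℝ × ℝ)} (hAm : MeasurableSet A)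
    (hA : ∀ q ∈ A, q.2 ∈ Icc 0 Real.pi) (F : ℝ × ℝ → ℝ) :
    IntegrableOn F (Ph P d1 d2 '' A) ↔
      IntegrableOn (fun q => Real.exp (2 * q.1) * F (Ph P d1 d2 q)) A := by
  rw [integrableOn_image_iff_integrableOn_abs_det_fderiv_smul volume hAm
    (fun q _ => (hasFDerivAt_Ph (P := P) (d1 := d1) (d2 := d2) q).hasFDerivWithinAt)
    (Ph_injOn hd hA) F]
  simp only [Ph_det _ hd, smul_eq_mul]

end NZ

namespace NZ

open MeasureTheory Filter Topology

/-- squared gradient -/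
def gsq (S : Set (ℝ × ℝ)) (U : ℝ × ℝ → ℝ) (p : ℝ × ℝ) : ℝ := dX S U p ^ 2 + dY S U p ^ 2
/-- squared hessian -/
def hsq (S : Set (ℝ × ℝ)) (U : ℝ × ℝ → ℝ) (p : ℝ × ℝ) : ℝ :=
  dX S (dX S U) p ^ 2 + 2 * dY S (dX S U) p ^ 2 + dY S (dY S U) p ^ 2

lemma gsq_nonneg (S U p) : 0 ≤ gsq S U p := by unfold gsq; positivity
lemma hsq_nonneg (S U p) : 0 ≤ hsq S U p := by unfold hsq; positivity

lemma gsq_cont {S : Set (ℝ × ℝ)} {U : ℝ × ℝ → ℝ} (hS : Good S) (hU : Sm S U) :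
    ContinuousOn (gsq S U) S :=
  ((hU.dX hS).cont.pow 2).add ((hU.dY hS).cont.pow 2)

lemma hsq_cont {S : Set (ℝ × ℝ)} {U : ℝ × ℝ → ℝ} (hS : Good S) (hU : Sm S U) :
    ContinuousOn (hsq S U) S :=
  ((((hU.dX hS).dX hS).cont.pow 2).add
    (continuousOn_const.mul (((hU.dX hS).dY hS).cont.pow 2))).add (((hU.dY hS).dY hS).cont.pow 2)

@[fun_prop] lemma rsq_cont (P : ℝ × ℝ) : Continuous (rsq P) := by unfold rsq; fun_prop

lemma rsq_pos {P q : ℝ × ℝ} (h : q ≠ P) : 0 < rsq P q := by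
  by_contra! hcon
  apply h
  simp only [rsq] at hcon
  ext <;> nlinarith [sq_nonneg (q.1 - P.1), sq_nonneg (q.2 - P.2)]

lemma rsq_nonneg (P q : ℝ × ℝ) : 0 ≤ rsq P q := by unfold rsq; positivity

lemma exp_two_eq {s : ℝ} : Real.exp (2 * s) * Real.exp (-2 * s) = 1 := by
  rw [← Real.exp_add]; simp

lemma vertex_int {τ : TriP} {μ : ℝ} {U : ℝ × ℝ → ℝ} (hE : τ.Eig μ U) {P : ℝ × ℝ} (hP : P ∈ τ.V) :
    ∃ W ∈ 𝓝 P, IntegrableOn (fun p => gsq τ.S U p / rsq P p + hsq τ.S U p) (W ∩ τ.Om) := by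
  obtain ⟨d1, d2, β, s0, hs⟩ := sector_exists τ P hP
  have hd := hs.hd
  have hG := good_KS (s0 := s0) hs.hβ
  have hmap : ∀ q ∈ KS s0 β, Ph P d1 d2 q ∈ τ.S := fun q hq => hs.mapsS q.1 hq.1 q.2 hq.2
  have hst := strip_of_pde hs hE.pos.le hE.sm hE.pde hE.neu
  obtain ⟨M, hM⟩ := τ.isCompact_T.exists_bound_of_continuousOn hE.cont
  obtain ⟨s2, hs2, hi⟩ := hst.en2_integrable (M := M) (fun q hq => by
    simpa using hM _ (τ.S_sub_T (hmap q hq)))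
  refine ⟨{q | rsq P q < Real.exp (2 * s2)}, ?_, ?_⟩
  · apply (isOpen_lt (rsq_cont P) continuous_const).mem_nhds
    simp [rsq_self, Real.exp_pos]
  set A : Set (ℝ × ℝ) := Iic s2 ×ˢ Ioo 0 β with hA
  have hAK : A ⊆ KS s0 β := fun q hq => ⟨lt_of_le_of_lt hq.1 hs2, Ioo_subset_Icc_self hq.2⟩
  have hAm : MeasurableSet A := measurableSet_Iic.prod measurableSet_Ioo
  have hsub : {q | rsq P q < Real.exp (2 * s2)} ∩ τ.Om ⊆ Ph P d1 d2 '' A := by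
    rintro q ⟨h1, h2⟩
    have h1' : rsq P q < Real.exp (2 * s2) := h1
    obtain ⟨s, h3, θ, h4, rfl⟩ := hs.coverO q h2 (h1'.trans (Real.exp_lt_exp.mpr (by linarith)))
    refine ⟨(s, θ), ⟨?_, h4⟩, rfl⟩
    rw [rsq_Ph hd, Real.exp_lt_exp] at h1'
    simp only [mem_Iic]
    simp only at h1'
    linarith
  refine IntegrableOn.mono_set ?_ hsub
  rw [polar_integrable hd hAm (fun q hq => ⟨hq.2.1.le, hq.2.2.le.trans hs.hπ.le⟩)]
  have hi' := (hi.mono_set (prod_mono_right Ioo_subset_Ioc_self : A ⊆ Iic s2 ×ˢ Ioc 0 β)).const_mul 5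
  refine Integrable.mono' hi' ?_ ?_
  · refine ContinuousOn.aestronglyMeasurable ?_ hAm
    have hc : ContinuousOn (Ph P d1 d2) A := contDiff_Ph.continuous.continuousOn
    have hmA : MapsTo (Ph P d1 d2) A τ.S := fun q hq => hmap q (hAK hq)
    refine (by fun_prop : ContinuousOn (fun q : ℝ × ℝ => Real.exp (2 * q.1)) A).mul
      ((((gsq_cont τ.good_S hE.sm).comp hc hmA).div ((rsq_cont P).comp_continuousOn hc) ?_).add
        ((hsq_cont τ.good_S hE.sm).comp hc hmA))
    intro q hq
    change rsq P (Ph P d1 d2 q) ≠ 0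
    rw [rsq_Ph hd]; exact (Real.exp_pos _).ne'
  · refine (ae_restrict_iff' hAm).mpr (Eventually.of_forall (fun q hq => ?_))
    have hq := hAK hq
    rw [Real.norm_of_nonneg (mul_nonneg (Real.exp_pos _).le (add_nonneg
      (div_nonneg (gsq_nonneg _ _ _) (rsq_nonneg _ _)) (hsq_nonneg _ _ _))), rsq_Ph hd]
    obtain ⟨h1, h2, h3⟩ := polar_two τ.good_S hG hmap hE.sm hq
    have k1 := polar_dX hG hmap hE.sm hq
    have k2 := polar_dY hG hmap hE.sm hq
    have k3 := dX_dY_comm hG (polar_sm hmap hE.sm) hq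
    have e := cxy_sq hd q
    have ee := exp_two_eq (s := q.1)
    simp only [en2, en]
    rw [k3]
    set Ws := dX (KS s0 β) (fun q => U (Ph P d1 d2 q)) q
    set Wt := dY (KS s0 β) (fun q => U (Ph P d1 d2 q)) q
    set Wss := dX (KS s0 β) (dX (KS s0 β) (fun q => U (Ph P d1 d2 q))) q
    set Wst := dY (KS s0 β) (dX (KS s0 β) (fun q => U (Ph P d1 d2 q))) q
    set Wtt := dY (KS s0 β) (dY (KS s0 β) (fun q => U (Ph P d1 d2 q))) q
    have g1 : Real.exp (2 * q.1) * gsq τ.S U (Ph P d1 d2 q) = Ws ^ 2 + Wt ^ 2 := by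
      rw [k1, k2, ← e, gsq]; ring
    have g2 : Real.exp (2 * q.1) ^ 2 * hsq τ.S U (Ph P d1 d2 q) =
        (Wss - Ws) ^ 2 + 2 * (Wst - Wt) ^ 2 + (Wtt + Ws) ^ 2 := by
      rw [h1, h2, h3, k1, k2, ← e, hsq]; ring
    set x := Real.exp (2 * q.1) with hx
    set y := Real.exp (-2 * q.1) with hy
    have hxp : 0 < x := Real.exp_pos _
    have hyp : 0 < y := Real.exp_pos _
    have l1 : x * (gsq τ.S U (Ph P d1 d2 q) / x + hsq τ.S U (Ph P d1 d2 q))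
       = y * (Ws ^ 2 + Wt ^ 2 + ((Wss - Ws) ^ 2 + 2 * (Wst - Wt) ^ 2 + (Wtt + Ws) ^ 2)) := by
      rw [← g1, ← g2]
      have : x * (gsq τ.S U (Ph P d1 d2 q) / x + hsq τ.S U (Ph P d1 d2 q))
        = gsq τ.S U (Ph P d1 d2 q) + x * hsq τ.S U (Ph P d1 d2 q) := by field_simp
      rw [this]
      linear_combination (-gsq τ.S U (Ph P d1 d2 q) - x * hsq τ.S U (Ph P d1 d2 q)) * ee
    rw [l1, mul_left_comm]
    refine mul_le_mul_of_nonneg_left ?_ hyp.le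
    nlinarith [sq_nonneg (Wss + Ws), sq_nonneg (Wst + Wt), sq_nonneg (Wtt - Ws)]

/-- limit at a vertex for finite energy solutions -/
lemma vertex_lim {τ : TriP} {μ : ℝ} {U : ℝ × ℝ → ℝ} (hμ : 0 ≤ μ) (hU : Sm τ.S U)
    (hpde : ∀ p ∈ τ.Om, dX τ.S (dX τ.S U) p + dY τ.S (dY τ.S U) p = -μ * U p) (hN : τ.Neu U)
    (hI : IntegrableOn (gsq τ.S U) τ.Om) {P : ℝ × ℝ} (hP : P ∈ τ.V) :
    ∃ c, Tendsto U (𝓝[τ.S] P) (𝓝 c) := by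
  obtain ⟨d1, d2, β, s0, hs⟩ := sector_exists τ P hP
  have hd := hs.hd
  have hG := good_KS (s0 := s0) hs.hβ
  have hmap : ∀ q ∈ KS s0 β, Ph P d1 d2 q ∈ τ.S := fun q hq => hs.mapsS q.1 hq.1 q.2 hq.2
  have hst := strip_of_pde hs hμ hU (pde_S hU hpde) hN
  have hs1 : s0 - 1 < s0 := by linarith
  set A : Set (ℝ × ℝ) := Iic (s0 - 1) ×ˢ Ioo 0 β with hA
  have hAm : MeasurableSet A := measurableSet_Iic.prod measurableSet_Ioo
  have hAK : A ⊆ KS s0 β := fun q hq => ⟨lt_of_le_of_lt hq.1 hs1, Ioo_subset_Icc_self hq.2⟩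
  have hsub : Ph P d1 d2 '' A ⊆ τ.Om := by
    rintro _ ⟨q, hq, rfl⟩
    exact hs.mapsO q.1 (lt_of_le_of_lt hq.1 hs1) q.2 hq.2
  have h1 := hI.mono_set hsub
  rw [polar_integrable hd hAm (fun q hq => ⟨hq.2.1.le, hq.2.2.le.trans hs.hπ.le⟩)] at h1
  have h2 : IntegrableOn (en s0 β (fun q => U (Ph P d1 d2 q))) A := by
    refine h1.congr_fun (fun q hq => ?_) hAm
    have hq := hAK hq
    simp only [en, gsq]
    rw [polar_dX hG hmap hU hq, polar_dY hG hmap hU hq, ← cxy_sq hd]; ring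
  have h3 : IntegrableOn (en s0 β (fun q => U (Ph P d1 d2 q))) (Iic (s0 - 1) ×ˢ Ioc 0 β) := by
    have e : (A : Set (ℝ × ℝ)) =ᵐ[volume] (Iic (s0 - 1) ×ˢ Ioc 0 β : Set (ℝ × ℝ)) := by
      rw [Measure.volume_eq_prod]
      exact Measure.set_prod_ae_eq (ae_eq_refl _) Ioo_ae_eq_Ioc
    exact h2.congr_set_ae e.symm
  obtain ⟨c, hc⟩ := hst.tendsto hs1 (av_integrable_of_strip hs.hβ h3)
  refine ⟨c, ?_⟩
  rw [Metric.tendsto_nhds]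
  intro ε hε
  obtain ⟨s2, hs2, h4⟩ := hc ε hε
  have hn : {q | rsq P q < Real.exp (2 * s2)} ∈ 𝓝 P := by
    apply (isOpen_lt (rsq_cont P) continuous_const).mem_nhds
    simp [rsq_self, Real.exp_pos]
  filter_upwards [mem_nhdsWithin_of_mem_nhds hn, self_mem_nhdsWithin] with q hq hqS
  have hq' : rsq P q < Real.exp (2 * s2) := hq
  obtain ⟨s, h5, θ, h6, rfl⟩ := hs.coverS q hqS (hq'.trans (Real.exp_lt_exp.mpr (by linarith)))
  rw [rsq_Ph hd, Real.exp_lt_exp] at hq'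
  rw [Real.dist_eq]
  exact h4 s (by simpa using hq') θ h6

end NZ

namespace NZ

open MeasureTheory Filter Topology

lemma TriP.measurableSet_S (τ : TriP) : MeasurableSet τ.S :=
  τ.isClosed_T.measurableSet.diff τ.finite_V.measurableSet

lemma int_of_local {τ : TriP} {F : ℝ × ℝ → ℝ} (hF : ContinuousOn F τ.S)
    (hV : ∀ P ∈ τ.V, ∃ W ∈ 𝓝 P, IntegrableOn F (W ∩ τ.Om)) : IntegrableOn F τ.Om := by
  have key : IntegrableOn F τ.T (volume.restrict τ.Om) := by
    refine LocallyIntegrableOn.integrableOn_isCompact (fun p hp => ?_) τ.isCompact_T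
    by_cases hpV : p ∈ τ.V
    · obtain ⟨W, hW, hi⟩ := hV p hpV
      obtain ⟨W', hW', hWo, hpW⟩ := mem_nhds_iff.mp hW
      refine ⟨W', mem_nhdsWithin_of_mem_nhds (hWo.mem_nhds hpW), ?_⟩
      rw [IntegrableOn, Measure.restrict_restrict hWo.measurableSet]
      exact hi.mono_set (inter_subset_inter_left _ hW')
    · have hpS : p ∈ τ.S := ⟨hp, hpV⟩
      have h1 := hF.integrableAt_nhdsWithin (μ := volume.restrict τ.Om) τ.measurableSet_S hpS
      have h2 : 𝓝[τ.T] p = 𝓝[τ.S] p := by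
        have : τ.S = τ.T ∩ τ.Vᶜ := Set.sdiff_eq _ _
        rw [this, inter_comm]
        exact (nhdsWithin_inter_of_mem
          (mem_nhdsWithin_of_mem_nhds (τ.finite_V.isClosed.isOpen_compl.mem_nhds hpV))).symm
      rw [h2]; exact h1
  rw [IntegrableOn, Measure.restrict_restrict τ.isClosed_T.measurableSet,
    inter_eq_self_of_subset_right (τ.Om_sub_S.trans τ.S_sub_T)] at key
  exact key

lemma int_of_major {τ : TriP} {μ : ℝ} {U : ℝ × ℝ → ℝ} (hE : τ.Eig μ U) {F : ℝ × ℝ → ℝ}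
    (hF : ContinuousOn F τ.S)
    (hV : ∀ P ∈ τ.V, ∃ C, ∀ᶠ p in 𝓝 P, p ∈ τ.Om →
      |F p| ≤ C * (gsq τ.S U p / rsq P p + hsq τ.S U p)) : IntegrableOn F τ.Om := by
  refine int_of_local hF (fun P hP => ?_)
  obtain ⟨C, hC⟩ := hV P hP
  obtain ⟨W, hW, hi⟩ := vertex_int hE hP
  obtain ⟨W', hW', hWo, hPW⟩ := mem_nhds_iff.mp (inter_mem hW hC)
  refine ⟨W', hWo.mem_nhds hPW, ?_⟩
  have hm : MeasurableSet (W' ∩ τ.Om) := hWo.measurableSet.inter τ.isOpen_Om.measurableSet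
  refine Integrable.mono' ((hi.mono_set (inter_subset_inter_left _ (hW'.trans inter_subset_left))).const_mul C)
    ((hF.mono (inter_subset_right.trans τ.Om_sub_S)).aestronglyMeasurable hm) ?_
  exact (ae_restrict_iff' hm).mpr (Eventually.of_forall (fun p hp => (hW' hp.1).2 hp.2))

lemma rsq_ne_of_S {τ : TriP} {P p : ℝ × ℝ} (hP : P ∈ τ.V) (hp : p ∈ τ.S) : 0 < rsq P p :=
  rsq_pos (fun h => hp.2 (h ▸ hP))

lemma int_hsq {τ : TriP} {μ : ℝ} {U : ℝ × ℝ → ℝ} (hE : τ.Eig μ U) :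
    IntegrableOn (hsq τ.S U) τ.Om := by
  refine int_of_major hE (hsq_cont τ.good_S hE.sm) (fun P hP => ⟨1, Eventually.of_forall (fun p hp => ?_)⟩)
  rw [abs_of_nonneg (hsq_nonneg _ _ _), one_mul]
  have := div_nonneg (gsq_nonneg τ.S U p) (rsq_nonneg P p)
  linarith

lemma int_gsq_div {τ : TriP} {μ : ℝ} {U : ℝ × ℝ → ℝ} (hE : τ.Eig μ U) {P : ℝ × ℝ} (hP : P ∈ τ.V) :
    IntegrableOn (fun p => gsq τ.S U p / rsq P p) τ.Om := by
  refine int_of_major hE ((gsq_cont τ.good_S hE.sm).div (rsq_cont P).continuousOn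
    (fun p hp => (rsq_ne_of_S hP hp).ne')) (fun P' hP' => ?_)
  by_cases h : P' = P
  · subst h
    refine ⟨1, Eventually.of_forall (fun p hp => ?_)⟩
    have := div_nonneg (gsq_nonneg τ.S U p) (rsq_nonneg P' p)
    rw [abs_of_nonneg this]
    have := hsq_nonneg τ.S U p
    linarith
  · have hpos : 0 < rsq P P' := rsq_pos h
    have hc : ContinuousAt (fun p => rsq P' p / rsq P p) P' :=
      (rsq_cont P').continuousAt.div (rsq_cont P).continuousAt hpos.ne'
    have h0 : rsq P' P' / rsq P P' < 1 := by rw [rsq_self, zero_div]; norm_num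
    refine ⟨1, (hc.eventually_lt continuousAt_const h0).mono (fun p hp hpO => ?_)⟩
    have hpS := τ.Om_sub_S hpO
    have r1 := rsq_ne_of_S hP hpS
    have r2 := rsq_ne_of_S hP' hpS
    rw [abs_of_nonneg (div_nonneg (gsq_nonneg _ _ _) r1.le), one_mul]
    have e : gsq τ.S U p / rsq P p = gsq τ.S U p / rsq P' p * (rsq P' p / rsq P p) := by
      field_simp
    rw [e]
    have g := div_nonneg (gsq_nonneg τ.S U p) r2.le
    have := hsq_nonneg τ.S U p
    nlinarith

lemma int_gsq {τ : TriP} {μ : ℝ} {U : ℝ × ℝ → ℝ} (hE : τ.Eig μ U) :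
    IntegrableOn (gsq τ.S U) τ.Om := by
  refine int_of_major hE (gsq_cont τ.good_S hE.sm) (fun P hP => ?_)
  have h0 : rsq P P < 1 := by rw [rsq_self]; norm_num
  refine ⟨1, ((rsq_cont P).continuousAt.eventually_lt continuousAt_const h0).mono (fun p hp hpO => ?_)⟩
  have r2 := rsq_ne_of_S hP (τ.Om_sub_S hpO)
  rw [abs_of_nonneg (gsq_nonneg _ _ _), one_mul]
  have g := div_nonneg (gsq_nonneg τ.S U p) r2.le
  have e : gsq τ.S U p = gsq τ.S U p / rsq P p * rsq P p := by field_simp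
  have := hsq_nonneg τ.S U p
  nlinarith

lemma int_inv_r {τ : TriP} {P : ℝ × ℝ} (hP : P ∈ τ.V) :
    IntegrableOn (fun p => 1 / Real.sqrt (rsq P p)) τ.Om := by
  have hc : ContinuousOn (fun p => 1 / Real.sqrt (rsq P p)) {P}ᶜ :=
    continuousOn_const.div (by fun_prop) (fun p hp => (Real.sqrt_pos.mpr (rsq_pos hp)).ne')
  refine int_of_local (hc.mono (fun p hp h => hp.2 (by rw [mem_singleton_iff] at h; rwa [h])))
    (fun P' hP' => ?_)
  by_cases h : P' = P
  · subst h
    obtain ⟨d1, d2, β, s0, hs⟩ := sector_exists τ P' hP'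
    have hd := hs.hd
    refine ⟨{q | rsq P' q < Real.exp (2 * s0)}, ?_, ?_⟩
    · apply (isOpen_lt (rsq_cont P') continuous_const).mem_nhds
      simp [rsq_self, Real.exp_pos]
    set A : Set (ℝ × ℝ) := Iic s0 ×ˢ Ioo 0 β with hA
    have hAm : MeasurableSet A := measurableSet_Iic.prod measurableSet_Ioo
    have hsub : {q | rsq P' q < Real.exp (2 * s0)} ∩ τ.Om ⊆ Ph P' d1 d2 '' A := by
      rintro q ⟨h1, h2⟩
      obtain ⟨s, h3, θ, h4, rfl⟩ := hs.coverO q h2 h1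
      exact ⟨(s, θ), ⟨h3.le, h4⟩, rfl⟩
    refine IntegrableOn.mono_set ?_ hsub
    rw [polar_integrable hd hAm (fun q hq => ⟨hq.2.1.le, hq.2.2.le.trans hs.hπ.le⟩)]
    have e : (fun q : ℝ × ℝ => Real.exp (2 * q.1) * (1 / Real.sqrt (rsq P' (Ph P' d1 d2 q))))
        = fun q => Real.exp q.1 * 1 := by
      funext q
      rw [rsq_Ph hd, show (2 * q.1) = q.1 + q.1 by ring, Real.exp_add,
        Real.sqrt_mul_self (Real.exp_pos _).le]
      field_simp
    rw [e, IntegrableOn, hA, Measure.volume_eq_prod, ← Measure.prod_restrict]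
    have i1 : Integrable (fun s : ℝ => Real.exp s) (volume.restrict (Iic s0)) := integrableOn_exp_Iic s0
    have i2 : Integrable (fun _ : ℝ => (1 : ℝ)) (volume.restrict (Ioo 0 β)) := by
      apply integrable_const
    exact i1.mul_prod i2
  · have h1 := hc.integrableAt_nhdsWithin (μ := volume) (measurableSet_singleton P).compl (a := P')
      (by simpa using h)
    rw [isOpen_compl_singleton.nhdsWithin_eq (by simpa using h)] at h1
    obtain ⟨W, hW, hi⟩ := h1
    exact ⟨W, hW, hi.mono_set inter_subset_left⟩

end NZ

namespace NZ

open MeasureTheory Filter Topology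

/-- closed standard simplex -/
def sD : Set (ℝ × ℝ) := {q | 0 ≤ q.1 ∧ 0 ≤ q.2 ∧ q.1 + q.2 ≤ 1}
/-- open standard simplex -/
def sO : Set (ℝ × ℝ) := {q | 0 < q.1 ∧ 0 < q.2 ∧ q.1 + q.2 < 1}

lemma isOpen_sO : IsOpen sO :=
  (isOpen_lt continuous_const continuous_fst).inter ((isOpen_lt continuous_const continuous_snd).inter
    (isOpen_lt (continuous_fst.add continuous_snd) continuous_const))

lemma sO_sub : sO ⊆ sD := fun _ h => ⟨h.1.le, h.2.1.le, h.2.2.le⟩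

lemma good_sD : Good sD := by
  refine good_of_convex ?_ ⟨(1/4, 1/4), interior_maximal sO_sub isOpen_sO ?_⟩
  · intro p hp q hq s t hs ht hst
    obtain ⟨h1, h2, h3⟩ := hp
    obtain ⟨k1, k2, k3⟩ := hq
    refine ⟨by simp; positivity, by simp; positivity, ?_⟩
    simp only [Prod.fst_add, Prod.smul_fst, Prod.snd_add, Prod.smul_snd, smul_eq_mul]
    nlinarith
  · refine ⟨by norm_num, by norm_num, by norm_num⟩

lemma isCompact_sD : IsCompact sD := by
  apply Metric.isCompact_of_isClosed_isBounded
  · exact (isClosed_le continuous_const continuous_fst).inter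
      ((isClosed_le continuous_const continuous_snd).inter (isClosed_le (continuous_fst.add continuous_snd) continuous_const))
  · refine (isCompact_Icc.prod isCompact_Icc : IsCompact (Icc (0:ℝ) 1 ×ˢ Icc (0:ℝ) 1)).isBounded.subset ?_
    rintro q ⟨h1, h2, h3⟩
    exact ⟨⟨h1, by linarith⟩, ⟨h2, by linarith⟩⟩

lemma sD_int {F : ℝ × ℝ → ℝ} (hF : ContinuousOn F sD) : IntegrableOn F sO :=
  (hF.integrableOn_compact isCompact_sD).mono_set sO_sub

lemma slice_aux {F f : ℝ → ℝ} {b : ℝ} (hb : 0 ≤ b) (hF : ContinuousOn F (Icc 0 b))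
    (hf : ContinuousOn f (Icc 0 b)) (h : ∀ x ∈ Ioo 0 b, HasDerivAt F (f x) x) :
    ∫ x in Ioo 0 b, f x = F b - F 0 := by
  rw [← integral_Ioc_eq_integral_Ioo, ← intervalIntegral.integral_of_le hb]
  refine intervalIntegral.integral_eq_sub_of_hasDerivAt_of_le hb hF h ?_
  apply ContinuousOn.intervalIntegrable
  rwa [uIcc_of_le hb]

lemma simplex_X {A : ℝ × ℝ → ℝ} (hA : Sm sD A) :
    ∫ q in sO, dX sD A q = ∫ y in Ioo (0 : ℝ) 1, (A (1 - y, y) - A (0, y)) := by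
  have hc := (hA.dX good_sD).cont
  have hm := isOpen_sO.measurableSet
  rw [← integral_indicator hm, ← integral_indicator measurableSet_Ioo, Measure.volume_eq_prod,
    integral_prod_symm]
  · congr 1
    funext y
    by_cases hy : y ∈ Ioo (0 : ℝ) 1
    · rw [indicator_of_mem hy]
      have e : (fun x => sO.indicator (dX sD A) (x, y)) = (Ioo 0 (1 - y)).indicator (fun x => dX sD A (x, y)) := by
        funext x
        by_cases hx : x ∈ Ioo 0 (1 - y)
        · rw [indicator_of_mem hx, indicator_of_mem]
          exact ⟨hx.1, hy.1, by have := hx.2; simp only; linarith⟩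
        · rw [indicator_of_notMem hx, indicator_of_notMem]
          rintro ⟨h1, h2, h3⟩
          exact hx ⟨h1, by simp only at h3; linarith⟩
      rw [e, integral_indicator measurableSet_Ioo]
      have hmap : MapsTo (fun x : ℝ => (x, y)) (Icc 0 (1 - y)) sD :=
        fun x hx => ⟨hx.1, hy.1.le, by have := hx.2; simp only; linarith⟩
      refine slice_aux (F := fun x => A (x, y)) (by linarith [hy.2])
        (hA.cont.comp (by fun_prop) hmap) (hc.comp (by fun_prop) hmap) (fun x hx => ?_)
      have hi : (x, y) ∈ interior sD := interior_maximal sO_sub isOpen_sO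
        ⟨hx.1, hy.1, by have := hx.2; simp only; linarith⟩
      have h := (hA.hasAt hi).comp_hasDerivAt x ((hasDerivAt_id x).prodMk (hasDerivAt_const x y))
      simp only [lin_apply, mul_one, mul_zero, add_zero, zero_add] at h
      exact h
    · rw [indicator_of_notMem hy]
      have e : (fun x => sO.indicator (dX sD A) (x, y)) = fun _ => 0 := by
        funext x
        rw [indicator_of_notMem]
        rintro ⟨h1, h2, h3⟩
        exact hy ⟨h2, by simp only at h1 h3; linarith⟩
      rw [e]; simp
  · rw [← Measure.volume_eq_prod, integrable_indicator_iff hm]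
    exact sD_int hc

lemma simplex_Y {A : ℝ × ℝ → ℝ} (hA : Sm sD A) :
    ∫ q in sO, dY sD A q = ∫ x in Ioo (0 : ℝ) 1, (A (x, 1 - x) - A (x, 0)) := by
  have hc := (hA.dY good_sD).cont
  have hm := isOpen_sO.measurableSet
  rw [← integral_indicator hm, ← integral_indicator measurableSet_Ioo, Measure.volume_eq_prod,
    integral_prod]
  · congr 1
    funext y
    by_cases hy : y ∈ Ioo (0 : ℝ) 1
    · rw [indicator_of_mem hy]
      have e : (fun x => sO.indicator (dY sD A) (y, x)) = (Ioo 0 (1 - y)).indicator (fun x => dY sD A (y, x)) := by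
        funext x
        by_cases hx : x ∈ Ioo 0 (1 - y)
        · rw [indicator_of_mem hx, indicator_of_mem]
          exact ⟨hy.1, hx.1, by have := hx.2; simp only; linarith⟩
        · rw [indicator_of_notMem hx, indicator_of_notMem]
          rintro ⟨h1, h2, h3⟩
          exact hx ⟨h2, by simp only at h3; linarith⟩
      rw [e, integral_indicator measurableSet_Ioo]
      have hmap : MapsTo (fun x : ℝ => (y, x)) (Icc 0 (1 - y)) sD :=
        fun x hx => ⟨hy.1.le, hx.1, by have := hx.2; simp only; linarith⟩
      refine slice_aux (F := fun x => A (y, x)) (by linarith [hy.2])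
        (hA.cont.comp (by fun_prop) hmap) (hc.comp (by fun_prop) hmap) (fun x hx => ?_)
      have hi : (y, x) ∈ interior sD := interior_maximal sO_sub isOpen_sO
        ⟨hy.1, hx.1, by have := hx.2; simp only; linarith⟩
      have h := (hA.hasAt hi).comp_hasDerivAt x ((hasDerivAt_const x y).prodMk (hasDerivAt_id x))
      simp only [lin_apply, mul_one, mul_zero, add_zero, zero_add] at h
      exact h
    · rw [indicator_of_notMem hy]
      have e : (fun x => sO.indicator (dY sD A) (y, x)) = fun _ => 0 := by
        funext x
        rw [indicator_of_notMem]
        rintro ⟨h1, h2, h3⟩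
        exact hy ⟨h1, by simp only at h2 h3; linarith⟩
      rw [e]; simp
  · rw [← Measure.volume_eq_prod, integrable_indicator_iff hm]
    exact sD_int hc

lemma simplex_div {A B : ℝ × ℝ → ℝ} (hA : Sm sD A) (hB : Sm sD B)
    (h0 : ∀ y ∈ Icc (0 : ℝ) 1, A (0, y) = 0)
    (h1 : ∀ y ∈ Icc (0 : ℝ) 1, A (1 - y, y) + B (1 - y, y) = 0) :
    ∫ q in sO, (dX sD A q + dY sD B q) = - ∫ x in (0 : ℝ)..1, B (x, 0) := by
  rw [integral_add (sD_int (hA.dX good_sD).cont) (sD_int (hB.dY good_sD).cont), simplex_X hA,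
    simplex_Y hB]
  rw [← integral_Ioc_eq_integral_Ioo, ← integral_Ioc_eq_integral_Ioo,
    ← intervalIntegral.integral_of_le zero_le_one, ← intervalIntegral.integral_of_le zero_le_one]
  have e1 : ∫ y in (0:ℝ)..1, (A (1 - y, y) - A (0, y)) = ∫ y in (0:ℝ)..1, -B (1 - y, y) := by
    refine intervalIntegral.integral_congr (fun y hy => ?_)
    rw [uIcc_of_le zero_le_one] at hy
    change A (1 - y, y) - A (0, y) = -B (1 - y, y)
    linarith [h0 y hy, h1 y hy]
  have e2 : ∫ y in (0:ℝ)..1, -B (1 - y, y) = ∫ y in (0:ℝ)..1, -B (y, 1 - y) := by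
    have := intervalIntegral.integral_comp_sub_left (a := (0:ℝ)) (b := 1) (fun y => -B (y, 1 - y)) 1
    simpa using this
  have c1 : IntervalIntegrable (fun x => B (x, 1 - x)) volume 0 1 := by
    apply ContinuousOn.intervalIntegrable
    rw [uIcc_of_le zero_le_one]
    exact hB.cont.comp (by fun_prop) (fun x hx => ⟨hx.1, by have := hx.2; simp only; linarith, by simp⟩)
  have c2 : IntervalIntegrable (fun x => B (x, 0)) volume 0 1 := by
    apply ContinuousOn.intervalIntegrable
    rw [uIcc_of_le zero_le_one]
    exact hB.cont.comp (by fun_prop) (fun x hx => ⟨hx.1, le_rfl, by simpa using hx.2⟩)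
  rw [e1, e2, intervalIntegral.integral_sub c1 c2, intervalIntegral.integral_neg]
  ring

/-- the affine parametrisation of the triangle -/
def TriP.La (τ : TriP) (q : ℝ × ℝ) : ℝ × ℝ := (q.1 * τ.L + q.2 * τ.a, q.2 * τ.h)

lemma TriP.La_D (τ : TriP) {q : ℝ × ℝ} (hq : q ∈ sD) : τ.La q ∈ τ.T := by
  obtain ⟨h1, h2, h3⟩ := hq
  have hL := τ.hL
  have hh := τ.hh
  have := mul_pos hL hh
  refine ⟨mul_nonneg h2 hh.le, ?_, ?_⟩
  · have : τ.l2 (τ.La q) = τ.h * τ.L * q.1 := by simp only [TriP.l2, TriP.La]; ring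
    rw [this]; positivity
  · have : τ.l3 (τ.La q) = τ.h * τ.L * (1 - q.1 - q.2) := by simp only [TriP.l3, TriP.La]; ring
    rw [this]; exact mul_nonneg (by positivity) (by linarith)

lemma TriP.La_O (τ : TriP) : τ.La '' sO = τ.Om := by
  have hL := τ.hL
  have hh := τ.hh
  have hm := mul_pos hh hL
  have f2 : ∀ q, τ.l2 (τ.La q) = τ.h * τ.L * q.1 := fun q => by simp only [TriP.l2, TriP.La]; ring
  have f3 : ∀ q, τ.l3 (τ.La q) = τ.h * τ.L * (1 - q.1 - q.2) := fun q => by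
    simp only [TriP.l3, TriP.La]; ring
  have key : ∀ q, τ.La q ∈ τ.Om ↔ q ∈ sO := by
    intro q
    simp only [TriP.Om, sO, mem_ofPred_eq, f2, f3, mul_pos_iff_of_pos_left hm, sub_pos]
    have : 0 < (τ.La q).2 ↔ 0 < q.2 := by simp only [TriP.La]; exact mul_pos_iff_of_pos_right hh
    rw [this]
    constructor
    · rintro ⟨h1, h2, h3⟩; exact ⟨h2, h1, by linarith⟩
    · rintro ⟨h1, h2, h3⟩; exact ⟨h2, h1, by linarith⟩
  apply Subset.antisymm
  · rintro _ ⟨q, hq, rfl⟩; exact (key q).mpr hq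
  · intro p hp
    have : τ.La ((p.1 - p.2 / τ.h * τ.a) / τ.L, p.2 / τ.h) = p := by
      ext <;> simp only [TriP.La]
      · field_simp; ring
      · field_simp
    rw [← this] at hp
    exact ⟨_, (key _).mp hp, this⟩

lemma TriP.La_has (τ : TriP) (q : ℝ × ℝ) :
    HasFDerivAt τ.La ((lin τ.L τ.a).prod (lin 0 τ.h)) q := by
  have : HasFDerivAt (fun q => ((lin τ.L τ.a).prod (lin 0 τ.h)) q) ((lin τ.L τ.a).prod (lin 0 τ.h)) q :=
    ContinuousLinearMap.hasFDerivAt _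
  refine this.congr_of_eventuallyEq (Eventually.of_forall (fun q => ?_))
  simp only [TriP.La, ContinuousLinearMap.prod_apply, lin_apply]
  ext <;> simp <;> ring

lemma La_comp_has {τ : TriP} {F : ℝ × ℝ → ℝ} (hF : Sm τ.T F) {q : ℝ × ℝ} (hq : q ∈ sD) :
    HasFDerivWithinAt (fun q => F (τ.La q)) (lin (τ.L * dX τ.T F (τ.La q))
      (τ.a * dX τ.T F (τ.La q) + τ.h * dY τ.T F (τ.La q))) sD q := by
  have h := (hF.has (τ.La_D hq)).comp q (τ.La_has q).hasFDerivWithinAt (fun x hx => τ.La_D hx)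
  refine h.congr_fderiv ?_
  apply lin_ext <;> simp <;> ring

lemma La_comp_sm {τ : TriP} {F : ℝ × ℝ → ℝ} (hF : Sm τ.T F) : Sm sD (fun q => F (τ.La q)) := by
  refine ContDiffOn.comp hF ?_ (fun q hq => τ.La_D hq)
  have : ContDiff ℝ (⊤ : ℕ∞) τ.La := by unfold TriP.La; fun_prop
  exact this.contDiffOn

/-- divergence theorem on the triangle, tangential on the two sides through `C` -/
lemma div_thm (τ : TriP) {P Q : ℝ × ℝ → ℝ} (hP : Sm τ.T P) (hQ : Sm τ.T Q)
    (h2 : ∀ p ∈ τ.T, τ.l2 p = 0 → τ.h * P p - τ.a * Q p = 0)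
    (h3 : ∀ p ∈ τ.T, τ.l3 p = 0 → τ.h * P p + (τ.L - τ.a) * Q p = 0) :
    ∫ p in τ.Om, (dX τ.T P p + dY τ.T Q p) = - ∫ x in (0:ℝ)..τ.L, Q (x, 0) := by
  have hL := τ.hL
  have hh := τ.hh
  set A : ℝ × ℝ → ℝ := fun q => (1 / τ.L) * P (τ.La q) - (τ.a / (τ.h * τ.L)) * Q (τ.La q) with hA
  set B : ℝ × ℝ → ℝ := fun q => (1 / τ.h) * Q (τ.La q) with hB
  have hPs := La_comp_sm hP
  have hQs := La_comp_sm hQ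
  have sA : Sm sD A := (contDiffOn_const.mul hPs).sub (contDiffOn_const.mul hQs)
  have sB : Sm sD B := contDiffOn_const.mul hQs
  have main := simplex_div sA sB ?_ ?_
  · have e1 : ∫ p in τ.Om, (dX τ.T P p + dY τ.T Q p) = (τ.L * τ.h) * ∫ q in sO, (dX sD A q + dY sD B q) := by
      rw [← τ.La_O, integral_image_eq_integral_abs_det_fderiv_smul volume isOpen_sO.measurableSet
        (fun q _ => (τ.La_has q).hasFDerivWithinAt), ← integral_const_mul]
      · refine setIntegral_congr_fun isOpen_sO.measurableSet (fun q hq => ?_)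
        have hq' := sO_sub hq
        have d : |((lin τ.L τ.a).prod (lin 0 τ.h)).det| = τ.L * τ.h := by
          rw [ContinuousLinearMap.det, ← LinearMap.det_toMatrix (Module.Basis.finTwoProd ℝ), Matrix.det_fin_two]
          simp [LinearMap.toMatrix_apply]
          rw [abs_of_pos hL, abs_of_pos hh]
        simp only [d, smul_eq_mul]
        congr 1
        have a1 : dX sD A q = _ := dX_of_has good_sD hq' (b := (1 / τ.L) * (τ.a * dX τ.T P (τ.La q) + τ.h * dY τ.T P (τ.La q))
          - (τ.a / (τ.h * τ.L)) * (τ.a * dX τ.T Q (τ.La q) + τ.h * dY τ.T Q (τ.La q)))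
          (a := (1 / τ.L) * (τ.L * dX τ.T P (τ.La q)) - (τ.a / (τ.h * τ.L)) * (τ.L * dX τ.T Q (τ.La q)))
          ((((La_comp_has hP hq').const_mul (1 / τ.L)).sub
            ((La_comp_has hQ hq').const_mul (τ.a / (τ.h * τ.L)))).congr_fderiv
            (by apply lin_ext <;> simp))
        have a2 : dY sD B q = _ := dY_of_has good_sD hq' (a := (1 / τ.h) * (τ.L * dX τ.T Q (τ.La q)))
          (b := (1 / τ.h) * (τ.a * dX τ.T Q (τ.La q) + τ.h * dY τ.T Q (τ.La q)))
          (((La_comp_has hQ hq').const_mul (1 / τ.h)).congr_fderiv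
            (by apply lin_ext <;> simp))
        rw [a1, a2]
        field_simp
        ring
      · intro q _ q' _ he
        have e1 := congrArg Prod.fst he
        have e2 := congrArg Prod.snd he
        simp only [TriP.La] at e1 e2
        have e2' := mul_right_cancel₀ hh.ne' e2
        rw [e2'] at e1
        exact Prod.ext (mul_right_cancel₀ hL.ne' (add_right_cancel e1)) e2'
    rw [e1, main]
    have e2 : ∀ x, B (x, 0) = (1 / τ.h) * (fun y => Q (y, 0)) (x * τ.L) := by
      intro x; simp [hB, TriP.La]
    simp only [e2]
    rw [intervalIntegral.integral_const_mul, intervalIntegral.integral_comp_mul_right (fun y => Q (y, 0)) hL.ne']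
    simp only [zero_mul, one_mul, smul_eq_mul]
    field_simp
  · intro y hy
    have hT : τ.La (0, y) ∈ τ.T := τ.La_D ⟨le_rfl, hy.1, by simpa using hy.2⟩
    have := h2 _ hT (by simp only [TriP.l2, TriP.La]; ring)
    simp only [hA]
    field_simp
    linarith
  · intro y hy
    have hT : τ.La (1 - y, y) ∈ τ.T := τ.La_D ⟨by linarith [hy.2], hy.1, by simp⟩
    have := h3 _ hT (by simp only [TriP.l3, TriP.La]; ring)
    simp only [hA, hB]
    field_simp
    linarith

end NZ

namespace NZ

open MeasureTheory Filter Topology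

lemma dX_int {S : Set (ℝ × ℝ)} {f : ℝ × ℝ → ℝ} {p : ℝ × ℝ} (hp : p ∈ interior S) :
    dX S f p = dX univ f p := by
  simp only [dX, fderivWithin_of_mem_nhds (mem_interior_iff_mem_nhds.mp hp), fderivWithin_univ]

lemma dY_int {S : Set (ℝ × ℝ)} {f : ℝ × ℝ → ℝ} {p : ℝ × ℝ} (hp : p ∈ interior S) :
    dY S f p = dY univ f p := by
  simp only [dY, fderivWithin_of_mem_nhds (mem_interior_iff_mem_nhds.mp hp), fderivWithin_univ]

lemma good_univ : Good (univ : Set (ℝ × ℝ)) := ⟨uniqueDiffOn_univ, by simp⟩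

lemma TriP.S_mem {τ : TriP} {p : ℝ × ℝ} (hp : p ∈ τ.S) : τ.S ∈ 𝓝[τ.T] p := by
  have : τ.S = τ.T ∩ τ.Vᶜ := Set.sdiff_eq _ _
  rw [this]
  exact inter_mem self_mem_nhdsWithin
    (mem_nhdsWithin_of_mem_nhds (τ.finite_V.isClosed.isOpen_compl.mem_nhds hp.2))

lemma sm_T_of_cut {τ : TriP} {χ F : ℝ × ℝ → ℝ} (hF : Sm τ.S F) (hχ : ContDiff ℝ (⊤ : ℕ∞) χ)
    (h0 : ∀ P ∈ τ.V, ∀ᶠ p in 𝓝 P, χ p = 0) : Sm τ.T (fun p => χ p * F p) := by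
  intro p hp
  by_cases hpV : p ∈ τ.V
  · have : (fun p => χ p * F p) =ᶠ[𝓝 p] fun _ => 0 := (h0 p hpV).mono (fun q hq => by simp [hq])
    exact (contDiffAt_const.congr_of_eventuallyEq this).contDiffWithinAt
  · have hpS : p ∈ τ.S := ⟨hp, hpV⟩
    have h1 : ContDiffWithinAt ℝ (⊤ : ℕ∞) (fun p => χ p * F p) τ.S p :=
      (hχ.contDiffAt.contDiffWithinAt).mul (hF p hpS)
    exact h1.mono_of_mem_nhdsWithin (TriP.S_mem hpS)

lemma div_cut (τ : TriP) {P Q χ : ℝ × ℝ → ℝ} (hP : Sm τ.S P) (hQ : Sm τ.S Q)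
    (h2 : ∀ p ∈ τ.S, τ.l2 p = 0 → τ.h * P p - τ.a * Q p = 0)
    (h3 : ∀ p ∈ τ.S, τ.l3 p = 0 → τ.h * P p + (τ.L - τ.a) * Q p = 0)
    (hχ : ContDiff ℝ (⊤ : ℕ∞) χ) (h0 : ∀ P ∈ τ.V, ∀ᶠ p in 𝓝 P, χ p = 0) :
    ∫ p in τ.Om, (χ p * (dX τ.S P p + dY τ.S Q p) + (dX univ χ p * P p + dY univ χ p * Q p))
      = - ∫ x in (0:ℝ)..τ.L, χ (x, 0) * Q (x, 0) := by
  have hχV : ∀ P ∈ τ.V, χ P = 0 := fun P hP => (h0 P hP).self_of_nhds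
  have key := div_thm τ (sm_T_of_cut hP hχ h0) (sm_T_of_cut hQ hχ h0) ?_ ?_
  · rw [← key]
    refine setIntegral_congr_fun τ.isOpen_Om.measurableSet (fun p hp => ?_)
    have hpS := τ.Om_sub_S hp
    have hiS : p ∈ interior τ.S := by rw [τ.interior_S]; exact hp
    have hiT : p ∈ interior τ.T := by rw [τ.interior_T]; exact hp
    have hχS : Sm τ.S χ := hχ.contDiffOn
    rw [dX_int hiT, dY_int hiT, ← dX_int hiS (f := fun q => χ q * P q), ← dY_int hiS (f := fun q => χ q * Q q), dX_mul τ.good_S hχS hP hpS,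
      dY_mul τ.good_S hχS hQ hpS, dX_int hiS (f := χ), dY_int hiS (f := χ)]
    ring
  · intro p hp hl
    by_cases hpV : p ∈ τ.V
    · simp [hχV p hpV]
    · linear_combination χ p * h2 p ⟨hp, hpV⟩ hl
  · intro p hp hl
    by_cases hpV : p ∈ τ.V
    · simp [hχV p hpV]
    · linear_combination χ p * h3 p ⟨hp, hpV⟩ hl

/-- one dimensional cutoff -/
def kap (t : ℝ) : ℝ := Real.smoothTransition (t - 1)

lemma kap_smooth : ContDiff ℝ (⊤ : ℕ∞) kap := by
  have : ContDiff ℝ (⊤ : ℕ∞) (fun t : ℝ => t - 1) := by fun_prop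
  exact Real.smoothTransition.contDiff.comp this

lemma kap_zero {t : ℝ} (h : t ≤ 1) : kap t = 0 := Real.smoothTransition.zero_of_nonpos (by linarith)
lemma kap_one {t : ℝ} (h : 2 ≤ t) : kap t = 1 := Real.smoothTransition.one_of_one_le (by linarith)
lemma kap_nonneg (t : ℝ) : 0 ≤ kap t := Real.smoothTransition.nonneg _
lemma kap_le (t : ℝ) : kap t ≤ 1 := Real.smoothTransition.le_one _

lemma dkap_zero {t : ℝ} (h : t < 1 ∨ 2 < t) : deriv kap t = 0 := by
  rcases h with h | h
  · have : kap =ᶠ[𝓝 t] fun _ => 0 := (eventually_lt_nhds h).mono (fun s hs => kap_zero hs.le)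
    rw [this.deriv_eq]; simp
  · have : kap =ᶠ[𝓝 t] fun _ => 1 := (eventually_gt_nhds h).mono (fun s hs => kap_one hs.le)
    rw [this.deriv_eq]; simp

lemma dkap_bdd : ∃ M : ℝ, 0 ≤ M ∧ ∀ t, |deriv kap t| ≤ M := by
  have hc : Continuous (deriv kap) := kap_smooth.continuous_deriv (by simp)
  obtain ⟨M, hM⟩ := (isCompact_Icc (a := (1:ℝ)) (b := 2)).exists_bound_of_continuousOn hc.continuousOn
  refine ⟨max M 0, le_max_right _ _, fun t => ?_⟩
  by_cases h : t < 1 ∨ 2 < t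
  · rw [dkap_zero h]; simp
  · push Not at h
    exact (hM t ⟨h.1, h.2⟩).trans (le_max_left _ _)

/-- cutoff at a point -/
def kc (n : ℝ) (P p : ℝ × ℝ) : ℝ := kap (n ^ 2 * rsq P p)

lemma kc_smooth (n : ℝ) (P : ℝ × ℝ) : ContDiff ℝ (⊤ : ℕ∞) (kc n P) := by
  have : ContDiff ℝ (⊤ : ℕ∞) (fun p => n ^ 2 * rsq P p) := by unfold rsq; fun_prop
  exact kap_smooth.comp this

lemma kc_has (n : ℝ) (P p : ℝ × ℝ) : HasFDerivAt (kc n P)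
    (lin (deriv kap (n ^ 2 * rsq P p) * (n ^ 2 * (2 * (p.1 - P.1))))
      (deriv kap (n ^ 2 * rsq P p) * (n ^ 2 * (2 * (p.2 - P.2))))) p := by
  have h1 : HasFDerivAt (fun q : ℝ × ℝ => q.1) (ContinuousLinearMap.fst ℝ ℝ ℝ) p := hasFDerivAt_fst
  have h2 : HasFDerivAt (fun q : ℝ × ℝ => q.2) (ContinuousLinearMap.snd ℝ ℝ ℝ) p := hasFDerivAt_snd
  have h3 := (((h1.sub_const P.1).pow 2).add ((h2.sub_const P.2).pow 2)).const_mul (n ^ 2)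
  have hd : HasDerivAt kap (deriv kap (n ^ 2 * rsq P p)) (n ^ 2 * rsq P p) :=
    (kap_smooth.differentiable (by simp) _).hasDerivAt
  refine (hd.comp_hasFDerivAt p (f := fun p => n ^ 2 * rsq P p) h3).congr_fderiv ?_
  apply lin_ext <;> simp

lemma kc_dX (n : ℝ) (P p : ℝ × ℝ) : dX univ (kc n P) p =
    deriv kap (n ^ 2 * rsq P p) * (n ^ 2 * (2 * (p.1 - P.1))) :=
  dX_of_has good_univ (mem_univ p) (kc_has n P p).hasFDerivWithinAt
lemma kc_dY (n : ℝ) (P p : ℝ × ℝ) : dY univ (kc n P) p =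
    deriv kap (n ^ 2 * rsq P p) * (n ^ 2 * (2 * (p.2 - P.2))) :=
  dY_of_has good_univ (mem_univ p) (kc_has n P p).hasFDerivWithinAt

lemma kc_bound_aux {M : ℝ} (hM : ∀ t, |deriv kap t| ≤ M) (n : ℝ) {P p : ℝ × ℝ}
    (hp : 0 < rsq P p) {x : ℝ} (hx : x ^ 2 ≤ rsq P p) :
    |deriv kap (n ^ 2 * rsq P p) * (n ^ 2 * (2 * x))| ≤ 4 * M / Real.sqrt (rsq P p) := by
  set r := Real.sqrt (rsq P p) with hr
  have hr0 : 0 < r := Real.sqrt_pos.mpr hp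
  have hr2 : r ^ 2 = rsq P p := Real.sq_sqrt hp.le
  have hM0 : 0 ≤ M := (abs_nonneg _).trans (hM 0)
  by_cases h : n ^ 2 * rsq P p < 1 ∨ 2 < n ^ 2 * rsq P p
  · rw [dkap_zero h, zero_mul, abs_zero]; positivity
  · push Not at h
    have hxr : |x| ≤ r := abs_le_of_sq_le_sq (by rw [hr2]; exact hx) hr0.le
    rw [abs_mul, abs_mul, abs_mul, abs_of_nonneg (sq_nonneg n), abs_two, le_div_iff₀ hr0]
    have h1 : n ^ 2 * (2 * |x|) * r ≤ 4 := by
      have : |x| * r ≤ r ^ 2 := by nlinarith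
      have h2 := h.2
      rw [← hr2] at h2
      nlinarith [sq_nonneg n]
    calc |deriv kap (n ^ 2 * rsq P p)| * (n ^ 2 * (2 * |x|)) * r
        = |deriv kap (n ^ 2 * rsq P p)| * (n ^ 2 * (2 * |x|) * r) := by ring
      _ ≤ M * 4 := mul_le_mul (hM _) h1 (by positivity) hM0
      _ = 4 * M := by ring

/-- full cutoff -/
def cut (τ : TriP) (n : ℝ) (p : ℝ × ℝ) : ℝ :=
  kc n (0, 0) p * (kc n (τ.L, 0) p * kc n (τ.a, τ.h) p)

lemma cut_smooth (τ : TriP) (n : ℝ) : ContDiff ℝ (⊤ : ℕ∞) (cut τ n) :=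
  (kc_smooth n _).mul ((kc_smooth n _).mul (kc_smooth n _))

lemma kc_near (n : ℝ) (P : ℝ × ℝ) : ∀ᶠ p in 𝓝 P, kc n P p = 0 := by
  have : n ^ 2 * rsq P P < 1 := by rw [rsq_self]; norm_num
  have hc : ContinuousAt (fun p => n ^ 2 * rsq P p) P := by fun_prop
  exact (hc.eventually_lt continuousAt_const this).mono (fun p hp => kap_zero hp.le)

lemma cut_near (τ : TriP) (n : ℝ) : ∀ P ∈ τ.V, ∀ᶠ p in 𝓝 P, cut τ n p = 0 := by
  intro P hP
  refine (kc_near n P).mono (fun p hp => ?_)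
  rcases hP with rfl | rfl | rfl <;> simp [cut, hp]

lemma kc_abs (n : ℝ) (P p : ℝ × ℝ) : |kc n P p| ≤ 1 := by
  rw [kc, abs_of_nonneg (kap_nonneg _)]; exact kap_le _

lemma cut_abs (τ : TriP) (n : ℝ) (p : ℝ × ℝ) : |cut τ n p| ≤ 1 := by
  rw [cut, abs_mul, abs_mul]
  have h1 := kc_abs n (0, 0) p
  have h2 := kc_abs n (τ.L, 0) p
  have h3 := kc_abs n (τ.a, τ.h) p
  exact mul_le_one₀ h1 (by positivity) (mul_le_one₀ h2 (by positivity) h3)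

lemma prod3_bound {a b c a' b' c' A B C : ℝ} (ha : |a| ≤ 1) (hb : |b| ≤ 1) (hc : |c| ≤ 1)
    (ha' : |a'| ≤ A) (hb' : |b'| ≤ B) (hc' : |c'| ≤ C) :
    |a' * (b * c) + a * (b' * c + b * c')| ≤ A + B + C := by
  have hA := (abs_nonneg _).trans ha'
  have hB := (abs_nonneg _).trans hb'
  have hC := (abs_nonneg _).trans hc'
  have e1 : |a' * (b * c)| ≤ A := by
    rw [abs_mul, abs_mul]
    exact (mul_le_of_le_one_right (abs_nonneg _) (mul_le_one₀ hb (abs_nonneg _) hc)).trans ha'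
  have e2 : |b' * c| ≤ B := by
    rw [abs_mul]; exact (mul_le_of_le_one_right (abs_nonneg _) hc).trans hb'
  have e3 : |b * c'| ≤ C := by
    rw [abs_mul]; exact (mul_le_of_le_one_left (abs_nonneg _) hb).trans hc'
  have e4 : |a * (b' * c + b * c')| ≤ B + C := by
    rw [abs_mul]
    exact (mul_le_of_le_one_left (abs_nonneg _) ha).trans ((abs_add_le _ _).trans (add_le_add e2 e3))
  exact (abs_add_le _ _).trans (by linarith)

/-- sum of inverse distances -/
def ir (τ : TriP) (p : ℝ × ℝ) : ℝ := 1 / Real.sqrt (rsq (0, 0) p) + 1 / Real.sqrt (rsq (τ.L, 0) p)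
  + 1 / Real.sqrt (rsq (τ.a, τ.h) p)

lemma V_A (τ : TriP) : ((0 : ℝ), (0 : ℝ)) ∈ τ.V := by simp [TriP.V]
lemma V_B (τ : TriP) : (τ.L, (0 : ℝ)) ∈ τ.V := by simp [TriP.V]
lemma V_C (τ : TriP) : (τ.a, τ.h) ∈ τ.V := by simp [TriP.V]

lemma cut_dX_eq (τ : TriP) (n : ℝ) (p : ℝ × ℝ) : dX univ (cut τ n) p =
    dX univ (kc n (0, 0)) p * (kc n (τ.L, 0) p * kc n (τ.a, τ.h) p) + kc n (0, 0) p *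
    (dX univ (kc n (τ.L, 0)) p * kc n (τ.a, τ.h) p + kc n (τ.L, 0) p * dX univ (kc n (τ.a, τ.h)) p) := by
  have s := fun P => (kc_smooth n P).contDiffOn (s := univ)
  rw [← dX_mul good_univ (s (τ.L, 0)) (s (τ.a, τ.h)) (mem_univ p),
    ← dX_mul good_univ (s (0, 0)) (((kc_smooth n _).mul (kc_smooth n _)).contDiffOn) (mem_univ p)]
  rfl

lemma cut_dY_eq (τ : TriP) (n : ℝ) (p : ℝ × ℝ) : dY univ (cut τ n) p =
    dY univ (kc n (0, 0)) p * (kc n (τ.L, 0) p * kc n (τ.a, τ.h) p) + kc n (0, 0) p *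
    (dY univ (kc n (τ.L, 0)) p * kc n (τ.a, τ.h) p + kc n (τ.L, 0) p * dY univ (kc n (τ.a, τ.h)) p) := by
  have s := fun P => (kc_smooth n P).contDiffOn (s := univ)
  rw [← dY_mul good_univ (s (τ.L, 0)) (s (τ.a, τ.h)) (mem_univ p),
    ← dY_mul good_univ (s (0, 0)) (((kc_smooth n _).mul (kc_smooth n _)).contDiffOn) (mem_univ p)]
  rfl

lemma cut_grad_bound (τ : TriP) {M : ℝ} (hM : ∀ t, |deriv kap t| ≤ M) (n : ℝ) {p : ℝ × ℝ}
    (hp : p ∈ τ.S) : |dX univ (cut τ n) p| ≤ 4 * M * ir τ p ∧ |dY univ (cut τ n) p| ≤ 4 * M * ir τ p := by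
  have b1 : ∀ P ∈ τ.V, |dX univ (kc n P) p| ≤ 4 * M / Real.sqrt (rsq P p) := fun P hP => by
    rw [kc_dX]; exact kc_bound_aux hM n (rsq_ne_of_S hP hp) (by simp only [rsq]; nlinarith [sq_nonneg (p.2 - P.2)])
  have b2 : ∀ P ∈ τ.V, |dY univ (kc n P) p| ≤ 4 * M / Real.sqrt (rsq P p) := fun P hP => by
    rw [kc_dY]; exact kc_bound_aux hM n (rsq_ne_of_S hP hp) (by simp only [rsq]; nlinarith [sq_nonneg (p.1 - P.1)])
  have e : 4 * M * ir τ p = 4 * M / Real.sqrt (rsq (0, 0) p) + 4 * M / Real.sqrt (rsq (τ.L, 0) p)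
    + 4 * M / Real.sqrt (rsq (τ.a, τ.h) p) := by simp only [ir]; ring
  rw [cut_dX_eq, cut_dY_eq, e]
  exact ⟨prod3_bound (kc_abs _ _ _) (kc_abs _ _ _) (kc_abs _ _ _) (b1 _ (V_A τ)) (b1 _ (V_B τ)) (b1 _ (V_C τ)),
    prod3_bound (kc_abs _ _ _) (kc_abs _ _ _) (kc_abs _ _ _) (b2 _ (V_A τ)) (b2 _ (V_B τ)) (b2 _ (V_C τ))⟩

lemma kc_ev {P p : ℝ × ℝ} (hp : 0 < rsq P p) : ∀ᶠ n : ℕ in atTop, kc n P p = 1 ∧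
    dX univ (kc n P) p = 0 ∧ dY univ (kc n P) p = 0 := by
  have h : Tendsto (fun n : ℕ => (n : ℝ) ^ 2 * rsq P p) atTop atTop :=
    ((tendsto_pow_atTop two_ne_zero).comp tendsto_natCast_atTop_atTop).atTop_mul_const hp
  filter_upwards [h.eventually_gt_atTop 2] with n hn
  refine ⟨kap_one hn.le, ?_, ?_⟩
  · rw [kc_dX, dkap_zero (Or.inr hn), zero_mul]
  · rw [kc_dY, dkap_zero (Or.inr hn), zero_mul]

lemma cut_ev (τ : TriP) {p : ℝ × ℝ} (hp : p ∈ τ.S) : ∀ᶠ n : ℕ in atTop, cut τ n p = 1 ∧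
    dX univ (cut τ n) p = 0 ∧ dY univ (cut τ n) p = 0 := by
  filter_upwards [kc_ev (rsq_ne_of_S (V_A τ) hp), kc_ev (rsq_ne_of_S (V_B τ) hp),
    kc_ev (rsq_ne_of_S (V_C τ) hp)] with n h1 h2 h3
  rw [cut_dX_eq, cut_dY_eq, cut, h1.1, h1.2.1, h1.2.2, h2.1, h2.2.1, h2.2.2, h3.1, h3.2.1, h3.2.2]
  simp

lemma div_lim (τ : TriP) {P Q : ℝ × ℝ → ℝ} (hP : Sm τ.S P) (hQ : Sm τ.S Q)
    (h2 : ∀ p ∈ τ.S, τ.l2 p = 0 → τ.h * P p - τ.a * Q p = 0)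
    (h3 : ∀ p ∈ τ.S, τ.l3 p = 0 → τ.h * P p + (τ.L - τ.a) * Q p = 0)
    (hd : IntegrableOn (fun p => dX τ.S P p + dY τ.S Q p) τ.Om)
    (hZ : IntegrableOn (fun p => ir τ p * (|P p| + |Q p|)) τ.Om) :
    Tendsto (fun n : ℕ => ∫ x in (0:ℝ)..τ.L, cut τ n (x, 0) * Q (x, 0)) atTop
      (𝓝 (-∫ p in τ.Om, (dX τ.S P p + dY τ.S Q p))) := by
  obtain ⟨M, hM0, hM⟩ := dkap_bdd
  have hm := τ.isOpen_Om.measurableSet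
  have key : Tendsto (fun n : ℕ => ∫ p in τ.Om, (cut τ n p * (dX τ.S P p + dY τ.S Q p)
      + (dX univ (cut τ n) p * P p + dY univ (cut τ n) p * Q p))) atTop
      (𝓝 (∫ p in τ.Om, (dX τ.S P p + dY τ.S Q p))) := by
    refine tendsto_integral_of_dominated_convergence
      (fun p => |dX τ.S P p + dY τ.S Q p| + 4 * M * (ir τ p * (|P p| + |Q p|))) ?_ ?_ ?_ ?_
    · intro n
      refine ContinuousOn.aestronglyMeasurable ?_ hm
      have hc := (cut_smooth τ n)
      have c1 : ContinuousOn (dX univ (cut τ n)) τ.Om := (Sm.dX good_univ hc.contDiffOn).cont.mono (subset_univ _)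
      have c2 : ContinuousOn (dY univ (cut τ n)) τ.Om := (Sm.dY good_univ hc.contDiffOn).cont.mono (subset_univ _)
      exact (hc.continuous.continuousOn.mul (((hP.dX τ.good_S).cont.mono τ.Om_sub_S).add
        ((hQ.dY τ.good_S).cont.mono τ.Om_sub_S))).add
        ((c1.mul (hP.cont.mono τ.Om_sub_S)).add (c2.mul (hQ.cont.mono τ.Om_sub_S)))
    · exact hd.abs.add (hZ.const_mul _)
    · intro n
      refine (ae_restrict_iff' hm).mpr (Eventually.of_forall (fun p hp => ?_))
      obtain ⟨g1, g2⟩ := cut_grad_bound τ hM n (τ.Om_sub_S hp)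
      have g3 := cut_abs τ n p
      rw [Real.norm_eq_abs]
      refine (abs_add_le _ _).trans (add_le_add ?_ ((abs_add_le _ _).trans ?_))
      · rw [abs_mul]; exact mul_le_of_le_one_left (abs_nonneg _) g3
      · rw [abs_mul, abs_mul]
        have := mul_le_mul_of_nonneg_right g1 (abs_nonneg (P p))
        have := mul_le_mul_of_nonneg_right g2 (abs_nonneg (Q p))
        linarith
    · refine (ae_restrict_iff' hm).mpr (Eventually.of_forall (fun p hp => ?_))
      refine tendsto_const_nhds.congr' ?_
      filter_upwards [cut_ev τ (τ.Om_sub_S hp)] with n hn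
      rw [hn.1, hn.2.1, hn.2.2]; ring
  have := key.neg
  refine this.congr (fun n => ?_)
  rw [div_cut τ hP hQ h2 h3 (cut_smooth τ n) (cut_near τ n), neg_neg]

end NZ

namespace NZ

open MeasureTheory Filter Topology

/-- `f` has partial derivatives `a`, `b` within `S` at `p` -/
def HL (S : Set (ℝ × ℝ)) (f : ℝ × ℝ → ℝ) (a b : ℝ) (p : ℝ × ℝ) : Prop :=
  HasFDerivWithinAt f (lin a b) S p

section HLs
variable {S : Set (ℝ × ℝ)} {f g : ℝ × ℝ → ℝ} {p : ℝ × ℝ} {a b c d : ℝ}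

lemma HL.mul (hf : HL S f a b p) (hg : HL S g c d p) :
    HL S (fun q => f q * g q) (a * g p + f p * c) (b * g p + f p * d) p := by
  refine (HasFDerivWithinAt.mul hf hg).congr_fderiv ?_
  apply lin_ext <;> simp <;> ring
lemma HL.add (hf : HL S f a b p) (hg : HL S g c d p) : HL S (fun q => f q + g q) (a + c) (b + d) p := by
  refine (HasFDerivWithinAt.add hf hg).congr_fderiv ?_
  apply lin_ext <;> simp
lemma HL.sub (hf : HL S f a b p) (hg : HL S g c d p) : HL S (fun q => f q - g q) (a - c) (b - d) p := by
  refine (HasFDerivWithinAt.sub hf hg).congr_fderiv ?_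
  apply lin_ext <;> simp
lemma HL.smul (k : ℝ) (hf : HL S f a b p) : HL S (fun q => k * f q) (k * a) (k * b) p := by
  refine (HasFDerivWithinAt.const_mul hf k).congr_fderiv ?_
  apply lin_ext <;> simp
lemma HL.xsub (k : ℝ) : HL S (fun q => q.1 - k) 1 0 p := by
  refine ((hasFDerivAt_fst (𝕜 := ℝ) (p := p)).sub_const k).hasFDerivWithinAt.congr_fderiv ?_
  apply lin_ext <;> simp
lemma HL.ysub (k : ℝ) : HL S (fun q => q.2 - k) 0 1 p := by
  refine ((hasFDerivAt_snd (𝕜 := ℝ) (p := p)).sub_const k).hasFDerivWithinAt.congr_fderiv ?_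
  apply lin_ext <;> simp
lemma HL.x (hS : Good S) (hp : p ∈ S) (hf : HL S f a b p) : dX S f p = a := dX_of_has hS hp hf
lemma HL.y (hS : Good S) (hp : p ∈ S) (hf : HL S f a b p) : dY S f p = b := dY_of_has hS hp hf
lemma HL.congr (hf : HL S f a b p) (h1 : a = c) (h2 : b = d) : HL S f c d p := h1 ▸ h2 ▸ hf

/-- derivative along a line on which `f` is constant -/
lemma tang_zero (hf : HL S f a b p) {v1 v2 k ε : ℝ} (hε : 0 < ε)
    (h : ∀ t, |t| < ε → (p.1 + t * v1, p.2 + t * v2) ∈ S ∧ f (p.1 + t * v1, p.2 + t * v2) = k) :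
    a * v1 + b * v2 = 0 := by
  have e0 : (p.1 + 0 * v1, p.2 + 0 * v2) = p := by simp
  have hl : HasDerivAt (fun t : ℝ => (p.1 + t * v1, p.2 + t * v2)) (v1, v2) 0 := by
    have h1 := ((hasDerivAt_id (0:ℝ)).mul_const v1).const_add p.1
    have h2 := ((hasDerivAt_id (0:ℝ)).mul_const v2).const_add p.2
    simpa using h1.prodMk h2
  have hf' : HasFDerivWithinAt f (lin a b) S (p.1 + 0 * v1, p.2 + 0 * v2) := by rw [e0]; exact hf
  have hB : Metric.ball (0:ℝ) ε ∈ 𝓝 (0:ℝ) := Metric.ball_mem_nhds _ hε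
  have hc := (hf'.comp_hasDerivWithinAt (0:ℝ) hl.hasDerivWithinAt (s := Metric.ball (0:ℝ) ε)
    (fun t ht => (h t (by simpa using ht)).1)).hasDerivAt hB
  have hk : HasDerivAt (f ∘ fun t : ℝ => (p.1 + t * v1, p.2 + t * v2)) 0 0 := by
    refine (hasDerivAt_const (0:ℝ) k).congr_of_eventuallyEq ?_
    filter_upwards [hB] with t ht
    exact (h t (by simpa using ht)).2
  simpa using hc.unique hk
end HLs

section sides
variable (τ : TriP) {p : ℝ × ℝ}

lemma side1 (hp : p ∈ τ.S) (h0 : p.2 = 0) : 0 < p.1 ∧ p.1 < τ.L := by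
  obtain ⟨⟨h1, h2, h3⟩, h4⟩ := hp
  simp only [TriP.l2, TriP.l3, h0] at h2 h3
  have hh := τ.hh
  have a1 : 0 ≤ p.1 := by nlinarith
  have a2 : p.1 ≤ τ.L := by nlinarith
  refine ⟨lt_of_le_of_ne a1 (fun h => h4 ?_), lt_of_le_of_ne a2 (fun h => h4 ?_)⟩
  · left; exact Prod.ext h.symm h0
  · right; left; exact Prod.ext h h0

lemma side1' {x : ℝ} (h1 : 0 < x) (h2 : x < τ.L) : (x, (0:ℝ)) ∈ τ.S := by
  have hh := τ.hh
  refine ⟨⟨le_refl _, ?_, ?_⟩, ?_⟩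
  · simp only [TriP.l2]; nlinarith
  · simp only [TriP.l3]; nlinarith
  · rintro (h | h | h)
    · have : x = 0 := congrArg Prod.fst h
      linarith
    · have : x = τ.L := congrArg Prod.fst h
      linarith
    · have : 0 = τ.h := congrArg Prod.snd h
      linarith

lemma side2 (hp : p ∈ τ.S) (h0 : τ.l2 p = 0) : 0 < p.2 ∧ p.2 < τ.h := by
  obtain ⟨⟨h1, h2, h3⟩, h4⟩ := hp
  simp only [TriP.l2, TriP.l3] at h0 h3
  have hh := τ.hh
  have hL := τ.hL
  have a2 : p.2 ≤ τ.h := by nlinarith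
  refine ⟨lt_of_le_of_ne h1 (fun h => h4 ?_), lt_of_le_of_ne a2 (fun h => h4 ?_)⟩
  · left; refine Prod.ext ?_ h.symm
    rw [← h] at h0; simpa [hh.ne'] using h0
  · right; right; refine Prod.ext ?_ h
    rw [h] at h0; exact mul_left_cancel₀ hh.ne' (by linarith)

lemma side2' (h0 : τ.l2 p = 0) (h1 : 0 < p.2) (h2 : p.2 < τ.h) : p ∈ τ.S := by
  have hh := τ.hh
  have hL := τ.hL
  simp only [TriP.l2] at h0
  refine ⟨⟨h1.le, ?_, ?_⟩, ?_⟩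
  · simp only [TriP.l2]; linarith
  · simp only [TriP.l3]; nlinarith
  · rintro (h | h | h) <;> rw [h] at h1 h2 <;> simp at h1 h2

lemma side3 (hp : p ∈ τ.S) (h0 : τ.l3 p = 0) : 0 < p.2 ∧ p.2 < τ.h := by
  obtain ⟨⟨h1, h2, h3⟩, h4⟩ := hp
  simp only [TriP.l2, TriP.l3] at h0 h2
  have hh := τ.hh
  have hL := τ.hL
  have a2 : p.2 ≤ τ.h := by nlinarith
  refine ⟨lt_of_le_of_ne h1 (fun h => h4 ?_), lt_of_le_of_ne a2 (fun h => h4 ?_)⟩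
  · right; left; refine Prod.ext ?_ h.symm
    rw [← h] at h0; exact mul_left_cancel₀ hh.ne' (by linarith)
  · right; right; refine Prod.ext ?_ h
    rw [h] at h0; exact mul_left_cancel₀ hh.ne' (by linarith)

lemma side3' (h0 : τ.l3 p = 0) (h1 : 0 < p.2) (h2 : p.2 < τ.h) : p ∈ τ.S := by
  have hh := τ.hh
  have hL := τ.hL
  simp only [TriP.l3] at h0
  refine ⟨⟨h1.le, ?_, ?_⟩, ?_⟩
  · simp only [TriP.l2]; nlinarith
  · simp only [TriP.l3]; linarith
  · rintro (h | h | h) <;> rw [h] at h1 h2 <;> simp at h1 h2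

lemma tang1 {f : ℝ × ℝ → ℝ} {a b k : ℝ} (hp : p ∈ τ.S) (h0 : p.2 = 0) (hf : HL τ.S f a b p)
    (hk : ∀ q ∈ τ.S, q.2 = 0 → f q = k) : a = 0 := by
  obtain ⟨h1, h2⟩ := side1 τ hp h0
  have := tang_zero hf (v1 := 1) (v2 := 0) (k := k) (lt_min h1 (sub_pos.mpr h2)) (fun t ht => ?_)
  · simpa using this
  · have := lt_of_lt_of_le ht (min_le_left _ _)
    have := lt_of_lt_of_le ht (min_le_right _ _)
    have := abs_lt.mp ht
    have hm : (p.1 + t * 1, p.2 + t * 0) ∈ τ.S := by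
      rw [h0, mul_zero, mul_one, add_zero]
      exact side1' τ (by cases abs_cases t <;> linarith) (by cases abs_cases t <;> linarith)
    exact ⟨hm, hk _ hm (by simp [h0])⟩

lemma tang2 {f : ℝ × ℝ → ℝ} {a b k : ℝ} (hp : p ∈ τ.S) (h0 : τ.l2 p = 0) (hf : HL τ.S f a b p)
    (hk : ∀ q ∈ τ.S, τ.l2 q = 0 → f q = k) : τ.a * a + τ.h * b = 0 := by
  obtain ⟨h1, h2⟩ := side2 τ hp h0
  have hh := τ.hh
  have := tang_zero hf (v1 := τ.a) (v2 := τ.h) (k := k)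
    (div_pos (lt_min h1 (sub_pos.mpr h2)) hh) (fun t ht => ?_)
  · linarith
  · rw [lt_div_iff₀ hh] at ht
    have := lt_of_lt_of_le ht (min_le_left _ _)
    have := lt_of_lt_of_le ht (min_le_right _ _)
    have e : τ.l2 (p.1 + t * τ.a, p.2 + t * τ.h) = 0 := by
      simp only [TriP.l2] at h0 ⊢; linarith
    have e1 : |t| * τ.h = |t * τ.h| := by rw [abs_mul, abs_of_pos hh]
    have hm : (p.1 + t * τ.a, p.2 + t * τ.h) ∈ τ.S := by
      refine side2' τ e ?_ ?_
      · change 0 < p.2 + t * τ.h; cases abs_cases (t * τ.h) <;> linarith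
      · change p.2 + t * τ.h < τ.h; cases abs_cases (t * τ.h) <;> linarith
    exact ⟨hm, hk _ hm e⟩

lemma tang3 {f : ℝ × ℝ → ℝ} {a b k : ℝ} (hp : p ∈ τ.S) (h0 : τ.l3 p = 0) (hf : HL τ.S f a b p)
    (hk : ∀ q ∈ τ.S, τ.l3 q = 0 → f q = k) : -(τ.L - τ.a) * a + τ.h * b = 0 := by
  obtain ⟨h1, h2⟩ := side3 τ hp h0
  have hh := τ.hh
  have := tang_zero hf (v1 := -(τ.L - τ.a)) (v2 := τ.h) (k := k)
    (div_pos (lt_min h1 (sub_pos.mpr h2)) hh) (fun t ht => ?_)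
  · linarith
  · rw [lt_div_iff₀ hh] at ht
    have := lt_of_lt_of_le ht (min_le_left _ _)
    have := lt_of_lt_of_le ht (min_le_right _ _)
    have e : τ.l3 (p.1 + t * -(τ.L - τ.a), p.2 + t * τ.h) = 0 := by
      simp only [TriP.l3] at h0 ⊢; linarith
    have e1 : |t| * τ.h = |t * τ.h| := by rw [abs_mul, abs_of_pos hh]
    have hm : (p.1 + t * -(τ.L - τ.a), p.2 + t * τ.h) ∈ τ.S := by
      refine side3' τ e ?_ ?_
      · change 0 < p.2 + t * τ.h; cases abs_cases (t * τ.h) <;> linarith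
      · change p.2 + t * τ.h < τ.h; cases abs_cases (t * τ.h) <;> linarith
    exact ⟨hm, hk _ hm e⟩
end sides

section Z
variable (τ : TriP) (μ : ℝ) (U : ℝ × ℝ → ℝ)

local notation "uX" => dX τ.S U
local notation "uY" => dY τ.S U
local notation "uXX" => dX τ.S (dX τ.S U)
local notation "uXY" => dY τ.S (dX τ.S U)
local notation "uYY" => dY τ.S (dY τ.S U)

/-- rotational derivative and its partials; Euler derivative and its partials -/
def wF (p : ℝ × ℝ) : ℝ := (p.1 - τ.a) * uY p - (p.2 - τ.h) * uX p
def wxF (p : ℝ × ℝ) : ℝ := uY p + (p.1 - τ.a) * uXY p - (p.2 - τ.h) * uXX p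
def wyF (p : ℝ × ℝ) : ℝ := (p.1 - τ.a) * uYY p - uX p - (p.2 - τ.h) * uXY p
def eF (p : ℝ × ℝ) : ℝ := (p.1 - τ.a) * uX p + (p.2 - τ.h) * uY p
def exF (p : ℝ × ℝ) : ℝ := uX p + (p.1 - τ.a) * uXX p + (p.2 - τ.h) * uXY p
def eyF (p : ℝ × ℝ) : ℝ := uY p + (p.1 - τ.a) * uXY p + (p.2 - τ.h) * uYY p
/-- the vector field -/
def mF (p : ℝ × ℝ) : ℝ := μ * (U p * U p) - (uX p * uX p + uY p * uY p)
def ZP (p : ℝ × ℝ) : ℝ := wF τ U p * wxF τ U p + eF τ U p * uX p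
  + 1 / 2 * (mF τ μ U p * (p.1 - τ.a)) - 1 / 2 * (wyF τ U p * eF τ U p + wF τ U p * eyF τ U p)
def ZQ (p : ℝ × ℝ) : ℝ := wF τ U p * wyF τ U p + eF τ U p * uY p
  + 1 / 2 * (mF τ μ U p * (p.2 - τ.h)) + 1 / 2 * (wxF τ U p * eF τ U p + wF τ U p * exF τ U p)

variable {τ μ U}

lemma sm_xsub (k : ℝ) : Sm τ.S (fun p => p.1 - k) := contDiffOn_fst.sub contDiffOn_const
lemma sm_ysub (k : ℝ) : Sm τ.S (fun p => p.2 - k) := contDiffOn_snd.sub contDiffOn_const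

lemma wF_sm (hU : Sm τ.S U) : Sm τ.S (wF τ U) :=
  ((sm_xsub _).mul (hU.dY τ.good_S)).sub ((sm_ysub _).mul (hU.dX τ.good_S))
lemma wxF_sm (hU : Sm τ.S U) : Sm τ.S (wxF τ U) :=
  ((hU.dY τ.good_S).add ((sm_xsub _).mul ((hU.dX τ.good_S).dY τ.good_S))).sub
    ((sm_ysub _).mul ((hU.dX τ.good_S).dX τ.good_S))
lemma wyF_sm (hU : Sm τ.S U) : Sm τ.S (wyF τ U) :=
  (((sm_xsub _).mul ((hU.dY τ.good_S).dY τ.good_S)).sub (hU.dX τ.good_S)).sub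
    ((sm_ysub _).mul ((hU.dX τ.good_S).dY τ.good_S))
lemma eF_sm (hU : Sm τ.S U) : Sm τ.S (eF τ U) :=
  ((sm_xsub _).mul (hU.dX τ.good_S)).add ((sm_ysub _).mul (hU.dY τ.good_S))
lemma exF_sm (hU : Sm τ.S U) : Sm τ.S (exF τ U) :=
  ((hU.dX τ.good_S).add ((sm_xsub _).mul ((hU.dX τ.good_S).dX τ.good_S))).add
    ((sm_ysub _).mul ((hU.dX τ.good_S).dY τ.good_S))
lemma eyF_sm (hU : Sm τ.S U) : Sm τ.S (eyF τ U) :=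
  ((hU.dY τ.good_S).add ((sm_xsub _).mul ((hU.dX τ.good_S).dY τ.good_S))).add
    ((sm_ysub _).mul ((hU.dY τ.good_S).dY τ.good_S))
lemma mF_sm (hU : Sm τ.S U) : Sm τ.S (mF τ μ U) :=
  (contDiffOn_const.mul (hU.mul hU)).sub
    (((hU.dX τ.good_S).mul (hU.dX τ.good_S)).add ((hU.dY τ.good_S).mul (hU.dY τ.good_S)))
lemma ZP_sm (hU : Sm τ.S U) : Sm τ.S (ZP τ μ U) :=
  ((((wF_sm hU).mul (wxF_sm hU)).add ((eF_sm hU).mul (hU.dX τ.good_S))).add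
    (contDiffOn_const.mul ((mF_sm hU).mul (sm_xsub _)))).sub
    (contDiffOn_const.mul (((wyF_sm hU).mul (eF_sm hU)).add ((wF_sm hU).mul (eyF_sm hU))))
lemma ZQ_sm (hU : Sm τ.S U) : Sm τ.S (ZQ τ μ U) :=
  ((((wF_sm hU).mul (wyF_sm hU)).add ((eF_sm hU).mul (hU.dY τ.good_S))).add
    (contDiffOn_const.mul ((mF_sm hU).mul (sm_ysub _)))).add
    (contDiffOn_const.mul (((wxF_sm hU).mul (eF_sm hU)).add ((wF_sm hU).mul (exF_sm hU))))

lemma jet1 (hU : Sm τ.S U) {p : ℝ × ℝ} (hp : p ∈ τ.S) :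
    HL τ.S U (uX p) (uY p) p ∧ HL τ.S uX (uXX p) (uXY p) p ∧ HL τ.S uY (uXY p) (uYY p) p := by
  refine ⟨hU.has hp, (hU.dX τ.good_S).has hp, ?_⟩
  have := (hU.dY τ.good_S).has hp
  rwa [dX_dY_comm τ.good_S hU hp] at this

lemma jet2 (hE : τ.Eig μ U) {p : ℝ × ℝ} (hp : p ∈ τ.S) :
    ∃ A B C D, HL τ.S uXX A B p ∧ HL τ.S uXY B C p ∧ HL τ.S uYY C D p ∧
      A + C = -μ * uX p ∧ B + D = -μ * uY p := by
  have hG := τ.good_S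
  have hU := hE.sm
  have h1 := ((hU.dX hG).dX hG).has hp
  have h2 := ((hU.dX hG).dY hG).has hp
  have h3 := ((hU.dY hG).dY hG).has hp
  have e1 : dX τ.S uXY p = dY τ.S uXX p := dX_dY_comm hG (hU.dX hG) hp
  have e2 : dX τ.S uYY p = dY τ.S uXY p := by
    rw [dX_dY_comm hG (hU.dY hG) hp]
    exact dY_congr (fun q hq => dX_dY_comm hG hU hq) hp
  rw [e1] at h2
  rw [e2] at h3
  refine ⟨_, _, _, _, h1, h2, h3, ?_, ?_⟩
  · rw [← e2, ← dX_add hG ((hU.dX hG).dX hG) ((hU.dY hG).dY hG) hp, ← dX_const_mul hG _ hU hp]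
    exact dX_congr (fun q hq => hE.pde q hq) hp
  · rw [← dY_add hG ((hU.dX hG).dX hG) ((hU.dY hG).dY hG) hp, ← dY_const_mul hG _ hU hp]
    exact dY_congr (fun q hq => hE.pde q hq) hp

lemma wF_has (hU : Sm τ.S U) {p : ℝ × ℝ} (hp : p ∈ τ.S) : HL τ.S (wF τ U) (wxF τ U p) (wyF τ U p) p := by
  obtain ⟨-, h2, h3⟩ := jet1 hU hp
  refine (((HL.xsub τ.a).mul h3).sub ((HL.ysub τ.h).mul h2)).congr ?_ ?_
  · simp only [wxF]; ring
  · simp only [wyF]; ring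

lemma eF_has (hU : Sm τ.S U) {p : ℝ × ℝ} (hp : p ∈ τ.S) : HL τ.S (eF τ U) (exF τ U p) (eyF τ U p) p := by
  obtain ⟨-, h2, h3⟩ := jet1 hU hp
  refine (((HL.xsub τ.a).mul h2).add ((HL.ysub τ.h).mul h3)).congr ?_ ?_
  · simp only [exF]; ring
  · simp only [eyF]; ring

set_option maxHeartbeats 1000000 in
lemma Z_div (hE : τ.Eig μ U) {p : ℝ × ℝ} (hp : p ∈ τ.S) :
    dX τ.S (ZP τ μ U) p + dY τ.S (ZQ τ μ U) p =
      wxF τ U p ^ 2 + wyF τ U p ^ 2 - μ * wF τ U p ^ 2 + μ * U p ^ 2 := by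
  have hG := τ.good_S
  have hU := hE.sm
  obtain ⟨h1, h2, h3⟩ := jet1 hU hp
  obtain ⟨A, B, C, D, k1, k2, k3, e1, e2⟩ := jet2 hE hp
  have e0 := hE.pde p hp
  have hw := wF_has hU hp
  have he := eF_has hU hp
  have hwx := (h3.add ((HL.xsub τ.a).mul k2)).sub ((HL.ysub τ.h).mul k1)
  have hwy := (((HL.xsub τ.a).mul k3).sub h2).sub ((HL.ysub τ.h).mul k2)
  have hex := (h2.add ((HL.xsub τ.a).mul k1)).add ((HL.ysub τ.h).mul k2)
  have hey := (h3.add ((HL.xsub τ.a).mul k2)).add ((HL.ysub τ.h).mul k3)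
  have hm := ((h1.mul h1).smul μ).sub ((h2.mul h2).add (h3.mul h3))
  have HP := (((hw.mul hwx).add (he.mul h2)).add ((hm.mul (HL.xsub τ.a)).smul (1 / 2))).sub
    (((hwy.mul he).add (hw.mul hey)).smul (1 / 2))
  have HQ := (((hw.mul hwy).add (he.mul h3)).add ((hm.mul (HL.ysub τ.h)).smul (1 / 2))).add
    (((hwx.mul he).add (hw.mul hex)).smul (1 / 2))
  have r1 : dX τ.S (ZP τ μ U) p = _ := HP.x hG hp
  have r2 : dY τ.S (ZQ τ μ U) p = _ := HQ.y hG hp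
  rw [r1, r2]
  clear r1 r2 HP HQ hm hey hex hwy hwx he hw k1 k2 k3 h1 h2 h3
  simp only [wF, wxF, wyF, eF, exF, eyF] at *
  generalize dX τ.S (dX τ.S U) p = xx at *
  generalize dY τ.S (dX τ.S U) p = xy at *
  generalize dY τ.S (dY τ.S U) p = yy at *
  generalize dX τ.S U p = ux at *
  generalize dY τ.S U p = uy at *
  generalize U p = u at *
  obtain rfl : A = -μ * ux - C := by linarith
  obtain rfl : B = -μ * uy - D := by linarith
  obtain rfl : yy = -μ * u - xx := by linarith
  ring

lemma wF_side2 (hE : τ.Eig μ U) {p : ℝ × ℝ} (hp : p ∈ τ.S) (h0 : τ.l2 p = 0) : wF τ U p = 0 := by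
  have := hE.neu.2.1 p hp h0
  refine mul_left_cancel₀ τ.hh.ne' ?_
  simp only [TriP.l2, wF] at *
  linear_combination (-(p.2 - τ.h)) * this + dY τ.S U p * h0
lemma wF_side3 (hE : τ.Eig μ U) {p : ℝ × ℝ} (hp : p ∈ τ.S) (h0 : τ.l3 p = 0) : wF τ U p = 0 := by
  have := hE.neu.2.2 p hp h0
  refine mul_left_cancel₀ τ.hh.ne' ?_
  simp only [TriP.l3, wF] at *
  linear_combination (-(p.2 - τ.h)) * this - dY τ.S U p * h0

lemma Z_side2 (hE : τ.Eig μ U) {p : ℝ × ℝ} (hp : p ∈ τ.S) (h0 : τ.l2 p = 0) :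
    τ.h * ZP τ μ U p - τ.a * ZQ τ μ U p = 0 := by
  have hw := wF_side2 hE hp h0
  have ht := tang2 τ hp h0 (wF_has hE.sm hp) (k := 0) (fun q hq h => wF_side2 hE hq h)
  have hn := hE.neu.2.1 p hp h0
  simp only [ZP, ZQ, hw, TriP.l2] at *
  linear_combination (-1 / 2 * eF τ U p) * ht + eF τ U p * hn + 1 / 2 * mF τ μ U p * h0
lemma Z_side3 (hE : τ.Eig μ U) {p : ℝ × ℝ} (hp : p ∈ τ.S) (h0 : τ.l3 p = 0) :
    τ.h * ZP τ μ U p + (τ.L - τ.a) * ZQ τ μ U p = 0 := by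
  have hw := wF_side3 hE hp h0
  have ht := tang3 τ hp h0 (wF_has hE.sm hp) (k := 0) (fun q hq h => wF_side3 hE hq h)
  have hn := hE.neu.2.2 p hp h0
  simp only [ZP, ZQ, hw, TriP.l3] at *
  linear_combination (-1 / 2 * eF τ U p) * ht + eF τ U p * hn - 1 / 2 * mF τ μ U p * h0

lemma Z_side1 (hE : τ.Eig μ U) {p : ℝ × ℝ} (hp : p ∈ τ.S) (h0 : p.2 = 0) :
    ZQ τ μ U p = -(τ.h * μ / 2) * (U p ^ 2 + 2 * (p.1 - τ.a) * U p * uX p) := by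
  have hn := hE.neu.1 p hp h0
  obtain ⟨-, -, h3⟩ := jet1 hE.sm hp
  have ht : uXY p = 0 := tang1 τ hp h0 h3 (k := 0) (fun q hq h => hE.neu.1 q hq h)
  have e0 := hE.pde p hp
  obtain hyy : uYY p = -μ * U p - uXX p := by linarith
  simp only [ZQ, wF, wyF, wxF, eF, exF, mF, hn, ht, h0, hyy]
  ring
end Z

end NZ

namespace NZ

open MeasureTheory Filter Topology

lemma bm {a b A B : ℝ} (ha : |a| ≤ A) (hb : |b| ≤ B) : |a * b| ≤ A * B := by
  rw [abs_mul]; exact mul_le_mul ha hb (abs_nonneg _) ((abs_nonneg _).trans ha)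
lemma ba {a b A B : ℝ} (ha : |a| ≤ A) (hb : |b| ≤ B) : |a + b| ≤ A + B :=
  (abs_add_le _ _).trans (add_le_add ha hb)
lemma bs {a b A B : ℝ} (ha : |a| ≤ A) (hb : |b| ≤ B) : |a - b| ≤ A + B :=
  (abs_sub _ _).trans (add_le_add ha hb)

section
variable {τ : TriP} {μ : ℝ} {U : ℝ × ℝ → ℝ}

/-- size of the gradient and of the hessian -/
def nN (τ : TriP) (U : ℝ × ℝ → ℝ) (p : ℝ × ℝ) : ℝ := |dX τ.S U p| + |dY τ.S U p|
def nM (τ : TriP) (U : ℝ × ℝ → ℝ) (p : ℝ × ℝ) : ℝ :=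
  nN τ U p + (|dX τ.S (dX τ.S U) p| + |dY τ.S (dX τ.S U) p| + |dY τ.S (dY τ.S U) p|)

lemma nN_nonneg (p) : 0 ≤ nN τ U p := by unfold nN; positivity
lemma nN_le_nM (p) : nN τ U p ≤ nM τ U p := by unfold nM; have : 0 ≤ (|dX τ.S (dX τ.S U) p| + |dY τ.S (dX τ.S U) p| + |dY τ.S (dY τ.S U) p|) := by positivity
                                               linarith

lemma nN_sq (p) : nN τ U p ^ 2 ≤ 2 * gsq τ.S U p := by
  unfold nN gsq
  rw [← sq_abs (dX τ.S U p), ← sq_abs (dY τ.S U p)]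
  nlinarith [sq_nonneg (|dX τ.S U p| - |dY τ.S U p|)]

lemma nM_sq (p) : nM τ U p ^ 2 ≤ 4 * gsq τ.S U p + 6 * hsq τ.S U p := by
  have h := nN_sq (τ := τ) (U := U) p
  unfold nM hsq
  rw [← sq_abs (dX τ.S (dX τ.S U) p), ← sq_abs (dY τ.S (dX τ.S U) p), ← sq_abs (dY τ.S (dY τ.S U) p)]
  generalize nN τ U p = n at *
  generalize |dX τ.S (dX τ.S U) p| = a at *
  generalize |dY τ.S (dX τ.S U) p| = b at *
  generalize |dY τ.S (dY τ.S U) p| = c at *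
  nlinarith [sq_nonneg (a - b), sq_nonneg (a - c), sq_nonneg (b - c), sq_nonneg (n - (a + b + c)), sq_nonneg b]

/-- uniform bounds on the triangle -/
lemma tri_bound (hE : τ.Eig μ U) : ∃ D, 1 ≤ D ∧ ∀ p ∈ τ.S, |p.1 - τ.a| ≤ D ∧ |p.2 - τ.h| ≤ D ∧ |U p| ≤ D := by
  obtain ⟨D1, h1⟩ := τ.isCompact_T.exists_bound_of_continuousOn (f := fun p => p.1 - τ.a) (by fun_prop)
  obtain ⟨D2, h2⟩ := τ.isCompact_T.exists_bound_of_continuousOn (f := fun p => p.2 - τ.h) (by fun_prop)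
  obtain ⟨D3, h3⟩ := τ.isCompact_T.exists_bound_of_continuousOn hE.cont
  refine ⟨max 1 (max D1 (max D2 D3)), le_max_left _ _, fun p hp => ?_⟩
  have hp' := τ.S_sub_T hp
  exact ⟨(h1 p hp').trans (by simp), (h2 p hp').trans (by simp), (h3 p hp').trans (by simp)⟩

lemma vol_Om : volume τ.Om < ⊤ :=
  (measure_mono (τ.Om_sub_S.trans τ.S_sub_T)).trans_lt τ.isCompact_T.measure_lt_top

lemma int_one (c : ℝ) : IntegrableOn (fun _ => c) τ.Om :=
  integrableOn_const vol_Om.ne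

lemma int_r_mul (hE : τ.Eig μ U) {P : ℝ × ℝ} (hP : P ∈ τ.V) {F : ℝ × ℝ → ℝ} (hF : ContinuousOn F τ.S)
    {K : ℝ} (hK0 : 0 ≤ K) (hK : ∀ p ∈ τ.Om, |F p| ≤ K * (nN τ U p * nM τ U p + 1)) :
    IntegrableOn (fun p => 1 / Real.sqrt (rsq P p) * F p) τ.Om := by
  have hm := τ.isOpen_Om.measurableSet
  have hi : IntegrableOn (fun p => K * (2 * (gsq τ.S U p / rsq P p) + (4 * gsq τ.S U p + 6 * hsq τ.S U p)
      + 1 / Real.sqrt (rsq P p))) τ.Om :=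
    ((((int_gsq_div hE hP).const_mul 2).add (((int_gsq hE).const_mul 4).add ((int_hsq hE).const_mul 6))).add
      (int_inv_r hP)).const_mul K
  refine Integrable.mono' hi ?_ ((ae_restrict_iff' hm).mpr (Eventually.of_forall (fun p hp => ?_)))
  · refine ContinuousOn.aestronglyMeasurable ?_ hm
    refine (continuousOn_const.div (by fun_prop) (fun p hp => ?_)).mul (hF.mono τ.Om_sub_S)
    exact (Real.sqrt_pos.mpr (rsq_ne_of_S hP (τ.Om_sub_S hp))).ne'
  · have hr := rsq_ne_of_S hP (τ.Om_sub_S hp)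
    set t := 1 / Real.sqrt (rsq P p) with ht
    have ht0 : 0 < t := by positivity
    have ht2 : t ^ 2 * rsq P p = 1 := by
      rw [ht, div_pow, Real.sq_sqrt hr.le]; field_simp
    have hg : gsq τ.S U p / rsq P p = t ^ 2 * gsq τ.S U p := by
      rw [div_eq_iff hr.ne']; linear_combination (-gsq τ.S U p) * ht2
    rw [hg, Real.norm_eq_abs, abs_mul, abs_of_pos ht0]
    have h1 := nN_sq (τ := τ) (U := U) p
    have h2 := nM_sq (τ := τ) (U := U) p
    have h3 := hK p hp
    have h4 : t * (nN τ U p * nM τ U p + 1) ≤ 2 * (t ^ 2 * gsq τ.S U p) + (4 * gsq τ.S U p + 6 * hsq τ.S U p) + t := by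
      nlinarith [sq_nonneg (t * nN τ U p - nM τ U p), mul_le_mul_of_nonneg_left h1 (sq_nonneg t),
        sq_nonneg (t * nN τ U p), sq_nonneg (nM τ U p)]
    calc t * |F p| ≤ t * (K * (nN τ U p * nM τ U p + 1)) := mul_le_mul_of_nonneg_left h3 ht0.le
      _ = K * (t * (nN τ U p * nM τ U p + 1)) := by ring
      _ ≤ _ := mul_le_mul_of_nonneg_left h4 hK0

lemma int_ir_mul (hE : τ.Eig μ U) {F : ℝ × ℝ → ℝ} (hF : ContinuousOn F τ.S)
    {K : ℝ} (hK0 : 0 ≤ K) (hK : ∀ p ∈ τ.Om, |F p| ≤ K * (nN τ U p * nM τ U p + 1)) :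
    IntegrableOn (fun p => ir τ p * F p) τ.Om := by
  refine (((int_r_mul hE (V_A τ) hF hK0 hK).add (int_r_mul hE (V_B τ) hF hK0 hK)).add
    (int_r_mul hE (V_C τ) hF hK0 hK)).congr (Eventually.of_forall (fun p => ?_))
  simp only [ir, Pi.add_apply]; ring

lemma jet_bounds {D : ℝ} (hD : 1 ≤ D) {p : ℝ × ℝ} (hx : |p.1 - τ.a| ≤ D) (hy : |p.2 - τ.h| ≤ D) :
    |wF τ U p| ≤ D * nN τ U p ∧ |eF τ U p| ≤ D * nN τ U p ∧ |wxF τ U p| ≤ D * nM τ U p ∧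
    |wyF τ U p| ≤ D * nM τ U p ∧ |exF τ U p| ≤ D * nM τ U p ∧ |eyF τ U p| ≤ D * nM τ U p := by
  have r := fun a : ℝ => le_refl |a|
  have n1 := abs_nonneg (dX τ.S U p)
  have n2 := abs_nonneg (dY τ.S U p)
  have n3 := abs_nonneg (dX τ.S (dX τ.S U) p)
  have n4 := abs_nonneg (dY τ.S (dX τ.S U) p)
  have n5 := abs_nonneg (dY τ.S (dY τ.S U) p)
  unfold nM nN
  refine ⟨(bs (bm hx (r _)) (bm hy (r _))).trans ?_, (ba (bm hx (r _)) (bm hy (r _))).trans ?_,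
    (bs (ba (r _) (bm hx (r _))) (bm hy (r _))).trans ?_,
    (bs (bs (bm hx (r _)) (r _)) (bm hy (r _))).trans ?_,
    (ba (ba (r _) (bm hx (r _))) (bm hy (r _))).trans ?_,
    (ba (ba (r _) (bm hx (r _))) (bm hy (r _))).trans ?_⟩ <;> nlinarith

lemma Z_bound (hμ : 0 < μ) {D : ℝ} (hD : 1 ≤ D) {p : ℝ × ℝ} (hx : |p.1 - τ.a| ≤ D) (hy : |p.2 - τ.h| ≤ D)
    (hu : |U p| ≤ D) : |ZP τ μ U p| ≤ (4 * D ^ 2 + 2 * D + μ * D ^ 3) * (nN τ U p * nM τ U p + 1) ∧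
    |ZQ τ μ U p| ≤ (4 * D ^ 2 + 2 * D + μ * D ^ 3) * (nN τ U p * nM τ U p + 1) := by
  obtain ⟨w, e, wx, wy, ex, ey⟩ := jet_bounds (U := U) hD hx hy
  have hN := nN_nonneg (τ := τ) (U := U) p
  have hM := nN_le_nM (τ := τ) (U := U) p
  have ux : |dX τ.S U p| ≤ nN τ U p := by unfold nN; linarith [abs_nonneg (dY τ.S U p)]
  have uy : |dY τ.S U p| ≤ nN τ U p := by unfold nN; linarith [abs_nonneg (dX τ.S U p)]
  have m : |mF τ μ U p| ≤ μ * (D * D) + nN τ U p * nN τ U p := by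
    refine bs (bm (abs_of_pos hμ).le (bm hu hu)) ?_
    unfold nN
    rw [abs_of_nonneg (by nlinarith [sq_nonneg (dX τ.S U p), sq_nonneg (dY τ.S U p)] : (0:ℝ) ≤ dX τ.S U p * dX τ.S U p + dY τ.S U p * dY τ.S U p)]
    rw [← abs_mul_abs_self (dX τ.S U p), ← abs_mul_abs_self (dY τ.S U p)]
    nlinarith [abs_nonneg (dX τ.S U p), abs_nonneg (dY τ.S U p), mul_nonneg (abs_nonneg (dX τ.S U p)) (abs_nonneg (dY τ.S U p))]
  have hf : |(1 / 2 : ℝ)| ≤ 1 / 2 := by norm_num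
  have hD3 : 0 ≤ μ * D ^ 3 := by positivity
  have hNM : nN τ U p * nN τ U p ≤ nN τ U p * nM τ U p := mul_le_mul_of_nonneg_left hM hN
  have q1 : D * (nN τ U p * nN τ U p) ≤ D * (nN τ U p * nM τ U p) := mul_le_mul_of_nonneg_left hNM (by linarith)
  have q2 : 0 ≤ μ * D ^ 3 * (nN τ U p * nM τ U p) := mul_nonneg hD3 (mul_nonneg hN (hN.trans hM))
  have q3 : 0 ≤ D * (nN τ U p * nM τ U p) := mul_nonneg (by linarith) (mul_nonneg hN (hN.trans hM))
  have q4 := sq_nonneg D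
  have q5 : 0 ≤ D ^ 2 * (nN τ U p * nM τ U p) := mul_nonneg q4 (mul_nonneg hN (hN.trans hM))
  constructor
  · refine (bs (ba (ba (bm w wx) (bm e ux)) (bm hf (bm m hx))) (bm hf (ba (bm wy e) (bm w ey)))).trans ?_
    nlinarith
  · refine (ba (ba (ba (bm w wy) (bm e uy)) (bm hf (bm m hy))) (bm hf (ba (bm wx e) (bm w ex)))).trans ?_
    nlinarith

lemma int_usq (hE : τ.Eig μ U) : IntegrableOn (fun p => U p ^ 2) τ.Om :=
  ((hE.cont.pow 2).integrableOn_compact τ.isCompact_T).mono_set (τ.Om_sub_S.trans τ.S_sub_T)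

lemma int_of_M (hE : τ.Eig μ U) {F : ℝ × ℝ → ℝ} (hF : ContinuousOn F τ.S) {K : ℝ}
    (hK : ∀ p ∈ τ.Om, |F p| ≤ K * nM τ U p) : IntegrableOn (fun p => F p ^ 2) τ.Om := by
  have hm := τ.isOpen_Om.measurableSet
  have hi : IntegrableOn (fun p => K ^ 2 * (4 * gsq τ.S U p + 6 * hsq τ.S U p)) τ.Om :=
    (((int_gsq hE).const_mul 4).add ((int_hsq hE).const_mul 6)).const_mul _
  refine Integrable.mono' hi (((hF.pow 2).mono τ.Om_sub_S).aestronglyMeasurable hm)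
    ((ae_restrict_iff' hm).mpr (Eventually.of_forall (fun p hp => ?_)))
  rw [Real.norm_eq_abs, abs_of_nonneg (sq_nonneg _), ← sq_abs]
  have := pow_le_pow_left₀ (abs_nonneg _) (hK p hp) 2
  have h2 := mul_le_mul_of_nonneg_left (nM_sq (τ := τ) (U := U) p) (sq_nonneg K)
  nlinarith

lemma int_w (hE : τ.Eig μ U) : IntegrableOn (fun p => wF τ U p ^ 2) τ.Om ∧
    IntegrableOn (fun p => wxF τ U p ^ 2) τ.Om ∧ IntegrableOn (fun p => wyF τ U p ^ 2) τ.Om := by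
  obtain ⟨D, hD, hb⟩ := tri_bound hE
  have hj := fun p (hp : p ∈ τ.Om) => jet_bounds (U := U) hD (hb p (τ.Om_sub_S hp)).1 (hb p (τ.Om_sub_S hp)).2.1
  refine ⟨int_of_M hE (wF_sm hE.sm).cont (K := D) (fun p hp => (hj p hp).1.trans ?_),
    int_of_M hE (wxF_sm hE.sm).cont (fun p hp => (hj p hp).2.2.1),
    int_of_M hE (wyF_sm hE.sm).cont (fun p hp => (hj p hp).2.2.2.1)⟩
  exact mul_le_mul_of_nonneg_left (nN_le_nM p) (by linarith)

lemma I1_lim (hE : τ.Eig μ U) :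
    Tendsto (fun n : ℕ => ∫ x in (0:ℝ)..τ.L, cut τ n (x, 0) * ZQ τ μ U (x, 0)) atTop
      (𝓝 (-∫ p in τ.Om, (wxF τ U p ^ 2 + wyF τ U p ^ 2 - μ * wF τ U p ^ 2 + μ * U p ^ 2))) := by
  obtain ⟨D, hD, hb⟩ := tri_bound hE
  have hm := τ.isOpen_Om.measurableSet
  obtain ⟨i1, i2, i3⟩ := int_w hE
  have e : EqOn (fun p => dX τ.S (ZP τ μ U) p + dY τ.S (ZQ τ μ U) p) (fun p => wxF τ U p ^ 2 + wyF τ U p ^ 2 - μ * wF τ U p ^ 2 + μ * U p ^ 2) τ.Om :=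
    fun p hp => Z_div hE (τ.Om_sub_S hp)
  rw [← setIntegral_congr_fun hm e]
  refine div_lim τ (ZP_sm hE.sm) (ZQ_sm hE.sm) (fun p hp h => Z_side2 hE hp h)
    (fun p hp h => Z_side3 hE hp h) ?_ ?_
  · rw [integrableOn_congr_fun e hm]
    exact ((i2.add i3).sub (i1.const_mul _)).add ((int_usq hE).const_mul _)
  · refine int_ir_mul hE ((ZP_sm hE.sm).cont.abs.add (ZQ_sm hE.sm).cont.abs)
      (K := 2 * (4 * D ^ 2 + 2 * D + μ * D ^ 3)) (by have := hE.pos; positivity) (fun p hp => ?_)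
    obtain ⟨b1, b2, b3⟩ := hb p (τ.Om_sub_S hp)
    obtain ⟨c1, c2⟩ := Z_bound (U := U) hE.pos hD b1 b2 b3
    rw [abs_of_nonneg (by positivity)]
    linarith

lemma I2 (hE : τ.Eig μ U) {φ φ' : ℝ → ℝ} (h1 : ContDiff ℝ (⊤ : ℕ∞) φ) (h2 : ∀ x, HasDerivAt φ (φ' x) x) :
    ∫ p in τ.Om, (wxF τ U p * φ p.1 + wF τ U p * φ' p.1) = 0 := by
  obtain ⟨D, hD, hb⟩ := tri_bound hE
  have hm := τ.isOpen_Om.measurableSet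
  have hG := τ.good_S
  obtain ⟨i1, i2, i3⟩ := int_w hE
  have hφ' : ContDiff ℝ (⊤ : ℕ∞) φ' := by
    have : deriv φ = φ' := funext (fun x => (h2 x).deriv)
    rw [← this]; exact (contDiff_infty_iff_deriv.mp h1).2
  have hφs : Sm τ.S (fun p => φ p.1) := h1.comp_contDiffOn contDiffOn_fst
  have hφs' : Sm τ.S (fun p => φ' p.1) := hφ'.comp_contDiffOn contDiffOn_fst
  have e : EqOn (fun p => dX τ.S (fun p => wF τ U p * φ p.1) p + dY τ.S (fun _ => (0:ℝ)) p)
      (fun p => wxF τ U p * φ p.1 + wF τ U p * φ' p.1) τ.Om := by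
    intro p hp
    have hpS := τ.Om_sub_S hp
    have hφ : HL τ.S (fun p => φ p.1) (φ' p.1) 0 p := by
      refine ((h2 p.1).comp_hasFDerivAt p (hasFDerivAt_fst (𝕜 := ℝ) (p := p))).hasFDerivWithinAt.congr_fderiv ?_
      apply lin_ext <;> simp
    have a1 := ((wF_has hE.sm hpS).mul hφ).x hG hpS
    have a2 : dY τ.S (fun _ => (0:ℝ)) p = 0 := by simp [dY]
    simp only [a1, a2, add_zero]
  obtain ⟨B1, hB1⟩ := τ.isCompact_T.exists_bound_of_continuousOn (f := fun p => φ p.1)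
    (h1.continuous.comp continuous_fst).continuousOn
  obtain ⟨B2, hB2⟩ := τ.isCompact_T.exists_bound_of_continuousOn (f := fun p => φ' p.1)
    (hφ'.continuous.comp continuous_fst).continuousOn
  have hTO : ∀ p ∈ τ.Om, p ∈ τ.T := fun p hp => τ.S_sub_T (τ.Om_sub_S hp)
  have key := div_lim τ (P := fun p => wF τ U p * φ p.1) (Q := fun _ => (0:ℝ))
    ((wF_sm hE.sm).mul hφs) contDiffOn_const
    (fun p hp h => by simp [wF_side2 hE hp h]) (fun p hp h => by simp [wF_side3 hE hp h]) ?_ ?_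
  · simp only [mul_zero, intervalIntegral.integral_zero] at key
    rw [← setIntegral_congr_fun hm e]
    have := tendsto_nhds_unique key tendsto_const_nhds
    linarith
  · rw [integrableOn_congr_fun e hm]
    have hc : ContinuousOn (fun p => wxF τ U p * φ p.1 + wF τ U p * φ' p.1) τ.Om :=
      (((wxF_sm hE.sm).cont.mul hφs.cont).add ((wF_sm hE.sm).cont.mul hφs'.cont)).mono τ.Om_sub_S
    refine Integrable.mono' ((i2.add i1).add (int_one (B1 ^ 2 + B2 ^ 2))) (hc.aestronglyMeasurable hm)
      ((ae_restrict_iff' hm).mpr (Eventually.of_forall (fun p hp => ?_)))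
    have b1 := hB1 p (hTO p hp)
    have b2 := hB2 p (hTO p hp)
    rw [Real.norm_eq_abs] at b1 b2 ⊢
    refine (ba (bm le_rfl b1) (bm le_rfl b2)).trans ?_
    simp only [Pi.add_apply]
    rw [← sq_abs (wxF τ U p), ← sq_abs (wF τ U p)]
    nlinarith [sq_nonneg (|wxF τ U p| - B1), sq_nonneg (|wF τ U p| - B2), sq_nonneg (|wxF τ U p| + B1), sq_nonneg (|wF τ U p| + B2)]
  · have hB0 : 0 ≤ B1 := (norm_nonneg _).trans (hB1 _ (hTO _ τ.Om_nonempty))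
    refine int_ir_mul hE (((wF_sm hE.sm).cont.mul hφs.cont).abs.add continuousOn_const.abs)
      (K := D * B1) (by positivity) (fun p hp => ?_)
    obtain ⟨b1, b2, b3⟩ := hb p (τ.Om_sub_S hp)
    obtain ⟨c1, -⟩ := jet_bounds (U := U) hD b1 b2
    have b4 := hB1 p (hTO p hp)
    rw [Real.norm_eq_abs] at b4
    rw [abs_zero, add_zero, abs_abs]
    refine (bm c1 b4).trans ?_
    have hN := nN_nonneg (τ := τ) (U := U) p
    have hM := nN_le_nM (τ := τ) (U := U) p
    have : nN τ U p ≤ nN τ U p * nM τ U p + 1 := by nlinarith [sq_nonneg (nN τ U p - 1)]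
    have := mul_le_mul_of_nonneg_left this (mul_nonneg (by linarith : 0 ≤ D) hB0)
    linarith
end

end NZ

namespace NZ

open MeasureTheory Filter Topology

lemma dkap_nonneg (t : ℝ) : 0 ≤ deriv kap t := by
  have : Monotone kap := fun a b h => Real.smoothTransition.monotone (by linarith)
  exact this.deriv_nonneg

/-- one-dimensional boundary lemma -/
lemma bdry_lim {τ : TriP} {ψ ψ' : ℝ → ℝ} (hψ : ContinuousOn ψ (Icc 0 τ.L)) (h0 : ψ 0 = 0) (h1 : ψ τ.L = 0)
    (hd : ∀ x ∈ Ioo 0 τ.L, HasDerivAt ψ (ψ' x) x)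
    (hi : ∀ n : ℕ, IntervalIntegrable (fun x => cut τ n (x, 0) * ψ' x) volume 0 τ.L) :
    Tendsto (fun n : ℕ => ∫ x in (0:ℝ)..τ.L, cut τ n (x, 0) * ψ' x) atTop (𝓝 0) := by
  have hL := τ.hL
  have hh := τ.hh
  rw [Metric.tendsto_atTop]
  intro ε hε
  -- continuity at ends
  have c0 : ∃ δ > 0, ∀ x ∈ Icc 0 τ.L, x < δ → |ψ x| ≤ ε / 4 := by
    obtain ⟨δ, hδ, h⟩ := Metric.continuousOn_iff.mp hψ 0 ⟨le_rfl, hL.le⟩ (ε / 4) (by positivity)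
    refine ⟨δ, hδ, fun x hx hxd => ?_⟩
    have := h x hx (by rw [Real.dist_eq, sub_zero, abs_of_nonneg hx.1]; exact hxd)
    rw [Real.dist_eq, h0, sub_zero] at this
    exact this.le
  have cL : ∃ δ > 0, ∀ x ∈ Icc 0 τ.L, τ.L - x < δ → |ψ x| ≤ ε / 4 := by
    obtain ⟨δ, hδ, h⟩ := Metric.continuousOn_iff.mp hψ τ.L ⟨hL.le, le_rfl⟩ (ε / 4) (by positivity)
    refine ⟨δ, hδ, fun x hx hxd => ?_⟩
    have := h x hx (by rw [Real.dist_eq, abs_sub_comm, abs_of_nonneg (by linarith [hx.2])]; exact hxd)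
    rw [Real.dist_eq, h1, sub_zero] at this
    exact this.le
  obtain ⟨δ0, hδ0, c0⟩ := c0
  obtain ⟨δ1, hδ1, cL⟩ := cL
  have ev : ∀ η > 0, ∀ᶠ n : ℕ in atTop, 2 < (n:ℝ) ^ 2 * η := fun η hη =>
    (((tendsto_pow_atTop two_ne_zero).comp tendsto_natCast_atTop_atTop).atTop_mul_const hη).eventually_gt_atTop 2
  obtain ⟨N, hN⟩ := eventually_atTop.mp ((ev (δ0 ^ 2) (by positivity)).and ((ev (δ1 ^ 2) (by positivity)).and
    ((ev (τ.h ^ 2) (by positivity)).and (ev (τ.L ^ 2) (by positivity)))))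
  refine ⟨N, fun n hn => ?_⟩
  obtain ⟨n0, n1, n2, n3⟩ := hN n hn
  set k0 : ℝ → ℝ := fun x => kap ((n:ℝ) ^ 2 * x ^ 2) with hk0
  set k1 : ℝ → ℝ := fun x => kap ((n:ℝ) ^ 2 * (x - τ.L) ^ 2) with hk1
  set k0' : ℝ → ℝ := fun x => deriv kap ((n:ℝ) ^ 2 * x ^ 2) * ((n:ℝ) ^ 2 * (2 * x)) with hk0'
  set k1' : ℝ → ℝ := fun x => deriv kap ((n:ℝ) ^ 2 * (x - τ.L) ^ 2) * ((n:ℝ) ^ 2 * (2 * (x - τ.L))) with hk1'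
  have hkd : ∀ t, HasDerivAt kap (deriv kap t) t := fun t => (kap_smooth.differentiable (by simp) _).hasDerivAt
  have hkc : Continuous (deriv kap) := kap_smooth.continuous_deriv (by simp)
  have d0 : ∀ x, HasDerivAt k0 (k0' x) x := fun x => by
    have := (((hasDerivAt_id x).pow 2).const_mul ((n:ℝ) ^ 2))
    have := (hkd ((n:ℝ) ^ 2 * x ^ 2)).comp x this
    refine this.congr_deriv ?_
    simp [hk0']
  have d1 : ∀ x, HasDerivAt k1 (k1' x) x := fun x => by
    have := ((((hasDerivAt_id x).sub_const τ.L).pow 2).const_mul ((n:ℝ) ^ 2))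
    have := (hkd ((n:ℝ) ^ 2 * (x - τ.L) ^ 2)).comp x this
    refine this.congr_deriv ?_
    simp [hk1']
  have kc0 : Continuous k0' := by fun_prop
  have kc1 : Continuous k1' := by fun_prop
  have ecut : ∀ x, cut τ n (x, 0) = k0 x * k1 x := fun x => by
    have : kc n (τ.a, τ.h) (x, 0) = 1 := by
      refine kap_one ?_
      simp only [rsq]
      nlinarith [mul_nonneg (sq_nonneg (n:ℝ)) (sq_nonneg (x - τ.a))]
    rw [cut, this, mul_one]
    simp [kc, rsq, hk0, hk1]
  have ecut' : (fun x => cut τ n (x, 0)) = fun x => k0 x * k1 x := funext ecut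
  have z0 : k0 0 = 0 := by simp [hk0, kap_zero]
  have zL : k1 τ.L = 0 := by simp [hk1, kap_zero]
  have oL : k0 τ.L = 1 := by simp only [hk0]; exact kap_one n3.le
  have o0 : k1 0 = 1 := by simp only [hk1]; exact kap_one (by simpa using n3.le)
  -- by parts
  have hII : IntervalIntegrable (fun x => (k0' x * k1 x + k0 x * k1' x) * ψ x) volume 0 τ.L := by
    refine ContinuousOn.intervalIntegrable ?_
    rw [uIcc_of_le hL.le]
    have e0 : Continuous k0 := continuous_iff_continuousAt.mpr (fun x => (d0 x).continuousAt)
    have e1 : Continuous k1 := continuous_iff_continuousAt.mpr (fun x => (d1 x).continuousAt)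
    exact ContinuousOn.mul (by fun_prop) hψ
  have hi' := hi n
  simp only [ecut] at hi' ⊢
  have ftc := intervalIntegral.integral_eq_sub_of_hasDerivAt_of_le (f := fun x => k0 x * k1 x * ψ x)
    (f' := fun x => (k0' x * k1 x + k0 x * k1' x) * ψ x + k0 x * k1 x * ψ' x) hL.le ?_ ?_ ?_
  rotate_left
  · have e0 : Continuous k0 := continuous_iff_continuousAt.mpr (fun x => (d0 x).continuousAt)
    have e1 : Continuous k1 := continuous_iff_continuousAt.mpr (fun x => (d1 x).continuousAt)
    exact ContinuousOn.mul (by fun_prop) hψ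
  · intro x hx
    exact ((d0 x).mul (d1 x)).mul (hd x hx)
  · exact hII.add hi'
  rw [intervalIntegral.integral_add hII hi', h0, h1, mul_zero, mul_zero, sub_zero] at ftc
  have e2 : ∫ x in (0:ℝ)..τ.L, k0 x * k1 x * ψ' x = -∫ x in (0:ℝ)..τ.L, (k0' x * k1 x + k0 x * k1' x) * ψ x := by linarith
  have f0 : ∫ x in (0:ℝ)..τ.L, k0' x = 1 := by
    rw [intervalIntegral.integral_eq_sub_of_hasDerivAt (fun x _ => d0 x) (kc0.intervalIntegrable _ _), z0, oL]; ring
  have f1 : ∫ x in (0:ℝ)..τ.L, k1' x = -1 := by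
    rw [intervalIntegral.integral_eq_sub_of_hasDerivAt (fun x _ => d1 x) (kc1.intervalIntegrable _ _), zL, o0]; ring
  have hb : ‖∫ x in (0:ℝ)..τ.L, (k0' x * k1 x + k0 x * k1' x) * ψ x‖ ≤ ∫ x in (0:ℝ)..τ.L, ε / 4 * (k0' x - k1' x) := by
    refine intervalIntegral.norm_integral_le_of_norm_le hL.le (Eventually.of_forall (fun x hx => ?_))
      ((continuous_const.mul (kc0.sub kc1)).intervalIntegrable _ _)
    have hxI : x ∈ Icc 0 τ.L := ⟨hx.1.le, hx.2⟩
    have p0 : 0 ≤ k0' x := mul_nonneg (dkap_nonneg _) (by have := hx.1; positivity)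
    have p1 : k1' x ≤ 0 := mul_nonpos_of_nonneg_of_nonpos (dkap_nonneg _)
      (by have := hx.2; have := sq_nonneg (n:ℝ); nlinarith)
    have q0 : k0' x * |ψ x| ≤ k0' x * (ε / 4) := by
      by_cases hc : x < δ0
      · exact mul_le_mul_of_nonneg_left (c0 x hxI hc) p0
      · push Not at hc
        have : k0' x = 0 := by
          have : 2 < (n:ℝ) ^ 2 * x ^ 2 := by
            have : δ0 ^ 2 ≤ x ^ 2 := pow_le_pow_left₀ hδ0.le hc 2
            nlinarith [sq_nonneg (n:ℝ)]
          simp only [hk0', dkap_zero (Or.inr this), zero_mul]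
        simp [this]
    have q1 : -k1' x * |ψ x| ≤ -k1' x * (ε / 4) := by
      by_cases hc : τ.L - x < δ1
      · exact mul_le_mul_of_nonneg_left (cL x hxI hc) (by linarith)
      · push Not at hc
        have : k1' x = 0 := by
          have : 2 < (n:ℝ) ^ 2 * (x - τ.L) ^ 2 := by
            have : δ1 ^ 2 ≤ (τ.L - x) ^ 2 := pow_le_pow_left₀ hδ1.le hc 2
            nlinarith [sq_nonneg (n:ℝ)]
          simp only [hk1', dkap_zero (Or.inr this), zero_mul]
        simp [this]
    have m0 : |k0 x| ≤ 1 := by rw [abs_of_nonneg (kap_nonneg _)]; exact kap_le _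
    have m1 : |k1 x| ≤ 1 := by rw [abs_of_nonneg (kap_nonneg _)]; exact kap_le _
    rw [Real.norm_eq_abs, abs_mul]
    have s1 : |k0' x * k1 x + k0 x * k1' x| ≤ k0' x * 1 + 1 * (-k1' x) :=
      ba (bm (abs_of_nonneg p0).le m1) (bm m0 (abs_of_nonpos p1).le)
    have := mul_le_mul_of_nonneg_right s1 (abs_nonneg (ψ x))
    linarith
  rw [intervalIntegral.integral_const_mul, intervalIntegral.integral_sub (kc0.intervalIntegrable _ _)
    (kc1.intervalIntegrable _ _), f0, f1] at hb
  rw [Real.dist_eq, sub_zero, e2, abs_neg]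
  rw [Real.norm_eq_abs] at hb
  linarith

variable {τ : TriP} {μ : ℝ} {U : ℝ × ℝ → ℝ}

lemma I1 (hE : τ.Eig μ U) (hA : U (0, 0) = 0) (hB : U (τ.L, 0) = 0) :
    ∫ p in τ.Om, (wxF τ U p ^ 2 + wyF τ U p ^ 2 - μ * wF τ U p ^ 2 + μ * U p ^ 2) = 0 := by
  have hL := τ.hL
  have hmem : ∀ x ∈ Icc 0 τ.L, (x, (0:ℝ)) ∈ τ.T := by
    intro x hx
    have hh := τ.hh
    refine ⟨le_rfl, ?_, ?_⟩
    · simp only [TriP.l2]; nlinarith [hx.1, hx.2]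
    · simp only [TriP.l3]; nlinarith [hx.1, hx.2]
  have hcx : ContinuousOn (fun x : ℝ => (x, (0:ℝ))) (Icc 0 τ.L) := by fun_prop
  set ψ : ℝ → ℝ := fun x => -(τ.h * μ / 2) * ((x - τ.a) * U (x, 0) ^ 2) with hψ
  have hψc : ContinuousOn ψ (Icc 0 τ.L) :=
    continuousOn_const.mul (ContinuousOn.mul (by fun_prop) ((hE.cont.comp hcx hmem).pow 2))
  have key := bdry_lim (τ := τ) (ψ := ψ) (ψ' := fun x => ZQ τ μ U (x, 0)) hψc (by simp [hψ, hA]) (by simp [hψ, hB]) ?_ ?_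
  · have := tendsto_nhds_unique key (I1_lim hE)
    linarith
  · intro x hx
    have hS := side1' τ hx.1 hx.2
    rw [Z_side1 hE hS rfl]
    have hd : HasDerivAt (fun t : ℝ => U (t, 0)) (dX τ.S U (x, 0)) x := by
      have hl : HasDerivAt (fun t : ℝ => (t, (0:ℝ))) (1, 0) x := (hasDerivAt_id x).prodMk (hasDerivAt_const x 0)
      have h1 := HasFDerivWithinAt.comp_hasDerivWithinAt x (hE.sm.has hS) (hl.hasDerivWithinAt (s := Ioo 0 τ.L)) (fun t ht => side1' τ ht.1 ht.2)
      have h2 := h1.hasDerivAt (Ioo_mem_nhds hx.1 hx.2)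
      refine h2.congr_deriv ?_
      simp
    refine ((((hasDerivAt_id x).sub_const τ.a).mul (hd.pow 2)).const_mul (-(τ.h * μ / 2))).congr_deriv ?_
    simp
    left
    ring
  · intro n
    refine ContinuousOn.intervalIntegrable ?_
    rw [uIcc_of_le hL.le]
    exact (sm_T_of_cut (ZQ_sm hE.sm) (cut_smooth τ n) (cut_near τ n)).cont.comp hcx hmem

/-- the function class -/
structure Cl (τ : TriP) (f : ℝ × ℝ → ℝ) : Prop where
  sm : Sm τ.S f
  i0 : IntegrableOn (fun p => f p ^ 2) τ.Om
  ix : IntegrableOn (fun p => dX τ.S f p ^ 2) τ.Om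
  iy : IntegrableOn (fun p => dY τ.S f p ^ 2) τ.Om

lemma int_mul_of_sq {f g : ℝ × ℝ → ℝ} (hf : ContinuousOn f τ.S) (hg : ContinuousOn g τ.S)
    (i : IntegrableOn (fun p => f p ^ 2) τ.Om) (j : IntegrableOn (fun p => g p ^ 2) τ.Om) :
    IntegrableOn (fun p => f p * g p) τ.Om := by
  have hm := τ.isOpen_Om.measurableSet
  refine Integrable.mono' (i.add j) (((hf.mul hg).mono τ.Om_sub_S).aestronglyMeasurable hm)
    (Eventually.of_forall (fun p => ?_))
  rw [Real.norm_eq_abs, abs_le]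
  simp only [Pi.add_apply]
  constructor <;> nlinarith [sq_nonneg (f p + g p), sq_nonneg (f p - g p)]

/-- the bilinear form -/
def BF (τ : TriP) (μ : ℝ) (f g : ℝ × ℝ → ℝ) : ℝ :=
  ∫ p in τ.Om, (dX τ.S f p * dX τ.S g p + dY τ.S f p * dY τ.S g p - μ * (f p * g p))

namespace Cl
variable {f g k : ℝ × ℝ → ℝ}

lemma m0 (hf : Cl τ f) (hg : Cl τ g) : IntegrableOn (fun p => f p * g p) τ.Om :=
  int_mul_of_sq hf.sm.cont hg.sm.cont hf.i0 hg.i0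
lemma mx (hf : Cl τ f) (hg : Cl τ g) : IntegrableOn (fun p => dX τ.S f p * dX τ.S g p) τ.Om :=
  int_mul_of_sq (hf.sm.dX τ.good_S).cont (hg.sm.dX τ.good_S).cont hf.ix hg.ix
lemma my (hf : Cl τ f) (hg : Cl τ g) : IntegrableOn (fun p => dY τ.S f p * dY τ.S g p) τ.Om :=
  int_mul_of_sq (hf.sm.dY τ.good_S).cont (hg.sm.dY τ.good_S).cont hf.iy hg.iy
lemma mB (hf : Cl τ f) (hg : Cl τ g) (μ : ℝ) : IntegrableOn (fun p => dX τ.S f p * dX τ.S g p + dY τ.S f p * dY τ.S g p - μ * (f p * g p)) τ.Om :=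
  ((hf.mx hg).add (hf.my hg)).sub ((hf.m0 hg).const_mul μ)

lemma const (c : ℝ) : Cl τ (fun _ => c) := by
  refine ⟨contDiffOn_const, int_one _, ?_, ?_⟩
  · simp [dX]
  · simp [dY]

lemma i1 (hf : Cl τ f) : IntegrableOn f τ.Om := by
  simpa using hf.m0 (Cl.const 1)

lemma comb (hf : Cl τ f) (hg : Cl τ g) (c : ℝ) : Cl τ (fun p => f p + c * g p) := by
  have hG := τ.good_S
  have hm := τ.isOpen_Om.measurableSet
  have hs : Sm τ.S (fun p => c * g p) := contDiffOn_const.mul hg.sm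
  refine ⟨hf.sm.add hs, ?_, ?_, ?_⟩
  · refine ((hf.i0.add (((hf.m0 hg)).const_mul (2 * c))).add (hg.i0.const_mul (c ^ 2))).congr (Eventually.of_forall (fun p => ?_))
    simp only [Pi.add_apply]; ring
  · refine ((hf.ix.add (((hf.mx hg)).const_mul (2 * c))).add (hg.ix.const_mul (c ^ 2))).congr_fun (fun p hp => ?_) hm
    simp only [Pi.add_apply]
    rw [dX_add hG hf.sm hs (τ.Om_sub_S hp), dX_const_mul hG c hg.sm (τ.Om_sub_S hp)]; ring
  · refine ((hf.iy.add (((hf.my hg)).const_mul (2 * c))).add (hg.iy.const_mul (c ^ 2))).congr_fun (fun p hp => ?_) hm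
    simp only [Pi.add_apply]
    rw [dY_add hG hf.sm hs (τ.Om_sub_S hp), dY_const_mul hG c hg.sm (τ.Om_sub_S hp)]; ring

lemma comb_dX (hf : Cl τ f) (hg : Cl τ g) (c : ℝ) {p : ℝ × ℝ} (hp : p ∈ τ.S) :
    dX τ.S (fun p => f p + c * g p) p = dX τ.S f p + c * dX τ.S g p := by
  rw [dX_add τ.good_S hf.sm (contDiffOn_const.mul hg.sm) hp, dX_const_mul τ.good_S c hg.sm hp]
lemma comb_dY (hf : Cl τ f) (hg : Cl τ g) (c : ℝ) {p : ℝ × ℝ} (hp : p ∈ τ.S) :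
    dY τ.S (fun p => f p + c * g p) p = dY τ.S f p + c * dY τ.S g p := by
  rw [dY_add τ.good_S hf.sm (contDiffOn_const.mul hg.sm) hp, dY_const_mul τ.good_S c hg.sm hp]

lemma int_comb (hf : Cl τ f) (hg : Cl τ g) (c : ℝ) :
    ∫ p in τ.Om, (f p + c * g p) = (∫ p in τ.Om, f p) + c * ∫ p in τ.Om, g p := by
  rw [integral_add hf.i1 (hg.i1.const_mul c), integral_const_mul]

lemma BF_comb (hf : Cl τ f) (hg : Cl τ g) (hk : Cl τ k) (c : ℝ) :
    BF τ μ k (fun p => f p + c * g p) = BF τ μ k f + c * BF τ μ k g := by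
  have hm := τ.isOpen_Om.measurableSet
  unfold BF
  rw [← integral_const_mul, ← integral_add (hk.mB hf μ) ((hk.mB hg μ).const_mul c)]
  refine setIntegral_congr_fun hm (fun p hp => ?_)
  simp only [comb_dX hf hg c (τ.Om_sub_S hp), comb_dY hf hg c (τ.Om_sub_S hp)]
  ring
end Cl

lemma BF_symm (f g : ℝ × ℝ → ℝ) : BF τ μ f g = BF τ μ g f := by
  unfold BF; congr 1; ext p; ring

lemma BF_sq {f g : ℝ × ℝ → ℝ} (hf : Cl τ f) (hg : Cl τ g) (c : ℝ) :
    BF τ μ (fun p => f p + c * g p) (fun p => f p + c * g p)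
      = BF τ μ f f + 2 * c * BF τ μ f g + c ^ 2 * BF τ μ g g := by
  rw [Cl.BF_comb hf hg (hf.comb hg c), BF_symm _ f, BF_symm _ g, Cl.BF_comb hf hg hf, Cl.BF_comb hf hg hg,
    BF_symm g f]
  ring

end NZ

namespace NZ

open MeasureTheory Filter Topology
variable {τ : TriP} {μ : ℝ} {U : ℝ × ℝ → ℝ}

lemma cl_w (hE : τ.Eig μ U) : Cl τ (wF τ U) := by
  have hm := τ.isOpen_Om.measurableSet
  obtain ⟨i1, i2, i3⟩ := int_w hE
  refine ⟨wF_sm hE.sm, i1, i2.congr_fun (fun p hp => ?_) hm, i3.congr_fun (fun p hp => ?_) hm⟩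
  · simp only [(wF_has hE.sm (τ.Om_sub_S hp)).x τ.good_S (τ.Om_sub_S hp)]
  · simp only [(wF_has hE.sm (τ.Om_sub_S hp)).y τ.good_S (τ.Om_sub_S hp)]

lemma cl_fst {φ : ℝ → ℝ} (h : ContDiff ℝ (⊤ : ℕ∞) φ) : Cl τ (fun p => φ p.1) := by
  have hs : ContDiff ℝ (⊤ : ℕ∞) (fun p : ℝ × ℝ => φ p.1) := h.comp contDiff_fst
  have hm := τ.isOpen_Om.measurableSet
  have hsub := τ.Om_sub_S.trans τ.S_sub_T
  have cc : ∀ F : ℝ × ℝ → ℝ, Continuous F → IntegrableOn F τ.Om := fun F hF =>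
    (hF.continuousOn.integrableOn_compact τ.isCompact_T).mono_set hsub
  have hi : ∀ p ∈ τ.Om, p ∈ interior τ.S := fun p hp => by rw [τ.interior_S]; exact hp
  have cx := (Sm.dX good_univ (hs.contDiffOn (s := univ))).cont
  have cy := (Sm.dY good_univ (hs.contDiffOn (s := univ))).cont
  rw [continuousOn_univ] at cx cy
  refine ⟨hs.contDiffOn, cc _ (hs.continuous.pow 2), (cc _ (cx.pow 2)).congr_fun (fun p hp => ?_) hm,
    (cc _ (cy.pow 2)).congr_fun (fun p hp => ?_) hm⟩
  · simp only [dX_int (hi p hp)]; rfl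
  · simp only [dY_int (hi p hp)]; rfl

lemma fst_has {φ φ' : ℝ → ℝ} (h2 : ∀ x, HasDerivAt φ (φ' x) x) (p : ℝ × ℝ) :
    HL τ.S (fun p => φ p.1) (φ' p.1) 0 p := by
  refine ((h2 p.1).comp_hasFDerivAt p (hasFDerivAt_fst (𝕜 := ℝ) (p := p))).hasFDerivWithinAt.congr_fderiv ?_
  apply lin_ext <;> simp

lemma BF_fst {φ φ' χ χ' : ℝ → ℝ} (h : ∀ x, HasDerivAt φ (φ' x) x) (k : ∀ x, HasDerivAt χ (χ' x) x) :
    BF τ μ (fun p => φ p.1) (fun p => χ p.1) = ∫ p in τ.Om, (φ' p.1 * χ' p.1 - μ * (φ p.1 * χ p.1)) := by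
  refine setIntegral_congr_fun τ.isOpen_Om.measurableSet (fun p hp => ?_)
  have hpS := τ.Om_sub_S hp
  simp only [(fst_has (τ := τ) h p).x τ.good_S hpS, (fst_has (τ := τ) k p).x τ.good_S hpS,
    (fst_has (τ := τ) h p).y τ.good_S hpS]
  ring

lemma usq_pos (hE : τ.Eig μ U) : 0 < ∫ p in τ.Om, U p ^ 2 := by
  have hm := τ.isOpen_Om.measurableSet
  have h0 : 0 ≤ ∫ p in τ.Om, U p ^ 2 := integral_nonneg (fun p => sq_nonneg _)
  refine lt_of_le_of_ne h0 (fun h => hE.nonconst ⟨0, ?_⟩)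
  have h1 := (setIntegral_eq_zero_iff_of_nonneg_ae (Eventually.of_forall (fun p => sq_nonneg (U p))) (int_usq hE)).mp h.symm
  have hc : ContinuousOn (fun p => U p ^ 2) τ.T := hE.cont.pow 2
  have hO : EqOn (fun p => U p ^ 2) (fun _ => 0) τ.Om := by
    refine Measure.eqOn_open_of_ae_eq h1 τ.isOpen_Om (hc.mono (τ.Om_sub_S.trans τ.S_sub_T)) continuousOn_const
  have hT : EqOn (fun p => U p ^ 2) (fun _ => 0) τ.T :=
    hO.of_subset_closure hc continuousOn_const (τ.Om_sub_S.trans τ.S_sub_T) τ.T_sub_closure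
  exact fun p hp => pow_eq_zero_iff two_ne_zero |>.mp (hT hp)

/-- final contradiction from positivity -/
theorem contra (hE : τ.Eig μ U) (hA : U (0, 0) = 0) (hB : U (τ.L, 0) = 0)
    (PSD : ∀ f, Cl τ f → ∫ p in τ.Om, f p = 0 → 0 ≤ BF τ μ f f) : False := by
  have hm := τ.isOpen_Om.measurableSet
  have hμ := hE.pos
  obtain ⟨i1, i2, i3⟩ := int_w hE
  have hw := cl_w hE
  set w := wF τ U with hwd
  -- B(w,w) < 0
  have Bw : BF τ μ w w < 0 := by
    have h1 := I1 hE hA hB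
    have h3 : ∫ p in τ.Om, (wxF τ U p ^ 2 + wyF τ U p ^ 2 - μ * wF τ U p ^ 2 + μ * U p ^ 2) =
        (∫ p in τ.Om, (wxF τ U p ^ 2 + wyF τ U p ^ 2 - μ * wF τ U p ^ 2)) + ∫ p in τ.Om, μ * U p ^ 2 :=
      integral_add ((i2.add i3).sub (i1.const_mul μ)) ((int_usq hE).const_mul μ)
    rw [h3, integral_const_mul] at h1
    have h2 : BF τ μ w w = ∫ p in τ.Om, (wxF τ U p ^ 2 + wyF τ U p ^ 2 - μ * wF τ U p ^ 2) := by
      refine setIntegral_congr_fun hm (fun p hp => ?_)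
      have hpS := τ.Om_sub_S hp
      simp only [hwd, (wF_has hE.sm hpS).x τ.good_S hpS, (wF_has hE.sm hpS).y τ.good_S hpS]
      ring
    rw [h2]
    have := mul_pos hμ (usq_pos hE)
    linarith
  set k := Real.sqrt μ with hk
  have hkk : k * k = μ := Real.mul_self_sqrt hμ.le
  have ds : ∀ x, HasDerivAt (fun x => Real.sin (k * x)) (k * Real.cos (k * x)) x := fun x => by
    have := (Real.hasDerivAt_sin (k * x)).comp x ((hasDerivAt_id x).const_mul k)
    refine this.congr_deriv ?_; simp; ring
  have dc : ∀ x, HasDerivAt (fun x => Real.cos (k * x)) (-k * Real.sin (k * x)) x := fun x => by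
    have := (Real.hasDerivAt_cos (k * x)).comp x ((hasDerivAt_id x).const_mul k)
    refine this.congr_deriv ?_; simp; ring
  have ss : ContDiff ℝ (⊤ : ℕ∞) (fun x => Real.sin (k * x)) := by fun_prop
  have sc : ContDiff ℝ (⊤ : ℕ∞) (fun x => Real.cos (k * x)) := by fun_prop
  set g1 : ℝ × ℝ → ℝ := fun p => Real.cos (k * p.1) with hg1
  set g2 : ℝ × ℝ → ℝ := fun p => Real.sin (k * p.1) with hg2
  have c1 : Cl τ g1 := cl_fst sc
  have c2 : Cl τ g2 := cl_fst ss
  -- B(g,w) = 0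
  have Bgw : ∀ {φ φ' : ℝ → ℝ}, ContDiff ℝ (⊤ : ℕ∞) φ' → (∀ x, HasDerivAt φ (φ' x) x) →
      (∀ x, HasDerivAt φ' (-μ * φ x) x) → BF τ μ (fun p => φ p.1) w = 0 := by
    intro φ φ' hs h1 h2
    rw [← I2 hE hs h2]
    refine setIntegral_congr_fun hm (fun p hp => ?_)
    have hpS := τ.Om_sub_S hp
    simp only [hwd, (wF_has hE.sm hpS).x τ.good_S hpS, (wF_has hE.sm hpS).y τ.good_S hpS,
      (fst_has (τ := τ) h1 p).x τ.good_S hpS, (fst_has (τ := τ) h1 p).y τ.good_S hpS]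
    ring
  have B1w : BF τ μ g1 w = 0 := by
    refine Bgw (φ := fun x => Real.cos (k * x)) (φ' := fun x => -k * Real.sin (k * x)) (by fun_prop) dc (fun x => ?_)
    refine ((ds x).const_mul (-k)).congr_deriv ?_
    rw [← hkk]; ring
  have B2w : BF τ μ g2 w = 0 := by
    refine Bgw (φ := fun x => Real.sin (k * x)) (φ' := fun x => k * Real.cos (k * x)) (by fun_prop) ds (fun x => ?_)
    refine ((dc x).const_mul k).congr_deriv ?_
    rw [← hkk]; ring
  have B12 : BF τ μ g1 g1 + BF τ μ g2 g2 = 0 := by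
    rw [hg1, hg2, BF_fst dc dc, BF_fst ds ds, ← integral_add]
    · rw [← integral_zero (ℝ × ℝ) ℝ (μ := volume.restrict τ.Om)]
      refine setIntegral_congr_fun hm (fun p hp => ?_)
      beta_reduce
      rw [← hkk]; ring
    · exact ((Continuous.continuousOn (by fun_prop)).integrableOn_compact τ.isCompact_T).mono_set (τ.Om_sub_S.trans τ.S_sub_T)
    · exact ((Continuous.continuousOn (by fun_prop)).integrableOn_compact τ.isCompact_T).mono_set (τ.Om_sub_S.trans τ.S_sub_T)
  have hW : ∫ p in τ.Om, w p ≠ 0 := fun h => absurd (PSD w hw h) (not_le.mpr Bw)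
  set W := ∫ p in τ.Om, w p with hWd
  have step : ∀ g, Cl τ g → BF τ μ g w = 0 → 0 ≤ BF τ μ g g + (-(∫ p in τ.Om, g p) / W) ^ 2 * BF τ μ w w := by
    intro g hg hgw
    have := PSD _ (hg.comb hw (-(∫ p in τ.Om, g p) / W)) (by
      rw [Cl.int_comb hg hw, ← hWd]; field_simp; ring)
    rw [BF_sq hg hw, hgw] at this
    linarith
  have s1 := step g1 c1 B1w
  have s2 := step g2 c2 B2w
  set G1 := ∫ p in τ.Om, g1 p with hG1
  set G2 := ∫ p in τ.Om, g2 p with hG2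
  have q1 := sq_nonneg (-G1 / W)
  have q2 := sq_nonneg (-G2 / W)
  have z1 : (-G1 / W) ^ 2 = 0 := by nlinarith
  have z2 : (-G2 / W) ^ 2 = 0 := by nlinarith
  have g1z : G1 = 0 := by
    have := pow_eq_zero_iff two_ne_zero |>.mp z1
    rw [div_eq_zero_iff] at this
    rcases this with h | h
    · linarith
    · exact absurd h hW
  have g2z : G2 = 0 := by
    have := pow_eq_zero_iff two_ne_zero |>.mp z2
    rw [div_eq_zero_iff] at this
    rcases this with h | h
    · linarith
    · exact absurd h hW
  rw [z1, zero_mul, add_zero] at s1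
  rw [z2, zero_mul, add_zero] at s2
  have b1 : BF τ μ g1 g1 = 0 := by linarith
  have b2 : BF τ μ g2 g2 = 0 := by linarith
  have hvol : 0 < volume.real τ.Om := by
    refine ENNReal.toReal_pos (τ.isOpen_Om.measure_pos volume ⟨_, τ.Om_nonempty⟩).ne' vol_Om.ne
  -- B(g, f) = 0 for all f
  have orth : ∀ g f, Cl τ g → Cl τ f → ∫ p in τ.Om, g p = 0 → BF τ μ g g = 0 → BF τ μ g f = 0 := by
    intro g f hg hf hgz hgg
    set c := -(∫ p in τ.Om, f p) / volume.real τ.Om with hc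
    have hf' : Cl τ (fun p => f p + c * 1) := hf.comb (Cl.const 1) c
    have e1 : ∫ p in τ.Om, (f p + c * 1) = 0 := by
      rw [Cl.int_comb hf (Cl.const 1)]; simp [hc]; field_simp; ring
    have e2 : BF τ μ g (fun p => f p + c * 1) = BF τ μ g f := by
      rw [Cl.BF_comb hf (Cl.const 1) hg]
      have : BF τ μ g (fun _ => (1:ℝ)) = 0 := by
        simp [BF, dX, dY, integral_neg, integral_const_mul, hgz]
      rw [this]; ring
    rw [← e2]
    set f' : ℝ × ℝ → ℝ := fun p => f p + c * 1 with hfd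
    by_contra hne
    set b := BF τ μ g f' with hb
    set d := BF τ μ f' f' with hd
    have hq : ∀ t : ℝ, 0 ≤ d + 2 * t * b := by
      intro t
      have := PSD _ (hf'.comb hg t) (by rw [Cl.int_comb hf' hg, e1, hgz]; ring)
      rw [BF_sq hf' hg, hgg, BF_symm f' g] at this
      linarith
    have := hq (-(d + 1) / (2 * b))
    have e : d + 2 * (-(d + 1) / (2 * b)) * b = -1 := by field_simp; ring
    linarith
  have df1 : ∀ x, HasDerivAt (fun x => x * (-k * Real.sin (k * x)))
      (-k * Real.sin (k * x) - k * k * x * Real.cos (k * x)) x := fun x => by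
    refine ((hasDerivAt_id x).mul ((ds x).const_mul (-k))).congr_deriv ?_
    simp; ring
  have df2 : ∀ x, HasDerivAt (fun x => x * (k * Real.cos (k * x)))
      (k * Real.cos (k * x) - k * k * x * Real.sin (k * x)) x := fun x => by
    refine ((hasDerivAt_id x).mul ((dc x).const_mul k)).congr_deriv ?_
    simp; ring
  have o1 := orth g1 _ c1 (cl_fst (φ := fun x => x * (-k * Real.sin (k * x))) (by fun_prop)) g1z b1
  have o2 := orth g2 _ c2 (cl_fst (φ := fun x => x * (k * Real.cos (k * x))) (by fun_prop)) g2z b2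
  rw [hg1, BF_fst dc df1] at o1
  rw [hg2, BF_fst ds df2] at o2
  have tot : ∫ p in τ.Om, μ = 0 := by
    have := congrArg₂ (· + ·) o1 o2
    beta_reduce at this
    rw [← integral_add, add_zero] at this
    · rw [← this]
      refine setIntegral_congr_fun hm (fun p hp => ?_)
      beta_reduce
      rw [← hkk]
      have := Real.sin_sq_add_cos_sq (k * p.1)
      linear_combination (-(k * k)) * this
    · exact ((Continuous.continuousOn (by fun_prop)).integrableOn_compact τ.isCompact_T).mono_set (τ.Om_sub_S.trans τ.S_sub_T)
    · exact ((Continuous.continuousOn (by fun_prop)).integrableOn_compact τ.isCompact_T).mono_set (τ.Om_sub_S.trans τ.S_sub_T)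
  rw [setIntegral_const, smul_eq_mul] at tot
  have := mul_pos hvol hμ
  linarith

end NZ

namespace NZ

open MeasureTheory Filter Topology

lemma cdX {H : ℝ × ℝ → ℝ} (hH : ContDiff ℝ (⊤ : ℕ∞) H) : ContDiff ℝ (⊤ : ℕ∞) (dX univ H) :=
  contDiffOn_univ.mp (Sm.dX good_univ hH.contDiffOn)
lemma cdY {H : ℝ × ℝ → ℝ} (hH : ContDiff ℝ (⊤ : ℕ∞) H) : ContDiff ℝ (⊤ : ℕ∞) (dY univ H) :=
  contDiffOn_univ.mp (Sm.dY good_univ hH.contDiffOn)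
lemma cdhas {H : ℝ × ℝ → ℝ} (hH : ContDiff ℝ (⊤ : ℕ∞) H) (p : ℝ × ℝ) :
    HasFDerivAt H (lin (dX univ H p) (dY univ H p)) p :=
  Sm.hasAt (S := univ) hH.contDiffOn (by simp)

/-- polar map -/
def pc (c q : ℝ × ℝ) : ℝ × ℝ := (c.1 + q.1 * Real.cos q.2, c.2 + q.1 * Real.sin q.2)

lemma pc_cd (c : ℝ × ℝ) : ContDiff ℝ (⊤ : ℕ∞) (pc c) := by unfold pc; fun_prop

lemma pc_has {H : ℝ × ℝ → ℝ} (hH : ContDiff ℝ (⊤ : ℕ∞) H) (S : Set (ℝ × ℝ)) (c q : ℝ × ℝ) :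
    HL S (fun q => H (pc c q))
      (dX univ H (pc c q) * Real.cos q.2 + dY univ H (pc c q) * Real.sin q.2)
      (q.1 * (-dX univ H (pc c q) * Real.sin q.2 + dY univ H (pc c q) * Real.cos q.2)) q := by
  have h := cdhas hH (pc c q)
  have hc : HasFDerivAt (fun q : ℝ × ℝ => Real.cos q.2) (lin 0 (-Real.sin q.2)) q := by
    refine ((Real.hasDerivAt_cos q.2).comp_hasFDerivAt q (hasFDerivAt_snd (𝕜 := ℝ) (p := q))).congr_fderiv ?_
    apply lin_ext <;> simp
  have hs : HasFDerivAt (fun q : ℝ × ℝ => Real.sin q.2) (lin 0 (Real.cos q.2)) q := by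
    refine ((Real.hasDerivAt_sin q.2).comp_hasFDerivAt q (hasFDerivAt_snd (𝕜 := ℝ) (p := q))).congr_fderiv ?_
    apply lin_ext <;> simp
  have hf := hasFDerivAt_fst (𝕜 := ℝ) (p := q) (E := ℝ) (F := ℝ)
  have h1 := ((hf.mul hc).const_add c.1).prodMk ((hf.mul hs).const_add c.2)
  have h2 := (HasFDerivAt.comp q h h1).hasFDerivWithinAt (s := S)
  refine h2.congr_fderiv ?_
  apply lin_ext <;> simp <;> ring

lemma circ {H : ℝ × ℝ → ℝ} (hH : ContDiff ℝ (⊤ : ℕ∞) H) {m r0 : ℝ} (hm : 0 < m) (hr0 : 0 < r0) {c : ℝ × ℝ}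
    (hp : ∀ p : ℝ × ℝ, (p.1 - c.1) ^ 2 + (p.2 - c.2) ^ 2 < r0 ^ 2 →
      dX univ (dX univ H) p + dY univ (dY univ H) p = -m * H p) (h0 : H c = 0)
    {r : ℝ} (hr : 0 ≤ r) (hrr : r < r0) : ∫ θ in (0:ℝ)..(2 * Real.pi), H (pc c (r, θ)) = 0 := by
  have hβ : 0 < 2 * Real.pi := by positivity
  set S := KS r0 (2 * Real.pi) with hS
  have gS : Good S := good_KS hβ
  set F : ℝ × ℝ → ℝ := fun q => H (pc c q) with hF
  have gx : ContDiff ℝ (⊤ : ℕ∞) (dX univ H) := cdX hH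
  have gy : ContDiff ℝ (⊤ : ℕ∞) (dY univ H) := cdY hH
  have gxx : ContDiff ℝ (⊤ : ℕ∞) (dX univ (dX univ H)) := cdX gx
  have gxy : ContDiff ℝ (⊤ : ℕ∞) (dY univ (dX univ H)) := cdY gx
  have gyx : ContDiff ℝ (⊤ : ℕ∞) (dX univ (dY univ H)) := cdX gy
  have gyy : ContDiff ℝ (⊤ : ℕ∞) (dY univ (dY univ H)) := cdY gy
  have co : ∀ {G : ℝ × ℝ → ℝ}, ContDiff ℝ (⊤ : ℕ∞) G → ContDiff ℝ (⊤ : ℕ∞) (fun q => G (pc c q)) :=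
    fun hG => hG.comp (pc_cd c)
  have hcos : ContDiff ℝ (⊤ : ℕ∞) (fun q : ℝ × ℝ => Real.cos q.2) := by fun_prop
  have hsin : ContDiff ℝ (⊤ : ℕ∞) (fun q : ℝ × ℝ => Real.sin q.2) := by fun_prop
  set Fr : ℝ × ℝ → ℝ := fun q => dX univ H (pc c q) * Real.cos q.2 + dY univ H (pc c q) * Real.sin q.2 with hFr
  set K : ℝ × ℝ → ℝ := fun q => dY univ H (pc c q) * Real.cos q.2 - dX univ H (pc c q) * Real.sin q.2 with hK
  set Frr : ℝ × ℝ → ℝ := fun q =>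
    (dX univ (dX univ H) (pc c q) * Real.cos q.2 + dY univ (dX univ H) (pc c q) * Real.sin q.2) * Real.cos q.2 +
    (dX univ (dY univ H) (pc c q) * Real.cos q.2 + dY univ (dY univ H) (pc c q) * Real.sin q.2) * Real.sin q.2 with hFrr
  have cF : ContDiff ℝ (⊤ : ℕ∞) F := co hH
  have cFr : ContDiff ℝ (⊤ : ℕ∞) Fr := ((co gx).mul hcos).add ((co gy).mul hsin)
  have cK : ContDiff ℝ (⊤ : ℕ∞) K := ((co gy).mul hcos).sub ((co gx).mul hsin)
  have cFrr : ContDiff ℝ (⊤ : ℕ∞) Frr :=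
    ((((co gxx).mul hcos).add ((co gxy).mul hsin)).mul hcos).add ((((co gyx).mul hcos).add ((co gyy).mul hsin)).mul hsin)
  have lc : ∀ q, HL S (fun q : ℝ × ℝ => Real.cos q.2) 0 (-Real.sin q.2) q := fun q => by
    refine ((Real.hasDerivAt_cos q.2).comp_hasFDerivAt q (hasFDerivAt_snd (𝕜 := ℝ) (p := q))).hasFDerivWithinAt.congr_fderiv ?_
    apply lin_ext <;> simp
  have ls : ∀ q, HL S (fun q : ℝ × ℝ => Real.sin q.2) 0 (Real.cos q.2) q := fun q => by
    refine ((Real.hasDerivAt_sin q.2).comp_hasFDerivAt q (hasFDerivAt_snd (𝕜 := ℝ) (p := q))).hasFDerivWithinAt.congr_fderiv ?_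
    apply lin_ext <;> simp
  have d1 : ∀ q ∈ S, dX S F q = Fr q := fun q hq => (pc_has hH S c q).x gS hq
  have d2 : ∀ q ∈ S, dX S Fr q = Frr q := fun q hq => by
    rw [(((pc_has gx S c q).mul (lc q)).add ((pc_has gy S c q).mul (ls q))).x gS hq]
    simp only [hFrr]; ring
  have d3 : ∀ q ∈ S, dY S K q = q.1 * (dX univ (dX univ H) (pc c q) + dY univ (dY univ H) (pc c q)) - (q.1 * Frr q + Fr q) :=
    fun q hq => by
    rw [(((pc_has gy S c q).mul (lc q)).sub ((pc_has gx S c q).mul (ls q))).y gS hq]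
    simp only [hFrr, hFr]
    have := Real.sin_sq_add_cos_sq q.2
    linear_combination (q.1 * (dX univ (dX univ H) (pc c q) + dY univ (dY univ H) (pc c q))) * this
  have D1 : ∀ s < r0, HasDerivAt (av (2 * Real.pi) F) (av (2 * Real.pi) Fr s) s := fun s hs => by
    have := av_hasDerivAt hβ (cF.contDiffOn (s := S)) hs
    rwa [av_congr hβ (fun θ hθ => d1 (s, θ) ⟨hs, hθ⟩)] at this
  have D2 : ∀ s < r0, HasDerivAt (av (2 * Real.pi) Fr) (av (2 * Real.pi) Frr s) s := fun s hs => by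
    have := av_hasDerivAt hβ (cFr.contDiffOn (s := S)) hs
    rwa [av_congr hβ (fun θ hθ => d2 (s, θ) ⟨hs, hθ⟩)] at this
  have D3 : ∀ s, 0 ≤ s → s < r0 → s * av (2 * Real.pi) Frr s + av (2 * Real.pi) Fr s = - m * s * av (2 * Real.pi) F s := by
    intro s hs0 hs
    have e := av_dY hβ (cK.contDiffOn (s := S)) hs
    have e0 : K (s, 2 * Real.pi) - K (s, 0) = 0 := by simp [hK, pc]
    rw [e0] at e
    have e1 : av (2 * Real.pi) (dY S K) s = av (2 * Real.pi) (fun q => (-m * s) * F q - (s * Frr q + Fr q)) s := by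
      refine av_congr hβ (fun θ hθ => ?_)
      rw [d3 (s, θ) ⟨hs, hθ⟩, hp]
      · simp only [hF]; ring
      · have := Real.sin_sq_add_cos_sq θ
        simp only [pc]
        have : (c.1 + s * Real.cos θ - c.1) ^ 2 + (c.2 + s * Real.sin θ - c.2) ^ 2 = s ^ 2 := by
          linear_combination s ^ 2 * this
        rw [this]; nlinarith
    have c1 : Continuous (fun q => (-m * s) * F q) := continuous_const.mul cF.continuous
    have c2 : Continuous (fun q => s * Frr q) := continuous_const.mul cFrr.continuous
    have c3 : Continuous (fun q => s * Frr q + Fr q) := c2.add cFr.continuous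
    rw [e1, av_sub (s0 := r0) hβ c1.continuousOn c3.continuousOn hs,
      av_add (s0 := r0) hβ c2.continuousOn cFr.continuous.continuousOn hs,
      av_const_mul, av_const_mul] at e
    linarith
  set E : ℝ → ℝ := fun s => av (2 * Real.pi) Fr s ^ 2 + m * av (2 * Real.pi) F s ^ 2 with hE
  have DE : ∀ s < r0, HasDerivAt E (2 * av (2 * Real.pi) Fr s * (av (2 * Real.pi) Frr s + m * av (2 * Real.pi) F s)) s :=
    fun s hs => by
    refine (((D2 s hs).pow 2).add (((D1 s hs).pow 2).const_mul m)).congr_deriv ?_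
    simp; ring
  have anti : AntitoneOn E (Icc 0 r) := by
    refine antitoneOn_of_hasDerivWithinAt_nonpos (convex_Icc 0 r)
      (f' := fun s => 2 * av (2 * Real.pi) Fr s * (av (2 * Real.pi) Frr s + m * av (2 * Real.pi) F s))
      (fun s hs => (DE s (hs.2.trans_lt hrr)).continuousAt.continuousWithinAt)
      (fun s hs => (DE s ((interior_subset hs).2.trans_lt hrr)).hasDerivWithinAt) (fun s hs => ?_)
    rw [interior_Icc] at hs
    have hs' := D3 s hs.1.le (hs.2.trans hrr)
    have : s * (2 * av (2 * Real.pi) Fr s * (av (2 * Real.pi) Frr s + m * av (2 * Real.pi) F s)) ≤ 0 := by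
      have : s * (2 * av (2 * Real.pi) Fr s * (av (2 * Real.pi) Frr s + m * av (2 * Real.pi) F s))
        = - 2 * av (2 * Real.pi) Fr s ^ 2 := by
        linear_combination (2 * av (2 * Real.pi) Fr s) * hs'
      rw [this]; nlinarith [sq_nonneg (av (2 * Real.pi) Fr s)]
    by_contra hc
    have := mul_pos hs.1 (not_le.mp hc)
    linarith
  have hle := anti (⟨le_refl _, hr⟩ : (0:ℝ) ∈ Icc 0 r) ⟨hr, le_refl _⟩ hr
  have E0 : E 0 = 0 := by
    have a1 : av (2 * Real.pi) F 0 = 0 := by simp [av, hF, pc, h0]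
    have a2 : av (2 * Real.pi) Fr 0 = 0 := by
      have := D3 0 (le_refl _) hr0
      linarith
    simp [hE, a1, a2]
  rw [E0] at hle
  have : m * av (2 * Real.pi) F r ^ 2 ≤ 0 := by nlinarith [sq_nonneg (av (2 * Real.pi) Fr r)]
  have h2 : av (2 * Real.pi) F r ^ 2 = 0 := by
    have := sq_nonneg (av (2 * Real.pi) F r)
    nlinarith
  exact pow_eq_zero_iff two_ne_zero |>.mp h2

/-- integration of radial weights -/
lemma radial {H : ℝ × ℝ → ℝ} {r0 : ℝ} {c : ℝ × ℝ}
    (h : ∀ r, 0 ≤ r → r < r0 → ∫ θ in (0:ℝ)..(2 * Real.pi), H (pc c (r, θ)) = 0)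
    {ψ : ℝ → ℝ} (h0 : ∀ t, r0 ^ 2 ≤ t → ψ t = 0) (hr0 : 0 < r0) :
    ∫ z : ℝ × ℝ, ψ (z.1 ^ 2 + z.2 ^ 2) * H (c.1 + z.1, c.2 + z.2) = 0 := by
  rw [← integral_comp_polarCoord_symm]
  have ht : polarCoord.target = Ioi (0:ℝ) ×ˢ Ioo (-Real.pi) Real.pi := rfl
  rw [ht]
  have e : ∀ p : ℝ × ℝ, p.1 • (ψ ((polarCoord.symm p).1 ^ 2 + (polarCoord.symm p).2 ^ 2) *
      H (c.1 + (polarCoord.symm p).1, c.2 + (polarCoord.symm p).2)) = p.1 * ψ (p.1 ^ 2) * H (pc c p) := by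
    intro p
    have := Real.sin_sq_add_cos_sq p.2
    have e : (p.1 * Real.cos p.2) ^ 2 + (p.1 * Real.sin p.2) ^ 2 = p.1 ^ 2 := by linear_combination p.1 ^ 2 * this
    simp only [polarCoord_symm_apply, pc, e, smul_eq_mul]; ring
  simp_rw [e]
  have inner : ∀ r ∈ Ioi (0:ℝ), ∫ θ in Ioo (-Real.pi) Real.pi, r * ψ (r ^ 2) * H (pc c (r, θ)) = 0 := by
    intro r hr
    rw [integral_const_mul]
    by_cases hrr : r < r0
    · have : ∫ θ in Ioo (-Real.pi) Real.pi, H (pc c (r, θ)) = 0 := by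
        rw [← integral_Ioc_eq_integral_Ioo, ← intervalIntegral.integral_of_le (by linarith [Real.pi_pos])]
        rw [← h r (le_of_lt hr) hrr]
        have hper : Function.Periodic (fun θ => H (pc c (r, θ))) (2 * Real.pi) := fun θ => by simp [pc]
        have := hper.intervalIntegral_add_eq (-Real.pi) 0
        rw [zero_add] at this
        rw [← this]; congr 1; ring
      rw [this, mul_zero]
    · rw [h0 _ (by have : r0 ≤ r := not_lt.mp hrr; nlinarith)]; simp
  by_cases hI : IntegrableOn (fun p : ℝ × ℝ => p.1 * ψ (p.1 ^ 2) * H (pc c p)) (Ioi (0:ℝ) ×ˢ Ioo (-Real.pi) Real.pi)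
  · rw [Measure.volume_eq_prod, setIntegral_prod _ (by rwa [← Measure.volume_eq_prod])]
    rw [setIntegral_congr_fun measurableSet_Ioi inner]; simp
  · exact integral_undef hI

end NZ

namespace NZ

open MeasureTheory Filter Topology

/-- Laplacian of functions on the plane -/
def lap (φ : ℝ × ℝ → ℝ) (p : ℝ × ℝ) : ℝ := dX univ (dX univ φ) p + dY univ (dY univ φ) p

/-- convolution -/
def cv (f φ : ℝ × ℝ → ℝ) (x : ℝ × ℝ) : ℝ := ∫ y, f y * φ (x - y)

lemma cv_eq (f φ : ℝ × ℝ → ℝ) : cv f φ = convolution f φ (ContinuousLinearMap.mul ℝ ℝ) volume := rfl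

lemma dX_univ_eq (φ : ℝ × ℝ → ℝ) : dX univ φ = fun x => fderiv ℝ φ x (1, 0) := by
  funext x; simp [dX, fderivWithin_univ]
lemma dY_univ_eq (φ : ℝ × ℝ → ℝ) : dY univ φ = fun x => fderiv ℝ φ x (0, 1) := by
  funext x; simp [dY, fderivWithin_univ]

lemma cs_dX {φ : ℝ × ℝ → ℝ} (hc : HasCompactSupport φ) : HasCompactSupport (dX univ φ) := by
  rw [dX_univ_eq]; exact hc.fderiv_apply (𝕜 := ℝ) (1, 0)
lemma cs_dY {φ : ℝ × ℝ → ℝ} (hc : HasCompactSupport φ) : HasCompactSupport (dY univ φ) := by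
  rw [dY_univ_eq]; exact hc.fderiv_apply (𝕜 := ℝ) (0, 1)

lemma cv_cd {f φ : ℝ × ℝ → ℝ} (hf : Integrable f) (hφ : ContDiff ℝ (⊤ : ℕ∞) φ) (hc : HasCompactSupport φ) :
    ContDiff ℝ (⊤ : ℕ∞) (cv f φ) := by
  rw [cv_eq]
  exact hc.contDiff_convolution_right (ContinuousLinearMap.mul ℝ ℝ) hf.locallyIntegrable hφ

lemma cv_dX {f φ : ℝ × ℝ → ℝ} (hf : Integrable f) (hφ : ContDiff ℝ (⊤ : ℕ∞) φ) (hc : HasCompactSupport φ) :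
    dX univ (cv f φ) = cv f (dX univ φ) := by
  have h1 : ContDiff ℝ 1 φ := hφ.of_le (by norm_cast)
  funext x
  have h := hc.hasFDerivAt_convolution_right (ContinuousLinearMap.mul ℝ ℝ) hf.locallyIntegrable h1 x
  rw [dX, fderivWithin_univ, cv_eq, h.fderiv,
    convolution_precompR_apply _ hf.locallyIntegrable (hc.fderiv ℝ) (h1.continuous_fderiv one_ne_zero)]
  rw [cv_eq, dX_univ_eq]

lemma cv_dY {f φ : ℝ × ℝ → ℝ} (hf : Integrable f) (hφ : ContDiff ℝ (⊤ : ℕ∞) φ) (hc : HasCompactSupport φ) :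
    dY univ (cv f φ) = cv f (dY univ φ) := by
  have h1 : ContDiff ℝ 1 φ := hφ.of_le (by norm_cast)
  funext x
  have h := hc.hasFDerivAt_convolution_right (ContinuousLinearMap.mul ℝ ℝ) hf.locallyIntegrable h1 x
  rw [dY, fderivWithin_univ, cv_eq, h.fderiv,
    convolution_precompR_apply _ hf.locallyIntegrable (hc.fderiv ℝ) (h1.continuous_fderiv one_ne_zero)]
  rw [cv_eq, dY_univ_eq]

lemma int_f_mul {f φ : ℝ × ℝ → ℝ} (hf : Integrable f) (hφ : Continuous φ) (hc : HasCompactSupport φ) :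
    Integrable (fun y => f y * φ y) := by
  obtain ⟨C, hC⟩ := hφ.bounded_above_of_compact_support hc
  exact hf.mul_bdd hφ.aestronglyMeasurable (Eventually.of_forall hC)

lemma cs_refl {φ : ℝ × ℝ → ℝ} (hc : HasCompactSupport φ) (x : ℝ × ℝ) : HasCompactSupport (fun y => φ (x - y)) :=
  hc.comp_homeomorph (Homeomorph.subLeft x)

lemma dX_refl {φ : ℝ × ℝ → ℝ} (hφ : ContDiff ℝ (⊤ : ℕ∞) φ) (x : ℝ × ℝ) :
    dX univ (fun y => φ (x - y)) = fun y => -dX univ φ (x - y) := by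
  funext y
  have h := (cdhas hφ (x - y)).comp y ((hasFDerivAt_id y).const_sub x)
  refine dX_of_has good_univ (mem_univ _) (b := -dY univ φ (x - y)) ((h.hasFDerivWithinAt).congr_fderiv ?_)
  apply lin_ext <;> simp
lemma dY_refl {φ : ℝ × ℝ → ℝ} (hφ : ContDiff ℝ (⊤ : ℕ∞) φ) (x : ℝ × ℝ) :
    dY univ (fun y => φ (x - y)) = fun y => -dY univ φ (x - y) := by
  funext y
  have h := (cdhas hφ (x - y)).comp y ((hasFDerivAt_id y).const_sub x)
  refine dY_of_has good_univ (mem_univ _) (a := -dX univ φ (x - y)) ((h.hasFDerivWithinAt).congr_fderiv ?_)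
  apply lin_ext <;> simp

lemma lap_refl {φ : ℝ × ℝ → ℝ} (hφ : ContDiff ℝ (⊤ : ℕ∞) φ) (x y : ℝ × ℝ) :
    lap (fun y => φ (x - y)) y = lap φ (x - y) := by
  simp only [lap, dX_refl hφ, dY_refl hφ]
  have e1 : (fun y => -dX univ φ (x - y)) = fun y => (-1) * (fun y => dX univ φ (x - y)) y := by funext; simp
  have e2 : (fun y => -dY univ φ (x - y)) = fun y => (-1) * (fun y => dY univ φ (x - y)) y := by funext; simp
  have s1 : ContDiff ℝ (⊤ : ℕ∞) (fun y => dX univ φ (x - y)) := (cdX hφ).comp (contDiff_const.sub contDiff_id)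
  have s2 : ContDiff ℝ (⊤ : ℕ∞) (fun y => dY univ φ (x - y)) := (cdY hφ).comp (contDiff_const.sub contDiff_id)
  rw [e1, e2, dX_const_mul good_univ (-1) s1.contDiffOn (mem_univ _), dY_const_mul good_univ (-1) s2.contDiffOn (mem_univ _),
    dX_refl (cdX hφ), dY_refl (cdY hφ)]
  ring

/-- convolution with a test function solves the equation -/
lemma cv_pde {f φ : ℝ × ℝ → ℝ} (hf : Integrable f) (hφ : ContDiff ℝ (⊤ : ℕ∞) φ) (hc : HasCompactSupport φ)
    {m : ℝ} {x : ℝ × ℝ}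
    (h : ∫ y, f y * (lap (fun y => φ (x - y)) y + m * φ (x - y)) = 0) :
    lap (cv f φ) x = -m * cv f φ x := by
  have e : lap (cv f φ) x = cv f (dX univ (dX univ φ)) x + cv f (dY univ (dY univ φ)) x := by
    rw [lap, cv_dX hf hφ hc, cv_dY hf hφ hc, cv_dX hf (cdX hφ) (cs_dX hc), cv_dY hf (cdY hφ) (cs_dY hc)]
  rw [e]
  have i : ∀ {ψ : ℝ × ℝ → ℝ}, Continuous ψ → HasCompactSupport ψ → Integrable (fun y => f y * ψ (x - y)) :=
    fun hψ h2 => int_f_mul hf (hψ.comp (continuous_const.sub continuous_id)) (cs_refl h2 x)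
  have i1 := i (cdX (cdX hφ)).continuous (cs_dX (cs_dX hc))
  have i2 := i (cdY (cdY hφ)).continuous (cs_dY (cs_dY hc))
  have i3 := i hφ.continuous hc
  have e2 : ∫ y, f y * (lap (fun y => φ (x - y)) y + m * φ (x - y)) =
      (cv f (dX univ (dX univ φ)) x + cv f (dY univ (dY univ φ)) x) + m * cv f φ x := by
    simp only [cv]
    rw [← integral_add i1 i2, ← integral_const_mul, ← integral_add (by exact i1.add i2) (i3.const_mul m)]
    refine integral_congr_ae (Eventually.of_forall (fun y => ?_))
    simp only [lap_refl hφ]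
    simp only [lap]; ring
  rw [e2] at h
  linarith

/-- radial bump -/
def et (δ : ℝ) (z : ℝ × ℝ) : ℝ := expNegInvGlue (δ ^ 2 - (z.1 ^ 2 + z.2 ^ 2))

lemma et_cd (δ : ℝ) : ContDiff ℝ (⊤ : ℕ∞) (et δ) := by
  unfold et
  exact expNegInvGlue.contDiff.comp (by fun_prop)
lemma et_nonneg (δ : ℝ) (z : ℝ × ℝ) : 0 ≤ et δ z := expNegInvGlue.nonneg _
lemma et_le (δ : ℝ) (z : ℝ × ℝ) : et δ z ≤ 1 := by
  unfold et expNegInvGlue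
  split_ifs with h
  · norm_num
  · rw [Real.exp_le_one_iff]; push Not at h; exact neg_nonpos.mpr (inv_nonneg.mpr h.le)
lemma et_neg (δ : ℝ) (z : ℝ × ℝ) : et δ (-z) = et δ z := by simp [et]
lemma et_zero {δ : ℝ} (hδ : 0 < δ) {z : ℝ × ℝ} (h : δ ≤ ‖z‖) : et δ z = 0 := by
  refine expNegInvGlue.zero_of_nonpos ?_
  rw [Prod.norm_def, le_max_iff] at h
  rcases h with h | h
  · have : δ ^ 2 ≤ z.1 ^ 2 := by rw [← sq_abs z.1]; gcongr; exact h
    nlinarith [sq_nonneg z.2]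
  · have : δ ^ 2 ≤ z.2 ^ 2 := by rw [← sq_abs z.2]; gcongr; exact h
    nlinarith [sq_nonneg z.1]
lemma et_supp {δ : ℝ} (hδ : 0 < δ) (x : ℝ × ℝ) : tsupport (fun y => et δ (x - y)) ⊆ Metric.closedBall x δ := by
  refine closure_minimal (fun y hy => ?_) Metric.isClosed_closedBall
  by_contra h
  rw [Metric.mem_closedBall, dist_comm, dist_eq_norm] at h
  exact hy (et_zero hδ (not_le.mp h).le)
lemma et_cs {δ : ℝ} (hδ : 0 < δ) : HasCompactSupport (et δ) := by
  refine HasCompactSupport.of_support_subset_isCompact (isCompact_closedBall (0 : ℝ × ℝ) δ) (fun y hy => ?_)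
  by_contra h
  rw [Metric.mem_closedBall, dist_zero_right] at h
  exact hy (et_zero hδ (not_le.mp h).le)
lemma et_int {δ : ℝ} (hδ : 0 < δ) {k : ℝ × ℝ → ℝ} (hk : Continuous k) : Integrable (fun z => et δ z * k z) :=
  ((et_cd δ).continuous.mul hk).integrable_of_hasCompactSupport (et_cs hδ).mul_right
lemma et_int' {δ : ℝ} (hδ : 0 < δ) : Integrable (et δ) :=
  (et_cd δ).continuous.integrable_of_hasCompactSupport (et_cs hδ)
lemma et_pos {δ : ℝ} (hδ : 0 < δ) : 0 < ∫ z, et δ z :=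
  (et_cd δ).continuous.integral_pos_of_hasCompactSupport_nonneg_nonzero (et_cs hδ) (et_nonneg δ)
    (x := 0) (expNegInvGlue.pos_of_pos (by simp; positivity)).ne'

lemma et_approx {δ e k0 : ℝ} (hδ : 0 < δ) {k : ℝ × ℝ → ℝ} (hk : Continuous k)
    (h : ∀ z : ℝ × ℝ, ‖z‖ < δ → |k z - k0| ≤ e) :
    |(∫ z, et δ z * k z) - k0 * ∫ z, et δ z| ≤ e * ∫ z, et δ z := by
  rw [← integral_const_mul, ← integral_sub (et_int hδ hk) ((et_int' hδ).const_mul _), ← integral_const_mul]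
  refine (norm_integral_le_integral_norm (fun z => et δ z * k z - k0 * et δ z)).trans
    (integral_mono (((et_int hδ hk).sub ((et_int' hδ).const_mul _)).norm) ((et_int' hδ).const_mul _) (fun z => ?_))
  have e1 : ‖et δ z * k z - k0 * et δ z‖ = et δ z * |k z - k0| := by
    rw [show et δ z * k z - k0 * et δ z = et δ z * (k z - k0) by ring, Real.norm_eq_abs, abs_mul, abs_of_nonneg (et_nonneg δ z)]
  simp only [e1]
  by_cases hz : ‖z‖ < δ
  · have := mul_le_mul_of_nonneg_left (h z hz) (et_nonneg δ z); linarith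
  · rw [et_zero hδ (not_lt.mp hz)]; simp

/-- multiplier of the mean value property -/
def cm (m δ : ℝ) : ℝ := ∫ z, et δ z * Real.cos (Real.sqrt m * z.1)

lemma cv_et (G : ℝ × ℝ → ℝ) (δ : ℝ) (x : ℝ × ℝ) : cv G (et δ) x = ∫ z, et δ z * G (x + z) := by
  rw [cv, ← integral_add_left_eq_self _ x]
  refine integral_congr_ae (Eventually.of_forall (fun z => ?_))
  simp only
  rw [show x - (x + z) = -z by abel, et_neg, mul_comm]

lemma cos_pde {m a c : ℝ} (hm : 0 < m) (p : ℝ × ℝ) :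
    lap (fun p : ℝ × ℝ => a * Real.cos (Real.sqrt m * (p.1 - c))) p = -m * (a * Real.cos (Real.sqrt m * (p.1 - c))) := by
  have hkk : Real.sqrt m * Real.sqrt m = m := Real.mul_self_sqrt hm.le
  set k := Real.sqrt m
  have h : ∀ q : ℝ × ℝ, HL univ (fun p : ℝ × ℝ => a * Real.cos (k * (p.1 - c))) (-(a * k) * Real.sin (k * (q.1 - c))) 0 q := fun q => by
    have h1 : HasDerivAt (fun x : ℝ => a * Real.cos (k * (x - c))) (-(a * k) * Real.sin (k * (q.1 - c))) q.1 := by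
      refine (((Real.hasDerivAt_cos (k * (q.1 - c))).comp q.1 (((hasDerivAt_id q.1).sub_const c).const_mul k)).const_mul a).congr_deriv ?_
      simp; ring
    refine (h1.comp_hasFDerivAt q (hasFDerivAt_fst (𝕜 := ℝ) (p := q))).hasFDerivWithinAt.congr_fderiv ?_
    apply lin_ext <;> simp
  have h' : ∀ q : ℝ × ℝ, HL univ (fun p : ℝ × ℝ => -(a * k) * Real.sin (k * (p.1 - c))) (-(a * k) * (k * Real.cos (k * (q.1 - c)))) 0 q := fun q => by
    have h1 : HasDerivAt (fun x : ℝ => -(a * k) * Real.sin (k * (x - c))) (-(a * k) * (k * Real.cos (k * (q.1 - c)))) q.1 := by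
      refine (((Real.hasDerivAt_sin (k * (q.1 - c))).comp q.1 (((hasDerivAt_id q.1).sub_const c).const_mul k)).const_mul (-(a * k))).congr_deriv ?_
      ring
    refine (h1.comp_hasFDerivAt q (hasFDerivAt_fst (𝕜 := ℝ) (p := q))).hasFDerivWithinAt.congr_fderiv ?_
    apply lin_ext <;> simp
  have ex : dX univ (fun p : ℝ × ℝ => a * Real.cos (k * (p.1 - c))) = fun p => -(a * k) * Real.sin (k * (p.1 - c)) :=
    funext fun q => (h q).x good_univ (mem_univ _)
  have ey : dY univ (fun p : ℝ × ℝ => a * Real.cos (k * (p.1 - c))) = fun p => 0 :=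
    funext fun q => (h q).y good_univ (mem_univ _)
  rw [lap, ex, ey, (h' p).x good_univ (mem_univ _)]
  simp [dY]
  rw [← hkk]; ring

lemma mean_value {G : ℝ × ℝ → ℝ} (hG : ContDiff ℝ (⊤ : ℕ∞) G) {m δ : ℝ} (hm : 0 < m) (hδ : 0 < δ) {x : ℝ × ℝ}
    (h : ∀ p, dist p x < δ → lap G p = -m * G p) : cv G (et δ) x = cm m δ * G x := by
  set C : ℝ × ℝ → ℝ := fun p => G x * Real.cos (Real.sqrt m * (p.1 - x.1)) with hC
  have cC : ContDiff ℝ (⊤ : ℕ∞) C := by rw [hC]; fun_prop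
  set H : ℝ × ℝ → ℝ := fun p => G p - C p with hH
  have cH : ContDiff ℝ (⊤ : ℕ∞) H := hG.sub cC
  have e1 : dX univ H = fun p => dX univ G p - dX univ C p :=
    funext fun p => dX_sub good_univ hG.contDiffOn cC.contDiffOn (mem_univ _)
  have e2 : dY univ H = fun p => dY univ G p - dY univ C p :=
    funext fun p => dY_sub good_univ hG.contDiffOn cC.contDiffOn (mem_univ _)
  have pde : ∀ p : ℝ × ℝ, (p.1 - x.1) ^ 2 + (p.2 - x.2) ^ 2 < δ ^ 2 →
      dX univ (dX univ H) p + dY univ (dY univ H) p = -m * H p := by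
    intro p hp
    have hd : dist p x < δ := by
      rw [Prod.dist_eq, max_lt_iff]
      constructor
      · rw [Real.dist_eq]; refine abs_lt_of_sq_lt_sq ?_ hδ.le; nlinarith [sq_nonneg (p.2 - x.2)]
      · rw [Real.dist_eq]; refine abs_lt_of_sq_lt_sq ?_ hδ.le; nlinarith [sq_nonneg (p.1 - x.1)]
    rw [e1, e2, dX_sub good_univ (cdX hG).contDiffOn (cdX cC).contDiffOn (mem_univ _),
      dY_sub good_univ (cdY hG).contDiffOn (cdY cC).contDiffOn (mem_univ _)]
    have a1 := h p hd
    have a2 := cos_pde (m := m) (a := G x) (c := x.1) hm p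
    rw [lap] at a1 a2
    simp only [hH, hC] at a2 ⊢
    linarith
  have r := radial (H := H) (r0 := δ) (c := x) (fun r hr hrr => circ cH hm hδ pde (by simp [hH, hC]) hr hrr)
    (ψ := fun t => expNegInvGlue (δ ^ 2 - t)) (fun t ht => expNegInvGlue.zero_of_nonpos (by linarith)) hδ
  have e3 : ∀ z : ℝ × ℝ, expNegInvGlue (δ ^ 2 - (z.1 ^ 2 + z.2 ^ 2)) * H (x.1 + z.1, x.2 + z.2) =
      et δ z * G (x + z) - G x * (et δ z * Real.cos (Real.sqrt m * z.1)) := by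
    intro z
    have : ((x.1 + z.1, x.2 + z.2) : ℝ × ℝ) = x + z := rfl
    rw [this]
    simp only [hH, hC, et, Prod.fst_add, add_sub_cancel_left]; ring
  simp only [e3] at r
  have hGc := hG.continuous
  have j1 : Integrable (fun z : ℝ × ℝ => et δ z * G (x + z)) := et_int hδ (by fun_prop)
  have j2 : Integrable (fun z : ℝ × ℝ => G x * (et δ z * Real.cos (Real.sqrt m * z.1))) := (et_int hδ (by fun_prop)).const_mul _
  rw [integral_sub j1 j2,
    integral_const_mul] at r
  rw [cv_et, cm]; linarith

lemma swap_int {f g k : ℝ × ℝ → ℝ} (hf : Integrable f) (hg : Integrable g) (hk : Continuous k)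
    (hb : ∀ z, ‖k z‖ ≤ 1) :
    ∫ z, g z * (∫ y, f y * k (z - y)) = ∫ y, f y * ∫ z, g z * k (z - y) := by
  have hi : Integrable (fun p : (ℝ × ℝ) × (ℝ × ℝ) => g p.1 * f p.2 * k (p.1 - p.2)) (volume.prod volume) := by
    have hs : AEStronglyMeasurable (fun p : (ℝ × ℝ) × (ℝ × ℝ) => k (p.1 - p.2)) (volume.prod volume) :=
      (hk.comp (continuous_fst.sub continuous_snd)).aestronglyMeasurable
    exact (hg.mul_prod hf).mul_bdd hs (Eventually.of_forall (fun p => hb _))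
  have := integral_integral_swap (f := fun z y => g z * f y * k (z - y)) hi
  simp only [← integral_const_mul]
  simp only [mul_assoc] at this
  rw [this]
  congr 1; funext y; congr 1; funext z; ring

lemma cv_comm {f : ℝ × ℝ → ℝ} (hf : Integrable f) {δ ε : ℝ} (hδ : 0 < δ) (hε : 0 < ε) (x : ℝ × ℝ) :
    cv (cv f (et ε)) (et δ) x = cv (cv f (et δ)) (et ε) x := by
  have key : ∀ {a b : ℝ}, 0 < a → 0 < b → cv (cv f (et a)) (et b) x = ∫ y, f y * ∫ z, et b (x - z) * et a (z - y) := by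
    intro a b ha hb
    have hg : Integrable (fun z => et b (x - z)) := (et_int' hb).comp_sub_left x
    rw [← swap_int hf hg (et_cd a).continuous (fun z => by rw [Real.norm_eq_abs, abs_of_nonneg (et_nonneg a z)]; exact et_le a z)]
    simp only [cv, mul_comm]
  rw [key hε hδ, key hδ hε]
  congr 1; funext y; congr 1
  rw [← integral_sub_left_eq_self _ volume (x + y)]
  congr 1; funext z
  rw [show x - (x + y - z) = z - y by abel, show x + y - z - y = x - z by abel, mul_comm]

end NZ

namespace NZ

open MeasureTheory Filter Topology

lemma ball_eq {f : ℝ × ℝ → ℝ} (hf : Integrable f) {m R : ℝ} (hm : 0 < m) {x0 : ℝ × ℝ}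
    (h : ∀ φ : ℝ × ℝ → ℝ, ContDiff ℝ (⊤ : ℕ∞) φ → HasCompactSupport φ → tsupport φ ⊆ Metric.ball x0 R →
      ∫ p, f p * (lap φ p + m * φ p) = 0) {δ : ℝ} (hδ : 0 < δ) (hδR : δ ≤ R / 4) {x : ℝ × ℝ}
    (hx : x ∈ Metric.ball x0 (3 * R / 4)) : lap (cv f (et δ)) x = -m * cv f (et δ) x := by
  refine cv_pde hf (et_cd δ) (et_cs hδ) ?_
  have hc := (et_cd δ)
  refine h (fun y => et δ (x - y)) (hc.comp (contDiff_const.sub contDiff_id)) (cs_refl (et_cs hδ) x) ((et_supp hδ x).trans ?_)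
  intro y hy
  rw [Metric.mem_closedBall] at hy
  rw [Metric.mem_ball] at hx ⊢
  have := dist_triangle y x x0
  linarith

lemma cos_small (m : ℝ) {e : ℝ} (he : 0 < e) :
    ∃ d > 0, ∀ z : ℝ × ℝ, ‖z‖ < d → |Real.cos (Real.sqrt m * z.1) - 1| ≤ e := by
  have hc : Continuous (fun z : ℝ × ℝ => Real.cos (Real.sqrt m * z.1)) := by fun_prop
  obtain ⟨d, hd, h⟩ := Metric.continuousAt_iff.mp (hc.continuousAt (x := 0)) e he
  refine ⟨d, hd, fun z hz => ?_⟩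
  have := h (x := z) (by simpa using hz)
  rw [Real.dist_eq] at this
  simpa using this.le

theorem weyl {f : ℝ × ℝ → ℝ} (hf : Integrable f) {m R : ℝ} (hm : 0 < m) (hR : 0 < R) {x0 : ℝ × ℝ}
    (h : ∀ φ : ℝ × ℝ → ℝ, ContDiff ℝ (⊤ : ℕ∞) φ → HasCompactSupport φ → tsupport φ ⊆ Metric.ball x0 R →
      ∫ p, f p * (lap φ p + m * φ p) = 0) :
    ∃ g : ℝ × ℝ → ℝ, ContDiff ℝ (⊤ : ℕ∞) g ∧ (∀ p ∈ Metric.ball x0 (R / 2), lap g p = -m * g p) ∧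
      ∀ᵐ p, p ∈ Metric.ball x0 (R / 2) → f p = g p := by
  obtain ⟨d, hd, hcos⟩ := cos_small m (e := 1 / 2) (by norm_num)
  set ε := min d (R / 4) with hε
  have ε0 : 0 < ε := lt_min hd (by linarith)
  have hcc : Continuous (fun z : ℝ × ℝ => Real.cos (Real.sqrt m * z.1)) := by fun_prop
  have cpos : 0 < cm m ε := by
    have h1 := et_approx ε0 hcc (fun z hz => hcos z (hz.trans_le (min_le_left _ _)))
    have h2 := et_pos ε0
    rw [abs_le] at h1
    rw [cm]; linarith [h1.1]
  have cG := cv_cd hf (et_cd ε) (et_cs ε0)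
  set G := cv f (et ε) with hG
  set g : ℝ × ℝ → ℝ := fun p => (cm m ε)⁻¹ * G p with hg
  have cg : ContDiff ℝ (⊤ : ℕ∞) g := contDiff_const.mul cG
  have lg : ∀ p, lap g p = (cm m ε)⁻¹ * lap G p := by
    intro p
    have e1 : dX univ g = fun p => (cm m ε)⁻¹ * dX univ G p :=
      funext fun p => dX_const_mul good_univ _ cG.contDiffOn (mem_univ _)
    have e2 : dY univ g = fun p => (cm m ε)⁻¹ * dY univ G p :=
      funext fun p => dY_const_mul good_univ _ cG.contDiffOn (mem_univ _)
    rw [lap, lap, e1, e2, dX_const_mul good_univ _ (cdX cG).contDiffOn (mem_univ _),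
      dY_const_mul good_univ _ (cdY cG).contDiffOn (mem_univ _)]
    ring
  have pG : ∀ x ∈ Metric.ball x0 (3 * R / 4), lap G x = -m * G x := fun x hx =>
    ball_eq hf hm h ε0 (min_le_right _ _) hx
  have key : ∀ δ, 0 < δ → δ ≤ R / 4 → ∀ x ∈ Metric.ball x0 (R / 2), cv f (et δ) x = cm m δ * g x := by
    intro δ hδ hδR x hx
    rw [Metric.mem_ball] at hx
    have h1 := mean_value cG hm hδ (x := x) (fun p hp => pG p (by
      rw [Metric.mem_ball]; have := dist_triangle p x x0; linarith))
    have h2 := mean_value (cv_cd hf (et_cd δ) (et_cs hδ)) hm ε0 (x := x) (fun p hp => ball_eq hf hm h hδ hδR (by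
      rw [Metric.mem_ball]; have := dist_triangle p x x0; have := min_le_right d (R / 4); linarith))
    rw [hG, cv_comm hf hδ ε0, h2] at h1
    rw [hg]; simp only; field_simp; linarith
  refine ⟨g, cg, fun p hp => ?_, ?_⟩
  · rw [lg, pG p (Metric.ball_subset_ball (by linarith) hp), hg]; ring
  have hloc : LocallyIntegrableOn (fun p => f p - g p) (Metric.ball x0 (R / 2)) :=
    (hf.locallyIntegrable.sub cg.continuous.locallyIntegrable).locallyIntegrableOn _
  have := Metric.isOpen_ball.ae_eq_zero_of_integral_contDiff_smul_eq_zero hloc (fun φ cφ sφ tφ => ?_)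
  · filter_upwards [this] with p hp hp2
    linarith [hp hp2]
  have cφ' : Continuous φ := cφ.continuous
  have iφ : Integrable φ := cφ'.integrable_of_hasCompactSupport sφ
  have i1 : Integrable (fun p => f p * φ p) := int_f_mul hf cφ' sφ
  have i2 : Integrable (fun p => g p * φ p) := (cg.continuous.mul cφ').integrable_of_hasCompactSupport sφ.mul_left
  have e0 : ∫ p, φ p • (f p - g p) = (∫ p, f p * φ p) - ∫ p, g p * φ p := by
    rw [← integral_sub i1 i2]; congr 1; funext p; simp only [smul_eq_mul]; ring
  rw [e0]
  set A := ∫ p, f p * φ p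
  set B := ∫ p, g p * φ p with hB
  set N := ∫ p, |f p| with hN
  have N0 : 0 ≤ N := integral_nonneg (fun p => abs_nonneg _)
  have main : ∀ e : ℝ, 0 < e → |A - B| ≤ e * (N + |B|) := by
    intro e he
    obtain ⟨d1, hd1, hcos1⟩ := cos_small m he
    have uc := sφ.uniformContinuous_of_continuous cφ'
    obtain ⟨d2, hd2, hu⟩ := Metric.uniformContinuous_iff.mp uc e he
    set δ := min (min d1 d2) (R / 4)
    have δ0 : 0 < δ := lt_min (lt_min hd1 hd2) (by linarith)
    have l1 : δ ≤ d1 := (min_le_left _ _).trans (min_le_left _ _)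
    have l2 : δ ≤ d2 := (min_le_left _ _).trans (min_le_right _ _)
    have hc := et_approx δ0 hcc (fun z hz => hcos1 z (hz.trans_le l1))
    have hI := et_pos δ0
    set I := ∫ z, et δ z with hIdef
    have s1 : ∫ p, φ p * cv f (et δ) p = cm m δ * B := by
      rw [hB, ← integral_const_mul]
      congr 1; funext p
      by_cases hp : p ∈ Metric.ball x0 (R / 2)
      · rw [key δ δ0 (min_le_right _ _) p hp]; ring
      · rw [image_eq_zero_of_notMem_tsupport (fun hh => hp (tφ hh))]; simp
    have s2 : ∫ p, φ p * cv f (et δ) p = ∫ y, f y * ∫ z, φ z * et δ (z - y) :=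
      swap_int hf iφ (et_cd δ).continuous (fun z => by
        rw [Real.norm_eq_abs, abs_of_nonneg (et_nonneg δ z)]; exact et_le δ z)
    have s3 : ∀ y, ∫ z, φ z * et δ (z - y) = ∫ z, et δ z * φ (y + z) := by
      intro y
      rw [← integral_add_left_eq_self _ y]
      congr 1; funext z
      rw [show y + z - y = z by abel, mul_comm]
    have s4 : ∀ y, |(∫ z, et δ z * φ (y + z)) - φ y * I| ≤ e * I := fun y =>
      et_approx δ0 (k := fun z => φ (y + z)) (by fun_prop) (fun z hz => by
        have := hu (a := y + z) (b := y) (by rw [dist_eq_norm]; simpa using hz.trans_le l2)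
        rw [Real.dist_eq] at this; exact this.le)
    have i3 : Integrable (fun y => f y * ∫ z, et δ z * φ (y + z)) := by
      have hm : AEStronglyMeasurable (fun y => ∫ z, et δ z * φ (y + z)) volume := by
        have := cv_cd iφ (et_cd δ) (et_cs δ0)
        refine this.continuous.aestronglyMeasurable.congr (Eventually.of_forall (fun y => ?_))
        exact cv_et φ δ y
      obtain ⟨C, hC⟩ := cφ'.bounded_above_of_compact_support sφ
      refine hf.mul_bdd (c := e * I + C * I) hm (Eventually.of_forall (fun y => ?_))
      have a1 := s4 y
      have a2 : |φ y * I| ≤ C * I := by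
        rw [abs_mul, abs_of_pos hI]; exact mul_le_mul_of_nonneg_right (hC y) hI.le
      rw [Real.norm_eq_abs]
      have := abs_sub_abs_le_abs_sub (∫ z, et δ z * φ (y + z)) (φ y * I)
      linarith
    have s5 : |(∫ y, f y * ∫ z, et δ z * φ (y + z)) - I * A| ≤ e * I * N := by
      rw [← integral_const_mul, ← integral_sub i3 (i1.const_mul I), hN, ← integral_const_mul]
      refine (norm_integral_le_integral_norm _).trans (integral_mono (i3.sub (i1.const_mul I)).norm (hf.abs.const_mul _) (fun y => ?_))
      have : f y * (∫ z, et δ z * φ (y + z)) - I * (f y * φ y) = ((∫ z, et δ z * φ (y + z)) - φ y * I) * f y := by ring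
      simp only [Pi.sub_apply, this, Real.norm_eq_abs, abs_mul]
      exact mul_le_mul_of_nonneg_right (s4 y) (abs_nonneg _)
    simp only [s3] at s2
    rw [← s2, s1] at s5
    have hc' : |cm m δ - I| ≤ e * I := by rw [cm]; simpa using hc
    have t : I * |A - B| ≤ I * (e * (N + |B|)) := by
      rw [← abs_of_pos hI, ← abs_mul, abs_of_pos hI]
      have : I * (A - B) = -(cm m δ * B - I * A) + (cm m δ - I) * B := by ring
      rw [this]
      refine (abs_add_le _ _).trans ?_
      rw [abs_neg, abs_mul]
      have := mul_le_mul_of_nonneg_right hc' (abs_nonneg B)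
      nlinarith
    exact le_of_mul_le_mul_left t hI
  have : |A - B| ≤ 0 := by
    refine le_of_forall_pos_le_add (fun e he => ?_)
    have K0 : 0 < N + |B| + 1 := by positivity
    have := main (e / (N + |B| + 1)) (by positivity)
    refine this.trans ?_
    rw [div_mul_eq_mul_div, div_le_iff₀ K0]
    nlinarith [abs_nonneg B]
  exact abs_eq_zero.mp (le_antisymm this (abs_nonneg _))

end NZ

namespace NZ

open MeasureTheory Filter Topology
open scoped ENNReal

lemma lint_scale {g : ℝ × ℝ → ℝ≥0∞} (hg : Measurable g) (w : ℝ × ℝ) {t : ℝ} (ht : 1 / 2 ≤ t) :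
    ∫⁻ x, g (w + t • x) ≤ 4 * ∫⁻ x, g x := by
  have t0 : t ≠ 0 := by linarith
  have hs : Measurable (fun x : ℝ × ℝ => t • x) := by fun_prop
  have h1 : ∫⁻ x, g (w + t • x) = ∫⁻ z, g (w + z) ∂(Measure.map (t • ·) volume) := by
    rw [lintegral_map (f := fun z => g (w + z)) (hg.comp (measurable_const_add w)) hs]
  rw [h1, Measure.map_addHaar_smul _ t0, lintegral_smul_measure, lintegral_add_left_eq_self g w, smul_eq_mul]
  gcongr
  have : Module.finrank ℝ (ℝ × ℝ) = 2 := by simp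
  rw [this]
  have h2 : |(t ^ 2)⁻¹| ≤ 4 := by
    rw [abs_of_nonneg (by positivity), inv_le_comm₀ (by positivity) (by norm_num)]
    nlinarith
  calc ENNReal.ofReal |(t ^ 2)⁻¹| ≤ ENNReal.ofReal 4 := ENNReal.ofReal_le_ofReal h2
    _ = 4 := by simp

lemma cs_interval {k : ℝ → ℝ} (hk : ContinuousOn k (Icc 0 1)) :
    (∫ t in (0:ℝ)..1, k t) ^ 2 ≤ ∫ t in (0:ℝ)..1, k t ^ 2 := by
  have hk' : ContinuousOn k (uIcc 0 1) := by rwa [uIcc_of_le zero_le_one]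
  have i1 : IntervalIntegrable k volume 0 1 := hk'.intervalIntegrable
  have i2 : IntervalIntegrable (fun t => k t ^ 2) volume 0 1 := (hk'.pow 2).intervalIntegrable
  set c := ∫ t in (0:ℝ)..1, k t
  have h0 : 0 ≤ ∫ t in (0:ℝ)..1, (k t - c) ^ 2 := intervalIntegral.integral_nonneg zero_le_one (fun t _ => sq_nonneg _)
  have h1 : ∫ t in (0:ℝ)..1, (k t - c) ^ 2 = (∫ t in (0:ℝ)..1, k t ^ 2) - 2 * c * c + c ^ 2 := by
    have : ∀ t, (k t - c) ^ 2 = (k t ^ 2 - 2 * c * k t) + c ^ 2 := fun t => by ring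
    simp only [this]
    rw [intervalIntegral.integral_add (i2.sub (i1.const_mul _)) (by simp), intervalIntegral.integral_sub i2 (i1.const_mul _),
      intervalIntegral.integral_const_mul]
    simp
    exact Or.inl rfl
  rw [h1] at h0
  linarith

variable {τ : TriP}


lemma meas_gsq {f : ℝ × ℝ → ℝ} (hf : Sm τ.S f) {C : Set (ℝ × ℝ)} (hC : MeasurableSet C) (hsub : C ⊆ τ.Om) :
    Measurable (C.indicator (fun p => ENNReal.ofReal (gsq τ.S f p))) := by
  have hm := τ.isOpen_Om.measurableSet
  have hc : ContinuousOn (fun p => ENNReal.ofReal (gsq τ.S f p)) τ.Om :=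
    ENNReal.continuous_ofReal.comp_continuousOn
      ((((hf.dX τ.good_S).cont.pow 2).add ((hf.dY τ.good_S).cont.pow 2)).mono τ.Om_sub_S)
  classical
  have h1 : Measurable (τ.Om.indicator (fun p => ENNReal.ofReal (gsq τ.S f p))) := by
    rw [← piecewise_eq_indicator]
    exact hc.measurable_piecewise continuousOn_const hm
  have : C.indicator (fun p => ENNReal.ofReal (gsq τ.S f p)) = C.indicator (τ.Om.indicator (fun p => ENNReal.ofReal (gsq τ.S f p))) := by
    rw [indicator_indicator, inter_eq_left.mpr hsub]
  rw [this]; exact h1.indicator hC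

lemma seg_bound {f : ℝ × ℝ → ℝ} (hf : Sm τ.S f) {C : Set (ℝ × ℝ)} (hcv : Convex ℝ C) (hsub : C ⊆ τ.Om) {δ : ℝ}
    (hd : ∀ x ∈ C, ∀ y ∈ C, |x.1 - y.1| ≤ δ ∧ |x.2 - y.2| ≤ δ) {x y : ℝ × ℝ} (hx : x ∈ C) (hy : y ∈ C) :
    ENNReal.ofReal ((f x - f y) ^ 2) ≤ ENNReal.ofReal (2 * δ ^ 2) *
      ∫⁻ t in Icc (0:ℝ) 1, C.indicator (fun p => ENNReal.ofReal (gsq τ.S f p)) ((1 - t) • y + t • x) := by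
  set γ : ℝ → ℝ × ℝ := fun t => (1 - t) • y + t • x with hγ
  have hγC : ∀ t ∈ Icc (0:ℝ) 1, γ t ∈ C := fun t ht => hcv hy hx (by linarith [ht.2]) ht.1 (by ring)
  have hγd : ∀ t, HasDerivAt γ (x - y) t := fun t => by
    have := (((hasDerivAt_id t).const_sub 1).smul_const y).add ((hasDerivAt_id t).smul_const x)
    refine this.congr_deriv ?_
    simp; abel
  have hγc : Continuous γ := continuous_iff_continuousAt.mpr (fun t => (hγd t).continuousAt)
  set k : ℝ → ℝ := fun t => dX τ.S f (γ t) * (x.1 - y.1) + dY τ.S f (γ t) * (x.2 - y.2) with hk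
  have hcd : ∀ {F : ℝ × ℝ → ℝ}, ContinuousOn F τ.S → ContinuousOn (fun t => F (γ t)) (Icc 0 1) := fun h =>
    h.comp hγc.continuousOn (fun t ht => τ.Om_sub_S (hsub (hγC t ht)))
  have cX := hcd (hf.dX τ.good_S).cont
  have cY := hcd (hf.dY τ.good_S).cont
  have hkc : ContinuousOn k (Icc 0 1) := (cX.mul continuousOn_const).add (cY.mul continuousOn_const)
  have hder : ∀ t ∈ Icc (0:ℝ) 1, HasDerivAt (fun t => f (γ t)) (k t) t := fun t ht => by
    have hi : τ.S ∈ 𝓝 (γ t) := mem_of_superset (τ.isOpen_Om.mem_nhds (hsub (hγC t ht))) τ.Om_sub_S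
    have h1 := (hf.has (τ.Om_sub_S (hsub (hγC t ht)))).hasFDerivAt hi
    refine (h1.comp_hasDerivAt t (hγd t)).congr_deriv ?_
    simp [hk, lin_apply]
  have ftc : ∫ t in (0:ℝ)..1, k t = f x - f y := by
    rw [intervalIntegral.integral_eq_sub_of_hasDerivAt (f := fun t => f (γ t))
      (fun t ht => hder t (by rwa [uIcc_of_le zero_le_one] at ht))]
    · simp [hγ]
    · exact ContinuousOn.intervalIntegrable (by rwa [uIcc_of_le zero_le_one])
  have h1 := cs_interval hkc
  rw [ftc] at h1
  have cG : ContinuousOn (fun t => 2 * δ ^ 2 * gsq τ.S f (γ t)) (Icc 0 1) :=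
    continuousOn_const.mul ((cX.pow 2).add (cY.pow 2))
  have h2 : ∫ t in (0:ℝ)..1, k t ^ 2 ≤ ∫ t in (0:ℝ)..1, 2 * δ ^ 2 * gsq τ.S f (γ t) := by
    refine intervalIntegral.integral_mono_on zero_le_one
      (ContinuousOn.intervalIntegrable (by rw [uIcc_of_le zero_le_one]; exact hkc.pow 2))
      (ContinuousOn.intervalIntegrable (by rw [uIcc_of_le zero_le_one]; exact cG)) (fun t ht => ?_)
    obtain ⟨a1, a2⟩ := hd x hx y hy
    have b1 : (x.1 - y.1) ^ 2 ≤ δ ^ 2 := by rw [← sq_abs]; exact pow_le_pow_left₀ (abs_nonneg _) a1 2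
    have b2 : (x.2 - y.2) ^ 2 ≤ δ ^ 2 := by rw [← sq_abs]; exact pow_le_pow_left₀ (abs_nonneg _) a2 2
    simp only [hk, gsq]
    generalize dX τ.S f (γ t) = A
    generalize dY τ.S f (γ t) = B
    generalize x.1 - y.1 = u at *
    generalize x.2 - y.2 = v at *
    have : (A * u + B * v) ^ 2 ≤ (A ^ 2 + B ^ 2) * (u ^ 2 + v ^ 2) := by nlinarith [sq_nonneg (A * v - B * u)]
    have : (A ^ 2 + B ^ 2) * (u ^ 2 + v ^ 2) ≤ (A ^ 2 + B ^ 2) * (2 * δ ^ 2) := by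
      gcongr; linarith
    linarith
  refine (ENNReal.ofReal_le_ofReal (h1.trans h2)).trans (le_of_eq ?_)
  rw [intervalIntegral.integral_of_le zero_le_one, ← integral_Icc_eq_integral_Ioc,
    ofReal_integral_eq_lintegral_ofReal (cG.integrableOn_Icc)
      (Eventually.of_forall (fun t => mul_nonneg (by positivity) (gsq_nonneg _ _ _))),
    ← lintegral_const_mul' _ _ ENNReal.ofReal_ne_top]
  refine setLIntegral_congr_fun measurableSet_Icc (fun t ht => ?_)
  rw [indicator_of_mem (hγC t ht), ENNReal.ofReal_mul (by positivity)]

lemma poinc_lint {f : ℝ × ℝ → ℝ} (hf : Sm τ.S f) {C : Set (ℝ × ℝ)} (hC : MeasurableSet C) (hcv : Convex ℝ C) (hsub : C ⊆ τ.Om) {δ : ℝ}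
    (hd : ∀ x ∈ C, ∀ y ∈ C, |x.1 - y.1| ≤ δ ∧ |x.2 - y.2| ≤ δ) :
    ∫⁻ x in C, ∫⁻ y in C, ENNReal.ofReal ((f x - f y) ^ 2) ≤
      ENNReal.ofReal (2 * δ ^ 2) * (4 * volume C * ∫⁻ x in C, ENNReal.ofReal (gsq τ.S f x)) := by
  have hG := meas_gsq hf hC hsub
  have eG : ∫⁻ x in C, ENNReal.ofReal (gsq τ.S f x) = ∫⁻ x, C.indicator (fun p => ENNReal.ofReal (gsq τ.S f p)) x :=
    (lintegral_indicator hC _).symm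
  have h1 : ∫⁻ x in C, ∫⁻ y in C, ENNReal.ofReal ((f x - f y) ^ 2) ≤ ∫⁻ x in C, ∫⁻ y in C, ENNReal.ofReal (2 * δ ^ 2) *
      ∫⁻ t in Icc (0:ℝ) 1, C.indicator (fun p => ENNReal.ofReal (gsq τ.S f p)) ((1 - t) • y + t • x) :=
    setLIntegral_mono' hC (fun x hx => setLIntegral_mono' hC (fun y hy => seg_bound hf hcv hsub hd hx hy))
  rw [eG]
  generalize C.indicator (fun p => ENNReal.ofReal (gsq τ.S f p)) = G at *
  refine h1.trans ?_
  simp only [lintegral_const_mul' _ _ ENNReal.ofReal_ne_top]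
  gcongr
  have e1 : ∀ x : ℝ × ℝ, ∫⁻ y in C, ∫⁻ t in Icc (0:ℝ) 1, G ((1 - t) • y + t • x) =
      ∫⁻ t in Icc (0:ℝ) 1, ∫⁻ y in C, G ((1 - t) • y + t • x) := fun x =>
    lintegral_lintegral_swap (f := fun (y : ℝ × ℝ) (t : ℝ) => G ((1 - t) • y + t • x))
      (hG.comp (by fun_prop)).aemeasurable
  simp only [e1]
  have m3 : Measurable (fun q : ((ℝ × ℝ) × ℝ) × (ℝ × ℝ) => G ((1 - q.1.2) • q.2 + q.1.2 • q.1.1)) := hG.comp (by fun_prop)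
  rw [lintegral_lintegral_swap (f := fun (x : ℝ × ℝ) (t : ℝ) => ∫⁻ y in C, G ((1 - t) • y + t • x))
    (m3.lintegral_prod_right' (ν := volume.restrict C)).aemeasurable]
  have b : ∀ t ∈ Icc (0:ℝ) 1, ∫⁻ x in C, ∫⁻ y in C, G ((1 - t) • y + t • x) ≤ 4 * volume C * ∫⁻ x, G x := by
    intro t ht
    by_cases h : 1 / 2 ≤ t
    · rw [lintegral_lintegral_swap (f := fun (x y : ℝ × ℝ) => G ((1 - t) • y + t • x)) (hG.comp (by fun_prop)).aemeasurable]
      calc ∫⁻ y in C, ∫⁻ x in C, G ((1 - t) • y + t • x) ≤ ∫⁻ y in C, 4 * ∫⁻ x, G x :=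
            lintegral_mono (fun y => (setLIntegral_le_lintegral _ _).trans (lint_scale hG _ h))
        _ = _ := by rw [setLIntegral_const]; ring
    · calc ∫⁻ x in C, ∫⁻ y in C, G ((1 - t) • y + t • x) ≤ ∫⁻ x in C, 4 * ∫⁻ x, G x := by
            refine lintegral_mono (fun x => (setLIntegral_le_lintegral _ _).trans ?_)
            have := lint_scale hG (t • x) (t := 1 - t) (by linarith)
            simpa only [add_comm] using this
        _ = _ := by rw [setLIntegral_const]; ring
  calc ∫⁻ t in Icc (0:ℝ) 1, ∫⁻ x in C, ∫⁻ y in C, G ((1 - t) • y + t • x)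
      ≤ ∫⁻ t in Icc (0:ℝ) 1, 4 * volume C * ∫⁻ x, G x := setLIntegral_mono' measurableSet_Icc b
    _ = _ := by rw [setLIntegral_const]; simp

lemma Cl.ig {f : ℝ × ℝ → ℝ} (hf : Cl τ f) : IntegrableOn (gsq τ.S f) τ.Om := hf.ix.add hf.iy

/-- Poincare inequality on convex pieces -/
theorem poinc {f : ℝ × ℝ → ℝ} (hf : Cl τ f) {C : Set (ℝ × ℝ)} (hC : MeasurableSet C) (hcv : Convex ℝ C) (hsub : C ⊆ τ.Om) {δ : ℝ}
    (hd : ∀ x ∈ C, ∀ y ∈ C, |x.1 - y.1| ≤ δ ∧ |x.2 - y.2| ≤ δ) :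
    volume.real C * ∫ p in C, f p ^ 2 ≤ (∫ p in C, f p) ^ 2 + 4 * δ ^ 2 * volume.real C * ∫ p in C, gsq τ.S f p := by
  have hv : volume C < ⊤ := (measure_mono hsub).trans_lt vol_Om
  have i1 : IntegrableOn f C := hf.i1.mono_set hsub
  have i2 : IntegrableOn (fun p => f p ^ 2) C := hf.i0.mono_set hsub
  have i3 : IntegrableOn (gsq τ.S f) C := hf.ig.mono_set hsub
  have ic : ∀ c : ℝ, IntegrableOn (fun _ => c) C := fun c => integrableOn_const hv.ne
  have h := poinc_lint hf.sm hC hcv hsub hd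
  set I1 := ∫ p in C, f p
  set I2 := ∫ p in C, f p ^ 2
  set v := volume.real C with hvdef
  have ii : ∀ x : ℝ × ℝ, IntegrableOn (fun y => (f x - f y) ^ 2) C := fun x => by
    refine (((ic (f x ^ 2)).sub (i1.const_mul (2 * f x))).add i2).congr (Eventually.of_forall (fun y => ?_))
    simp only [Pi.add_apply, Pi.sub_apply]; ring
  have e1 : ∀ x : ℝ × ℝ, ∫ y in C, (f x - f y) ^ 2 = v * f x ^ 2 - 2 * I1 * f x + I2 := fun x => by
    have : ∀ y, (f x - f y) ^ 2 = (f x ^ 2 - 2 * f x * f y) + f y ^ 2 := fun y => by ring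
    simp only [this]
    have j1 : IntegrableOn (fun y => f x ^ 2 - 2 * f x * f y) C := (ic (f x ^ 2)).sub (i1.const_mul (2 * f x))
    rw [integral_add j1 i2, integral_sub (ic _) (i1.const_mul _), integral_const_mul, setIntegral_const, smul_eq_mul]
    ring
  have l1 : ∀ x : ℝ × ℝ, ∫⁻ y in C, ENNReal.ofReal ((f x - f y) ^ 2) = ENNReal.ofReal (v * f x ^ 2 - 2 * I1 * f x + I2) := fun x => by
    rw [← ofReal_integral_eq_lintegral_ofReal (ii x) (Eventually.of_forall (fun y => sq_nonneg _)), e1]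
  have pos : ∀ x : ℝ × ℝ, 0 ≤ v * f x ^ 2 - 2 * I1 * f x + I2 := fun x => by
    rw [← e1]; exact integral_nonneg (fun y => sq_nonneg _)
  have j2 : IntegrableOn (fun x => v * f x ^ 2 - 2 * I1 * f x) C := (i2.const_mul v).sub (i1.const_mul _)
  have j3 : IntegrableOn (fun x => v * f x ^ 2 - 2 * I1 * f x + I2) C := j2.add (ic I2)
  have e2 : ∫ x in C, (v * f x ^ 2 - 2 * I1 * f x + I2) = 2 * v * I2 - 2 * I1 ^ 2 := by
    rw [integral_add j2 (ic I2), integral_sub (i2.const_mul v) (i1.const_mul _), integral_const_mul, integral_const_mul,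
      setIntegral_const, smul_eq_mul]
    simp only [← hvdef]; ring
  simp only [l1] at h
  rw [← ofReal_integral_eq_lintegral_ofReal j3 (Eventually.of_forall pos), e2,
    ← ofReal_integral_eq_lintegral_ofReal i3 (Eventually.of_forall (fun y => gsq_nonneg _ _ _))] at h
  have e3 : volume C = ENNReal.ofReal v := (ENNReal.ofReal_toReal hv.ne).symm
  have G0 : 0 ≤ ∫ x in C, gsq τ.S f x := integral_nonneg (fun y => gsq_nonneg _ _ _)
  rw [e3, show (4 : ℝ≥0∞) = ENNReal.ofReal 4 by simp, ← ENNReal.ofReal_mul (by norm_num), ← ENNReal.ofReal_mul (by positivity),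
    ← ENNReal.ofReal_mul (by positivity), ENNReal.ofReal_le_ofReal_iff (by positivity)] at h
  linarith

end NZ

namespace NZ

open MeasureTheory Filter Topology

variable {τ : TriP}

/-- grid cells -/
def cell (τ : TriP) (k : ℕ) (c : ℤ × ℤ) : Set (ℝ × ℝ) :=
  τ.Om ∩ {p | ⌊((k:ℝ) + 1) * p.1⌋ = c.1 ∧ ⌊((k:ℝ) + 1) * p.2⌋ = c.2}

lemma cell_sub (k : ℕ) (c : ℤ × ℤ) : cell τ k c ⊆ τ.Om := inter_subset_left

lemma cell_meas (k : ℕ) (c : ℤ × ℤ) : MeasurableSet (cell τ k c) := by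
  refine τ.isOpen_Om.measurableSet.inter (MeasurableSet.inter ?_ ?_)
  · exact measurableSet_eq_fun (f := fun p : ℝ × ℝ => ⌊((k:ℝ) + 1) * p.1⌋) (by fun_prop) measurable_const
  · exact measurableSet_eq_fun (f := fun p : ℝ × ℝ => ⌊((k:ℝ) + 1) * p.2⌋) (by fun_prop) measurable_const

lemma cell_convex (k : ℕ) (c : ℤ × ℤ) : Convex ℝ (cell τ k c) := by
  refine τ.convex_Om.inter ?_
  intro p hp q hq s t hs ht hst
  simp only [mem_ofPred_eq, Int.floor_eq_iff] at hp hq ⊢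
  obtain ⟨⟨a1, a2⟩, a3, a4⟩ := hp
  obtain ⟨⟨b1, b2⟩, b3, b4⟩ := hq
  have e : t = 1 - s := by linarith
  simp only [Prod.fst_add, Prod.smul_fst, Prod.snd_add, Prod.smul_snd, smul_eq_mul]
  have key : ∀ x y u v : ℝ, x ≤ u → x ≤ v → x ≤ s * u + t * v := fun x y u v h1 h2 => by
    have := mul_le_mul_of_nonneg_left h1 hs; have := mul_le_mul_of_nonneg_left h2 ht
    have : s * x + t * x = x := by rw [← add_mul, hst, one_mul]
    linarith
  have key2 : ∀ x u v : ℝ, u < x → v < x → s * u + t * v < x := fun x u v h1 h2 => by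
    have h3 : s * x + t * x = x := by rw [← add_mul, hst, one_mul]
    rcases hs.eq_or_lt with h | h
    · have : t = 1 := by linarith
      rw [← h, this]; linarith
    · have := mul_lt_mul_of_pos_left h1 h
      have := mul_le_mul_of_nonneg_left h2.le ht
      linarith
  refine ⟨⟨?_, ?_⟩, ?_, ?_⟩
  · have := key _ 0 _ _ a1 b1; linarith
  · have := key2 _ _ _ a2 b2; linarith
  · have := key _ 0 _ _ a3 b3; linarith
  · have := key2 _ _ _ a4 b4; linarith

lemma cell_diam (k : ℕ) (c : ℤ × ℤ) : ∀ x ∈ cell τ k c, ∀ y ∈ cell τ k c,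
    |x.1 - y.1| ≤ 1 / ((k:ℝ) + 1) ∧ |x.2 - y.2| ≤ 1 / ((k:ℝ) + 1) := by
  rintro x ⟨-, hx⟩ y ⟨-, hy⟩
  have hk : (0:ℝ) < (k:ℝ) + 1 := by positivity
  simp only [mem_ofPred_eq, Int.floor_eq_iff] at hx hy
  obtain ⟨⟨a1, a2⟩, a3, a4⟩ := hx
  obtain ⟨⟨b1, b2⟩, b3, b4⟩ := hy
  constructor
  · rw [le_div_iff₀ hk, ← abs_of_pos hk, ← abs_mul, abs_le]; constructor <;> linarith
  · rw [le_div_iff₀ hk, ← abs_of_pos hk, ← abs_mul, abs_le]; constructor <;> linarith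

lemma cell_disj (k : ℕ) {c d : ℤ × ℤ} (h : c ≠ d) : Disjoint (cell τ k c) (cell τ k d) := by
  rw [Set.disjoint_left]
  rintro x ⟨-, h1, h2⟩ ⟨-, h3, h4⟩
  exact h (Prod.ext (h1.symm.trans h3) (h2.symm.trans h4))

lemma cell_cover (τ : TriP) (k : ℕ) : ∃ F : Finset (ℤ × ℤ), τ.Om = ⋃ c ∈ F, cell τ k c := by
  obtain ⟨D, hD⟩ := τ.isCompact_T.isBounded.exists_norm_le
  set M := ⌈((k:ℝ) + 1) * D⌉ + 1
  refine ⟨Finset.Icc (-M) M ×ˢ Finset.Icc (-M) M, Subset.antisymm (fun p hp => ?_) (iUnion₂_subset (fun c _ => cell_sub k c))⟩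
  have hk : (0:ℝ) < (k:ℝ) + 1 := by positivity
  have hn := hD p (τ.S_sub_T (τ.Om_sub_S hp))
  rw [Prod.norm_def, max_le_iff, Real.norm_eq_abs, Real.norm_eq_abs] at hn
  have key : ∀ x : ℝ, |x| ≤ D → -M ≤ ⌊((k:ℝ) + 1) * x⌋ ∧ ⌊((k:ℝ) + 1) * x⌋ ≤ M := by
    intro x hx
    have c1 := Int.le_ceil (((k:ℝ) + 1) * D)
    rw [abs_le] at hx
    have u1 : ((k:ℝ) + 1) * x ≤ ((k:ℝ) + 1) * D := mul_le_mul_of_nonneg_left hx.2 hk.le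
    have u2 : ((k:ℝ) + 1) * (-D) ≤ ((k:ℝ) + 1) * x := mul_le_mul_of_nonneg_left hx.1 hk.le
    constructor
    · rw [Int.le_floor]; push_cast [M]; linarith
    · have h1 := Int.floor_le (((k:ℝ) + 1) * x)
      have : ((⌊((k:ℝ) + 1) * x⌋ : ℤ) : ℝ) ≤ (M : ℝ) := by push_cast [M]; linarith
      exact_mod_cast this
  simp only [mem_iUnion]
  refine ⟨(⌊((k:ℝ) + 1) * p.1⌋, ⌊((k:ℝ) + 1) * p.2⌋), ?_, hp, rfl, rfl⟩
  rw [Finset.mem_product, Finset.mem_Icc, Finset.mem_Icc]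
  exact ⟨key _ hn.1, key _ hn.2⟩

lemma loc_bound (τ : TriP) (k : ℕ) : ∃ F : Finset (ℤ × ℤ), ∀ f, Cl τ f →
    ∫ p in τ.Om, f p ^ 2 ≤ ∑ c ∈ F, (∫ p in cell τ k c, f p) ^ 2 / volume.real (cell τ k c)
      + 4 * (1 / ((k:ℝ) + 1)) ^ 2 * ∫ p in τ.Om, gsq τ.S f p := by
  obtain ⟨F, hF⟩ := cell_cover τ k
  refine ⟨F, fun f hf => ?_⟩
  have sp : ∀ g : ℝ × ℝ → ℝ, IntegrableOn g τ.Om → ∫ p in τ.Om, g p = ∑ c ∈ F, ∫ p in cell τ k c, g p := by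
    intro g hg
    conv_lhs => rw [hF]
    exact integral_biUnion_finset F (fun c _ => cell_meas k c) (fun c _ d _ h => cell_disj k h)
      (fun c _ => hg.mono_set (cell_sub k c))
  rw [sp _ hf.i0, sp _ hf.ig, Finset.mul_sum, ← Finset.sum_add_distrib]
  refine Finset.sum_le_sum (fun c _ => ?_)
  have h := poinc hf (cell_meas k c) (cell_convex k c) (cell_sub k c) (cell_diam k c)
  have G0 : 0 ≤ ∫ p in cell τ k c, gsq τ.S f p := integral_nonneg (fun y => gsq_nonneg _ _ _)
  have hv : volume (cell τ k c) < ⊤ := (measure_mono (cell_sub k c)).trans_lt vol_Om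
  rcases (measureReal_nonneg (μ := volume) (s := cell τ k c)).eq_or_lt with h0 | h0
  · have : volume (cell τ k c) = 0 := by
      rw [Measure.real, eq_comm, ENNReal.toReal_eq_zero_iff] at h0
      exact h0.resolve_right hv.ne
    rw [Measure.restrict_eq_zero.mpr this]; simp
  · rw [← sub_le_iff_le_add, le_div_iff₀ h0]
    linarith

lemma Cl.gsub {f g : ℝ × ℝ → ℝ} (hf : Cl τ f) (hg : Cl τ g) :
    ∫ p in τ.Om, gsq τ.S (fun p => f p + (-1) * g p) p ≤ 2 * (∫ p in τ.Om, gsq τ.S f p) + 2 * ∫ p in τ.Om, gsq τ.S g p := by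
  rw [← integral_const_mul, ← integral_const_mul, ← integral_add (hf.ig.const_mul 2) (hg.ig.const_mul 2)]
  refine setIntegral_mono_on (hf.comb hg (-1)).ig ((hf.ig.const_mul 2).add (hg.ig.const_mul 2)) τ.isOpen_Om.measurableSet (fun p hp => ?_)
  simp only [gsq, Cl.comb_dX hf hg (-1) (τ.Om_sub_S hp), Cl.comb_dY hf hg (-1) (τ.Om_sub_S hp)]
  nlinarith [sq_nonneg (dX τ.S f p + dX τ.S g p), sq_nonneg (dY τ.S f p + dY τ.S g p)]

/-- Rellich -/
theorem rellich {f : ℕ → ℝ × ℝ → ℝ} (hf : ∀ n, Cl τ (f n)) {K : ℝ} (h0 : ∀ n, ∫ p in τ.Om, f n p ^ 2 ≤ 1)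
    (h1 : ∀ n, ∫ p in τ.Om, gsq τ.S (f n) p ≤ K) :
    ∃ s : ℕ → ℕ, StrictMono s ∧ ∀ ε > 0, ∃ N, ∀ n ≥ N, ∀ l ≥ N, ∫ p in τ.Om, (f (s n) p + (-1) * f (s l) p) ^ 2 ≤ ε := by
  set M := (1 + volume.real τ.Om) with hM
  set a : ℕ → (ℕ × ℤ × ℤ) → ℝ := fun n c => ∫ p in cell τ c.1 c.2, f n p with ha
  have K0 : 0 ≤ K := (integral_nonneg (fun y => gsq_nonneg _ _ _)).trans (h1 0)
  have hb : ∀ n, a n ∈ Set.pi univ (fun _ : ℕ × ℤ × ℤ => Icc (-M) M) := by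
    intro n c _
    show a n c ∈ Icc (-M) M
    rw [mem_Icc, ← abs_le]
    have i1 := (hf n).i1
    calc |a n c| ≤ ∫ p in cell τ c.1 c.2, |f n p| := norm_integral_le_integral_norm (f n)
      _ ≤ ∫ p in τ.Om, |f n p| := setIntegral_mono_set i1.abs (Eventually.of_forall (fun p => abs_nonneg _))
          (Eventually.of_forall (cell_sub c.1 c.2))
      _ ≤ ∫ p in τ.Om, (f n p ^ 2 + 1) := by
          refine integral_mono i1.abs ((hf n).i0.add (int_one 1)) (fun p => ?_)
          show |f n p| ≤ f n p ^ 2 + 1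
          rw [← sq_abs]; nlinarith [sq_nonneg (|f n p| - 1)]
      _ ≤ M := by
          rw [integral_add (hf n).i0 (int_one 1), setIntegral_const, smul_eq_mul, mul_one, hM]
          linarith [h0 n]
  obtain ⟨A, -, s, hs, hA⟩ := (isCompact_univ_pi (fun _ => isCompact_Icc)).tendsto_subseq hb
  refine ⟨s, hs, fun ε hε => ?_⟩
  obtain ⟨k, hk⟩ := exists_nat_gt (32 * K / ε + 1)
  obtain ⟨F, hF⟩ := loc_bound τ k
  have lim : Tendsto (fun q : ℕ × ℕ => ∑ c ∈ F, (a (s q.1) (k, c) + (-1) * a (s q.2) (k, c)) ^ 2 / volume.real (cell τ k c))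
      (atTop ×ˢ atTop) (𝓝 (∑ c ∈ F, (A (k, c) + (-1) * A (k, c)) ^ 2 / volume.real (cell τ k c))) := by
    refine tendsto_finsetSum _ (fun c _ => ?_)
    have hc : Tendsto (fun n => a (s n) (k, c)) atTop (𝓝 (A (k, c))) := (tendsto_pi_nhds.mp hA) (k, c)
    exact (((hc.comp tendsto_fst).add ((hc.comp tendsto_snd).const_mul (-1))).pow 2).div_const _
  have z : ∑ c ∈ F, (A (k, c) + (-1) * A (k, c)) ^ 2 / volume.real (cell τ k c) = 0 :=
    Finset.sum_eq_zero (fun c _ => by simp)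
  rw [z, prod_atTop_atTop_eq] at lim
  obtain ⟨N, hN⟩ := eventually_atTop_prod_self.mp (lim.eventually_le_const (show (0:ℝ) < ε / 2 by positivity))
  refine ⟨N, fun n hn l hl => ?_⟩
  have hc := (hf (s n)).comb (hf (s l)) (-1)
  have e : ∀ c, ∫ p in cell τ k c, (f (s n) p + (-1) * f (s l) p) = a (s n) (k, c) + (-1) * a (s l) (k, c) := by
    intro c
    rw [integral_add ((hf _).i1.mono_set (cell_sub k c)) (((hf _).i1.mono_set (cell_sub k c)).const_mul _), integral_const_mul]
  have b := hF _ hc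
  simp only [e] at b
  have b2 := hN n l hn hl
  simp only at b2
  have b3 := Cl.gsub (hf (s n)) (hf (s l))
  have b4 : ∫ p in τ.Om, gsq τ.S (fun p => f (s n) p + (-1) * f (s l) p) p ≤ 4 * K := by linarith [h1 (s n), h1 (s l)]
  have hk1 : (0:ℝ) < (k:ℝ) + 1 := by positivity
  have b5 : 4 * (1 / ((k:ℝ) + 1)) ^ 2 * (∫ p in τ.Om, gsq τ.S (fun p => f (s n) p + (-1) * f (s l) p) p) ≤ ε / 2 := by
    have : 4 * (1 / ((k:ℝ) + 1)) ^ 2 * (∫ p in τ.Om, gsq τ.S (fun p => f (s n) p + (-1) * f (s l) p) p) ≤ 4 * (1 / ((k:ℝ) + 1)) ^ 2 * (4 * K) := by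
      gcongr
    refine this.trans ?_
    have h3 : 32 * K ≤ ε * ((k:ℝ) + 1) := by
      have : 32 * K / ε < (k:ℝ) + 1 := by linarith
      rw [div_lt_iff₀ hε] at this; linarith
    have h4 : (1:ℝ) ≤ (k:ℝ) + 1 := by linarith [Nat.cast_nonneg (α := ℝ) k]
    rw [one_div, inv_pow, show 4 * (((k:ℝ) + 1) ^ 2)⁻¹ * (4 * K) = (16 * K) / ((k:ℝ) + 1) ^ 2 by ring, div_le_iff₀ (by positivity)]
    nlinarith [mul_le_mul_of_nonneg_left h4 (mul_pos hε hk1).le]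
  linarith

end NZ

namespace NZ

open MeasureTheory Filter Topology

lemma L2_complete {X : Type*} [MeasurableSpace X] {ν : Measure X} {g : ℕ → X → ℝ} (hg : ∀ n, MemLp (g n) 2 ν)
    (hc : ∀ ε > 0, ∃ N, ∀ n ≥ N, ∀ l ≥ N, ∫ p, (g n p + (-1) * g l p) ^ 2 ∂ν ≤ ε) :
    ∃ F, MemLp F 2 ν ∧ (∀ ψ, MemLp ψ 2 ν → Tendsto (fun n => ∫ p, g n p * ψ p ∂ν) atTop (𝓝 (∫ p, F p * ψ p ∂ν))) ∧
      Tendsto (fun n => ∫ p, g n p ^ 2 ∂ν) atTop (𝓝 (∫ p, F p ^ 2 ∂ν)) := by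
  set G : ℕ → Lp ℝ 2 ν := fun n => (hg n).toLp (g n) with hG
  have inn : ∀ a b : Lp ℝ 2 ν, inner ℝ a b = ∫ p, a p * b p ∂ν := by
    intro a b
    rw [L2.inner_def]
    refine integral_congr_ae (Eventually.of_forall (fun p => ?_))
    simp [mul_comm]
  have hd : ∀ n l, dist (G n) (G l) ^ 2 = ∫ p, (g n p + (-1) * g l p) ^ 2 ∂ν := by
    intro n l
    rw [dist_eq_norm, ← real_inner_self_eq_norm_sq, inn]
    refine integral_congr_ae ?_
    filter_upwards [Lp.coeFn_sub (G n) (G l), (hg n).coeFn_toLp, (hg l).coeFn_toLp] with p h1 h2 h3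
    rw [h1, Pi.sub_apply, h2, h3]; ring
  have cau : CauchySeq G := by
    rw [Metric.cauchySeq_iff]
    intro ε hε
    obtain ⟨N, hN⟩ := hc ((ε / 2) ^ 2) (by positivity)
    refine ⟨N, fun n hn l hl => ?_⟩
    have := hN n hn l hl
    rw [← hd] at this
    have := abs_le_of_sq_le_sq this (by positivity)
    linarith [le_abs_self (dist (G n) (G l))]
  obtain ⟨F, hF⟩ := cauchySeq_tendsto_of_complete cau
  refine ⟨F, Lp.memLp F, fun ψ hψ => ?_, ?_⟩
  · have h := hF.inner (tendsto_const_nhds (x := hψ.toLp ψ)) (𝕜 := ℝ)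
    simp only [inn] at h
    have e1 : ∫ p, F p * (hψ.toLp ψ) p ∂ν = ∫ p, F p * ψ p ∂ν := by
      refine integral_congr_ae ?_
      filter_upwards [hψ.coeFn_toLp] with p h3
      rw [h3]
    have e2 : ∀ n, ∫ p, (G n) p * (hψ.toLp ψ) p ∂ν = ∫ p, g n p * ψ p ∂ν := fun n => by
      refine integral_congr_ae ?_
      filter_upwards [hψ.coeFn_toLp, (hg n).coeFn_toLp] with p h3 h4
      rw [h3, h4]
    simpa only [e1, e2] using h
  · have h := hF.inner hF (𝕜 := ℝ)
    simp only [inn] at h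
    have e2 : ∀ n, ∫ p, (G n) p * (G n) p ∂ν = ∫ p, g n p ^ 2 ∂ν := fun n => by
      refine integral_congr_ae ?_
      filter_upwards [(hg n).coeFn_toLp] with p h4
      rw [h4]; ring
    have e1 : ∫ p, F p * F p ∂ν = ∫ p, F p ^ 2 ∂ν := by simp only [pow_two]
    simpa only [e1, e2] using h

lemma cd_dX {φ : ℝ × ℝ → ℝ} (hφ : ContDiff ℝ (⊤ : ℕ∞) φ) : ContDiff ℝ (⊤ : ℕ∞) (dX univ φ) :=
  contDiffOn_univ.mp (Sm.dX good_univ hφ.contDiffOn)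
lemma cd_dY {φ : ℝ × ℝ → ℝ} (hφ : ContDiff ℝ (⊤ : ℕ∞) φ) : ContDiff ℝ (⊤ : ℕ∞) (dY univ φ) :=
  contDiffOn_univ.mp (Sm.dY good_univ hφ.contDiffOn)

variable {τ : TriP}

lemma cont_int {f : ℝ × ℝ → ℝ} (hf : Continuous f) : IntegrableOn f τ.Om :=
  (hf.continuousOn.integrableOn_compact τ.isCompact_T).mono_set (τ.Om_sub_S.trans τ.S_sub_T)

lemma cont_L2 {f : ℝ × ℝ → ℝ} (hf : Continuous f) : MemLp f 2 (volume.restrict τ.Om) := by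
  rw [memLp_two_iff_integrable_sq hf.aestronglyMeasurable]
  exact cont_int (hf.pow 2)

lemma Sm_L2 {f : ℝ × ℝ → ℝ} (hf : Sm τ.S f) (h : IntegrableOn (fun p => f p ^ 2) τ.Om) :
    MemLp f 2 (volume.restrict τ.Om) := by
  rw [memLp_two_iff_integrable_sq ((hf.cont.mono τ.Om_sub_S).aestronglyMeasurable τ.isOpen_Om.measurableSet)]
  exact h

/-- integration by parts against a smooth tangential field -/
lemma ibp {f χ1 χ2 : ℝ × ℝ → ℝ} (hf : Cl τ f) (h1 : ContDiff ℝ (⊤ : ℕ∞) χ1) (h2 : ContDiff ℝ (⊤ : ℕ∞) χ2)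
    (z1 : ∀ P ∈ τ.V, ∀ᶠ p in 𝓝 P, χ1 p = 0) (z2 : ∀ P ∈ τ.V, ∀ᶠ p in 𝓝 P, χ2 p = 0)
    (b1 : ∀ x, χ2 (x, 0) = 0) (b2 : ∀ p, τ.l2 p = 0 → τ.h * χ1 p - τ.a * χ2 p = 0)
    (b3 : ∀ p, τ.l3 p = 0 → τ.h * χ1 p + (τ.L - τ.a) * χ2 p = 0) :
    ∫ p in τ.Om, (χ1 p * dX τ.S f p + χ2 p * dY τ.S f p) = -∫ p in τ.Om, f p * (dX univ χ1 p + dY univ χ2 p) := by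
  have key := div_thm τ (sm_T_of_cut hf.sm h1 z1) (sm_T_of_cut hf.sm h2 z2)
    (fun p _ hl => by linear_combination f p * b2 p hl) (fun p _ hl => by linear_combination f p * b3 p hl)
  simp only [b1, zero_mul, intervalIntegral.integral_zero, neg_zero] at key
  have c1 : Continuous (dX univ χ1) := (cd_dX h1).continuous
  have c2 : Continuous (dY univ χ2) := (cd_dY h2).continuous
  have i1 : IntegrableOn (fun p => χ1 p * dX τ.S f p + χ2 p * dY τ.S f p) τ.Om :=
    ((cont_L2 h1.continuous).integrable_mul (Sm_L2 (hf.sm.dX τ.good_S) hf.ix)).add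
      ((cont_L2 h2.continuous).integrable_mul (Sm_L2 (hf.sm.dY τ.good_S) hf.iy))
  have i2 : IntegrableOn (fun p => f p * (dX univ χ1 p + dY univ χ2 p)) τ.Om :=
    (Sm_L2 hf.sm hf.i0).integrable_mul (cont_L2 (c1.add c2))
  rw [eq_neg_iff_add_eq_zero, ← integral_add i1 i2, ← key]
  refine setIntegral_congr_fun τ.isOpen_Om.measurableSet (fun p hp => ?_)
  have hpS := τ.Om_sub_S hp
  have hiS : p ∈ interior τ.S := by rw [τ.interior_S]; exact hp
  have hiT : p ∈ interior τ.T := by rw [τ.interior_T]; exact hp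
  have s1 : Sm τ.S χ1 := h1.contDiffOn
  have s2 : Sm τ.S χ2 := h2.contDiffOn
  rw [dX_int hiT, dY_int hiT, ← dX_int hiS (f := fun q => χ1 q * f q), ← dY_int hiS (f := fun q => χ2 q * f q),
    dX_mul τ.good_S s1 hf.sm hpS, dY_mul τ.good_S s2 hf.sm hpS, dX_int hiS (f := χ1), dY_int hiS (f := χ2)]
  ring

lemma Cl.scale {f : ℝ × ℝ → ℝ} (hf : Cl τ f) (c : ℝ) : Cl τ (fun p => c * f p) ∧
    (∫ p in τ.Om, c * f p = c * ∫ p in τ.Om, f p) ∧ (∫ p in τ.Om, (c * f p) ^ 2 = c ^ 2 * ∫ p in τ.Om, f p ^ 2) ∧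
    ∫ p in τ.Om, gsq τ.S (fun p => c * f p) p = c ^ 2 * ∫ p in τ.Om, gsq τ.S f p := by
  refine ⟨?_, integral_const_mul _ _, ?_, ?_⟩
  · have := (Cl.const (τ := τ) 0).comb hf c
    simpa using this
  · rw [← integral_const_mul]; simp only [mul_pow]
  · rw [← integral_const_mul]
    refine setIntegral_congr_fun τ.isOpen_Om.measurableSet (fun p hp => ?_)
    simp only [gsq, dX_const_mul τ.good_S c hf.sm (τ.Om_sub_S hp), dY_const_mul τ.good_S c hf.sm (τ.Om_sub_S hp)]
    ring

lemma Cl.BF_self {f : ℝ × ℝ → ℝ} (hf : Cl τ f) (m : ℝ) :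
    BF τ m f f = (∫ p in τ.Om, gsq τ.S f p) - m * ∫ p in τ.Om, f p ^ 2 := by
  rw [← integral_const_mul, ← integral_sub hf.ig (hf.i0.const_mul m)]
  unfold BF
  congr 1; ext p; simp only [gsq]; ring

lemma cl_smooth {φ : ℝ × ℝ → ℝ} (hφ : ContDiff ℝ (⊤ : ℕ∞) φ) : Cl τ φ := by
  have c1 : Continuous (dX univ φ) := (cd_dX hφ).continuous
  have c2 : Continuous (dY univ φ) := (cd_dY hφ).continuous
  refine ⟨hφ.contDiffOn, cont_int (hφ.continuous.pow 2), ?_, ?_⟩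
  · refine (cont_int (c1.pow 2)).congr_fun (fun p hp => ?_) τ.isOpen_Om.measurableSet
    simp only [dX_int (show p ∈ interior τ.S by rw [τ.interior_S]; exact hp), Pi.pow_apply]
  · refine (cont_int (c2.pow 2)).congr_fun (fun p hp => ?_) τ.isOpen_Om.measurableSet
    simp only [dY_int (show p ∈ interior τ.S by rw [τ.interior_S]; exact hp), Pi.pow_apply]

lemma vol_Om_pos : 0 < volume.real τ.Om := by
  rw [Measure.real, ENNReal.toReal_pos_iff]
  exact ⟨τ.isOpen_Om.measure_pos _ ⟨_, τ.Om_nonempty⟩, vol_Om⟩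

lemma normalise {f : ℝ × ℝ → ℝ} (hf : Cl τ f) (h0 : ∫ p in τ.Om, f p = 0) (h1 : 0 < ∫ p in τ.Om, f p ^ 2) :
    ∃ g, Cl τ g ∧ ∫ p in τ.Om, g p = 0 ∧ ∫ p in τ.Om, g p ^ 2 = 1 ∧
      (∫ p in τ.Om, gsq τ.S g p) * (∫ p in τ.Om, f p ^ 2) = ∫ p in τ.Om, gsq τ.S f p := by
  set c := (Real.sqrt (∫ p in τ.Om, f p ^ 2))⁻¹ with hc
  have hc2 : c ^ 2 * (∫ p in τ.Om, f p ^ 2) = 1 := by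
    rw [hc, inv_pow, Real.sq_sqrt h1.le]; field_simp
  obtain ⟨a1, a2, a3, a4⟩ := hf.scale c
  refine ⟨_, a1, by rw [a2, h0, mul_zero], by rw [a3, hc2], ?_⟩
  rw [a4]; linear_combination (∫ p in τ.Om, gsq τ.S f p) * hc2

/-- weak minimiser data -/
structure Weak (τ : TriP) (m : ℝ) (F F1 F2 : ℝ × ℝ → ℝ) : Prop where
  hm : 0 < m
  l0 : MemLp F 2 (volume.restrict τ.Om)
  l1 : MemLp F1 2 (volume.restrict τ.Om)
  l2 : MemLp F2 2 (volume.restrict τ.Om)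
  mean : ∫ p in τ.Om, F p = 0
  norm : ∫ p in τ.Om, F p ^ 2 = 1
  weak : ∀ φ, ContDiff ℝ (⊤ : ℕ∞) φ → (∀ P ∈ τ.V, ∀ᶠ p in 𝓝 P, φ p = 0) →
    (∀ x, dY univ φ (x, 0) = 0) → (∀ p, τ.l2 p = 0 → τ.h * dX univ φ p - τ.a * dY univ φ p = 0) →
    (∀ p, τ.l3 p = 0 → τ.h * dX univ φ p + (τ.L - τ.a) * dY univ φ p = 0) →
    ∫ p in τ.Om, F p * (lap φ p + m * φ p) = 0
  gx : ∀ ψ, ContDiff ℝ (⊤ : ℕ∞) ψ → tsupport ψ ⊆ τ.Om → ∫ p in τ.Om, F1 p * ψ p = -∫ p in τ.Om, F p * dX univ ψ p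
  gy : ∀ ψ, ContDiff ℝ (⊤ : ℕ∞) ψ → tsupport ψ ⊆ τ.Om → ∫ p in τ.Om, F2 p * ψ p = -∫ p in τ.Om, F p * dY univ ψ p

lemma dX_near {φ : ℝ × ℝ → ℝ} {P : ℝ × ℝ} (h : ∀ᶠ p in 𝓝 P, φ p = 0) : ∀ᶠ p in 𝓝 P, dX univ φ p = 0 := by
  filter_upwards [h.eventually_nhds] with p hp
  have : φ =ᶠ[𝓝 p] fun _ => 0 := hp
  rw [dX_univ_eq]; simp only [this.fderiv_eq]; simp
lemma dY_near {φ : ℝ × ℝ → ℝ} {P : ℝ × ℝ} (h : ∀ᶠ p in 𝓝 P, φ p = 0) : ∀ᶠ p in 𝓝 P, dY univ φ p = 0 := by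
  filter_upwards [h.eventually_nhds] with p hp
  have : φ =ᶠ[𝓝 p] fun _ => 0 := hp
  rw [dY_univ_eq]; simp only [this.fderiv_eq]; simp

theorem minimizer {μ : ℝ} {f0 : ℝ × ℝ → ℝ} (hf0 : Cl τ f0) (h0 : ∫ p in τ.Om, f0 p = 0) (hneg : BF τ μ f0 f0 < 0)  :
    ∃ m F F1 F2, m < μ ∧ Weak τ m F F1 F2 := by
  have hOm := τ.isOpen_Om.measurableSet
  have D0 : ∀ f, 0 ≤ ∫ p in τ.Om, gsq τ.S f p := fun f => integral_nonneg (fun y => gsq_nonneg _ _ _)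
  set Q : Set ℝ := {q | ∃ f, Cl τ f ∧ ∫ p in τ.Om, f p = 0 ∧ ∫ p in τ.Om, f p ^ 2 = 1 ∧ q = ∫ p in τ.Om, gsq τ.S f p} with hQ
  set m := sInf Q with hm
  -- positivity
  have pos : ∃ c > 0, ∀ q ∈ Q, c ≤ q := by
    obtain ⟨D, hD⟩ := τ.isCompact_T.isBounded.exists_norm_le
    set δ := 2 * (|D| + 1) with hδ
    have hδ0 : 0 < δ := by positivity
    refine ⟨1 / (4 * δ ^ 2), by positivity, ?_⟩
    rintro q ⟨f, hf, hz, hn, rfl⟩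
    have := poinc hf hOm τ.convex_Om subset_rfl (δ := δ) (fun x hx y hy => by
      have a := hD x (τ.S_sub_T (τ.Om_sub_S hx))
      have b := hD y (τ.S_sub_T (τ.Om_sub_S hy))
      rw [Prod.norm_def, max_le_iff, Real.norm_eq_abs, Real.norm_eq_abs] at a b
      have := le_abs_self D
      constructor
      · exact (abs_sub _ _).trans (by linarith [a.1, b.1])
      · exact (abs_sub _ _).trans (by linarith [a.2, b.2]))
    rw [hz, hn] at this
    have hv := vol_Om_pos (τ := τ)
    rw [div_le_iff₀ (by positivity)]
    nlinarith
  obtain ⟨c, hc, hcQ⟩ := pos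
  have bdd : BddBelow Q := ⟨c, hcQ⟩
  have fpos : 0 < ∫ p in τ.Om, f0 p ^ 2 ∧ 0 < μ := by
    rw [hf0.BF_self] at hneg
    have n0 : 0 ≤ ∫ p in τ.Om, f0 p ^ 2 := integral_nonneg (fun y => sq_nonneg _)
    have := D0 f0
    have h1 : 0 < μ * ∫ p in τ.Om, f0 p ^ 2 := by linarith
    rcases n0.eq_or_lt with h | h
    · rw [← h] at h1; simp at h1
    · exact ⟨h, pos_of_mul_pos_left h1 n0⟩
  obtain ⟨g0, k1, k2, k3, k4⟩ := normalise hf0 h0 fpos.1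
  have g0Q : (∫ p in τ.Om, gsq τ.S g0 p) ∈ Q := ⟨g0, k1, k2, k3, rfl⟩
  have neQ : Q.Nonempty := ⟨_, g0Q⟩
  have hm0 : 0 < m := hc.trans_le (le_csInf neQ hcQ)
  have hmμ : m < μ := by
    refine (csInf_le bdd g0Q).trans_lt ?_
    rw [hf0.BF_self, ← k4] at hneg
    have : ((∫ p in τ.Om, gsq τ.S g0 p) - μ) * (∫ p in τ.Om, f0 p ^ 2) < 0 := by linarith
    by_contra hcon
    push Not at hcon
    have := mul_nonneg (sub_nonneg.mpr hcon) fpos.1.le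
    linarith
  have PSD : ∀ f, Cl τ f → ∫ p in τ.Om, f p = 0 → 0 ≤ BF τ m f f := by
    intro f hf hz
    rw [hf.BF_self]
    rcases (integral_nonneg (fun y => sq_nonneg _) : 0 ≤ ∫ p in τ.Om, f p ^ 2).eq_or_lt with h | h
    · rw [← h, mul_zero, sub_zero]; exact D0 f
    · obtain ⟨g, a1, a2, a3, a4⟩ := normalise hf hz h
      rw [← a4]
      have := csInf_le bdd (show (∫ p in τ.Om, gsq τ.S g p) ∈ Q from ⟨g, a1, a2, a3, rfl⟩)
      have := mul_nonneg (sub_nonneg.mpr this) h.le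
      linarith
  have CS : ∀ f g, Cl τ f → Cl τ g → ∫ p in τ.Om, f p = 0 → ∫ p in τ.Om, g p = 0 →
      BF τ m f g ^ 2 ≤ BF τ m f f * BF τ m g g := by
    intro f g hf hg hfz hgz
    have := discrim_le_zero (a := BF τ m g g) (b := 2 * BF τ m f g) (c := BF τ m f f) (fun t => by
      have := PSD _ (hf.comb hg t) (by rw [Cl.int_comb hf hg, hfz, hgz]; ring)
      rw [BF_sq hf hg] at this
      linarith)
    rw [discrim] at this
    linarith
  -- minimizing sequence
  have seq : ∀ n : ℕ, ∃ f, Cl τ f ∧ ∫ p in τ.Om, f p = 0 ∧ ∫ p in τ.Om, f p ^ 2 = 1 ∧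
      ∫ p in τ.Om, gsq τ.S f p < m + 1 / ((n:ℝ) + 1) := by
    intro n
    obtain ⟨q, ⟨f, a1, a2, a3, rfl⟩, hq⟩ := exists_lt_of_csInf_lt neQ (show m < m + 1 / ((n:ℝ) + 1) by
      have : 0 < 1 / ((n:ℝ) + 1) := by positivity
      linarith)
    exact ⟨f, a1, a2, a3, hq⟩
  choose f fC fz fn fD using seq
  obtain ⟨s, hs, hcau⟩ := rellich fC (K := m + 1) (fun n => (fn n).le) (fun n => (fD n).le.trans (by
    have : 1 / ((n:ℝ) + 1) ≤ 1 := by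
      rw [div_le_one (by positivity)]; linarith [Nat.cast_nonneg (α := ℝ) n]
    linarith))
  set g : ℕ → ℝ × ℝ → ℝ := fun n => f (s n) with hgdef
  have gC : ∀ n, Cl τ (g n) := fun n => fC _
  have gz : ∀ n, ∫ p in τ.Om, g n p = 0 := fun n => fz _
  have gn : ∀ n, ∫ p in τ.Om, g n p ^ 2 = 1 := fun n => fn _
  have gB : ∀ n : ℕ, BF τ m (g n) (g n) ≤ 1 / ((n:ℝ) + 1) := by
    intro n
    rw [(gC n).BF_self, gn, mul_one]
    have h1 := fD (s n)
    have h2 : 1 / ((s n : ℕ) + 1 : ℝ) ≤ 1 / ((n:ℝ) + 1) := by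
      have : (n:ℝ) ≤ s n := by exact_mod_cast hs.id_le n
      gcongr
    have h3 : ∫ p in τ.Om, gsq τ.S (g n) p < m + 1 / ((s n : ℕ) + 1 : ℝ) := h1
    linarith
  have lim0 : Tendsto (fun n : ℕ => 1 / ((n:ℝ) + 1)) atTop (𝓝 0) := tendsto_one_div_add_atTop_nhds_zero_nat
  -- gradients Cauchy
  have gcau : ∀ ε > 0, ∃ N, ∀ n ≥ N, ∀ l ≥ N,
      ∫ p in τ.Om, gsq τ.S (fun p => g n p + (-1) * g l p) p ≤ ε := by
    intro ε hε
    obtain ⟨N, hN⟩ := hcau (ε / (2 * m)) (by positivity)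
    obtain ⟨N', hN'⟩ := eventually_atTop.mp (lim0.eventually_le_const (show 0 < ε / 8 by positivity))
    refine ⟨max N N', fun n hn l hl => ?_⟩
    have a1 := hN n (le_of_max_le_left hn) l (le_of_max_le_left hl)
    have a2 := gB n
    have a3 := gB l
    have a4 := hN' n (le_of_max_le_right hn)
    have a5 := hN' l (le_of_max_le_right hl)
    have b1 := ((gC n).comb (gC l) (-1)).BF_self m
    have b2 := PSD _ ((gC n).comb (gC l) 1) (by rw [Cl.int_comb (gC n) (gC l), gz, gz]; ring)
    rw [BF_sq (gC n) (gC l)] at b1 b2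
    have a6 : m * ∫ p in τ.Om, (g n p + (-1) * g l p) ^ 2 ≤ ε / 2 := by
      calc m * ∫ p in τ.Om, (g n p + (-1) * g l p) ^ 2 ≤ m * (ε / (2 * m)) := mul_le_mul_of_nonneg_left a1 hm0.le
        _ = ε / 2 := by field_simp
    linarith
  obtain ⟨F, F0, Fp, Fs⟩ := L2_complete (ν := volume.restrict τ.Om) (g := g) (fun n => Sm_L2 (gC n).sm (gC n).i0) hcau
  obtain ⟨F1, F10, F1p, -⟩ := L2_complete (ν := volume.restrict τ.Om) (g := fun n => dX τ.S (g n))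
    (fun n => Sm_L2 ((gC n).sm.dX τ.good_S) (gC n).ix) (fun ε hε => by
      obtain ⟨N, hN⟩ := gcau ε hε
      refine ⟨N, fun n hn l hl => le_trans (setIntegral_mono_on ?_ ((gC n).comb (gC l) (-1)).ig hOm (fun p hp => ?_)) (hN n hn l hl)⟩
      · refine ((gC n).comb (gC l) (-1)).ix.congr_fun (fun p hp => ?_) hOm
        simp only [Cl.comb_dX (gC n) (gC l) (-1) (τ.Om_sub_S hp)]
      · rw [gsq, Cl.comb_dX (gC n) (gC l) (-1) (τ.Om_sub_S hp)]
        linarith [sq_nonneg (dY τ.S (fun p => g n p + (-1) * g l p) p)])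
  obtain ⟨F2, F20, F2p, -⟩ := L2_complete (ν := volume.restrict τ.Om) (g := fun n => dY τ.S (g n))
    (fun n => Sm_L2 ((gC n).sm.dY τ.good_S) (gC n).iy) (fun ε hε => by
      obtain ⟨N, hN⟩ := gcau ε hε
      refine ⟨N, fun n hn l hl => le_trans (setIntegral_mono_on ?_ ((gC n).comb (gC l) (-1)).ig hOm (fun p hp => ?_)) (hN n hn l hl)⟩
      · refine ((gC n).comb (gC l) (-1)).iy.congr_fun (fun p hp => ?_) hOm
        simp only [Cl.comb_dY (gC n) (gC l) (-1) (τ.Om_sub_S hp)]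
      · rw [gsq, Cl.comb_dY (gC n) (gC l) (-1) (τ.Om_sub_S hp)]
        linarith [sq_nonneg (dX τ.S (fun p => g n p + (-1) * g l p) p)])
  refine ⟨m, F, F1, F2, hmμ, hm0, F0, F10, F20, ?_, ?_, ?_, ?_, ?_⟩
  · have := Fp (fun _ => 1) (cont_L2 continuous_const)
    simp only [mul_one, gz] at this
    exact (tendsto_nhds_unique this tendsto_const_nhds)
  · simp only [gn] at Fs
    exact tendsto_nhds_unique Fs tendsto_const_nhds
  · intro φ hφ hV b1 b2 b3
    have s1 : ContDiff ℝ (⊤ : ℕ∞) (dX univ φ) := cd_dX hφ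
    have s2 : ContDiff ℝ (⊤ : ℕ∞) (dY univ φ) := cd_dY hφ
    have lc : Continuous (lap φ) := by
      have t1 : Continuous (dX univ (dX univ φ)) := (cd_dX s1).continuous
      have t2 : Continuous (dY univ (dY univ φ)) := (cd_dY s2).continuous
      exact t1.add t2
    have φC : Cl τ φ := cl_smooth hφ
    set c := (∫ p in τ.Om, φ p) / volume.real τ.Om with hcd
    have hv := vol_Om_pos (τ := τ)
    have φ'C : Cl τ (fun p => φ p + (-c) * 1) := φC.comb (Cl.const 1) (-c)
    have φ'z : ∫ p in τ.Om, (φ p + (-c) * 1) = 0 := by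
      rw [Cl.int_comb φC (Cl.const 1), setIntegral_const, smul_eq_mul, mul_one, hcd]; field_simp; ring
    have hB : ∀ n, BF τ m (g n) (fun p => φ p + (-c) * 1) = -∫ p in τ.Om, g n p * (lap φ p + m * φ p) := by
      intro n
      rw [Cl.BF_comb φC (Cl.const 1) (gC n)]
      have e1 : BF τ m (g n) (fun _ => 1) = 0 := by
        have : BF τ m (g n) (fun _ => 1) = ∫ p in τ.Om, (-m) * g n p := by
          unfold BF; congr 1; ext p; simp [dX, dY]
        rw [this, integral_const_mul, gz, mul_zero]
      rw [e1, mul_zero, add_zero]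
      have e2 := ibp (gC n) s1 s2 (fun P hP => dX_near (hV P hP)) (fun P hP => dY_near (hV P hP)) b1 b2 b3
      have i1 : IntegrableOn (fun p => dX univ φ p * dX τ.S (g n) p + dY univ φ p * dY τ.S (g n) p) τ.Om :=
        ((cont_L2 s1.continuous).integrable_mul (Sm_L2 ((gC n).sm.dX τ.good_S) (gC n).ix)).add
        ((cont_L2 s2.continuous).integrable_mul (Sm_L2 ((gC n).sm.dY τ.good_S) (gC n).iy))
      have i2 : IntegrableOn (fun p => g n p * lap φ p) τ.Om := (Sm_L2 (gC n).sm (gC n).i0).integrable_mul (cont_L2 lc)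
      have i3 : IntegrableOn (fun p => m * (g n p * φ p)) τ.Om := ((Sm_L2 (gC n).sm (gC n).i0).integrable_mul (cont_L2 hφ.continuous)).const_mul m
      have e3 : BF τ m (g n) φ = (∫ p in τ.Om, (dX univ φ p * dX τ.S (g n) p + dY univ φ p * dY τ.S (g n) p))
          - ∫ p in τ.Om, m * (g n p * φ p) := by
        rw [← integral_sub i1 i3]
        refine setIntegral_congr_fun hOm (fun p hp => ?_)
        have hiS : p ∈ interior τ.S := by rw [τ.interior_S]; exact hp
        simp only [dX_int hiS (f := φ), dY_int hiS (f := φ)]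
        ring
      have e4 : ∫ p in τ.Om, g n p * (lap φ p + m * φ p) = (∫ p in τ.Om, g n p * lap φ p) + ∫ p in τ.Om, m * (g n p * φ p) := by
        rw [← integral_add i2 i3]; congr 1; ext p; ring
      rw [e3, e4, e2]
      simp only [lap]
      ring
    have l1 : Tendsto (fun n => BF τ m (g n) (fun p => φ p + (-c) * 1)) atTop (𝓝 0) := by
      have : Tendsto (fun n => BF τ m (g n) (fun p => φ p + (-c) * 1) ^ 2) atTop (𝓝 0) := by
        refine squeeze_zero (fun n => sq_nonneg _) (fun n => (CS _ _ (gC n) φ'C (gz n) φ'z).trans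
          (mul_le_mul_of_nonneg_right (gB n) (PSD _ φ'C φ'z))) ?_
        simpa using lim0.mul_const (BF τ m (fun p => φ p + (-c) * 1) (fun p => φ p + (-c) * 1))
      have h2 := (Real.continuous_sqrt.tendsto 0).comp this
      simp only [Function.comp_def, Real.sqrt_sq_eq_abs, Real.sqrt_zero] at h2
      exact (tendsto_zero_iff_abs_tendsto_zero _).mpr h2
    have l2 := (Fp _ (cont_L2 (lc.add (hφ.continuous.const_mul m)))).neg
    have l3 := tendsto_nhds_unique (l1.congr hB) l2
    simp only [Pi.add_apply] at l3
    linarith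
  · intro ψ hψ hsup
    have nV : ∀ P ∈ τ.V, ∀ᶠ p in 𝓝 P, ψ p = 0 := fun P hP =>
      notMem_tsupport_iff_eventuallyEq.mp (fun h => τ.V_not_Om hP (hsup h))
    have nO : ∀ p, p ∉ τ.Om → ψ p = 0 := fun p hp => image_eq_zero_of_notMem_tsupport (fun h => hp (hsup h))
    have e := fun n => ibp (gC n) hψ (contDiff_const (c := (0:ℝ))) nV (fun P _ => by simp) (fun x => rfl)
      (fun p hp => by rw [nO p (fun h => by rw [TriP.Om] at h; exact absurd h.2.1 (by rw [hp]; simp))]; simp)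
      (fun p hp => by rw [nO p (fun h => by rw [TriP.Om] at h; exact absurd h.2.2 (by rw [hp]; simp))]; simp)
    have c1 : Continuous (dX univ ψ) := (cd_dX hψ).continuous
    have z : ∀ p, dY univ (fun _ : ℝ × ℝ => (0:ℝ)) p = 0 := fun p => by simp [dY]
    simp only [zero_mul, add_zero, z] at e
    refine tendsto_nhds_unique (F1p ψ (cont_L2 hψ.continuous)) ((Fp _ (cont_L2 c1)).neg.congr (fun n => ?_))
    rw [← e n]; congr 1; ext p; ring
  · intro ψ hψ hsup
    have nV : ∀ P ∈ τ.V, ∀ᶠ p in 𝓝 P, ψ p = 0 := fun P hP =>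
      notMem_tsupport_iff_eventuallyEq.mp (fun h => τ.V_not_Om hP (hsup h))
    have nO : ∀ p, p ∉ τ.Om → ψ p = 0 := fun p hp => image_eq_zero_of_notMem_tsupport (fun h => hp (hsup h))
    have e := fun n => ibp (gC n) (contDiff_const (c := (0:ℝ))) hψ (fun P _ => by simp) nV
      (fun x => nO _ (fun h => by rw [TriP.Om] at h; exact absurd h.1 (by simp)))
      (fun p hp => by rw [nO p (fun h => by rw [TriP.Om] at h; exact absurd h.2.1 (by rw [hp]; simp))]; simp)
      (fun p hp => by rw [nO p (fun h => by rw [TriP.Om] at h; exact absurd h.2.2 (by rw [hp]; simp))]; simp)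
    have c1 : Continuous (dY univ ψ) := (cd_dY hψ).continuous
    have z : ∀ p, dX univ (fun _ : ℝ × ℝ => (0:ℝ)) p = 0 := fun p => by simp [dX]
    simp only [zero_mul, zero_add, z] at e
    refine tendsto_nhds_unique (F2p ψ (cont_L2 hψ.continuous)) ((Fp _ (cont_L2 c1)).neg.congr (fun n => ?_))
    rw [← e n]; congr 1; ext p; ring

end NZ

namespace NZ

open MeasureTheory Filter Topology

/-- reflection at the line `n1 x + n2 y = d` -/
def rf (n1 n2 d : ℝ) (p : ℝ × ℝ) : ℝ × ℝ :=
  (p.1 - 2 * (n1 * p.1 + n2 * p.2 - d) * n1, p.2 - 2 * (n1 * p.1 + n2 * p.2 - d) * n2)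

section
variable {n1 n2 d : ℝ}

lemma rf_rf (hn : n1 ^ 2 + n2 ^ 2 = 1) (p : ℝ × ℝ) : rf n1 n2 d (rf n1 n2 d p) = p := by
  ext
  · simp only [rf]; linear_combination (4 * n1 * (n1 * p.1 + n2 * p.2 - d)) * hn
  · simp only [rf]; linear_combination (4 * n2 * (n1 * p.1 + n2 * p.2 - d)) * hn

lemma rf_l (hn : n1 ^ 2 + n2 ^ 2 = 1) (p : ℝ × ℝ) :
    n1 * (rf n1 n2 d p).1 + n2 * (rf n1 n2 d p).2 - d = -(n1 * p.1 + n2 * p.2 - d) := by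
  simp only [rf]; linear_combination (-2 * (n1 * p.1 + n2 * p.2 - d)) * hn

lemma rf_fix {p : ℝ × ℝ} (h : n1 * p.1 + n2 * p.2 - d = 0) : rf n1 n2 d p = p := by
  simp [rf, h]

lemma rf_cd : ContDiff ℝ (⊤ : ℕ∞) (rf n1 n2 d) := by unfold rf; fun_prop

lemma rf_has (p : ℝ × ℝ) :
    HasFDerivAt (rf n1 n2 d) ((lin (1 - 2 * n1 ^ 2) (-2 * n1 * n2)).prod (lin (-2 * n1 * n2) (1 - 2 * n2 ^ 2))) p := by
  set A := (lin (1 - 2 * n1 ^ 2) (-2 * n1 * n2)).prod (lin (-2 * n1 * n2) (1 - 2 * n2 ^ 2)) with hA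
  have : HasFDerivAt (fun q => A q + (2 * d * n1, 2 * d * n2)) A p := (ContinuousLinearMap.hasFDerivAt _).add_const _
  refine this.congr_of_eventuallyEq (Eventually.of_forall (fun q => ?_))
  simp only [rf, hA, ContinuousLinearMap.prod_apply, lin_apply]
  ext <;> simp <;> ring

lemma rf_mp (hn : n1 ^ 2 + n2 ^ 2 = 1) : MeasurePreserving (rf n1 n2 d) volume volume := by
  set A := (lin (1 - 2 * n1 ^ 2) (-2 * n1 * n2)).prod (lin (-2 * n1 * n2) (1 - 2 * n2 ^ 2)) with hA
  have hd : LinearMap.det (A : ℝ × ℝ →ₗ[ℝ] ℝ × ℝ) = -1 := by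
    rw [← LinearMap.det_toMatrix (Module.Basis.finTwoProd ℝ), Matrix.det_fin_two]
    simp [LinearMap.toMatrix_apply, hA, lin_apply]
    linear_combination (-2) * hn
  have h1 : MeasurePreserving A volume volume := by
    refine ⟨A.continuous.measurable, ?_⟩
    have := Measure.map_linearMap_addHaar_eq_smul_addHaar (volume : Measure (ℝ × ℝ)) (f := (A : ℝ × ℝ →ₗ[ℝ] ℝ × ℝ)) (by rw [hd]; norm_num)
    rw [hd] at this
    simpa using this
  have h2 := (measurePreserving_add_right (volume : Measure (ℝ × ℝ)) (2 * d * n1, 2 * d * n2)).comp h1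
  convert h2 using 1
  funext q
  simp only [rf, hA, Function.comp_def, ContinuousLinearMap.prod_apply, lin_apply]
  ext <;> simp <;> ring

lemma rf_ball (hn : n1 ^ 2 + n2 ^ 2 = 1) {x0 p : ℝ × ℝ} (hx : n1 * x0.1 + n2 * x0.2 - d = 0) {R : ℝ}
    (hp : p ∈ Metric.ball x0 R) : rf n1 n2 d p ∈ Metric.ball x0 (3 * R) := by
  rw [Metric.mem_ball, dist_eq_norm, Prod.norm_def, max_lt_iff, Real.norm_eq_abs, Real.norm_eq_abs, Prod.fst_sub, Prod.snd_sub] at hp ⊢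
  obtain ⟨h1, h2⟩ := hp
  set a := p.1 - x0.1 with ha
  set b := p.2 - x0.2 with hb
  have e1 : (rf n1 n2 d p).1 - x0.1 = (1 - 2 * n1 ^ 2) * a + (-2 * n1 * n2) * b := by
    simp only [rf, ha, hb]; linear_combination (-2 * n1) * hx
  have e2 : (rf n1 n2 d p).2 - x0.2 = (-2 * n1 * n2) * a + (1 - 2 * n2 ^ 2) * b := by
    simp only [rf, ha, hb]; linear_combination (-2 * n2) * hx
  have k1 : |1 - 2 * n1 ^ 2| ≤ 1 := by rw [abs_le]; constructor <;> nlinarith [sq_nonneg n1, sq_nonneg n2]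
  have k2 : |1 - 2 * n2 ^ 2| ≤ 1 := by rw [abs_le]; constructor <;> nlinarith [sq_nonneg n1, sq_nonneg n2]
  have k3 : |-2 * n1 * n2| ≤ 1 := by rw [abs_le]; constructor <;> nlinarith [sq_nonneg (n1 + n2), sq_nonneg (n1 - n2)]
  have hR : 0 < R := (abs_nonneg _).trans_lt h1
  rw [e1, e2]
  exact ⟨(ba (bm k1 h1.le) (bm k3 h2.le)).trans_lt (by linarith), (ba (bm k3 h1.le) (bm k2 h2.le)).trans_lt (by linarith)⟩

lemma rf_comp_has {φ : ℝ × ℝ → ℝ} (hφ : ContDiff ℝ (⊤ : ℕ∞) φ) (p : ℝ × ℝ) :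
    HasFDerivAt (fun p => φ (rf n1 n2 d p)) (lin ((1 - 2 * n1 ^ 2) * dX univ φ (rf n1 n2 d p) + (-2 * n1 * n2) * dY univ φ (rf n1 n2 d p))
      ((-2 * n1 * n2) * dX univ φ (rf n1 n2 d p) + (1 - 2 * n2 ^ 2) * dY univ φ (rf n1 n2 d p))) p := by
  refine ((cdhas hφ (rf n1 n2 d p)).comp p (rf_has p)).congr_fderiv ?_
  apply lin_ext <;> simp [lin_apply] <;> ring

lemma rf_dX {φ : ℝ × ℝ → ℝ} (hφ : ContDiff ℝ (⊤ : ℕ∞) φ) : dX univ (fun p => φ (rf n1 n2 d p)) = fun p =>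
    (1 - 2 * n1 ^ 2) * dX univ φ (rf n1 n2 d p) + (-2 * n1 * n2) * dY univ φ (rf n1 n2 d p) := by
  funext p
  exact dX_of_has good_univ (mem_univ _) (rf_comp_has hφ p).hasFDerivWithinAt
lemma rf_dY {φ : ℝ × ℝ → ℝ} (hφ : ContDiff ℝ (⊤ : ℕ∞) φ) : dY univ (fun p => φ (rf n1 n2 d p)) = fun p =>
    (-2 * n1 * n2) * dX univ φ (rf n1 n2 d p) + (1 - 2 * n2 ^ 2) * dY univ φ (rf n1 n2 d p) := by
  funext p
  exact dY_of_has good_univ (mem_univ _) (rf_comp_has hφ p).hasFDerivWithinAt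

lemma dX_lc {f g : ℝ × ℝ → ℝ} (hf : ContDiff ℝ (⊤ : ℕ∞) f) (hg : ContDiff ℝ (⊤ : ℕ∞) g) (a b : ℝ) (p : ℝ × ℝ) :
    dX univ (fun p => a * f p + b * g p) p = a * dX univ f p + b * dX univ g p := by
  have h1 : Sm univ f := hf.contDiffOn
  have h2 : Sm univ g := hg.contDiffOn
  rw [dX_add good_univ (contDiffOn_const.mul h1) (contDiffOn_const.mul h2) (mem_univ p), dX_const_mul good_univ a h1 (mem_univ p),
    dX_const_mul good_univ b h2 (mem_univ p)]
lemma dY_lc {f g : ℝ × ℝ → ℝ} (hf : ContDiff ℝ (⊤ : ℕ∞) f) (hg : ContDiff ℝ (⊤ : ℕ∞) g) (a b : ℝ) (p : ℝ × ℝ) :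
    dY univ (fun p => a * f p + b * g p) p = a * dY univ f p + b * dY univ g p := by
  have h1 : Sm univ f := hf.contDiffOn
  have h2 : Sm univ g := hg.contDiffOn
  rw [dY_add good_univ (contDiffOn_const.mul h1) (contDiffOn_const.mul h2) (mem_univ p), dY_const_mul good_univ a h1 (mem_univ p),
    dY_const_mul good_univ b h2 (mem_univ p)]

lemma rf_lap (hn : n1 ^ 2 + n2 ^ 2 = 1) {φ : ℝ × ℝ → ℝ} (hφ : ContDiff ℝ (⊤ : ℕ∞) φ) (p : ℝ × ℝ) :
    lap (fun p => φ (rf n1 n2 d p)) p = lap φ (rf n1 n2 d p) := by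
  have c1 := cd_dX hφ
  have c2 := cd_dY hφ
  simp only [lap, rf_dX hφ, rf_dY hφ]
  have k1 : ContDiff ℝ (⊤ : ℕ∞) (fun p => dX univ φ (rf n1 n2 d p)) := c1.comp rf_cd
  have k2 : ContDiff ℝ (⊤ : ℕ∞) (fun p => dY univ φ (rf n1 n2 d p)) := c2.comp rf_cd
  rw [dX_lc k1 k2, dY_lc k1 k2]
  simp only [rf_dX c1, rf_dX c2, rf_dY c1, rf_dY c2]
  have e : n2 ^ 2 = 1 - n1 ^ 2 := by linarith
  linear_combination (4 * n1 ^ 2 * dX univ (dX univ φ) (rf n1 n2 d p) + 4 * n2 ^ 2 * dY univ (dY univ φ) (rf n1 n2 d p)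
    + 4 * n1 * n2 * (dX univ (dY univ φ) (rf n1 n2 d p) + dY univ (dX univ φ) (rf n1 n2 d p))) * hn

lemma lap_add {f g : ℝ × ℝ → ℝ} (hf : ContDiff ℝ (⊤ : ℕ∞) f) (hg : ContDiff ℝ (⊤ : ℕ∞) g) (p : ℝ × ℝ) :
    lap (fun p => f p + g p) p = lap f p + lap g p := by
  have e : ∀ f g : ℝ × ℝ → ℝ, (fun p => f p + g p) = fun p => 1 * f p + 1 * g p := fun f g => by funext; ring
  have h1 : dX univ (fun p => f p + g p) = fun p => dX univ f p + dX univ g p := by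
    rw [e]; funext p; rw [dX_lc hf hg]; ring
  have h2 : dY univ (fun p => f p + g p) = fun p => dY univ f p + dY univ g p := by
    rw [e]; funext p; rw [dY_lc hf hg]; ring
  rw [lap, h1, h2, e, dX_lc (cd_dX hf) (cd_dX hg), e, dY_lc (cd_dY hf) (cd_dY hg), lap, lap]
  ring
end

lemma lap_cont {φ : ℝ × ℝ → ℝ} (hφ : ContDiff ℝ (⊤ : ℕ∞) φ) : Continuous (lap φ) :=
  (cd_dX (cd_dX hφ)).continuous.add (cd_dY (cd_dY hφ)).continuous

lemma lap_cs {φ : ℝ × ℝ → ℝ} (hc : HasCompactSupport φ) (m : ℝ) : HasCompactSupport (fun p => lap φ p + m * φ p) :=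
  ((cs_dX (cs_dX hc)).add (cs_dY (cs_dY hc))).add hc.mul_left

variable {τ : TriP}

lemma ind_int {F : ℝ × ℝ → ℝ} (h : MemLp F 2 (volume.restrict τ.Om)) : Integrable (τ.Om.indicator F) := by
  rw [integrable_indicator_iff τ.isOpen_Om.measurableSet]
  have : IsFiniteMeasure (volume.restrict τ.Om) := ⟨by rw [Measure.restrict_apply_univ]; exact vol_Om⟩
  exact h.integrable (by norm_num)

lemma ind_mul {F g : ℝ × ℝ → ℝ} : ∫ p, τ.Om.indicator F p * g p = ∫ p in τ.Om, F p * g p := by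
  rw [← integral_indicator τ.isOpen_Om.measurableSet]
  congr 1; ext p; by_cases h : p ∈ τ.Om <;> simp [h]

lemma local_int {m : ℝ} {F F1 F2 : ℝ × ℝ → ℝ} (hW : Weak τ m F F1 F2) {x0 : ℝ × ℝ} (hx : x0 ∈ τ.Om) :
    ∃ r > 0, ∃ g : ℝ × ℝ → ℝ, ContDiff ℝ (⊤ : ℕ∞) g ∧ (∀ p ∈ Metric.ball x0 r, lap g p = -m * g p) ∧
      (∀ᵐ p, p ∈ Metric.ball x0 r → p ∈ τ.Om → F p = g p) := by
  obtain ⟨R, hR, hb⟩ := Metric.isOpen_iff.mp τ.isOpen_Om x0 hx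
  obtain ⟨g, g1, g2, g3⟩ := weyl (ind_int hW.l0) hW.hm hR (x0 := x0) (fun φ hφ _ hs => by
    have hs' := hs.trans hb
    have nV : ∀ P ∈ τ.V, ∀ᶠ p in 𝓝 P, φ p = 0 := fun P hP =>
      notMem_tsupport_iff_eventuallyEq.mp (fun h => τ.V_not_Om hP (hs' h))
    have nO : ∀ p, p ∉ τ.Om → ∀ᶠ q in 𝓝 p, φ q = 0 := fun p hp => notMem_tsupport_iff_eventuallyEq.mp (fun h => hp (hs' h))
    rw [ind_mul]
    refine hW.weak φ hφ nV (fun x => ?_) (fun p hp => ?_) (fun p hp => ?_)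
    · exact (dY_near (nO _ (fun h => absurd h.1 (by simp)))).self_of_nhds
    · rw [(dX_near (nO p (fun h => absurd h.2.1 (by rw [hp]; simp)))).self_of_nhds,
        (dY_near (nO p (fun h => absurd h.2.1 (by rw [hp]; simp)))).self_of_nhds]; ring
    · rw [(dX_near (nO p (fun h => absurd h.2.2 (by rw [hp]; simp)))).self_of_nhds,
        (dY_near (nO p (fun h => absurd h.2.2 (by rw [hp]; simp)))).self_of_nhds]; ring)
  refine ⟨R / 2, by positivity, g, g1, g2, ?_⟩
  filter_upwards [g3] with p hp h1 h2
  rw [← hp h1, indicator_of_mem h2]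

lemma local_side {m : ℝ} {F F1 F2 : ℝ × ℝ → ℝ} (hW : Weak τ m F F1 F2) {x0 : ℝ × ℝ} {n1 n2 d : ℝ}
    (hn : n1 ^ 2 + n2 ^ 2 = 1) (hx : n1 * x0.1 + n2 * x0.2 - d = 0) {R : ℝ} (hR : 0 < R)
    (hO : ∀ p ∈ Metric.ball x0 R, p ∈ τ.Om → 0 < n1 * p.1 + n2 * p.2 - d)
    (hw : ∀ φ : ℝ × ℝ → ℝ, ContDiff ℝ (⊤ : ℕ∞) φ → tsupport φ ⊆ Metric.ball x0 R →
      (∀ p : ℝ × ℝ, n1 * p.1 + n2 * p.2 - d = 0 → n1 * dX univ φ p + n2 * dY univ φ p = 0) →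
      ∫ p in τ.Om, F p * (lap φ p + m * φ p) = 0) :
    ∃ r > 0, ∃ g : ℝ × ℝ → ℝ, ContDiff ℝ (⊤ : ℕ∞) g ∧ (∀ p ∈ Metric.ball x0 r, lap g p = -m * g p) ∧
      (∀ᵐ p, p ∈ Metric.ball x0 r → p ∈ τ.Om → F p = g p) ∧ n1 * dX univ g x0 + n2 * dY univ g x0 = 0 := by
  set ρ := rf n1 n2 d with hρ
  set G := τ.Om.indicator F with hG
  have hGi : Integrable G := ind_int hW.l0
  have mp : MeasurePreserving ρ volume volume := rf_mp hn
  have hGρ : Integrable (fun p => G (ρ p)) := mp.integrable_comp_of_integrable hGi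
  have emb : MeasurableEmbedding ρ := by
    have : Function.Involutive ρ := rf_rf hn
    exact (MeasurableEquiv.ofInvolutive ρ this rf_cd.continuous.measurable).measurableEmbedding
  obtain ⟨g, g1, g2, g3⟩ := weyl (hGi.add hGρ) hW.hm (R := R / 3) (by positivity) (x0 := x0) (fun φ hφ hc hs => by
    have hcomp : ContDiff ℝ (⊤ : ℕ∞) (fun p => φ (ρ p)) := hφ.comp rf_cd
    have i1 : Integrable (fun p => G p * (lap φ p + m * φ p)) :=
      int_f_mul hGi ((lap_cont hφ).add (hφ.continuous.const_mul m)) (lap_cs hc m)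
    have i2 : Integrable (fun p => G (ρ p) * (lap φ p + m * φ p)) :=
      int_f_mul hGρ ((lap_cont hφ).add (hφ.continuous.const_mul m)) (lap_cs hc m)
    have i3 : Integrable (fun p => G p * (lap φ (ρ p) + m * φ (ρ p))) := by
      have := mp.integrable_comp_of_integrable i2
      refine this.congr (Eventually.of_forall (fun p => ?_))
      simp only [Function.comp_def, hρ, rf_rf hn]
    have e2 : ∫ p, G (ρ p) * (lap φ p + m * φ p) = ∫ p, G p * (lap φ (ρ p) + m * φ (ρ p)) := by
      rw [← mp.integral_comp emb]
      congr 1; ext p; simp only [hρ, rf_rf hn]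
    have e1 : ∫ p, (G + fun p => G (ρ p)) p * (lap φ p + m * φ p) = ∫ p, G p * (lap (fun p => φ p + φ (ρ p)) p + m * (φ p + φ (ρ p))) := by
      have : ∀ p, (G + fun p => G (ρ p)) p * (lap φ p + m * φ p) = G p * (lap φ p + m * φ p) + G (ρ p) * (lap φ p + m * φ p) := fun p => by
        simp only [Pi.add_apply]; ring
      simp only [this]
      rw [integral_add i1 i2, e2, ← integral_add i1 i3]
      congr 1; ext p
      rw [lap_add hφ hcomp, rf_lap hn hφ]; ring
    rw [e1, ind_mul]
    refine hw _ (hφ.add hcomp) ?_ ?_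
    · have hcl : IsClosed (tsupport φ ∪ ρ ⁻¹' (tsupport φ)) :=
        (isClosed_tsupport φ).union ((isClosed_tsupport φ).preimage rf_cd.continuous)
      refine (closure_minimal (fun p hp => ?_) hcl).trans (union_subset (hs.trans (Metric.ball_subset_ball (by linarith))) ?_)
      · by_contra hcon
        rw [mem_union, not_or] at hcon
        apply hp
        simp only []
        rw [image_eq_zero_of_notMem_tsupport hcon.1, image_eq_zero_of_notMem_tsupport hcon.2, add_zero]
      · intro p hp
        have := rf_ball hn hx (hs hp)
        rw [hρ, rf_rf hn] at this
        convert this using 1; ring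
    · intro p hp
      have e : ∀ f g : ℝ × ℝ → ℝ, (fun p => f p + g p) = fun p => 1 * f p + 1 * g p := fun f g => by funext; ring
      rw [e φ, dX_lc hφ hcomp, dY_lc hφ hcomp, rf_dX hφ, rf_dY hφ]
      simp only [rf_fix hp]
      linear_combination (-2 * n1 * dX univ φ p - 2 * n2 * dY univ φ p) * hn)
  refine ⟨R / 6, by positivity, g, g1, fun p hp => g2 p (by convert hp using 1; ring), ?_, ?_⟩
  · filter_upwards [g3] with p hp h1 h2
    have hin : p ∈ Metric.ball x0 (R / 3) := Metric.ball_subset_ball (by linarith) h1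
    rw [← hp (by convert h1 using 1; ring), Pi.add_apply, hG, indicator_of_mem h2, indicator_of_notMem, add_zero]
    intro h3
    have b := rf_ball hn hx hin
    have p1 := hO _ (by convert b using 1; ring) h3
    have p2 := hO p (Metric.ball_subset_ball (by linarith) hin) h2
    rw [rf_l hn] at p1
    linarith
  · have ae : ∀ᵐ p, p ∈ Metric.ball x0 (R / 18) → g (ρ p) = g p := by
      filter_upwards [g3, mp.quasiMeasurePreserving.ae g3] with p h1 h2 hp
      rw [← h1 (Metric.ball_subset_ball (by linarith) hp), ← h2 (Metric.ball_subset_ball (by linarith) (rf_ball hn hx hp))]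
      simp only [Pi.add_apply, hρ, rf_rf hn]; ring
    have eq := Measure.eqOn_open_of_ae_eq (μ := (volume : Measure (ℝ × ℝ))) (f := fun p => g (ρ p)) (g := g) (U := Metric.ball x0 (R / 18))
      ((ae_restrict_iff' Metric.isOpen_ball.measurableSet).mpr ae) Metric.isOpen_ball (g1.comp rf_cd).continuous.continuousOn g1.continuous.continuousOn
    have ev : (fun p => g (ρ p)) =ᶠ[𝓝 x0] g := eq.eventuallyEq_of_mem (Metric.ball_mem_nhds x0 (by positivity))
    have u1 : dX univ (fun p => g (ρ p)) x0 = dX univ g x0 := by simp only [dX_univ_eq, ev.fderiv_eq]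
    have u2 : dY univ (fun p => g (ρ p)) x0 = dY univ g x0 := by simp only [dY_univ_eq, ev.fderiv_eq]
    rw [rf_dX g1] at u1
    rw [rf_dY g1] at u2
    simp only [rf_fix hx] at u1 u2
    linear_combination (-(1:ℝ) / 2) * (n1 * u1 + n2 * u2) - (n1 * dX univ g x0 + n2 * dY univ g x0) * hn

end NZ

namespace NZ

open MeasureTheory Filter Topology

variable {τ : TriP}

lemma local_side' {m : ℝ} {F F1 F2 : ℝ × ℝ → ℝ} (hW : Weak τ m F F1 F2) {x0 : ℝ × ℝ} {n1 n2 d : ℝ}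
    (hn : 0 < n1 ^ 2 + n2 ^ 2) (hx : n1 * x0.1 + n2 * x0.2 - d = 0) {R : ℝ} (hR : 0 < R)
    (hO : ∀ p ∈ τ.Om, 0 < n1 * p.1 + n2 * p.2 - d)
    (hw : ∀ φ : ℝ × ℝ → ℝ, ContDiff ℝ (⊤ : ℕ∞) φ → tsupport φ ⊆ Metric.ball x0 R →
      (∀ p : ℝ × ℝ, n1 * p.1 + n2 * p.2 - d = 0 → n1 * dX univ φ p + n2 * dY univ φ p = 0) →
      ∫ p in τ.Om, F p * (lap φ p + m * φ p) = 0) :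
    ∃ r > 0, ∃ g : ℝ × ℝ → ℝ, ContDiff ℝ (⊤ : ℕ∞) g ∧ (∀ p ∈ Metric.ball x0 r, lap g p = -m * g p) ∧
      (∀ᵐ p, p ∈ Metric.ball x0 r → p ∈ τ.Om → F p = g p) ∧ n1 * dX univ g x0 + n2 * dY univ g x0 = 0 := by
  set k := Real.sqrt (n1 ^ 2 + n2 ^ 2) with hk
  have hk0 : 0 < k := Real.sqrt_pos.mpr hn
  have hk2 : k ^ 2 = n1 ^ 2 + n2 ^ 2 := Real.sq_sqrt hn.le
  have sc : ∀ x y z : ℝ, n1 / k * x + n2 / k * y - z / k = (n1 * x + n2 * y - z) / k := fun x y z => by ring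
  have sc' : ∀ x y : ℝ, n1 / k * x + n2 / k * y = (n1 * x + n2 * y) / k := fun x y => by ring
  obtain ⟨r, hr, g, h1, h2, h3, h4⟩ := local_side hW (x0 := x0) (n1 := n1 / k) (n2 := n2 / k) (d := d / k) (R := R)
    (by rw [div_pow, div_pow, ← add_div, hk2, div_self hn.ne']) (by rw [sc, hx, zero_div]) hR
    (fun p _ hp => by rw [sc]; exact div_pos (hO p hp) hk0)
    (fun φ hφ hs hb => hw φ hφ hs (fun p hp => by
      have := hb p (by rw [sc, hp, zero_div])
      rw [sc', div_eq_zero_iff] at this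
      exact this.resolve_right hk0.ne'))
  refine ⟨r, hr, g, h1, h2, h3, ?_⟩
  rw [sc', div_eq_zero_iff] at h4
  exact h4.resolve_right hk0.ne'

lemma S_cases {p : ℝ × ℝ} (hp : p ∈ τ.S) : p ∈ τ.Om ∨ (p.2 = 0 ∧ 0 < τ.l2 p ∧ 0 < τ.l3 p) ∨
    (0 < p.2 ∧ τ.l2 p = 0 ∧ 0 < τ.l3 p) ∨ (0 < p.2 ∧ 0 < τ.l2 p ∧ τ.l3 p = 0) := by
  obtain ⟨⟨h1, h2, h3⟩, hV⟩ := hp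
  have hL := τ.hL
  have hh := τ.hh
  have v1 : p.2 = 0 → τ.l2 p = 0 → False := fun e1 e2 => hV (by
    rw [TriP.l2, e1] at e2
    have : p.1 = 0 := by
      have : τ.h * p.1 = 0 := by linarith
      exact (mul_eq_zero.mp this).resolve_left hh.ne'
    have : p = (0, 0) := Prod.ext this e1
    rw [this]; exact V_A τ)
  have v2 : p.2 = 0 → τ.l3 p = 0 → False := fun e1 e2 => hV (by
    rw [TriP.l3, e1] at e2
    have : p.1 = τ.L := by
      have : τ.h * (τ.L - p.1) = 0 := by linarith
      linarith [(mul_eq_zero.mp this).resolve_left hh.ne']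
    have : p = (τ.L, 0) := Prod.ext this e1
    rw [this]; exact V_B τ)
  have v3 : τ.l2 p = 0 → τ.l3 p = 0 → False := fun e1 e2 => hV (by
    rw [TriP.l2] at e1
    rw [TriP.l3] at e2
    have k2 : p.2 = τ.h := by
      have : τ.L * (τ.h - p.2) = 0 := by linarith
      linarith [(mul_eq_zero.mp this).resolve_left hL.ne']
    have k1 : p.1 = τ.a := by
      rw [k2] at e1
      have : τ.h * (p.1 - τ.a) = 0 := by linarith
      linarith [(mul_eq_zero.mp this).resolve_left hh.ne']
    have : p = (τ.a, τ.h) := Prod.ext k1 k2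
    rw [this]; exact V_C τ)
  rcases h1.eq_or_lt with e1 | e1 <;> rcases h2.eq_or_lt with e2 | e2 <;> rcases h3.eq_or_lt with e3 | e3
  · exact (v1 e1.symm e2.symm).elim
  · exact (v1 e1.symm e2.symm).elim
  · exact (v2 e1.symm e3.symm).elim
  · exact Or.inr (Or.inl ⟨e1.symm, e2, e3⟩)
  · exact (v3 e2.symm e3.symm).elim
  · exact Or.inr (Or.inr (Or.inl ⟨e1, e2.symm, e3⟩))
  · exact Or.inr (Or.inr (Or.inr ⟨e1, e2, e3.symm⟩))
  · exact Or.inl ⟨e1, e2, e3⟩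

/-- local smooth representative at a point of `S` -/
structure Loc (τ : TriP) (m : ℝ) (F : ℝ × ℝ → ℝ) (x0 : ℝ × ℝ) (r : ℝ) (g : ℝ × ℝ → ℝ) : Prop where
  hr : 0 < r
  cd : ContDiff ℝ (⊤ : ℕ∞) g
  pde : ∀ p ∈ Metric.ball x0 r, lap g p = -m * g p
  ae : ∀ᵐ p, p ∈ Metric.ball x0 r → p ∈ τ.Om → F p = g p
  n1 : x0.2 = 0 → dY univ g x0 = 0
  n2 : τ.l2 x0 = 0 → τ.h * dX univ g x0 - τ.a * dY univ g x0 = 0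
  n3 : τ.l3 x0 = 0 → τ.h * dX univ g x0 + (τ.L - τ.a) * dY univ g x0 = 0

lemma near_two {f k : ℝ × ℝ → ℝ} (hf : Continuous f) (hk : Continuous k) {x0 : ℝ × ℝ} (h1 : 0 < f x0) (h2 : 0 < k x0) :
    ∃ R > 0, ∀ p ∈ Metric.ball x0 R, 0 < f p ∧ 0 < k p :=
  Metric.eventually_nhds_iff_ball.mp ((hf.continuousAt.eventually_const_lt h1).and (hk.continuousAt.eventually_const_lt h2))

lemma tsupp_near {φ : ℝ × ℝ → ℝ} {s : Set (ℝ × ℝ)} (hs : tsupport φ ⊆ s) {p : ℝ × ℝ} (hp : p ∉ s) : ∀ᶠ q in 𝓝 p, φ q = 0 :=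
  notMem_tsupport_iff_eventuallyEq.mp (fun h => hp (hs h))

lemma local_g {m : ℝ} {F F1 F2 : ℝ × ℝ → ℝ} (hW : Weak τ m F F1 F2) {x0 : ℝ × ℝ} (hx : x0 ∈ τ.S) :
    ∃ r g, Loc τ m F x0 r g := by
  have hL := τ.hL
  have hh := τ.hh
  have a1 : τ.l2 (0, 0) = 0 := by simp [TriP.l2]
  have a3 : τ.l3 (τ.L, 0) = 0 := by simp [TriP.l3]
  have b2 : τ.l2 (τ.a, τ.h) = 0 := by simp [TriP.l2]; ring
  have b3 : τ.l3 (τ.a, τ.h) = 0 := by simp [TriP.l3]; ring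
  have z : ∀ {φ : ℝ × ℝ → ℝ} {s : Set (ℝ × ℝ)} (_ : tsupport φ ⊆ s) {p : ℝ × ℝ} (_ : p ∉ s) , dX univ φ p = 0 ∧ dY univ φ p = 0 :=
    fun hs p hp => ⟨(dX_near (tsupp_near hs hp)).self_of_nhds, (dY_near (tsupp_near hs hp)).self_of_nhds⟩
  rcases S_cases hx with h | ⟨h1, h2, h3⟩ | ⟨h1, h2, h3⟩ | ⟨h1, h2, h3⟩
  · obtain ⟨r, hr, g, g1, g2, g3⟩ := local_int hW h
    exact ⟨r, g, hr, g1, g2, g3, fun e => absurd e h.1.ne', fun e => absurd e h.2.1.ne', fun e => absurd e h.2.2.ne'⟩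
  · obtain ⟨R, hR, hB⟩ := near_two τ.cont_l2 τ.cont_l3 h2 h3
    obtain ⟨r, hr, g, g1, g2, g3, g4⟩ := local_side' hW (x0 := x0) (n1 := 0) (n2 := 1) (d := 0) (by norm_num) (by linarith) hR
      (fun p hp => by linarith [hp.1]) (fun φ hφ hs hb => by
        have n2 : ∀ p, τ.l2 p = 0 → p ∉ Metric.ball x0 R := fun p e hp => (hB p hp).1.ne' e
        have n3 : ∀ p, τ.l3 p = 0 → p ∉ Metric.ball x0 R := fun p e hp => (hB p hp).2.ne' e
        refine hW.weak φ hφ ?_ (fun x => ?_) (fun p hp => ?_) (fun p hp => ?_)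
        · rintro P (rfl | rfl | rfl)
          · exact tsupp_near hs (n2 _ a1)
          · exact tsupp_near hs (n3 _ a3)
          · exact tsupp_near hs (n2 _ b2)
        · have := hb (x, 0) (by simp); linarith
        · rw [(z hs (n2 p hp)).1, (z hs (n2 p hp)).2]; ring
        · rw [(z hs (n3 p hp)).1, (z hs (n3 p hp)).2]; ring)
    exact ⟨r, g, hr, g1, g2, g3, fun _ => by linarith, fun e => absurd e h2.ne', fun e => absurd e h3.ne'⟩
  · obtain ⟨R, hR, hB⟩ := near_two continuous_snd τ.cont_l3 h1 h3
    have hx2 := h2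
    rw [TriP.l2] at hx2
    obtain ⟨r, hr, g, g1, g2, g3, g4⟩ := local_side' hW (x0 := x0) (n1 := τ.h) (n2 := -τ.a) (d := 0) (by positivity) (by linarith) hR
      (fun p hp => by have := hp.2.1; rw [TriP.l2] at this; linarith) (fun φ hφ hs hb => by
        have n2 : ∀ p : ℝ × ℝ, p.2 = 0 → p ∉ Metric.ball x0 R := fun p e hp => (hB p hp).1.ne' e
        have n3 : ∀ p, τ.l3 p = 0 → p ∉ Metric.ball x0 R := fun p e hp => (hB p hp).2.ne' e
        refine hW.weak φ hφ ?_ (fun x => ?_) (fun p hp => ?_) (fun p hp => ?_)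
        · rintro P (rfl | rfl | rfl)
          · exact tsupp_near hs (n2 _ rfl)
          · exact tsupp_near hs (n3 _ a3)
          · exact tsupp_near hs (n3 _ b3)
        · exact (z hs (n2 (x, 0) rfl)).2
        · have := hb p (by rw [TriP.l2] at hp; linarith); linarith
        · rw [(z hs (n3 p hp)).1, (z hs (n3 p hp)).2]; ring)
    exact ⟨r, g, hr, g1, g2, g3, fun e => absurd e h1.ne', fun _ => by linarith, fun e => absurd e h3.ne'⟩
  · obtain ⟨R, hR, hB⟩ := near_two continuous_snd τ.cont_l2 h1 h2
    have hx3 := h3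
    rw [TriP.l3] at hx3
    obtain ⟨r, hr, g, g1, g2, g3, g4⟩ := local_side' hW (x0 := x0) (n1 := -τ.h) (n2 := -(τ.L - τ.a)) (d := -(τ.h * τ.L))
      (by have := sq_pos_of_pos hh; nlinarith [sq_nonneg (τ.L - τ.a)]) (by linarith) hR
      (fun p hp => by have := hp.2.2; rw [TriP.l3] at this; linarith) (fun φ hφ hs hb => by
        have n2 : ∀ p : ℝ × ℝ, p.2 = 0 → p ∉ Metric.ball x0 R := fun p e hp => (hB p hp).1.ne' e
        have n3 : ∀ p, τ.l2 p = 0 → p ∉ Metric.ball x0 R := fun p e hp => (hB p hp).2.ne' e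
        refine hW.weak φ hφ ?_ (fun x => ?_) (fun p hp => ?_) (fun p hp => ?_)
        · rintro P (rfl | rfl | rfl)
          · exact tsupp_near hs (n2 _ rfl)
          · exact tsupp_near hs (n2 _ rfl)
          · exact tsupp_near hs (n3 _ b2)
        · exact (z hs (n2 (x, 0) rfl)).2
        · rw [(z hs (n3 p hp)).1, (z hs (n3 p hp)).2]; ring
        · have := hb p (by rw [TriP.l3] at hp; linarith); linarith)
    exact ⟨r, g, hr, g1, g2, g3, fun e => absurd e h1.ne', fun e => absurd e h2.ne', fun _ => by linarith⟩

lemma dS_eq {f g : ℝ × ℝ → ℝ} (hg : ContDiff ℝ (⊤ : ℕ∞) g) {p : ℝ × ℝ} (hp : p ∈ τ.S) (h : f =ᶠ[𝓝[τ.S] p] g) :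
    dX τ.S f p = dX univ g p ∧ dY τ.S f p = dY univ g p := by
  have h1 := ((cdhas hg p).hasFDerivWithinAt (s := τ.S)).congr_of_eventuallyEq h (h.self_of_nhdsWithin hp)
  exact ⟨dX_of_has τ.good_S hp h1, dY_of_has τ.good_S hp h1⟩

lemma loc_eq {m : ℝ} {F : ℝ × ℝ → ℝ} {x y : ℝ × ℝ} {r s : ℝ} {g k : ℝ × ℝ → ℝ} (h1 : Loc τ m F x r g) (h2 : Loc τ m F y s k)
    (hy : y ∈ τ.S) (hb : y ∈ Metric.ball x r) : g y = k y := by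
  set O := Metric.ball x r ∩ Metric.ball y s ∩ τ.Om with hO
  have oO : IsOpen O := (Metric.isOpen_ball.inter Metric.isOpen_ball).inter τ.isOpen_Om
  have e : EqOn g k O := Measure.eqOn_open_of_ae_eq (μ := (volume : Measure (ℝ × ℝ)))
    ((ae_restrict_iff' oO.measurableSet).mpr (by
      filter_upwards [h1.ae, h2.ae] with p p1 p2 hp
      rw [← p1 hp.1.1 hp.2, ← p2 hp.1.2 hp.2])) oO h1.cd.continuous.continuousOn h2.cd.continuous.continuousOn
  have hc : y ∈ closure O := by
    have : y ∈ closure τ.Om := τ.T_sub_closure (τ.S_sub_T hy)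
    exact (Metric.isOpen_ball.inter Metric.isOpen_ball).inter_closure ⟨⟨hb, Metric.mem_ball_self h2.hr⟩, this⟩
  exact e.closure h1.cd.continuous h2.cd.continuous hc

/-- integration by parts against a test function supported in `Om` -/
lemma test_ibp {U ψ : ℝ × ℝ → ℝ} (hU : Sm τ.S U) (hψ : ContDiff ℝ (⊤ : ℕ∞) ψ) (hc : HasCompactSupport ψ) (hs : tsupport ψ ⊆ τ.Om) :
    (∫ p in τ.Om, U p * dX univ ψ p = -∫ p in τ.Om, dX τ.S U p * ψ p) ∧
    (∫ p in τ.Om, U p * dY univ ψ p = -∫ p in τ.Om, dY τ.S U p * ψ p) ∧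
    Integrable (fun p => dX τ.S U p * ψ p) ∧ Integrable (fun p => dY τ.S U p * ψ p) := by
  have hsS : tsupport ψ ⊆ τ.S := hs.trans τ.Om_sub_S
  have ig : ∀ f φ : ℝ × ℝ → ℝ, Sm τ.S f → Continuous φ → (tsupport φ ⊆ tsupport ψ) → Integrable (fun p => f p * φ p) := by
    intro f φ hf hφ hsub
    rw [← integrableOn_iff_integrable_of_support_subset (s := tsupport ψ)]
    · exact ((hf.continuousOn.mono hsS).mul hφ.continuousOn).integrableOn_compact hc
    · exact (Function.support_mul_subset_right f φ).trans ((subset_tsupport φ).trans hsub)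
  have z0 : ∀ f φ : ℝ × ℝ → ℝ, tsupport φ ⊆ tsupport ψ → ∀ p, p ∉ τ.Om → f p * φ p = 0 := fun f φ hφ p hp => by
    rw [image_eq_zero_of_notMem_tsupport (fun h => hp (hs (hφ h))), mul_zero]
  have tx : tsupport (dX univ ψ) ⊆ tsupport ψ := by rw [dX_univ_eq]; exact tsupport_fderiv_apply_subset ℝ _
  have ty : tsupport (dY univ ψ) ⊆ tsupport ψ := by rw [dY_univ_eq]; exact tsupport_fderiv_apply_subset ℝ _
  have mI : ∀ p ∈ τ.Om, p ∈ interior τ.S := fun p hp => by rwa [τ.interior_S]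
  have hd : ∀ p ∈ tsupport ψ, DifferentiableAt ℝ U p := fun p hp => (hU.hasAt (mI p (hs hp))).differentiableAt
  have fx : ∀ v, (fun p => fderiv ℝ U p v * ψ p) = fun p => fderivWithin ℝ U τ.S p v * ψ p := fun v => by
    funext p
    by_cases hp : p ∈ τ.Om
    · rw [fderivWithin_of_mem_nhds (mem_interior_iff_mem_nhds.mp (mI p hp))]
    · rw [z0 (fun p => fderiv ℝ U p v) ψ subset_rfl p hp, z0 (fun p => fderivWithin ℝ U τ.S p v) ψ subset_rfl p hp]
  have i1 := ig _ _ (hU.dX τ.good_S) hψ.continuous subset_rfl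
  have i2 := ig _ _ (hU.dY τ.good_S) hψ.continuous subset_rfl
  have i3 := ig _ _ hU (cd_dX hψ).continuous tx
  have i4 := ig _ _ hU (cd_dY hψ).continuous ty
  have i0 := ig _ _ hU hψ.continuous subset_rfl
  have dψ : Differentiable ℝ ψ := hψ.differentiable (by simp)
  refine ⟨?_, ?_, i1, i2⟩
  · rw [setIntegral_eq_integral_of_forall_compl_eq_zero (z0 _ _ tx), setIntegral_eq_integral_of_forall_compl_eq_zero (z0 _ _ subset_rfl)]
    have := integral_mul_fderiv_eq_neg_fderiv_mul_of_integrable (μ := (volume : Measure (ℝ × ℝ))) (f := U) (g := ψ) (v := (1, 0))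
      (by rw [fx]; exact i1) (by rw [dX_univ_eq] at i3; exact i3) i0 hd (fun x _ => dψ x)
    rw [fx] at this
    rw [dX_univ_eq]; exact this
  · rw [setIntegral_eq_integral_of_forall_compl_eq_zero (z0 _ _ ty), setIntegral_eq_integral_of_forall_compl_eq_zero (z0 _ _ subset_rfl)]
    have := integral_mul_fderiv_eq_neg_fderiv_mul_of_integrable (μ := (volume : Measure (ℝ × ℝ))) (f := U) (g := ψ) (v := (0, 1))
      (by rw [fx]; exact i2) (by rw [dY_univ_eq] at i4; exact i4) i0 hd (fun x _ => dψ x)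
    rw [fx] at this
    rw [dY_univ_eq]; exact this

lemma grad_ae {F1 D U F : ℝ × ℝ → ℝ} {dd : (ℝ × ℝ → ℝ) → ℝ × ℝ → ℝ} (l1 : MemLp F1 2 (volume.restrict τ.Om)) (hD : ContinuousOn D τ.S)
    (hae : ∀ᵐ p, p ∈ τ.Om → F p = U p)
    (gx : ∀ ψ, ContDiff ℝ (⊤ : ℕ∞) ψ → tsupport ψ ⊆ τ.Om → ∫ p in τ.Om, F1 p * ψ p = -∫ p in τ.Om, F p * dd ψ p)
    (hi : ∀ ψ, ContDiff ℝ (⊤ : ℕ∞) ψ → HasCompactSupport ψ → tsupport ψ ⊆ τ.Om →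
      (∫ p in τ.Om, U p * dd ψ p = -∫ p in τ.Om, D p * ψ p) ∧ Integrable (fun p => D p * ψ p)) :
    ∀ᵐ p, p ∈ τ.Om → F1 p = D p := by
  have hOm := τ.isOpen_Om.measurableSet
  have key := τ.isOpen_Om.ae_eq_zero_of_integral_contDiff_smul_eq_zero (μ := (volume : Measure (ℝ × ℝ))) (f := fun p => F1 p - D p) (by
    have h1 : LocallyIntegrableOn F1 τ.Om := by
      have : IntegrableOn F1 τ.Om := by
        have := ind_int l1
        rwa [integrable_indicator_iff hOm] at this
      exact this.locallyIntegrableOn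
    exact h1.sub ((hD.mono τ.Om_sub_S).locallyIntegrableOn hOm)) (fun ψ hψ hc hs => by
    have z0 : ∀ p, p ∉ τ.Om → ψ p • (F1 p - D p) = 0 := fun p hp => by
      rw [image_eq_zero_of_notMem_tsupport (fun h => hp (hs h)), zero_smul]
    obtain ⟨e, i⟩ := hi ψ hψ hc hs
    have i1 : IntegrableOn (fun p => F1 p * ψ p) τ.Om := by
      have h2 : MemLp ψ 2 (volume.restrict τ.Om) := cont_L2 hψ.continuous
      exact l1.integrable_mul h2
    rw [← setIntegral_eq_integral_of_forall_compl_eq_zero z0]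
    have : ∀ p, ψ p • (F1 p - D p) = F1 p * ψ p - D p * ψ p := fun p => by rw [smul_eq_mul]; ring
    simp only [this]
    rw [integral_sub i1 i.integrableOn, gx ψ hψ hs]
    have : ∫ p in τ.Om, F p * dd ψ p = ∫ p in τ.Om, U p * dd ψ p :=
      setIntegral_congr_ae hOm (hae.mono (fun p h hp => by rw [h hp]))
    rw [this, e]; ring)
  exact key.mono (fun p h hp => sub_eq_zero.mp (h hp))

theorem eig_of_weak {m : ℝ} {F F1 F2 : ℝ × ℝ → ℝ} (hW : Weak τ m F F1 F2) : ∃ u, τ.Eig m u := by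
  have hOm := τ.isOpen_Om.measurableSet
  have : ∀ x, ∃ r g, x ∈ τ.S → Loc τ m F x r g := fun x => by
    by_cases hx : x ∈ τ.S
    · obtain ⟨r, g, h⟩ := local_g hW hx; exact ⟨r, g, fun _ => h⟩
    · exact ⟨0, 0, fun h => absurd h hx⟩
  choose r g hl using this
  set U : ℝ × ℝ → ℝ := fun p => g p p with hU
  have eqb : ∀ x ∈ τ.S, ∀ y ∈ τ.S, y ∈ Metric.ball x (r x) → U y = g x y := fun x hx y hy hb =>
    (loc_eq (hl x hx) (hl y hy) hy hb).symm
  have ev : ∀ x ∈ τ.S, ∀ y ∈ τ.S, y ∈ Metric.ball x (r x) → U =ᶠ[𝓝[τ.S] y] g x := fun x hx y hy hb => by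
    filter_upwards [self_mem_nhdsWithin, mem_nhdsWithin_of_mem_nhds (Metric.isOpen_ball.mem_nhds hb)] with z h1 h2
    exact eqb x hx z h1 h2
  have self : ∀ x ∈ τ.S, x ∈ Metric.ball x (r x) := fun x hx => Metric.mem_ball_self (hl x hx).hr
  have sm : Sm τ.S U := fun x hx =>
    ((hl x hx).cd.contDiffWithinAt).congr_of_eventuallyEq (ev x hx x hx (self x hx)) (eqb x hx x hx (self x hx))
  have d1 : ∀ x ∈ τ.S, dX τ.S U =ᶠ[𝓝[τ.S] x] dX univ (g x) := fun x hx => by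
    filter_upwards [self_mem_nhdsWithin, mem_nhdsWithin_of_mem_nhds (Metric.isOpen_ball.mem_nhds (self x hx))] with z h1 h2
    exact (dS_eq (hl x hx).cd h1 (ev x hx z h1 h2)).1
  have d2 : ∀ x ∈ τ.S, dY τ.S U =ᶠ[𝓝[τ.S] x] dY univ (g x) := fun x hx => by
    filter_upwards [self_mem_nhdsWithin, mem_nhdsWithin_of_mem_nhds (Metric.isOpen_ball.mem_nhds (self x hx))] with z h1 h2
    exact (dS_eq (hl x hx).cd h1 (ev x hx z h1 h2)).2
  have pde : ∀ p ∈ τ.Om, dX τ.S (dX τ.S U) p + dY τ.S (dY τ.S U) p = -m * U p := fun p hp => by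
    have hS := τ.Om_sub_S hp
    rw [(dS_eq (cd_dX (hl p hS).cd) hS (d1 p hS)).1, (dS_eq (cd_dY (hl p hS).cd) hS (d2 p hS)).2]
    exact (hl p hS).pde p (self p hS)
  have neu : τ.Neu U := by
    refine ⟨fun p hp e => ?_, fun p hp e => ?_, fun p hp e => ?_⟩
    · rw [(d2 p hp).self_of_nhdsWithin hp]; exact (hl p hp).n1 e
    · rw [(d1 p hp).self_of_nhdsWithin hp, (d2 p hp).self_of_nhdsWithin hp]; exact (hl p hp).n2 e
    · rw [(d1 p hp).self_of_nhdsWithin hp, (d2 p hp).self_of_nhdsWithin hp]; exact (hl p hp).n3 e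
  have hae : ∀ᵐ p, p ∈ τ.Om → F p = U p := by
    rw [ae_iff]
    refine measure_null_of_locally_null _ (fun x hx => ?_)
    simp only [mem_ofPred_eq, Classical.not_imp] at hx
    have hS := τ.Om_sub_S hx.1
    refine ⟨_, inter_mem_nhdsWithin _ (Metric.isOpen_ball.mem_nhds (self x hS)), ?_⟩
    refine measure_mono_null ?_ (ae_iff.mp (hl x hS).ae)
    rintro p ⟨h1, h2⟩
    simp only [mem_ofPred_eq, Classical.not_imp] at h1 ⊢
    exact ⟨h2, h1.1, by rw [← eqb x hS p (τ.Om_sub_S h1.1) h2]; exact h1.2⟩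
  have a1 := grad_ae hW.l1 (sm.dX τ.good_S).continuousOn hae hW.gx (fun ψ h1 h2 h3 => ⟨(test_ibp sm h1 h2 h3).1, (test_ibp sm h1 h2 h3).2.2.1⟩)
  have a2 := grad_ae hW.l2 (sm.dY τ.good_S).continuousOn hae hW.gy (fun ψ h1 h2 h3 => ⟨(test_ibp sm h1 h2 h3).2.1, (test_ibp sm h1 h2 h3).2.2.2⟩)
  have hI : IntegrableOn (gsq τ.S U) τ.Om := by
    have i : IntegrableOn (fun p => F1 p ^ 2 + F2 p ^ 2) τ.Om := hW.l1.integrable_sq.add hW.l2.integrable_sq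
    refine Integrable.congr i ((ae_restrict_iff' hOm).mpr ?_)
    filter_upwards [a1, a2] with p h1 h2 hp
    rw [gsq, h1 hp, h2 hp]
  have hlim : ∀ x ∈ τ.T, ∃ y, Tendsto U (𝓝[τ.S] x) (𝓝 y) := fun x hx => by
    by_cases hV : x ∈ τ.V
    · exact vertex_lim hW.hm.le sm pde neu hI hV
    · exact ⟨_, sm.continuousOn x ⟨hx, hV⟩⟩
  have hcl : τ.T ⊆ closure τ.S := τ.T_sub_closure.trans (closure_mono τ.Om_sub_S)
  set W := extendFrom τ.S U with hWd
  have eq : EqOn W U τ.S := fun x hx => extendFrom_eq (hcl (τ.S_sub_T hx)) (sm.continuousOn x hx)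
  have x1 : EqOn (dX τ.S W) (dX τ.S U) τ.S := fun x hx => dX_congr eq hx
  have x2 : EqOn (dY τ.S W) (dY τ.S U) τ.S := fun x hx => dY_congr eq hx
  refine ⟨W, hW.hm, ?_, continuousOn_extendFrom hcl hlim, sm.congr eq, fun p hp => ?_, ?_⟩
  · rintro ⟨c, hc⟩
    have f : ∀ᵐ p ∂(volume.restrict τ.Om), F p = c := (ae_restrict_iff' hOm).mpr (hae.mono (fun p h hp => by
      rw [h hp, ← eq (τ.Om_sub_S hp), hc p (τ.S_sub_T (τ.Om_sub_S hp))]))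
    have h1 := hW.mean
    have h2 := hW.norm
    rw [integral_congr_ae f] at h1
    rw [integral_congr_ae (f.mono (fun p h => by show F p ^ 2 = c ^ 2; rw [h]))] at h2
    simp only [setIntegral_const, smul_eq_mul] at h1 h2
    have : c = 0 := (mul_eq_zero.mp h1).resolve_left vol_Om_pos.ne'
    rw [this] at h2; norm_num at h2
  · have hS := τ.Om_sub_S hp
    rw [dX_congr x1 hS, dY_congr x2 hS, eq hS]; exact pde p hp
  · refine ⟨fun p hp e => ?_, fun p hp e => ?_, fun p hp e => ?_⟩
    · rw [x2 hp]; exact neu.1 p hp e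
    · rw [x1 hp, x2 hp]; exact neu.2.1 p hp e
    · rw [x1 hp, x2 hp]; exact neu.2.2 p hp e

theorem thmE {μ : ℝ} {f0 : ℝ × ℝ → ℝ} (hf0 : Cl τ f0) (h0 : ∫ p in τ.Om, f0 p = 0) (hneg : BF τ μ f0 f0 < 0) :
    ∃ m u, m < μ ∧ τ.Eig m u := by
  obtain ⟨m, F, F1, F2, hm, hW⟩ := minimizer hf0 h0 hneg
  obtain ⟨u, hu⟩ := eig_of_weak hW
  exact ⟨m, u, hm, hu⟩

/-- the normalised theorem -/
theorem core {μ : ℝ} {U : ℝ × ℝ → ℝ} (hE : τ.Eig μ U) (hmin : ∀ m u, τ.Eig m u → μ ≤ m)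
    (hA : U (0, 0) = 0) (hB : U (τ.L, 0) = 0) : False :=
  contra hE hA hB (fun f hf h0 => by
    by_contra! hc
    obtain ⟨m, u, hm, hu⟩ := thmE hf h0 hc
    exact absurd (hmin m u hu) (not_le.mpr hm))

end NZ

namespace NZ

open MeasureTheory Filter Topology

/-- an orthonormal frame at `b`, given by coordinates -/
structure Fr where
  b : E2
  k1 : ℝ
  k2 : ℝ
  n1 : ℝ
  n2 : ℝ
  hk : k1 ^ 2 + k2 ^ 2 = 1
  hn : n1 ^ 2 + n2 ^ 2 = 1
  hkn : k1 * n1 + k2 * n2 = 0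
  h1 : k1 ^ 2 + n1 ^ 2 = 1
  h2 : k2 ^ 2 + n2 ^ 2 = 1
  h12 : k1 * k2 + n1 * n2 = 0

namespace Fr
variable (Λ : Fr)

def ek : E2 := !₂[Λ.k1, Λ.k2]
def en : E2 := !₂[Λ.n1, Λ.n2]
def dk (w : E2) : ℝ := w 0 * Λ.k1 + w 1 * Λ.k2
def dn (w : E2) : ℝ := w 0 * Λ.n1 + w 1 * Λ.n2
def Phi (p : ℝ × ℝ) : E2 := Λ.b + (p.1 • Λ.ek + p.2 • Λ.en)
def Psi (z : E2) : ℝ × ℝ := (Λ.dk (z - Λ.b), Λ.dn (z - Λ.b))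
def lPhi : ℝ × ℝ →L[ℝ] E2 := (ContinuousLinearMap.fst ℝ ℝ ℝ).smulRight Λ.ek + (ContinuousLinearMap.snd ℝ ℝ ℝ).smulRight Λ.en
def ldk : E2 →L[ℝ] ℝ := Λ.k1 • EuclideanSpace.proj 0 + Λ.k2 • EuclideanSpace.proj 1
def ldn : E2 →L[ℝ] ℝ := Λ.n1 • EuclideanSpace.proj 0 + Λ.n2 • EuclideanSpace.proj 1
def lPsi : E2 →L[ℝ] ℝ × ℝ := Λ.ldk.prod Λ.ldn

lemma lPhi_apply (p : ℝ × ℝ) : Λ.lPhi p = p.1 • Λ.ek + p.2 • Λ.en := by simp [lPhi]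
lemma lPsi_apply (w : E2) : Λ.lPsi w = (Λ.dk w, Λ.dn w) := by
  simp [lPsi, ldk, ldn, dk, dn, mul_comm]

lemma Phi_eq : Λ.Phi = fun p => Λ.b + Λ.lPhi p := by funext p; rw [lPhi_apply]; rfl
lemma Psi_eq : Λ.Psi = fun z => Λ.lPsi (z - Λ.b) := by funext p; rw [lPsi_apply]; rfl

lemma Phi_has (p : ℝ × ℝ) : HasFDerivAt Λ.Phi Λ.lPhi p := by
  rw [Phi_eq]; exact Λ.lPhi.hasFDerivAt.const_add _
lemma Psi_has (z : E2) : HasFDerivAt Λ.Psi Λ.lPsi z := by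
  rw [Psi_eq]; simp only [map_sub]; exact Λ.lPsi.hasFDerivAt.sub_const _
lemma Phi_cd : ContDiff ℝ (⊤ : ℕ∞) Λ.Phi := by rw [Phi_eq]; exact contDiff_const.add Λ.lPhi.contDiff
lemma Psi_cd : ContDiff ℝ (⊤ : ℕ∞) Λ.Psi := by rw [Psi_eq]; exact Λ.lPsi.contDiff.comp (contDiff_id.sub contDiff_const)

lemma E2_ext {z w : E2} (h0 : z 0 = w 0) (h1 : z 1 = w 1) : z = w := by
  ext i; fin_cases i <;> assumption

lemma ek0 : Λ.ek 0 = Λ.k1 := by simp [ek]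
lemma ek1 : Λ.ek 1 = Λ.k2 := by simp [ek]
lemma en0 : Λ.en 0 = Λ.n1 := by simp [en]
lemma en1 : Λ.en 1 = Λ.n2 := by simp [en]
lemma Phi0 (p : ℝ × ℝ) : Λ.Phi p 0 = Λ.b 0 + (p.1 * Λ.k1 + p.2 * Λ.n1) := by simp [Phi, ek, en]
lemma Phi1 (p : ℝ × ℝ) : Λ.Phi p 1 = Λ.b 1 + (p.1 * Λ.k2 + p.2 * Λ.n2) := by simp [Phi, ek, en]

lemma Psi_Phi (p : ℝ × ℝ) : Λ.Psi (Λ.Phi p) = p := by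
  apply Prod.ext
  · simp only [Psi, dk, PiLp.sub_apply, Phi0, Phi1]
    linear_combination p.1 * Λ.hk + p.2 * Λ.hkn
  · simp only [Psi, dn, PiLp.sub_apply, Phi0, Phi1]
    linear_combination p.2 * Λ.hn + p.1 * Λ.hkn

lemma decomp (w : E2) : w = Λ.dk w • Λ.ek + Λ.dn w • Λ.en := by
  apply E2_ext
  · simp only [PiLp.add_apply, PiLp.smul_apply, smul_eq_mul, ek0, en0, dk, dn]
    linear_combination (-w 0) * Λ.h1 - w 1 * Λ.h12
  · simp only [PiLp.add_apply, PiLp.smul_apply, smul_eq_mul, ek1, en1, dk, dn]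
    linear_combination (-w 1) * Λ.h2 - w 0 * Λ.h12

lemma Phi_Psi (z : E2) : Λ.Phi (Λ.Psi z) = z := by
  simp only [Phi, Psi]
  rw [← decomp]; abel

/-- homeomorphism -/
def homeo : E2 ≃ₜ ℝ × ℝ where
  toFun := Λ.Psi
  invFun := Λ.Phi
  left_inv := Λ.Phi_Psi
  right_inv := Λ.Psi_Phi
  continuous_toFun := Λ.Psi_cd.continuous
  continuous_invFun := Λ.Phi_cd.continuous

lemma Phi_inj {p q : ℝ × ℝ} : Λ.Phi p = Λ.Phi q ↔ p = q :=
  ⟨fun h => by rw [← Λ.Psi_Phi p, h, Λ.Psi_Phi], fun h => by rw [h]⟩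

lemma Phi_comb {s t : ℝ} (hst : s + t = 1) (p q : ℝ × ℝ) : Λ.Phi (s • p + t • q) = s • Λ.Phi p + t • Λ.Phi q := by
  have : t = 1 - s := by linarith
  subst this
  apply E2_ext
  · simp only [PiLp.add_apply, PiLp.smul_apply, smul_eq_mul, Phi0, Prod.fst_add, Prod.snd_add, Prod.smul_fst, Prod.smul_snd]; ring
  · simp only [PiLp.add_apply, PiLp.smul_apply, smul_eq_mul, Phi1, Prod.fst_add, Prod.snd_add, Prod.smul_fst, Prod.smul_snd]; ring

lemma Phi_seg (p q r : ℝ × ℝ) : Λ.Phi r ∈ segment ℝ (Λ.Phi p) (Λ.Phi q) ↔ r ∈ segment ℝ p q := by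
  constructor
  · rintro ⟨s, t, hs, ht, hst, e⟩
    rw [← Λ.Phi_comb hst, Phi_inj] at e
    exact ⟨s, t, hs, ht, hst, e⟩
  · rintro ⟨s, t, hs, ht, hst, e⟩
    exact ⟨s, t, hs, ht, hst, by rw [← Λ.Phi_comb hst, e]⟩

lemma inner_eq (w x : E2) : @inner ℝ _ _ w x = w 0 * x 0 + w 1 * x 1 := by
  simp [PiLp.inner_apply, Fin.sum_univ_two, mul_comm]

lemma inner_Phi (w : E2) (p q : ℝ × ℝ) : @inner ℝ _ _ w (Λ.Phi q - Λ.Phi p) = (q.1 - p.1) * Λ.dk w + (q.2 - p.2) * Λ.dn w := by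
  rw [inner_eq]; simp only [PiLp.sub_apply, Phi0, Phi1, dk, dn]; ring

end Fr

variable {τ : TriP} (Λ : Fr)

/-- the three vertices -/
abbrev Q1 : ℝ × ℝ := (0, 0)
abbrev Q2 (τ : TriP) : ℝ × ℝ := (τ.L, 0)
abbrev Q3 (τ : TriP) : ℝ × ℝ := (τ.a, τ.h)

lemma bary (p : ℝ × ℝ) : p = (τ.l3 p / (τ.h * τ.L)) • Q1 + ((τ.l2 p / (τ.h * τ.L)) • Q2 τ + (p.2 / τ.h) • Q3 τ) := by
  have := τ.hL.ne'
  have := τ.hh.ne'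
  apply Prod.ext
  · simp [TriP.l2, TriP.l3]; field_simp; ring
  · simp; field_simp

lemma T_hull : τ.T = convexHull ℝ {Q1, Q2 τ, Q3 τ} := by
  have hL := τ.hL
  have hh := τ.hh
  apply Subset.antisymm
  · intro p hp
    have c := convex_convexHull ℝ ({Q1, Q2 τ, Q3 τ} : Set (ℝ × ℝ))
    have m : ∀ q ∈ ({Q1, Q2 τ, Q3 τ} : Set (ℝ × ℝ)), q ∈ convexHull ℝ ({Q1, Q2 τ, Q3 τ} : Set (ℝ × ℝ)) := fun q hq => subset_convexHull ℝ _ hq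
    have := c.sum_mem (t := Finset.univ) (w := ![τ.l3 p / (τ.h * τ.L), τ.l2 p / (τ.h * τ.L), p.2 / τ.h]) (z := ![Q1, Q2 τ, Q3 τ])
      (by
        have h1 := hp.1
        have h2 := hp.2.1
        have h3 := hp.2.2
        intro i _; fin_cases i <;> simp <;> positivity)
      (by simp [Fin.sum_univ_three, TriP.l2, TriP.l3]; field_simp; ring)
      (by intro i _; fin_cases i <;> apply m <;> simp)
    rw [Fin.sum_univ_three] at this
    simp only [Matrix.cons_val_zero, Matrix.cons_val_one, Matrix.cons_val] at this
    rw [add_assoc, ← bary] at this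
    exact this
  · refine convexHull_min ?_ τ.convex_T
    have : 0 < τ.h * τ.L := by positivity
    rintro q (rfl | rfl | rfl)
    · refine ⟨le_rfl, ?_, ?_⟩ <;> simp [TriP.l2, TriP.l3]; positivity
    · refine ⟨le_rfl, ?_, ?_⟩ <;> simp [TriP.l2, TriP.l3]; positivity
    · refine ⟨hh.le, ?_, ?_⟩ <;> simp [TriP.l2, TriP.l3] <;> linarith

lemma Phi_aff (s : Set (ℝ × ℝ)) : Λ.Phi '' (convexHull ℝ s) = convexHull ℝ (Λ.Phi '' s) := by
  have : Λ.Phi = (AffineMap.const ℝ (ℝ × ℝ) Λ.b + Λ.lPhi.toLinearMap.toAffineMap : (ℝ × ℝ) →ᵃ[ℝ] E2) := by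
    rw [Λ.Phi_eq]; rfl
  rw [this, AffineMap.image_convexHull]

variable (τ) in
lemma Tri_eq : Tri (Λ.Phi Q1) (Λ.Phi (Q2 τ)) (Λ.Phi (Q3 τ)) = Λ.Psi ⁻¹' τ.T := by
  have : ({Λ.Phi Q1, Λ.Phi (Q2 τ), Λ.Phi (Q3 τ)} : Set E2) = Λ.Phi '' {Q1, Q2 τ, Q3 τ} := by
    simp [image_insert_eq]
  rw [Tri, this, ← Phi_aff, ← T_hull]
  exact Λ.homeo.symm.toEquiv.image_eq_preimage_symm _

variable (τ) in
lemma Vtx_eq : Vtx (Λ.Phi Q1) (Λ.Phi (Q2 τ)) (Λ.Phi (Q3 τ)) = Λ.Psi ⁻¹' τ.V := by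
  have : Vtx (Λ.Phi Q1) (Λ.Phi (Q2 τ)) (Λ.Phi (Q3 τ)) = Λ.Phi '' {Q1, Q2 τ, Q3 τ} := by
    simp [Vtx, image_insert_eq]
  rw [this]
  exact Λ.homeo.symm.toEquiv.image_eq_preimage_symm _

variable (τ) in
lemma Dom_eq : TriDom (Λ.Phi Q1) (Λ.Phi (Q2 τ)) (Λ.Phi (Q3 τ)) = Λ.Psi ⁻¹' τ.S := by
  rw [TriDom, Tri_eq, Vtx_eq]; rfl

variable (τ) in
lemma Int_eq : interior (Tri (Λ.Phi Q1) (Λ.Phi (Q2 τ)) (Λ.Phi (Q3 τ))) = Λ.Psi ⁻¹' τ.Om := by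
  rw [Tri_eq, ← τ.interior_T]
  exact (Λ.homeo.preimage_interior τ.T).symm

lemma fd_within {u : E2 → ℝ} (hu : ContDiffOn ℝ (⊤ : ℕ∞) u (Λ.Psi ⁻¹' τ.S)) {p : ℝ × ℝ} (hp : p ∈ τ.S) (w : E2) :
    fderivWithin ℝ u (Λ.Psi ⁻¹' τ.S) (Λ.Phi p) w =
      Λ.dk w * dX τ.S (u ∘ Λ.Phi) p + Λ.dn w * dY τ.S (u ∘ Λ.Phi) p := by
  have hin : Λ.Phi p ∈ Λ.Psi ⁻¹' τ.S := by rw [mem_preimage, Λ.Psi_Phi]; exact hp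
  have h1 := (hu.differentiableOn (by simp) _ hin).hasFDerivWithinAt
  have h2 := h1.comp p (Λ.Phi_has p).hasFDerivWithinAt (s := τ.S) (fun q hq => by rw [mem_preimage, Λ.Psi_Phi]; exact hq)
  set l := fderivWithin ℝ u (Λ.Psi ⁻¹' τ.S) (Λ.Phi p) with hl
  have e1 : dX τ.S (u ∘ Λ.Phi) p = l Λ.ek := by
    rw [dX, h2.fderivWithin (τ.good_S.ud p hp)]; simp [Λ.lPhi_apply]
  have e2 : dY τ.S (u ∘ Λ.Phi) p = l Λ.en := by
    rw [dY, h2.fderivWithin (τ.good_S.ud p hp)]; simp [Λ.lPhi_apply]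
  rw [e1, e2]
  conv_lhs => rw [Λ.decomp w, map_add, map_smul, map_smul]
  rfl

lemma comp_Psi (u : E2 → ℝ) : u = fun z => (u ∘ Λ.Phi) (Λ.Psi z) := by
  funext z; simp only [Function.comp, Λ.Phi_Psi]

lemma fd_at {U : ℝ × ℝ → ℝ} (hU : Sm τ.S U) {z : E2} (hz : Λ.Psi z ∈ τ.Om) (w : E2) :
    HasFDerivAt (fun z => U (Λ.Psi z)) ((lin (dX τ.S U (Λ.Psi z)) (dY τ.S U (Λ.Psi z))).comp Λ.lPsi) z :=
  (hU.hasAt (by rw [τ.interior_S]; exact hz)).comp z (Λ.Psi_has z)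

lemma mixed_eq {U : ℝ × ℝ → ℝ} (hU : Sm τ.S U) {z : E2} (hz : Λ.Psi z ∈ τ.Om) (w : E2) :
    mixedDeriv (fun z => U (Λ.Psi z)) z w w =
      Λ.dk w * (Λ.dk w * dX τ.S (dX τ.S U) (Λ.Psi z) + Λ.dn w * dY τ.S (dX τ.S U) (Λ.Psi z)) +
      Λ.dn w * (Λ.dk w * dX τ.S (dY τ.S U) (Λ.Psi z) + Λ.dn w * dY τ.S (dY τ.S U) (Λ.Psi z)) := by
  have ev : (fun y => fderiv ℝ (fun z => U (Λ.Psi z)) y w) =ᶠ[𝓝 z]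
      fun y => Λ.dk w * (fun z => dX τ.S U (Λ.Psi z)) y + Λ.dn w * (fun z => dY τ.S U (Λ.Psi z)) y := by
    filter_upwards [(τ.isOpen_Om.preimage Λ.Psi_cd.continuous).mem_nhds hz] with y hy
    rw [(fd_at Λ hU hy w).fderiv]
    simp [Λ.lPsi_apply]; ring
  rw [mixedDeriv, ev.fderiv_eq]
  have h := ((fd_at Λ (hU.dX τ.good_S) hz w).const_mul (Λ.dk w)).add ((fd_at Λ (hU.dY τ.good_S) hz w).const_mul (Λ.dn w))
  have h' := h.fderiv
  simp only [Pi.add_def] at h'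
  rw [h']
  simp [Λ.lPsi_apply]; ring

lemma negLap_eq {U : ℝ × ℝ → ℝ} (hU : Sm τ.S U) {z : E2} (hz : Λ.Psi z ∈ τ.Om) :
    negLap (fun z => U (Λ.Psi z)) z = -(dX τ.S (dX τ.S U) (Λ.Psi z) + dY τ.S (dY τ.S U) (Λ.Psi z)) := by
  rw [negLap, mixed_eq Λ hU hz, mixed_eq Λ hU hz]
  simp only [Fr.dk, Fr.dn, EuclideanSpace.single_apply]
  simp
  linear_combination -dX τ.S (dX τ.S U) (Λ.Psi z) * Λ.hk - dY τ.S (dY τ.S U) (Λ.Psi z) * Λ.hn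
    - (dX τ.S (dY τ.S U) (Λ.Psi z) + dY τ.S (dX τ.S U) (Λ.Psi z)) * Λ.hkn

lemma neu_iff {u : E2 → ℝ} (hu : ContDiffOn ℝ (⊤ : ℕ∞) u (Λ.Psi ⁻¹' τ.S)) {A B : ℝ × ℝ} {P : ℝ × ℝ → Prop}
    (hAB : ∀ p, (p ∈ segment ℝ A B ∧ p ≠ A ∧ p ≠ B) ↔ (p ∈ τ.S ∧ P p)) (hne : (B.1 - A.1) ^ 2 + (B.2 - A.2) ^ 2 ≠ 0) :
    NeumannOn (Λ.Psi ⁻¹' τ.S) (Λ.Phi A) (Λ.Phi B) u ↔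
      ∀ p ∈ τ.S, P p → -(B.2 - A.2) * dX τ.S (u ∘ Λ.Phi) p + (B.1 - A.1) * dY τ.S (u ∘ Λ.Phi) p = 0 := by
  constructor
  · intro h p hp hP
    obtain ⟨h1, h2, h3⟩ := (hAB p).mpr ⟨hp, hP⟩
    set w : E2 := (-(B.2 - A.2)) • Λ.ek + (B.1 - A.1) • Λ.en with hw
    have w1 : Λ.dk w = -(B.2 - A.2) := by
      simp only [hw, Fr.dk, PiLp.add_apply, PiLp.smul_apply, smul_eq_mul, Fr.ek0, Fr.en0, Fr.ek1, Fr.en1]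
      linear_combination (-(B.2 - A.2)) * Λ.hk + (B.1 - A.1) * Λ.hkn
    have w2 : Λ.dn w = B.1 - A.1 := by
      simp only [hw, Fr.dn, PiLp.add_apply, PiLp.smul_apply, smul_eq_mul, Fr.ek0, Fr.en0, Fr.ek1, Fr.en1]
      linear_combination (-(B.2 - A.2)) * Λ.hkn + (B.1 - A.1) * Λ.hn
    have := h (Λ.Phi p) ((Λ.Phi_seg _ _ _).mpr h1) (fun e => h2 (Λ.Phi_inj.mp e)) (fun e => h3 (Λ.Phi_inj.mp e)) w
      (by rw [Λ.inner_Phi, w1, w2]; ring)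
    rw [fd_within Λ hu hp, w1, w2] at this
    exact this
  · intro h z hz hA hB w hw
    obtain ⟨p, rfl⟩ : ∃ p, Λ.Phi p = z := ⟨_, Λ.Phi_Psi z⟩
    obtain ⟨hp, hP⟩ := (hAB p).mp ⟨(Λ.Phi_seg _ _ _).mp hz, fun e => hA (by rw [e]), fun e => hB (by rw [e])⟩
    have := h p hp hP
    rw [fd_within Λ hu hp]
    rw [Λ.inner_Phi] at hw
    have key : ((B.1 - A.1) ^ 2 + (B.2 - A.2) ^ 2) * (Λ.dk w * dX τ.S (u ∘ Λ.Phi) p + Λ.dn w * dY τ.S (u ∘ Λ.Phi) p) = 0 := by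
      linear_combination ((B.1 - A.1) * dX τ.S (u ∘ Λ.Phi) p + (B.2 - A.2) * dY τ.S (u ∘ Λ.Phi) p) * hw
        + (-(B.2 - A.2) * Λ.dk w + (B.1 - A.1) * Λ.dn w) * this
    exact (mul_eq_zero.mp key).resolve_left hne

lemma seg12 (p : ℝ × ℝ) : (p ∈ segment ℝ Q1 (Q2 τ) ∧ p ≠ Q1 ∧ p ≠ Q2 τ) ↔ (p ∈ τ.S ∧ p.2 = 0) := by
  have hL := τ.hL
  have hh := τ.hh
  constructor
  · rintro ⟨⟨s, t, hs, ht, hst, e⟩, h1, h2⟩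
    have e1 : p.1 = t * τ.L := by rw [← e]; simp
    have e2 : p.2 = 0 := by rw [← e]; simp
    refine ⟨⟨⟨e2.ge, ?_, ?_⟩, ?_⟩, e2⟩
    · rw [TriP.l2, e1, e2]; simp; positivity
    · rw [TriP.l3, e1, e2]
      have : τ.h * τ.L - τ.h * (t * τ.L) - (τ.L - τ.a) * 0 = s * (τ.h * τ.L) := by linear_combination (-(τ.h * τ.L)) * hst
      rw [this]; positivity
    · rintro (r | r | r)
      · exact h1 r
      · exact h2 r
      · rw [mem_singleton_iff] at r; rw [r] at e2; exact hh.ne' e2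
  · rintro ⟨⟨⟨h1, h2, h3⟩, hV⟩, e⟩
    refine ⟨⟨τ.l3 p / (τ.h * τ.L), τ.l2 p / (τ.h * τ.L), by positivity, by positivity, ?_, ?_⟩, fun r => hV (r ▸ V_A τ), fun r => hV (r ▸ V_B τ)⟩
    · rw [TriP.l2, TriP.l3, e]; field_simp; ring
    · conv_rhs => rw [bary (τ := τ) p, e]
      simp

lemma seg23 (p : ℝ × ℝ) : (p ∈ segment ℝ (Q2 τ) (Q3 τ) ∧ p ≠ Q2 τ ∧ p ≠ Q3 τ) ↔ (p ∈ τ.S ∧ τ.l3 p = 0) := by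
  have hL := τ.hL
  have hh := τ.hh
  constructor
  · rintro ⟨⟨s, t, hs, ht, hst, e⟩, h1, h2⟩
    have e1 : p.1 = s * τ.L + t * τ.a := by rw [← e]; simp
    have e2 : p.2 = t * τ.h := by rw [← e]; simp
    have e3 : τ.l3 p = 0 := by rw [TriP.l3, e1, e2]; linear_combination (-(τ.h * τ.L)) * hst
    refine ⟨⟨⟨by rw [e2]; positivity, ?_, e3.ge⟩, ?_⟩, e3⟩
    · have : τ.l2 p = s * (τ.h * τ.L) := by rw [TriP.l2, e1, e2]; ring
      rw [this]; positivity
    · rintro (r | r | r)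
      · rw [r] at e3; simp [TriP.l3] at e3; exact e3.elim hh.ne' hL.ne'
      · exact h1 r
      · exact h2 r
  · rintro ⟨⟨⟨h1, h2, h3⟩, hV⟩, e⟩
    refine ⟨⟨τ.l2 p / (τ.h * τ.L), p.2 / τ.h, by positivity, by positivity, ?_, ?_⟩, fun r => hV (r ▸ V_B τ), fun r => hV (r ▸ V_C τ)⟩
    · rw [TriP.l3] at e
      rw [TriP.l2]; field_simp; linarith
    · conv_rhs => rw [bary (τ := τ) p, e]
      simp

lemma seg31 (p : ℝ × ℝ) : (p ∈ segment ℝ (Q3 τ) Q1 ∧ p ≠ Q3 τ ∧ p ≠ Q1) ↔ (p ∈ τ.S ∧ τ.l2 p = 0) := by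
  have hL := τ.hL
  have hh := τ.hh
  constructor
  · rintro ⟨⟨s, t, hs, ht, hst, e⟩, h1, h2⟩
    have e1 : p.1 = s * τ.a := by rw [← e]; simp
    have e2 : p.2 = s * τ.h := by rw [← e]; simp
    have e3 : τ.l2 p = 0 := by rw [TriP.l2, e1, e2]; ring
    refine ⟨⟨⟨by rw [e2]; positivity, e3.ge, ?_⟩, ?_⟩, e3⟩
    · have : τ.l3 p = t * (τ.h * τ.L) := by rw [TriP.l3, e1, e2]; linear_combination (-(τ.h * τ.L)) * hst
      rw [this]; positivity
    · rintro (r | r | r)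
      · exact h2 r
      · rw [r] at e3; simp [TriP.l2] at e3; exact e3.elim hh.ne' hL.ne'
      · exact h1 r
  · rintro ⟨⟨⟨h1, h2, h3⟩, hV⟩, e⟩
    refine ⟨⟨p.2 / τ.h, τ.l3 p / (τ.h * τ.L), by positivity, by positivity, ?_, ?_⟩, fun r => hV (r ▸ V_C τ), fun r => hV (r ▸ V_A τ)⟩
    · rw [TriP.l2] at e
      rw [TriP.l3]; field_simp; linarith
    · conv_rhs => rw [bary (τ := τ) p, e]
      simp

theorem transport {μ : ℝ} {u : E2 → ℝ} :
    IsNeumannEigenfun (Λ.Phi Q1) (Λ.Phi (Q2 τ)) (Λ.Phi (Q3 τ)) μ u ↔ τ.Eig μ (u ∘ Λ.Phi) := by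
  have hL := τ.hL
  have hh := τ.hh
  have mT : MapsTo Λ.Phi τ.T (Λ.Psi ⁻¹' τ.T) := fun p hp => by rw [mem_preimage, Λ.Psi_Phi]; exact hp
  have mS : MapsTo Λ.Phi τ.S (Λ.Psi ⁻¹' τ.S) := fun p hp => by rw [mem_preimage, Λ.Psi_Phi]; exact hp
  have mO : MapsTo Λ.Phi τ.Om (Λ.Psi ⁻¹' τ.Om) := fun p hp => by rw [mem_preimage, Λ.Psi_Phi]; exact hp
  have c12 : (τ.L - 0) ^ 2 + ((0 : ℝ) - 0) ^ 2 ≠ 0 := by simp; exact hL.ne'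
  have c23 : (τ.a - τ.L) ^ 2 + (τ.h - 0) ^ 2 ≠ 0 := by have := sq_pos_of_pos hh; nlinarith [sq_nonneg (τ.a - τ.L)]
  have c31 : (0 - τ.a) ^ 2 + (0 - τ.h) ^ 2 ≠ 0 := by have := sq_pos_of_pos hh; nlinarith [sq_nonneg τ.a]
  constructor
  · rintro ⟨h0, h1, h2, h3, h4, h5, h6, h7⟩
    rw [Dom_eq] at h3 h5 h6 h7
    rw [Tri_eq] at h1 h2
    rw [Int_eq] at h4
    have sm : Sm τ.S (u ∘ Λ.Phi) := h3.comp Λ.Phi_cd.contDiffOn mS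
    rw [neu_iff Λ h3 seg12 c12] at h5
    rw [neu_iff Λ h3 seg23 c23] at h6
    rw [neu_iff Λ h3 seg31 c31] at h7
    refine ⟨h0, ?_, h2.comp Λ.Phi_cd.continuous.continuousOn mT, sm, fun p hp => ?_, fun p hp e => ?_, fun p hp e => ?_, fun p hp e => ?_⟩
    · rintro ⟨c, hc⟩
      exact h1 ⟨c, fun z hz => by have := hc _ hz; rwa [Function.comp, Λ.Phi_Psi] at this⟩
    · have := h4 _ (mO hp)
      rw [comp_Psi Λ u, negLap_eq Λ sm (mO hp), Λ.Psi_Phi] at this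
      simp only [Λ.Psi_Phi] at this
      linarith
    · have := h5 p hp e
      have : τ.L * dY τ.S (u ∘ Λ.Phi) p = 0 := by linarith
      exact (mul_eq_zero.mp this).resolve_left hL.ne'
    · have := h7 p hp e; linarith
    · have := h6 p hp e; linarith
  · rintro ⟨h0, h1, h2, h3, h4, h5, h6, h7⟩
    have hu : ContDiffOn ℝ (⊤ : ℕ∞) u (Λ.Psi ⁻¹' τ.S) := by
      rw [comp_Psi Λ u]; exact h3.comp Λ.Psi_cd.contDiffOn (fun z hz => hz)
    refine ⟨h0, ?_, ?_, ?_, ?_, ?_, ?_, ?_⟩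
    · rw [Tri_eq]
      rintro ⟨c, hc⟩
      exact h1 ⟨c, fun p hp => hc _ (mT hp)⟩
    · rw [Tri_eq, comp_Psi Λ u]
      exact h2.comp Λ.Psi_cd.continuous.continuousOn (fun z hz => hz)
    · rw [Dom_eq]; exact hu
    · rw [Int_eq]
      intro z hz
      have := h4 _ hz
      rw [comp_Psi Λ u, negLap_eq Λ h3 hz]
      linarith
    · rw [Dom_eq, neu_iff Λ hu seg12 c12]
      intro p hp e
      rw [h5 p hp e]; simp
    · rw [Dom_eq, neu_iff Λ hu seg23 c23]
      intro p hp e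
      have := h7 p hp e
      simp only [sub_zero]; linarith
    · rw [Dom_eq, neu_iff Λ hu seg31 c31]
      intro p hp e
      have := h6 p hp e
      simp only [zero_sub]; linarith

/-- twice the signed area -/
def det3 (x y z : E2) : ℝ := (y 0 - x 0) * (z 1 - x 1) - (y 1 - x 1) * (z 0 - x 0)

lemma det3_ne {x y z : E2} (h : AffineIndependent ℝ ![x, y, z]) : det3 x y z ≠ 0 := by
  rw [affineIndependent_iff] at h
  intro hd
  have key : ∀ s t : ℝ, s * (y 0 - x 0) + t * (z 0 - x 0) = 0 → s * (y 1 - x 1) + t * (z 1 - x 1) = 0 → s = 0 ∧ t = 0 := by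
    intro s t e0 e1
    have := h Finset.univ ![-s - t, s, t] (by simp [Fin.sum_univ_three]; ring) (by
      rw [Fin.sum_univ_three]
      apply Fr.E2_ext
      · simp; linarith
      · simp; linarith)
    exact ⟨by simpa using this 1 (Finset.mem_univ _), by simpa using this 2 (Finset.mem_univ _)⟩
  rw [det3] at hd
  have a := key (z 0 - x 0) (-(y 0 - x 0)) (by ring) (by linarith)
  have b := key (z 1 - x 1) (-(y 1 - x 1)) (by linarith) (by ring)
  have := key 1 0 (by linarith [a.2]) (by linarith [b.2])
  exact one_ne_zero this.1

lemma frame_exists {x y z : E2} (h : det3 x y z ≠ 0) : ∃ (Λ : Fr) (τ : TriP), x = Λ.Phi Q1 ∧ y = Λ.Phi (Q2 τ) ∧ z = Λ.Phi (Q3 τ) := by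
  set p := y 0 - x 0 with hp
  set q := y 1 - x 1 with hq
  have hpos : 0 < p ^ 2 + q ^ 2 := by
    rcases (by positivity : 0 ≤ p ^ 2 + q ^ 2).eq_or_lt with e | e
    · exfalso
      have h1 : p = 0 := by nlinarith [sq_nonneg p, sq_nonneg q]
      have h2 : q = 0 := by nlinarith [sq_nonneg p, sq_nonneg q]
      apply h; rw [det3, ← hp, ← hq, h1, h2]; ring
    · exact e
  set L := Real.sqrt (p ^ 2 + q ^ 2) with hL
  have L0 : 0 < L := Real.sqrt_pos.mpr hpos
  have L2 : L ^ 2 = p ^ 2 + q ^ 2 := Real.sq_sqrt hpos.le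
  obtain ⟨ε, hε, hd⟩ : ∃ ε : ℝ, ε ^ 2 = 1 ∧ 0 < ε * det3 x y z := by
    rcases h.lt_or_gt with e | e
    · exact ⟨-1, by norm_num, by linarith⟩
    · exact ⟨1, by norm_num, by linarith⟩
  have Ln := L0.ne'
  have hd' : det3 x y z = p * (z 1 - x 1) - q * (z 0 - x 0) := rfl
  refine ⟨⟨x, p / L, q / L, -(ε * q / L), ε * p / L, ?_, ?_, ?_, ?_, ?_, ?_⟩,
    ⟨L, ε * det3 x y z / L, (p * (z 0 - x 0) + q * (z 1 - x 1)) / L, L0, by positivity⟩, ?_, ?_, ?_⟩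
  · field_simp; linarith
  · field_simp; rw [L2]; linear_combination (p ^ 2 + q ^ 2) * hε
  · field_simp; ring
  · field_simp; rw [L2]; linear_combination q ^ 2 * hε
  · field_simp; rw [L2]; linear_combination p ^ 2 * hε
  · field_simp; linear_combination (-(p * q)) * hε
  · apply Fr.E2_ext <;> simp [Fr.Phi0, Fr.Phi1]
  · apply Fr.E2_ext <;> simp [Fr.Phi0, Fr.Phi1] <;> field_simp
    · rw [hp]; ring
    · rw [hq]; ring
  · apply Fr.E2_ext
    · simp only [Fr.Phi0]; rw [hd']; field_simp; rw [L2]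
      linear_combination (q * (p * (z 1 - x 1) - q * (z 0 - x 0))) * hε
    · simp only [Fr.Phi1]; rw [hd']; field_simp; rw [L2]
      linear_combination (-p * (p * (z 1 - x 1) - q * (z 0 - x 0))) * hε

theorem main12 {x y z : E2} (h : det3 x y z ≠ 0) {u : E2 → ℝ} (hu : IsSecondNeumannEigenfun x y z u) (h1 : u x = 0) (h2 : u y = 0) : False := by
  obtain ⟨Λ, τ, rfl, rfl, rfl⟩ := frame_exists h
  obtain ⟨μ, hE, hmin⟩ := hu
  refine core ((transport Λ).mp hE) (fun m v hv => hmin m (fun z => v (Λ.Psi z)) ((transport Λ).mpr ?_)) h1 h2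
  have : (fun z => v (Λ.Psi z)) ∘ Λ.Phi = v := by funext p; simp only [Function.comp, Λ.Psi_Phi]
  rw [this]; exact hv

lemma neu_swap {S : Set E2} {a b : E2} {u : E2 → ℝ} (h : NeumannOn S a b u) : NeumannOn S b a u := by
  intro p hp ha hb w hw
  refine h p (by rwa [segment_symm]) hb ha w ?_
  rw [← neg_sub, inner_neg_right, hw, neg_zero]

lemma set_cyc (x y z : E2) : ({y, z, x} : Set E2) = {x, y, z} := by
  ext w; simp only [mem_insert_iff, mem_singleton_iff]; tauto
lemma set_swap (x y z : E2) : ({y, x, z} : Set E2) = {x, y, z} := by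
  ext w; simp only [mem_insert_iff, mem_singleton_iff]; tauto

lemma eig_cyc {x y z : E2} {μ : ℝ} {u : E2 → ℝ} (h : IsNeumannEigenfun x y z μ u) : IsNeumannEigenfun y z x μ u := by
  have e1 : Tri y z x = Tri x y z := by rw [Tri, Tri, set_cyc]
  have e2 : TriDom y z x = TriDom x y z := by rw [TriDom, TriDom, e1, Vtx, Vtx, set_cyc]
  obtain ⟨h0, h1, h2, h3, h4, h5, h6, h7⟩ := h
  exact ⟨h0, by rwa [e1], by rwa [e1], by rwa [e2], by rwa [e1], by rwa [e2], by rwa [e2], by rwa [e2]⟩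

lemma eig_swap {x y z : E2} {μ : ℝ} {u : E2 → ℝ} (h : IsNeumannEigenfun x y z μ u) : IsNeumannEigenfun y x z μ u := by
  have e1 : Tri y x z = Tri x y z := by rw [Tri, Tri, set_swap]
  have e2 : TriDom y x z = TriDom x y z := by rw [TriDom, TriDom, e1, Vtx, Vtx, set_swap]
  obtain ⟨h0, h1, h2, h3, h4, h5, h6, h7⟩ := h
  exact ⟨h0, by rwa [e1], by rwa [e1], by rwa [e2], by rwa [e1], by rw [e2]; exact neu_swap h5, by rw [e2]; exact neu_swap h7,
    by rw [e2]; exact neu_swap h6⟩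

lemma sec_cyc {x y z : E2} {u : E2 → ℝ} (h : IsSecondNeumannEigenfun x y z u) : IsSecondNeumannEigenfun y z x u := by
  obtain ⟨μ, h1, h2⟩ := h
  exact ⟨μ, eig_cyc h1, fun m v hv => h2 m v (eig_cyc (eig_cyc hv))⟩

lemma det_cyc {x y z : E2} (h : det3 x y z ≠ 0) : det3 y z x ≠ 0 := by
  have : det3 y z x = det3 x y z := by simp only [det3]; ring
  rwa [this]

end NZ

/-- A second Neumann eigenfunction of a triangle cannot vanish at two distinct
vertices. -/
theorem not_zero_at_two_vertices
    (v₁ v₂ v₃ : E2) (hT : AffineIndependent ℝ ![v₁, v₂, v₃])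
    (u : E2 → ℝ) (hu : IsSecondNeumannEigenfun v₁ v₂ v₃ u)
    (v v' : E2) (hv : v ∈ Vtx v₁ v₂ v₃) (hv' : v' ∈ Vtx v₁ v₂ v₃) (hne : v ≠ v') :
    ¬ (u v = 0 ∧ u v' = 0) := by
  rintro ⟨h1, h2⟩
  have d := NZ.det3_ne hT
  have d' := NZ.det_cyc d
  have d2 := NZ.det_cyc d'
  have s' := NZ.sec_cyc hu
  have s2 := NZ.sec_cyc s'
  simp only [Vtx, mem_insert_iff, mem_singleton_iff] at hv hv'
  rcases hv with e | e | e <;> rcases hv' with f | f | f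
  · exact hne (e.trans f.symm)
  · exact NZ.main12 d hu (e ▸ h1) (f ▸ h2)
  · exact NZ.main12 d2 s2 (f ▸ h2) (e ▸ h1)
  · exact NZ.main12 d hu (f ▸ h2) (e ▸ h1)
  · exact hne (e.trans f.symm)
  · exact NZ.main12 d' s' (e ▸ h1) (f ▸ h2)
  · exact NZ.main12 d2 s2 (e ▸ h1) (f ▸ h2)
  · exact NZ.main12 d' s' (f ▸ h2) (e ▸ h1)
  · exact hne (e.trans f.symm)

end
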